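/- Let f:(R,m,k) → (S,n,l) be a local homomorphism of noetherian local rings such that the flat dimension of S as an R-module is finite, where R has a dualizing complex and S is G-regular, and let M be a non-zero artinian S-module with Gid_R(M) ≤ edim(R) − edim(S). Then: (i) M is an injective S-module; (ii) f is an exceptional complete intersection map; and (iii) Gid_R(M) = edim(R) − edim(S). In particular, if M is Gorenstein injective as an R-module, then edim(R) = edim(S). -/

import Mathlib

/- ## Preliminary definitions -/

universe u

open IsLocalRing

noncomputable section

/-- The embedding dimension of a local ring: `dim_k (m/m²)`. -/
def embDim (R : Type u) [CommRing R] [IsLocalRing R] : ℕ :=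
  Module.finrank (ResidueField R) (CotangentSpace R)

/-- Witness that `Q` is a Gorenstein flat `R`-module: a two-sided exact complex `F` of
flat modules, which stays exact after applying `I ⊗ᵣ -` for every injective module `I`,
with `Q` isomorphic to the image of the differential `F₁ → F₀`. -/
structure GorensteinFlatWitness (R : Type u) [CommRing R] (Q : Type u) [AddCommGroup Q]
    [Module R Q] where
  F : ℤ → Type u
  [instAdd : ∀ i, AddCommGroup (F i)]
  [instMod : ∀ i, Module R (F i)]
  d : (i : ℤ) → F (i + 1) →ₗ[R] F i
  flat : ∀ i, Module.Flat R (F i)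
  exact : ∀ i : ℤ, Function.Exact (d (i + 1)) (d i)
  exact_tensor : ∀ (I : Type u) [AddCommGroup I] [Module R I], Module.Injective R I →
    ∀ i : ℤ, Function.Exact (LinearMap.lTensor I (d (i + 1))) (LinearMap.lTensor I (d i))
  iso : Nonempty (Q ≃ₗ[R] LinearMap.range (d 0))

/-- `Q` is a Gorenstein flat `R`-module. -/
def IsGorensteinFlat (R : Type u) [CommRing R] (Q : Type u) [AddCommGroup Q]
    [Module R Q] : Prop :=
  Nonempty (GorensteinFlatWitness R Q)

/-- Witness that `J` is a Gorenstein injective `R`-module: a two-sided exact complex `I` of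
injective modules, which stays exact after applying `Hom_R(E, -)` for every injective module
`E`, with `J` isomorphic to the image of the differential `I₁ → I₀`. -/
structure GorensteinInjectiveWitness (R : Type u) [CommRing R] (J : Type u) [AddCommGroup J]
    [Module R J] where
  I : ℤ → Type u
  [instAdd : ∀ i, AddCommGroup (I i)]
  [instMod : ∀ i, Module R (I i)]
  d : (i : ℤ) → I (i + 1) →ₗ[R] I i
  injective : ∀ i, Module.Injective R (I i)
  exact : ∀ i : ℤ, Function.Exact (d (i + 1)) (d i)
  exact_hom : ∀ (E : Type u) [AddCommGroup E] [Module R E], Module.Injective R E →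
    ∀ i : ℤ, Function.Exact (LinearMap.llcomp (σ₁₂ := RingHom.id R) (σ₁₃ := RingHom.id R)
        R E (I (i + 1 + 1)) (I (i + 1)) (d (i + 1)))
      (LinearMap.llcomp (σ₁₂ := RingHom.id R) (σ₁₃ := RingHom.id R)
        R E (I (i + 1)) (I i) (d i))
  iso : Nonempty (J ≃ₗ[R] LinearMap.range (d 0))

/-- `J` is a Gorenstein injective `R`-module. -/
def IsGorensteinInjective (R : Type u) [CommRing R] (J : Type u) [AddCommGroup J]
    [Module R J] : Prop :=
  Nonempty (GorensteinInjectiveWitness R J)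

/-- A surjection onto `M` whose source is Gorenstein flat. -/
structure GorensteinFlatCover (R : Type u) [CommRing R] (M : Type u) [AddCommGroup M]
    [Module R M] where
  Q : Type u
  [instAdd : AddCommGroup Q]
  [instMod : Module R Q]
  π : Q →ₗ[R] M
  gflat : IsGorensteinFlat R Q
  surj : Function.Surjective π

attribute [instance] GorensteinFlatCover.instAdd GorensteinFlatCover.instMod

/-- `M` admits an exact sequence `0 → Qₙ → ⋯ → Q₀ → M → 0` with all `Qᵢ` Gorenstein flat;
equivalently (by splicing), defined by recursion on `n`. -/
def gfdLE (R : Type u) [CommRing R] :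
    (n : ℕ) → (M : Type u) → [AddCommGroup M] → [Module R M] → Prop
  | 0, M, _, _ => IsGorensteinFlat R M
  | n + 1, M, _, _ => ∃ c : GorensteinFlatCover R M, gfdLE R n (LinearMap.ker c.π)

/-- The Gorenstein flat dimension of `M` over `R`, as an element of `ℕ∞`
(the zero module has Gorenstein flat dimension `0` here, and `⊤` means infinite). -/
def gfd (R : Type u) [CommRing R] (M : Type u) [AddCommGroup M] [Module R M] : ℕ∞ :=
  sInf ((↑) '' { n : ℕ | gfdLE R n M })

/-- A flat cover of `M`. -/
structure FlatCover (R : Type u) [CommRing R] (M : Type u) [AddCommGroup M]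
    [Module R M] where
  Q : Type u
  [instAdd : AddCommGroup Q]
  [instMod : Module R Q]
  π : Q →ₗ[R] M
  flat : Module.Flat R Q
  surj : Function.Surjective π

attribute [instance] FlatCover.instAdd FlatCover.instMod

/-- `M` admits a flat resolution of length `≤ n`. -/
def fdLE (R : Type u) [CommRing R] :
    (n : ℕ) → (M : Type u) → [AddCommGroup M] → [Module R M] → Prop
  | 0, M, _, _ => Module.Flat R M
  | n + 1, M, _, _ => ∃ c : FlatCover R M, fdLE R n (LinearMap.ker c.π)

/-- The flat dimension of `M` over `R`, as an element of `ℕ∞`. -/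
def flatDim (R : Type u) [CommRing R] (M : Type u) [AddCommGroup M] [Module R M] : ℕ∞ :=
  sInf ((↑) '' { n : ℕ | fdLE R n M })

/-- An embedding of `M` into a Gorenstein injective module. -/
structure GorensteinInjectiveHull (R : Type u) [CommRing R] (M : Type u) [AddCommGroup M]
    [Module R M] where
  J : Type u
  [instAdd : AddCommGroup J]
  [instMod : Module R J]
  ι : M →ₗ[R] J
  ginj : IsGorensteinInjective R J
  inj : Function.Injective ι

attribute [instance] GorensteinInjectiveHull.instAdd GorensteinInjectiveHull.instMod

/-- `M` admits an exact sequence `0 → M → J₀ → ⋯ → J₋ₙ → 0` with all `Jᵢ`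
Gorenstein injective. -/
def gidLE (R : Type u) [CommRing R] :
    (n : ℕ) → (M : Type u) → [AddCommGroup M] → [Module R M] → Prop
  | 0, M, _, _ => IsGorensteinInjective R M
  | n + 1, M, _, _ => ∃ c : GorensteinInjectiveHull R M,
      gidLE R n (c.J ⧸ LinearMap.range c.ι)

/-- The Gorenstein injective dimension of `M` over `R`, as an element of `ℕ∞`. -/
def gid (R : Type u) [CommRing R] (M : Type u) [AddCommGroup M] [Module R M] : ℕ∞ :=
  sInf ((↑) '' { n : ℕ | gidLE R n M })

/-- An embedding of `M` into an injective module. -/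
structure InjectiveHullStep (R : Type u) [CommRing R] (M : Type u) [AddCommGroup M]
    [Module R M] where
  J : Type u
  [instAdd : AddCommGroup J]
  [instMod : Module R J]
  ι : M →ₗ[R] J
  injective : Module.Injective R J
  inj : Function.Injective ι

attribute [instance] InjectiveHullStep.instAdd InjectiveHullStep.instMod

/-- `M` admits an injective resolution of length `≤ n`. -/
def idLE (R : Type u) [CommRing R] :
    (n : ℕ) → (M : Type u) → [AddCommGroup M] → [Module R M] → Prop
  | 0, M, _, _ => Module.Injective R M
  | n + 1, M, _, _ => ∃ c : InjectiveHullStep R M, idLE R n (c.J ⧸ LinearMap.range c.ι)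

/-- The injective dimension of `M` over `R`, as an element of `ℕ∞`. -/
def injDim (R : Type u) [CommRing R] (M : Type u) [AddCommGroup M] [Module R M] : ℕ∞ :=
  sInf ((↑) '' { n : ℕ | idLE R n M })

/-- The `i`-th Ext module `Ext_R^i(N, M)`. -/
def extModule (R : Type u) [CommRing R] (i : ℕ) (N M : Type u) [AddCommGroup N] [Module R N]
    [AddCommGroup M] [Module R M] : ModuleCat.{u} R :=
  ((Ext R (ModuleCat.{u} R) i).obj (Opposite.op (ModuleCat.of R N))).obj (ModuleCat.of R M)

/-- The depth of `M` with respect to the ideal `I`: the least `i` such that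
`Ext_R^i(R/I, M) ≠ 0` (with value `⊤ : ℕ∞` if no such `i` exists). -/
def idealDepth (R : Type u) [CommRing R] (I : Ideal R) (M : Type u) [AddCommGroup M]
    [Module R M] : ℕ∞ :=
  sInf ((↑) '' { i : ℕ | ¬ Subsingleton (extModule R i (R ⧸ I) M) })

/-- A finitely generated `S`-module `M` is totally reflexive if the biduality map
`M → Hom_S(Hom_S(M,S),S)` is bijective and `Ext_S^i(M,S) = 0 = Ext_S^i(M^*,S)`
for all `i ≥ 1`. -/
def IsTotallyReflexive (S : Type u) [CommRing S] (M : Type u) [AddCommGroup M]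
    [Module S M] : Prop :=
  Module.Finite S M ∧ Function.Bijective (Module.Dual.eval S M) ∧
    ∀ i : ℕ, 1 ≤ i → Subsingleton (extModule S i M S) ∧
      Subsingleton (extModule S i (Module.Dual S M) S)

/-- A noetherian local ring is G-regular if every totally reflexive module is free. -/
def IsGRegular (S : Type u) [CommRing S] : Prop :=
  ∀ (M : Type u) [AddCommGroup M] [Module S M], IsTotallyReflexive S M → Module.Free S M

/-- A commutative ring is a regular local ring if it is a noetherian local ring whose
maximal ideal is generated by a regular sequence. -/
def IsRegularLocal (A : Type u) [CommRing A] : Prop :=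
  IsNoetherianRing A ∧ ∃ h : IsLocalRing A, ∃ rs : List A,
    RingTheory.Sequence.IsRegular A rs ∧
      Ideal.span { x | x ∈ rs } = @IsLocalRing.maximalIdeal A _ h

/-- A Gorenstein local ring: a noetherian local ring of finite self-injective dimension. -/
def IsGorensteinLocal (A : Type u) [CommRing A] : Prop :=
  IsNoetherianRing A ∧ IsLocalRing A ∧ injDim A A < ⊤

/-- `E` is an injective envelope (injective hull) of the residue field of the local
ring `S`: an injective module containing the residue field as an essential submodule. -/
def IsInjEnvResidueField (S : Type u) [CommRing S] [IsLocalRing S] (E : Type u)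
    [AddCommGroup E] [Module S E] : Prop :=
  Module.Injective S E ∧ ∃ ι : ResidueField S →ₗ[S] E, Function.Injective ι ∧
    ∀ N : Submodule S E, N ≠ ⊥ → N ⊓ LinearMap.range ι ≠ ⊥

end
/- ## Cohen factorizations and (exceptional) complete intersection maps -/

noncomputable section

/-- The canonical ring homomorphism from a local ring `S` to its
maximal-adic completion. -/
def completionHom (S : Type u) [CommRing S] [IsLocalRing S] :
    S →+* AdicCompletion (maximalIdeal S) S :=
  algebraMap S (AdicCompletion (maximalIdeal S) S)

/-- `R → R' → Ŝ` is a Cohen factorization of the local homomorphism `f : R → S`: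
`R'` is a complete noetherian local ring, `R → R'` is a flat local homomorphism with
regular closed fiber `R'/mR'`, and `R' → Ŝ` is surjective, the composite being the
composition of `f` with the completion map of `S`. -/
def IsCohenFactorization {R S R' : Type u} [CommRing R] [CommRing S] [IsLocalRing R]
    [IsLocalRing S] [CommRing R'] (f : R →+* S) (g : R →+* R')
    (h : R' →+* AdicCompletion (maximalIdeal S) S) : Prop :=
  IsNoetherianRing R' ∧ IsLocalRing R' ∧ IsAdicComplete ((⊥ : Ideal R').jacobson) R' ∧
    h.comp g = (completionHom S).comp f ∧ IsLocalHom g ∧ g.Flat ∧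
    IsRegularLocal (R' ⧸ (maximalIdeal R).map g) ∧ Function.Surjective h

/-- A local homomorphism `f : R → S` of noetherian local rings is a complete intersection
map if in some Cohen factorization `R → R' → Ŝ` the kernel of `R' → Ŝ` is generated by a
regular sequence. -/
def IsCIMap {R S : Type u} [CommRing R] [CommRing S] [IsLocalRing R] [IsLocalRing S]
    (f : R →+* S) : Prop :=
  ∃ (R' : Type u) (_ : CommRing R') (g : R →+* R')
    (h : R' →+* AdicCompletion (maximalIdeal S) S),
    IsCohenFactorization f g h ∧ ∃ rs : List R',
      RingTheory.Sequence.IsRegular R' rs ∧ RingHom.ker h = Ideal.span { x | x ∈ rs }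

/-- A local homomorphism `f : R → S` of noetherian local rings is an exceptional complete
intersection map if it is a complete intersection map and
`edim R - dim R = edim S - dim S`. -/
def IsExceptionalCIMap {R S : Type u} [CommRing R] [CommRing S] [IsLocalRing R]
    [IsLocalRing S] (f : R →+* S) : Prop :=
  IsCIMap f ∧
    (embDim R : WithBot ℕ∞) + ringKrullDim S =
      (embDim S : WithBot ℕ∞) + ringKrullDim R

end
/- ## Homological dimensions along a ring homomorphism -/

noncomputable section

variable {R S : Type u} [CommRing R] [CommRing S]

/-- The flat dimension `fd_R S` of `S` as an `R`-module along `f : R → S`. -/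
def flatDimAlong (f : R →+* S) : ℕ∞ :=
  letI := f.toModule; flatDim R S

/-- The Gorenstein flat dimension over `R` of an `S`-module `M`, viewed as an
`R`-module along `f : R → S`. -/
def gfdAlong (f : R →+* S) (M : Type u) [AddCommGroup M] [Module S M] : ℕ∞ :=
  letI := Module.compHom M f; gfd R M

/-- The Gorenstein injective dimension over `R` of an `S`-module `M`, viewed as an
`R`-module along `f : R → S`. -/
def gidAlong (f : R →+* S) (M : Type u) [AddCommGroup M] [Module S M] : ℕ∞ :=
  letI := Module.compHom M f; gid R M

/-- `M` is Gorenstein flat as an `R`-module along `f : R → S`. -/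
def IsGorensteinFlatAlong (f : R →+* S) (M : Type u) [AddCommGroup M] [Module S M] : Prop :=
  letI := Module.compHom M f; IsGorensteinFlat R M

/-- `M` is Gorenstein injective as an `R`-module along `f : R → S`. -/
def IsGorensteinInjectiveAlong (f : R →+* S) (M : Type u) [AddCommGroup M]
    [Module S M] : Prop :=
  letI := Module.compHom M f; IsGorensteinInjective R M

end
/- ## Dualizing complexes -/

noncomputable section

/-- The data of a `ℤ`-indexed sequence of modules with degree `+1` maps. -/
structure CochainData (R : Type u) [CommRing R] where
  D : ℤ → Type u
  [instAdd : ∀ i, AddCommGroup (D i)]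
  [instMod : ∀ i, Module R (D i)]
  d : (i : ℤ) → D i →ₗ[R] D (i + 1)

attribute [instance] CochainData.instAdd CochainData.instMod

namespace CochainData

variable {R : Type u} [CommRing R] (C : CochainData R)

/-- Transport along an equality of indices. -/
def cast {a b : ℤ} (h : a = b) : C.D a →ₗ[R] C.D b := by subst h; exact LinearMap.id

/-- Degree `n` component of the endomorphism Hom-complex `Hom(C, C)`. -/
abbrev Hc (n : ℤ) : Type u := ∀ i : ℤ, C.D i →ₗ[R] C.D (i + n)

/-- Transport along an equality of degrees in the Hom-complex. -/
def hcast {a b : ℤ} (h : a = b) (x : C.Hc a) : C.Hc b := h ▸ x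

/-- The differential of the endomorphism Hom-complex:
`δ(φ) = d ∘ φ - (-1)ⁿ φ ∘ d`. -/
def δ (n : ℤ) (φ : C.Hc n) : C.Hc (n + 1) := fun i =>
  (C.cast (show i + n + 1 = i + (n + 1) by ring)).comp ((C.d (i + n)).comp (φ i)) -
    (Int.negOnePow n : ℤ) •
      (C.cast (show i + 1 + n = i + (n + 1) by ring)).comp ((φ (i + 1)).comp (C.d i))

/-- The canonical degree-zero cocycle `r • id` of the endomorphism Hom-complex. -/
def unit (r : R) : C.Hc 0 := fun i =>
  (C.cast (show i = i + 0 by ring)).comp (r • LinearMap.id)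

end CochainData

/-- A dualizing complex for `R`: a bounded complex of injective `R`-modules with finitely
generated cohomology (in particular of finite injective dimension), whose endomorphism
complex in the derived category is isomorphic to `R`, i.e. the cohomology of the Hom-complex
`Hom(D, D)` vanishes in nonzero degrees and in degree zero is isomorphic to `R` via
`r ↦ r • id`. -/
structure DualizingComplex (R : Type u) [CommRing R] extends CochainData R where
  comp_zero : ∀ i : ℤ, (d (i + 1)).comp (d i) = 0
  injective : ∀ i, Module.Injective R (D i)
  bounded : ∃ a b : ℤ, ∀ i : ℤ, i < a ∨ b < i → Subsingleton (D i)
  finite_cohomology : ∀ i : ℤ,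
    Module.Finite R
      (↥(LinearMap.ker (d (i + 1))) ⧸
        Submodule.comap (LinearMap.ker (d (i + 1))).subtype (LinearMap.range (d i)))
  hom_exact : ∀ n : ℤ, n ≠ -1 →
    Function.Exact (toCochainData.δ n) (toCochainData.δ (n + 1))
  h0_surjective : ∀ φ : toCochainData.Hc 0, toCochainData.δ 0 φ = 0 →
    ∃ (r : R) (ψ : toCochainData.Hc (-1)),
      φ = toCochainData.unit r +
        toCochainData.hcast (by norm_num) (toCochainData.δ (-1) ψ)
  h0_injective : ∀ r : R,
    (∃ ψ : toCochainData.Hc (-1),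
      toCochainData.hcast (by norm_num) (toCochainData.δ (-1) ψ) =
        toCochainData.unit r) → r = 0

/-- `R` has a dualizing complex. -/
def HasDualizingComplex (R : Type u) [CommRing R] : Prop :=
  Nonempty (DualizingComplex R)

end
universe v

/-- Every element of `X` is killed by a power of `𝔞`. -/
def IsTors {R : Type u} [CommRing R] (𝔞 : Ideal R) (X : Type v) [AddCommGroup X] [Module R X] :
    Prop :=
  ∀ x : X, ∃ n : ℕ, ∀ r ∈ 𝔞 ^ n, r • x = 0

section Torsion

variable {R : Type u} [CommRing R] {𝔪 : Ideal R} {W : Type v} [AddCommGroup W] [Module R W]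

theorem LinearPMap.exists_extend_total_of_pow_le [IsNoetherianRing R] [h𝔪 : 𝔪.IsMaximal]
    (h : ∀ φ : 𝔪 →ₗ[R] W, ∃ w, ∀ r : 𝔪, φ r = (r : R) • w) (f : R →ₗ.[R] W) (N : ℕ)
    (hN : 𝔪 ^ N ≤ f.domain) : ∃ w : W, ∀ x : f.domain, f x = (x : R) • w := by
  suffices H : ∀ (I : Submodule R R) (f : R →ₗ.[R] W), f.domain = I → 𝔪 ^ N ≤ f.domain →
      ∃ w : W, ∀ x : f.domain, f x = (x : R) • w from H _ f rfl hN
  clear hN f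
  intro I
  refine IsNoetherian.induction (R := R) (M := R) (P := fun I => ∀ f : R →ₗ.[R] W, f.domain = I →
    𝔪 ^ N ≤ f.domain → ∃ w : W, ∀ x : f.domain, f x = (x : R) • w) ?_ I
  · rintro I ih f rfl hN
    by_cases htop : f.domain = ⊤
    · refine ⟨f ⟨1, by simp [htop]⟩, fun x => ?_⟩
      rw [← f.map_smul]
      congr 1
      ext
      simp
    · have hex : ∃ n, 𝔪 ^ n ≤ f.domain := ⟨N, hN⟩
      classical
      obtain ⟨n, hn⟩ : ∃ n, Nat.find hex = n + 1 := by
        refine Nat.exists_eq_succ_of_ne_zero fun h0 => htop ?_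
        have := Nat.find_spec hex
        rw [h0, pow_zero, Ideal.one_eq_top, top_le_iff] at this
        exact this
      have hspec := Nat.find_spec hex
      rw [hn] at hspec
      have hnot : ¬ 𝔪 ^ n ≤ f.domain := Nat.find_min hex (by omega)
      obtain ⟨z, hz, hzd⟩ := SetLike.not_le_iff_exists.mp hnot
      have hmz : ∀ r ∈ 𝔪, r * z ∈ f.domain := fun r hr => hspec (by
        rw [pow_succ']; exact Ideal.mul_mem_mul hr hz)
      have hmem : ∀ r, r * z ∈ f.domain → r ∈ 𝔪 := by
        intro r hr
        by_contra hrm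
        obtain ⟨a, b, hb, hab⟩ := h𝔪.exists_inv hrm
        apply hzd
        have : z = a • (r * z) + b * z := by
          rw [smul_eq_mul, ← mul_assoc, ← add_mul, hab, one_mul]
        rw [this]
        exact f.domain.add_mem (f.domain.smul_mem _ hr) (hmz b hb)
      obtain ⟨w, hw⟩ := h
        { toFun := fun r => f ⟨r * z, hmz r r.2⟩
          map_add' := fun a b => by
            rw [← f.map_add]; congr 1; ext; simp [add_mul]
          map_smul' := fun a b => by
            rw [RingHom.id_apply, ← f.map_smul]; congr 1; ext; simp [mul_assoc] }
      have hw' : ∀ r (hr : r * z ∈ f.domain), f ⟨r * z, hr⟩ = r • w :=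
        fun r hr => hw ⟨r, hmem r hr⟩
      have H : ∀ c : R, c • z = 0 → c • w = 0 := by
        intro c hc
        rw [smul_eq_mul] at hc
        rw [← hw' c (by rw [hc]; exact f.domain.zero_mem)]
        convert f.map_zero
        simpa using hc
      let g : R →ₗ.[R] W := LinearPMap.mkSpanSingleton' (σ := RingHom.id R) z w H
      have Hc : ∀ (x : f.domain) (y : g.domain), (x : R) = y → f x = g y := by
        rintro ⟨x, hx⟩ ⟨y, hy⟩ hxy
        obtain ⟨c, rfl⟩ := Submodule.mem_span_singleton.mp hy
        rw [LinearPMap.mkSpanSingleton'_apply]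
        simp only [smul_eq_mul] at hxy
        subst hxy
        exact hw' c hx
      have hlt : f.domain < (f.sup g Hc).domain := by
        refine lt_of_le_of_ne (LinearPMap.left_le_sup _ _ Hc).1 fun heq => hzd ?_
        rw [heq]
        exact (LinearPMap.right_le_sup _ _ Hc).1 (Submodule.mem_span_singleton_self z)
      obtain ⟨w', hw''⟩ := ih _ hlt (f.sup g Hc) rfl
        (hN.trans (LinearPMap.left_le_sup _ _ _).1)
      refine ⟨w', fun x => ?_⟩
      rw [← hw'' ⟨x, (LinearPMap.left_le_sup _ _ Hc).1 x.2⟩]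
      exact (LinearPMap.left_le_sup _ _ Hc).2 rfl

/-- A map from an ideal to a torsion module extends by zero to a power of the ideal. -/
theorem IsTors.exists_extend_pmap [IsNoetherianRing R] {𝔞 : Ideal R} (hW : IsTors 𝔞 W)
    (I : Ideal R) (φ : I →ₗ[R] W) : ∃ (N : ℕ) (f : R →ₗ.[R] W),
      (∀ x (hx : x ∈ I), ∃ hx' : x ∈ f.domain, f ⟨x, hx'⟩ = φ ⟨x, hx⟩) ∧
      ∀ x ∈ 𝔞 ^ N, ∃ hx' : x ∈ f.domain, f ⟨x, hx'⟩ = 0 := by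
  obtain ⟨t, ht⟩ : ∃ t : ℕ, ∀ r ∈ 𝔞 ^ t, ∀ x : I, r • φ x = 0 := by
    obtain ⟨s, hs⟩ := (inferInstance : Module.Finite R I)
    choose n hn using fun x : I => hW (φ x)
    refine ⟨s.sup n, fun r hr x => ?_⟩
    have hx : x ∈ Submodule.span R (s : Set I) := hs ▸ Submodule.mem_top
    induction hx using Submodule.span_induction with
    | mem x hx => exact hn x r (Ideal.pow_le_pow_right (Finset.le_sup hx) hr)
    | zero => simp
    | add x y _ _ hx hy => rw [map_add, smul_add, hx, hy, add_zero]
    | smul a x _ hx => rw [map_smul, smul_comm, hx, smul_zero]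
  obtain ⟨k, hk⟩ := Ideal.exists_pow_inf_eq_pow_smul 𝔞 (M := R) I
  have hAR : ∀ x (hx : x ∈ I), x ∈ 𝔞 ^ (k + t) → φ ⟨x, hx⟩ = 0 := by
    intro x hx hxm
    have h1 : x ∈ 𝔞 ^ t • I := by
      have := hk (k + t) (by omega)
      rw [Nat.add_sub_cancel_left] at this
      exact (Submodule.smul_mono le_rfl inf_le_right) (this.le ⟨by simpa using hxm, hx⟩)
    have h2 : ∀ y ∈ 𝔞 ^ t • I, ∀ hy : y ∈ I, φ ⟨y, hy⟩ = 0 := by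
      intro y hy
      induction hy using Submodule.smul_induction_on' with
      | smul r hr n hn =>
        intro hy
        have : (⟨r • n, hy⟩ : I) = r • ⟨n, hn⟩ := rfl
        rw [this, map_smul, ht r hr]
      | add a ha b hb iha ihb =>
        intro hab
        have ha' : a ∈ I := Submodule.smul_le_right ha
        have hb' : b ∈ I := Submodule.smul_le_right hb
        have : (⟨a + b, hab⟩ : I) = ⟨a, ha'⟩ + ⟨b, hb'⟩ := rfl
        rw [this, map_add, iha, ihb, add_zero]
    exact h2 x h1 hx
  let f : R →ₗ.[R] W := ⟨I, φ⟩
  let g : R →ₗ.[R] W := ⟨𝔞 ^ (k + t), 0⟩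
  have hfg : ∀ (x : f.domain) (y : g.domain), (x : R) = y → f x = g y := by
    rintro ⟨x, hx⟩ ⟨y, hy⟩ rfl
    exact hAR x hx hy
  exact ⟨k + t, f.sup g hfg, fun x hx => ⟨(LinearPMap.left_le_sup _ _ hfg).1 hx,
    ((LinearPMap.left_le_sup _ _ hfg).2 (x := ⟨x, hx⟩) rfl).symm⟩,
    fun x hx => ⟨(LinearPMap.right_le_sup _ _ hfg).1 hx,
    ((LinearPMap.right_le_sup _ _ hfg).2 (x := ⟨x, hx⟩) rfl).symm⟩⟩

/-- A torsion module into which maps from the maximal ideal extend is injective. -/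
theorem IsTors.baer [IsNoetherianRing R] [h𝔪 : 𝔪.IsMaximal] (hW : IsTors 𝔪 W)
    (h : ∀ φ : 𝔪 →ₗ[R] W, ∃ w, ∀ r : 𝔪, φ r = (r : R) • w) : Module.Baer R W := by
  intro I φ
  obtain ⟨N, f, hf, hN⟩ := hW.exists_extend_pmap I φ
  obtain ⟨w, hw⟩ := LinearPMap.exists_extend_total_of_pow_le h f N fun x hx => (hN x hx).choose
  refine ⟨LinearMap.toSpanSingleton R W w, fun x hx => ?_⟩
  obtain ⟨hx', hfx⟩ := hf x hx
  rw [LinearMap.toSpanSingleton_apply, ← hfx, hw]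

end Torsion

/-- Injective and torsion. -/
structure TInj {R : Type u} [CommRing R] (𝔞 : Ideal R) (J : Type u) [AddCommGroup J]
    [Module R J] : Prop where
  inj : Module.Injective R J
  tors : IsTors 𝔞 J

section Torsion

variable {R : Type u} [CommRing R] {𝔞 𝔪 : Ideal R}

theorem Module.Injective.extend {R : Type u} [CommRing R] {Q X Y : Type u} [AddCommGroup Q]
    [Module R Q] [AddCommGroup X] [Module R X] [AddCommGroup Y] [Module R Y]
    (hQ : Module.Injective R Q) {i : X →ₗ[R] Y} (hi : Function.Injective i) (f : X →ₗ[R] Q) :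
    ∃ g : Y →ₗ[R] Q, g ∘ₗ i = f := by
  obtain ⟨g, hg⟩ := hQ.out i hi f
  exact ⟨g, LinearMap.ext hg⟩

theorem Module.Injective.of_linearEquiv {Q Q' : Type u} [AddCommGroup Q] [Module R Q]
    [AddCommGroup Q'] [Module R Q'] (e : Q ≃ₗ[R] Q') (h : Module.Injective R Q) :
    Module.Injective R Q' :=
  Module.Baer.injective ((Module.Baer.of_injective h).of_equiv e)

theorem Module.Injective.prod {Q Q' : Type u} [AddCommGroup Q] [Module R Q]
    [AddCommGroup Q'] [Module R Q'] (h : Module.Injective R Q) (h' : Module.Injective R Q') :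
    Module.Injective R (Q × Q') := by
  refine ⟨fun X Y _ _ _ _ f hf g => ?_⟩
  obtain ⟨a, ha⟩ := h.out f hf (LinearMap.fst R Q Q' ∘ₗ g)
  obtain ⟨b, hb⟩ := h'.out f hf (LinearMap.snd R Q Q' ∘ₗ g)
  exact ⟨a.prod b, fun x => Prod.ext (ha x) (hb x)⟩

theorem Module.Injective.of_retract {Q Q' : Type u} [AddCommGroup Q] [Module R Q]
    [AddCommGroup Q'] [Module R Q'] (h : Module.Injective R Q) (i : Q' →ₗ[R] Q) (p : Q →ₗ[R] Q')
    (hpi : ∀ x, p (i x) = x) : Module.Injective R Q' := by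
  refine ⟨fun X Y _ _ _ _ f hf g => ?_⟩
  obtain ⟨a, ha⟩ := h.out f hf (i ∘ₗ g)
  exact ⟨p ∘ₗ a, fun x => by simp [ha, hpi]⟩

theorem exists_injective_embedding (X : Type u) [AddCommGroup X] [Module R X] :
    ∃ (Q : ModuleCat.{u} R) (i : X →ₗ[R] Q), Module.Injective R Q ∧ Function.Injective i := by
  let p := CategoryTheory.Injective.under (ModuleCat.of R X)
  refine ⟨p, (CategoryTheory.Injective.ι (ModuleCat.of R X)).hom, ?_, ?_⟩
  · have : CategoryTheory.Injective (ModuleCat.of R p) :=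
      inferInstanceAs (CategoryTheory.Injective (CategoryTheory.Injective.under (ModuleCat.of R X)))
    exact Module.injective_module_of_injective_object R p
  · exact (ModuleCat.mono_iff_injective _).mp inferInstance

section basic

variable {X Y : Type v} [AddCommGroup X] [Module R X] [AddCommGroup Y] [Module R Y]

theorem IsTors.of_injective (h : IsTors 𝔞 Y) (f : X →ₗ[R] Y) (hf : Function.Injective f) :
    IsTors 𝔞 X := fun x => by
  obtain ⟨n, hn⟩ := h (f x)
  exact ⟨n, fun r hr => hf (by rw [map_smul, hn r hr, map_zero])⟩

theorem IsTors.of_surjective (h : IsTors 𝔞 X) (f : X →ₗ[R] Y) (hf : Function.Surjective f) :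
    IsTors 𝔞 Y := fun y => by
  obtain ⟨x, rfl⟩ := hf y
  obtain ⟨n, hn⟩ := h x
  exact ⟨n, fun r hr => by rw [← map_smul, hn r hr, map_zero]⟩

theorem IsTors.of_equiv (h : IsTors 𝔞 X) (e : X ≃ₗ[R] Y) : IsTors 𝔞 Y :=
  h.of_surjective e.toLinearMap e.surjective

theorem IsTors.prod (hX : IsTors 𝔞 X) (hY : IsTors 𝔞 Y) : IsTors 𝔞 (X × Y) := fun ⟨x, y⟩ => by
  obtain ⟨n, hn⟩ := hX x
  obtain ⟨m, hm⟩ := hY y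
  refine ⟨max n m, fun r hr => Prod.ext ?_ ?_⟩
  · exact hn r (Ideal.pow_le_pow_right (le_max_left _ _) hr)
  · exact hm r (Ideal.pow_le_pow_right (le_max_right _ _) hr)

theorem IsTors.finsupp (ι : Type*) (hX : IsTors 𝔞 X) : IsTors 𝔞 (ι →₀ X) := fun f => by
  choose n hn using hX
  refine ⟨f.support.sup fun i => n (f i), fun r hr => Finsupp.ext fun i => ?_⟩
  by_cases hi : i ∈ f.support
  · exact hn (f i) r (Ideal.pow_le_pow_right
      (Finset.le_sup (f := fun i => n (f i)) hi) hr)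
  · simp [Finsupp.notMem_support_iff.mp hi]

variable (𝔞 X) in
/-- The `𝔞`-torsion submodule. -/
def torsSub : Submodule R X where
  carrier := {x | ∃ n : ℕ, ∀ r ∈ 𝔞 ^ n, r • x = 0}
  zero_mem' := ⟨0, by simp⟩
  add_mem' := by
    rintro x y ⟨n, hn⟩ ⟨m, hm⟩
    refine ⟨max n m, fun r hr => ?_⟩
    rw [smul_add, hn r (Ideal.pow_le_pow_right (le_max_left _ _) hr),
      hm r (Ideal.pow_le_pow_right (le_max_right _ _) hr), add_zero]
  smul_mem' := by
    rintro c x ⟨n, hn⟩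
    exact ⟨n, fun r hr => by rw [smul_comm, hn r hr, smul_zero]⟩

theorem isTors_torsSub : IsTors 𝔞 (torsSub 𝔞 X) := fun ⟨_, n, hn⟩ =>
  ⟨n, fun r hr => Subtype.ext (hn r hr)⟩

/-- A nonzero submodule of a torsion module contains a nonzero socle element. -/
theorem IsTors.exists_socle (hX : IsTors 𝔞 X) {K : Submodule R X} {x : X}
    (hx : x ∈ K) (hx0 : x ≠ 0) : ∃ y ∈ K, y ≠ 0 ∧ ∀ r ∈ 𝔞, r • y = 0 := by
  obtain ⟨n, hn⟩ := hX x
  induction n generalizing x with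
  | zero => exact absurd (by simpa using hn 1 (by simp)) hx0
  | succ n ih =>
    by_cases h : ∀ r ∈ 𝔞, r • x = 0
    · exact ⟨x, hx, hx0, h⟩
    · push Not at h
      obtain ⟨r, hr, hrx⟩ := h
      exact ih (K.smul_mem r hx) hrx fun a ha => by
        rw [← mul_smul]
        exact hn _ (by rw [pow_succ]; exact Ideal.mul_mem_mul ha hr)

theorem IsTors.injective_of_socle (hX : IsTors 𝔞 X) (f : X →ₗ[R] Y)
    (hf : ∀ x, (∀ r ∈ 𝔞, r • x = 0) → f x = 0 → x = 0) : Function.Injective f := by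
  refine (injective_iff_map_eq_zero f).mpr fun x hx => ?_
  by_contra h0
  obtain ⟨y, hy, hy0, hy1⟩ := hX.exists_socle (K := LinearMap.ker f) hx h0
  exact hy0 (hf y hy1 hy)

end basic

variable {J J' : Type u} [AddCommGroup J] [Module R J] [AddCommGroup J'] [Module R J']

theorem TInj.prod (h : TInj 𝔞 J) (h' : TInj 𝔞 J') : TInj 𝔞 (J × J') :=
  ⟨h.inj.prod h'.inj, h.tors.prod h'.tors⟩

theorem TInj.of_equiv (h : TInj 𝔞 J) (e : J ≃ₗ[R] J') : TInj 𝔞 J' :=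
  ⟨h.inj.of_linearEquiv e, h.tors.of_equiv e⟩

theorem TInj.torsSub [IsNoetherianRing R] (hQ : Module.Injective R J) :
    TInj 𝔞 (torsSub 𝔞 J) := by
  refine ⟨Module.Baer.injective fun I φ => ?_, isTors_torsSub⟩
  obtain ⟨N, f, hf, hfN⟩ := (isTors_torsSub (𝔞 := 𝔞) (X := J)).exists_extend_pmap I φ
  obtain ⟨g, hg⟩ := (Module.Baer.of_injective hQ) f.domain ((_root_.torsSub 𝔞 J).subtype ∘ₗ f.toFun)
  have h1 : g 1 ∈ _root_.torsSub 𝔞 J := ⟨N, fun r hr => by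
    rw [← map_smul, smul_eq_mul, mul_one, hg r (hfN r hr).choose]
    exact congrArg Subtype.val (hfN r hr).choose_spec⟩
  refine ⟨LinearMap.toSpanSingleton R _ ⟨g 1, h1⟩, fun x hx => Subtype.ext ?_⟩
  obtain ⟨hx', hfx⟩ := hf x hx
  rw [LinearMap.toSpanSingleton_apply, ← hfx]
  change x • g 1 = _
  rw [← map_smul, smul_eq_mul, mul_one, hg x hx']
  rfl

theorem TInj.finsupp [IsNoetherianRing R] [𝔪.IsMaximal] (ι : Type u) (h : TInj 𝔪 J) :
    TInj 𝔪 (ι →₀ J) := by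
  refine ⟨((h.tors.finsupp ι).baer fun φ => ?_).injective, h.tors.finsupp ι⟩
  have hw : ∀ i, ∃ w, ∀ r : 𝔪, φ r i = (r : R) • w := fun i => by
    obtain ⟨g, hg⟩ := h.inj.extend (i := 𝔪.subtype) Subtype.val_injective
      (Finsupp.lapply i ∘ₗ φ)
    refine ⟨g 1, fun r => ?_⟩
    rw [← map_smul, smul_eq_mul, mul_one]
    exact (LinearMap.congr_fun hg r).symm
  choose w hw using hw
  obtain ⟨s, hs⟩ := (inferInstance : Module.Finite R 𝔪)
  classical
  let t : Finset ι := s.biUnion fun r => (φ r).support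
  have ht : ∀ i ∉ t, ∀ r, φ r i = 0 := by
    intro i hi r
    have hr : r ∈ Submodule.span R (s : Set 𝔪) := hs ▸ Submodule.mem_top
    induction hr using Submodule.span_induction with
    | mem r hr =>
      by_contra h0
      exact hi (Finset.mem_biUnion.mpr ⟨r, hr, Finsupp.mem_support_iff.mpr h0⟩)
    | zero => simp
    | add a b _ _ h1 h2 => rw [map_add, Finsupp.add_apply, h1, h2, add_zero]
    | smul a b _ h1 => rw [map_smul, Finsupp.smul_apply, h1, smul_zero]
  refine ⟨∑ i ∈ t, Finsupp.single i (w i), fun r => Finsupp.ext fun i => ?_⟩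
  rw [Finsupp.smul_apply, Finsupp.finsetSum_apply]
  simp only [Finsupp.single_apply, Finset.sum_ite_eq']
  split_ifs with hi
  · exact hw i r
  · rw [ht i hi, smul_zero]

theorem IsTors.exists_embedding [IsNoetherianRing R] {X : Type u} [AddCommGroup X]
    [Module R X] (hX : IsTors 𝔞 X) :
    ∃ (Q : ModuleCat.{u} R) (i : X →ₗ[R] Q), TInj 𝔞 Q ∧ Function.Injective i := by
  obtain ⟨Q, i, hQ, hi⟩ := exists_injective_embedding (R := R) X
  refine ⟨ModuleCat.of R (torsSub 𝔞 Q), LinearMap.codRestrict _ i fun x => ?_, TInj.torsSub hQ,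
    fun x y h => hi (congrArg Subtype.val h)⟩
  obtain ⟨n, hn⟩ := hX x
  exact ⟨n, fun r hr => by rw [← map_smul, hn r hr, map_zero]⟩

/-- `E` is a torsion injective module with simple socle generated by `e`. -/
structure IsMatlis {R : Type u} [CommRing R] (𝔪 : Ideal R) (E : Type u) [AddCommGroup E]
    [Module R E] (e : E) : Prop where
  tinj : TInj 𝔪 E
  ne_zero : e ≠ 0
  smul_eq_zero : ∀ r ∈ 𝔪, r • e = 0
  socle : ∀ x : E, (∀ r ∈ 𝔪, r • x = 0) → ∃ c : R, x = c • e

theorem exists_isMatlis [IsNoetherianRing R] (𝔪 : Ideal R) [h𝔪 : 𝔪.IsMaximal] :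
    ∃ (E : ModuleCat.{u} R) (e : E), IsMatlis 𝔪 E e := by
  have hk : ∀ r ∈ 𝔪, ∀ x : R ⧸ 𝔪, r • x = 0 := fun r hr x => by
    obtain ⟨x, rfl⟩ := Ideal.Quotient.mk_surjective x
    exact Ideal.Quotient.eq_zero_iff_mem.mpr (𝔪.mul_mem_right x hr)
  have htors : IsTors 𝔪 (R ⧸ 𝔪) := fun x => ⟨1, fun r hr => hk r (by simpa using hr) x⟩
  obtain ⟨Q, i, hQ, hi⟩ := htors.exists_embedding
  have hi1 : i 1 ≠ 0 := by
    rw [Ne, ← map_zero i, hi.eq_iff]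
    exact one_ne_zero
  have hie : ∀ r ∈ 𝔪, r • i 1 = 0 := fun r hr => by rw [← map_smul, hk r hr, map_zero]
  obtain ⟨E, hE0, hE⟩ := zorn_le_nonempty₀
    {E : Submodule R Q | ∀ x ∈ E, (∀ r ∈ 𝔪, r • x = 0) → ∃ c : R, x = c • i 1} (by
      intro c hc hchain y hy
      refine ⟨sSup c, fun x hx => ?_, fun z hz => le_sSup hz⟩
      obtain ⟨F, hF, hxF⟩ := (Submodule.mem_sSup_of_directed ⟨y, hy⟩ hchain.directedOn).mp hx
      exact hc hF x hxF) (R ∙ i 1) (by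
      intro x hx _
      obtain ⟨c, rfl⟩ := Submodule.mem_span_singleton.mp hx
      exact ⟨c, rfl⟩)
  have hmem : i 1 ∈ E := hE0 (Submodule.mem_span_singleton_self _)
  have hEt : IsTors 𝔪 E := hQ.tors.of_injective E.subtype Subtype.val_injective
  refine ⟨ModuleCat.of R E, ⟨i 1, hmem⟩, ⟨⟨(hEt.baer fun φ => ?_).injective, hEt⟩,
    fun h => hi1 (congrArg Subtype.val h), fun r hr => Subtype.ext (hie r hr),
    fun x hx => ?_⟩⟩
  · obtain ⟨g, hg⟩ := hQ.inj.extend (i := 𝔪.subtype) Subtype.val_injective (E.subtype ∘ₗ φ)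
    have hg' : ∀ r : 𝔪, (φ r : Q) = (r : R) • g 1 := fun r => by
      rw [← map_smul, smul_eq_mul, mul_one]
      exact (LinearMap.congr_fun hg r).symm
    have hgE : ∀ r ∈ 𝔪, r • g 1 ∈ E := fun r hr => by
      rw [← hg' ⟨r, hr⟩]; exact (φ ⟨r, hr⟩).2
    by_cases hw : g 1 ∈ E
    · exact ⟨⟨g 1, hw⟩, fun r => Subtype.ext (hg' r)⟩
    have hnot : ¬ ∀ x ∈ E ⊔ R ∙ g 1, (∀ r ∈ 𝔪, r • x = 0) → ∃ c : R, x = c • i 1 := fun h =>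
      hw (hE.le_of_ge h le_sup_left
        (Submodule.mem_sup_right (Submodule.mem_span_singleton_self _)))
    push Not at hnot
    obtain ⟨x, hx, hx0, hxe⟩ := hnot
    obtain ⟨q, hq, y, hy, rfl⟩ := Submodule.mem_sup.mp hx
    obtain ⟨r, rfl⟩ := Submodule.mem_span_singleton.mp hy
    have hr : r ∉ 𝔪 := fun hr => by
      obtain ⟨c, hc⟩ := hE.prop _ (E.add_mem hq (hgE r hr)) hx0
      exact hxe c hc
    obtain ⟨a, b, hb, hab⟩ := h𝔪.exists_inv hr
    have hmem' : b • g 1 - a • q ∈ E := E.sub_mem (hgE b hb) (E.smul_mem a hq)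
    refine ⟨⟨b • g 1 - a • q, hmem'⟩, fun t => Subtype.ext ?_⟩
    have h1 : b • g 1 - a • q = g 1 - a • (q + r • g 1) := by
      have : g 1 = (a * r + b) • g 1 := by rw [hab, one_smul]
      nth_rw 2 [this]
      module
    rw [hg', SetLike.val_smul]
    change _ = (t : R) • (b • g 1 - a • q)
    rw [h1, smul_sub, smul_comm, hx0 t t.2, smul_zero, sub_zero]
  · obtain ⟨c, hc⟩ := hE.prop x x.2 fun r hr => congrArg Subtype.val (hx r hr)
    exact ⟨c, Subtype.ext hc⟩

/-- A torsion module embeds in a direct sum of copies of `E`, and in a finite one if its socle is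
finitely generated. -/
theorem IsMatlis.exists_embedding [IsNoetherianRing R] [h𝔪 : 𝔪.IsMaximal] {E : Type u}
    [AddCommGroup E] [Module R E] {e : E} (hE : IsMatlis 𝔪 E e) {X : Type u} [AddCommGroup X]
    [Module R X] (hX : IsTors 𝔪 X) :
    ∃ (ι : Type u) (j : X →ₗ[R] (ι →₀ E)), Function.Injective j ∧
      ((Submodule.torsionBySet R X 𝔪).FG → Finite ι) := by
  let := Ideal.Quotient.field 𝔪
  let s := Submodule.torsionBySet R X 𝔪
  have hs : ∀ x, (∀ r ∈ 𝔪, r • x = 0) → x ∈ s := fun x hx =>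
    (Submodule.mem_torsionBySet_iff _ _).mpr fun r => hx r r.2
  let b := Module.Basis.ofVectorSpace (R ⧸ 𝔪) s
  let ψ : (R ⧸ 𝔪) →ₗ[R] E := Submodule.liftQ 𝔪 (LinearMap.toSpanSingleton R E e) fun r hr => by
    simpa using hE.smul_eq_zero r hr
  have hψ : Function.Injective ψ := by
    refine (injective_iff_map_eq_zero ψ).mpr fun x hx => ?_
    obtain ⟨x, rfl⟩ := Ideal.Quotient.mk_surjective x
    by_contra h0
    have hx𝔪 : x ∉ 𝔪 := fun h => h0 (Ideal.Quotient.eq_zero_iff_mem.mpr h)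
    obtain ⟨a, c, hc, hac⟩ := h𝔪.exists_inv hx𝔪
    apply hE.ne_zero
    have hx' : x • e = 0 := hx
    rw [← one_smul R e, ← hac, add_smul, mul_smul, hx', smul_zero, zero_add,
      hE.smul_eq_zero c hc]
  let j0 : s →ₗ[R] (_ →₀ E) :=
    Finsupp.mapRange.linearMap ψ ∘ₗ (b.repr.restrictScalars R).toLinearMap
  have hj0 : Function.Injective j0 := by
    refine Function.Injective.comp (g := Finsupp.mapRange.linearMap ψ) ?_ b.repr.injective
    exact Finsupp.mapRange_injective ψ (map_zero ψ) hψ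
  obtain ⟨j, hj⟩ := (hE.tinj.finsupp _).inj.extend (i := s.subtype) Subtype.val_injective j0
  refine ⟨_, j, hX.injective_of_socle j fun x hx hjx => ?_, fun hfg => ?_⟩
  · have : j0 ⟨x, hs x hx⟩ = 0 := by rw [← hj]; exact hjx
    exact congrArg Subtype.val ((injective_iff_map_eq_zero j0).mp hj0 _ this)
  · have : Module.Finite R s := Module.Finite.iff_fg.mpr hfg
    have : Module.Finite (R ⧸ 𝔪) s := Module.Finite.of_restrictScalars_finite R _ _
    exact Module.Finite.finite_basis b

theorem IsMatlis.exists_apply_ne_zero [IsNoetherianRing R] [h𝔪 : 𝔪.IsMaximal] {E : Type u}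
    [AddCommGroup E] [Module R E] {e : E} (hE : IsMatlis 𝔪 E e) {X : Type u} [AddCommGroup X]
    [Module R X] (hX : IsTors 𝔪 X) {x : X} (hx : x ≠ 0) : ∃ ψ : X →ₗ[R] E, ψ x ≠ 0 := by
  obtain ⟨ι, j, hj, -⟩ := hE.exists_embedding hX
  have : j x ≠ 0 := fun h => hx ((injective_iff_map_eq_zero j).mp hj x h)
  obtain ⟨i, hi⟩ := Finsupp.ne_iff.mp this
  exact ⟨Finsupp.lapply i ∘ₗ j, hi⟩

end Torsion

section ShortExact

variable {R : Type u} [CommRing R]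

/-- Short exact sequences of modules. -/
structure Ses {X Y Z : Type*} [AddCommGroup X] [Module R X] [AddCommGroup Y] [Module R Y]
    [AddCommGroup Z] [Module R Z] (f : X →ₗ[R] Y) (g : Y →ₗ[R] Z) : Prop where
  inj : Function.Injective f
  exact : Function.Exact f g
  surj : Function.Surjective g

namespace Ses

section

variable {X Y Z W : Type*} [AddCommGroup X] [Module R X] [AddCommGroup Y] [Module R Y]
    [AddCommGroup Z] [Module R Z] [AddCommGroup W] [Module R W]

theorem zero {f : X →ₗ[R] Y} {g : Y →ₗ[R] Z} (h : Ses f g) (x : X) : g (f x) = 0 :=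
  h.exact.apply_apply_eq_zero x

theorem of_zero {f : X →ₗ[R] Y} {g : Y →ₗ[R] Z} (hf : Function.Injective f)
    (hg : Function.Surjective g) (h0 : ∀ x, g (f x) = 0) (h : ∀ y, g y = 0 → ∃ x, f x = y) :
    Ses f g :=
  ⟨hf, fun y => ⟨h y, by rintro ⟨x, rfl⟩; exact h0 x⟩, hg⟩

theorem exists_of {f : X →ₗ[R] Y} {g : Y →ₗ[R] Z} (h : Ses f g) {y : Y} (hy : g y = 0) :
    ∃ x, f x = y := (h.exact y).mp hy

theorem desc {f : X →ₗ[R] Y} {g : Y →ₗ[R] Z} (h : Ses f g) (t : Y →ₗ[R] W)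
    (ht : ∀ x, t (f x) = 0) : ∃ t' : Z →ₗ[R] W, ∀ y, t' (g y) = t y := by
  have hk : LinearMap.ker g ≤ LinearMap.ker t := fun y hy => by
    obtain ⟨x, rfl⟩ := h.exists_of hy
    exact ht x
  refine ⟨(LinearMap.ker g).liftQ t hk ∘ₗ (g.quotKerEquivOfSurjective h.surj).symm.toLinearMap,
    fun y => ?_⟩
  have : (g.quotKerEquivOfSurjective h.surj).symm (g y) = (LinearMap.ker g).mkQ y := by
    rw [LinearEquiv.symm_apply_eq]; rfl
  simp [this]

theorem lift {f : X →ₗ[R] Y} {g : Y →ₗ[R] Z} (h : Ses f g) (t : W →ₗ[R] Y)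
    (ht : ∀ w, g (t w) = 0) : ∃ t' : W →ₗ[R] X, ∀ w, f (t' w) = t w := by
  refine ⟨(LinearEquiv.ofInjective f h.inj).symm.toLinearMap ∘ₗ t.codRestrict _
    (fun w => h.exists_of (ht w)), fun w => ?_⟩
  exact congrArg Subtype.val ((LinearEquiv.ofInjective f h.inj).apply_symm_apply
    ⟨t w, h.exists_of (ht w)⟩)

theorem quot {f : X →ₗ[R] Y} (hf : Function.Injective f) : Ses f (LinearMap.range f).mkQ :=
  ⟨hf, fun y => by simp, Submodule.mkQ_surjective _⟩

theorem mkQ (N : Submodule R X) : Ses N.subtype N.mkQ :=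
  ⟨Subtype.val_injective, fun y => by simp, Submodule.mkQ_surjective _⟩

theorem ker {g : Y →ₗ[R] Z} (hg : Function.Surjective g) : Ses (LinearMap.ker g).subtype g :=
  ⟨Subtype.val_injective, fun y => by simp, hg⟩

theorem inl_snd : Ses (LinearMap.inl R X Y) (LinearMap.snd R X Y) :=
  of_zero LinearMap.inl_injective (fun y => ⟨(0, y), rfl⟩) (fun _ => rfl)
    fun y hy => ⟨y.1, Prod.ext rfl hy.symm⟩

theorem inr_fst : Ses (LinearMap.inr R X Y) (LinearMap.fst R X Y) :=
  of_zero LinearMap.inr_injective (fun y => ⟨(y, 0), rfl⟩) (fun _ => rfl)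
    fun y hy => ⟨y.2, Prod.ext hy.symm rfl⟩

theorem equiv_left {f : X →ₗ[R] Y} {g : Y →ₗ[R] Z} (h : Ses f g) (e : W ≃ₗ[R] X) :
    Ses (f ∘ₗ e.toLinearMap) g :=
  of_zero (h.inj.comp e.injective) h.surj (fun x => h.zero _) fun y hy => by
    obtain ⟨x, rfl⟩ := h.exists_of hy
    exact ⟨e.symm x, by simp⟩

theorem equiv_right {f : X →ₗ[R] Y} {g : Y →ₗ[R] Z} (h : Ses f g) (e : Z ≃ₗ[R] W) :
    Ses f (e.toLinearMap ∘ₗ g) :=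
  of_zero h.inj (e.surjective.comp h.surj) (fun x => by simp [h.zero]) fun y hy =>
    h.exists_of (by simpa using hy)

theorem id_zero : Ses (LinearMap.id : X →ₗ[R] X) (0 : X →ₗ[R] PUnit.{v + 1}) :=
  of_zero Function.injective_id (fun _ => ⟨0, rfl⟩) (fun _ => rfl) fun y _ => ⟨y, rfl⟩

theorem zero_id : Ses (0 : PUnit.{v + 1} →ₗ[R] X) (LinearMap.id : X →ₗ[R] X) :=
  of_zero (fun _ _ _ => rfl) Function.surjective_id (fun _ => rfl) fun _ hy => ⟨0, hy.symm⟩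

/-- For `X ⊆ B ⊆ U`, there is an exact sequence `B/X → U/X → U/B`. -/
theorem quot_of_comp {X B Y U V : Type*} [AddCommGroup X] [Module R X] [AddCommGroup B] [Module R B]
    [AddCommGroup Y] [Module R Y] [AddCommGroup U] [Module R U] [AddCommGroup V] [Module R V]
    {f : X →ₗ[R] B} {g : B →ₗ[R] Y} (h : Ses f g) {i : B →ₗ[R] U} {p : U →ₗ[R] V} (h' : Ses i p) :
    ∃ (a : Y →ₗ[R] U ⧸ LinearMap.range (i ∘ₗ f)) (b : (U ⧸ LinearMap.range (i ∘ₗ f)) →ₗ[R] V),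
      Ses a b ∧ (∀ u, b ((LinearMap.range (i ∘ₗ f)).mkQ u) = p u) ∧
      ∀ y, a (g y) = (LinearMap.range (i ∘ₗ f)).mkQ (i y) := by
  have hq := quot (R := R) (f := i ∘ₗ f) (h'.inj.comp h.inj)
  obtain ⟨a, ha⟩ := h.desc ((LinearMap.range (i ∘ₗ f)).mkQ ∘ₗ i) fun x => hq.zero x
  obtain ⟨b, hb⟩ := hq.desc p fun x => h'.zero _
  refine ⟨a, b, of_zero ?_ ?_ ?_ ?_, hb, ha⟩
  · rw [← LinearMap.ker_eq_bot, LinearMap.ker_eq_bot']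
    intro y hy
    obtain ⟨c, rfl⟩ := h.surj y
    rw [ha] at hy
    obtain ⟨x, hx⟩ := hq.exists_of hy
    rw [← h'.inj hx, h.zero]
  · intro v
    obtain ⟨u, rfl⟩ := h'.surj v
    exact ⟨_, hb u⟩
  · intro y
    obtain ⟨c, rfl⟩ := h.surj y
    rw [ha, LinearMap.comp_apply, hb, h'.zero]
  · intro u hu
    obtain ⟨u, rfl⟩ := hq.surj u
    rw [hb] at hu
    obtain ⟨c, rfl⟩ := h'.exists_of hu
    exact ⟨g c, ha c⟩

/-- For surjections `I → B → Y`, there is an exact sequence of kernels. -/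
theorem ker_of_comp {X B Y U V : Type*} [AddCommGroup X] [Module R X] [AddCommGroup B] [Module R B]
    [AddCommGroup Y] [Module R Y] [AddCommGroup U] [Module R U] [AddCommGroup V] [Module R V]
    {f : X →ₗ[R] B} {g : B →ₗ[R] Y} (h : Ses f g) {i : V →ₗ[R] U} {p : U →ₗ[R] B} (h' : Ses i p) :
    ∃ (a : V →ₗ[R] LinearMap.ker (g ∘ₗ p)) (b : LinearMap.ker (g ∘ₗ p) →ₗ[R] X),
      Ses a b ∧ ∀ v, (a v : U) = i v := by
  obtain ⟨b, hb⟩ := h.lift (p ∘ₗ (LinearMap.ker (g ∘ₗ p)).subtype) fun w => w.2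
  refine ⟨i.codRestrict _ fun v => ?_, b, of_zero ?_ ?_ ?_ ?_, fun _ => rfl⟩
  · simp [h'.zero]
  · intro x y hxy
    exact h'.inj (congrArg Subtype.val hxy)
  · intro x
    obtain ⟨u, hu⟩ := h'.surj (f x)
    exact ⟨⟨u, by simp [hu, h.zero]⟩, h.inj (by rw [hb]; exact hu)⟩
  · intro v
    apply h.inj
    rw [hb]
    simp [h'.zero]
  · intro u hu
    have := hb u
    rw [hu, map_zero] at this
    obtain ⟨v, hv⟩ := h'.exists_of this.symm
    exact ⟨v, Subtype.ext hv⟩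

end

section

variable {X B Y : Type u} [AddCommGroup X] [Module R X] [AddCommGroup B] [Module R B]
    [AddCommGroup Y] [Module R Y]

theorem switch {I X' : Type u} [AddCommGroup I] [Module R I] [AddCommGroup X'] [Module R X']
    {f : X →ₗ[R] B} {g : B →ₗ[R] Y} (h : Ses f g) {i : X →ₗ[R] I} {p : I →ₗ[R] X'} (h' : Ses i p)
    {i' : B →ₗ[R] I} (hi : ∀ x, i' (f x) = i x) :
    ∃ (a : B →ₗ[R] Y × I) (b : Y × I →ₗ[R] X'), Ses a b ∧ (∀ c, (a c).1 = g c) ∧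
      ∃ φ : Y →ₗ[R] X', ∀ z, b z = p z.2 - φ z.1 := by
  obtain ⟨φ, hφ⟩ := h.desc (p ∘ₗ i') fun x => by
    rw [LinearMap.comp_apply, hi x, h'.zero]
  refine ⟨g.prod i', p ∘ₗ LinearMap.snd R Y I - φ ∘ₗ LinearMap.fst R Y I, of_zero ?_ ?_ ?_ ?_,
    fun _ => rfl, φ, fun _ => rfl⟩
  · rw [← LinearMap.ker_eq_bot, LinearMap.ker_eq_bot']
    intro c hc
    obtain ⟨x, rfl⟩ := h.exists_of (congrArg Prod.fst hc)
    have : i x = 0 := by rw [← hi x]; exact congrArg Prod.snd hc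
    rw [h'.inj (this.trans (map_zero i).symm), map_zero]
  · intro x
    obtain ⟨t, rfl⟩ := h'.surj x
    exact ⟨(0, t), by simp⟩
  · intro c
    simp [hφ]
  · rintro ⟨y, t⟩ hyt
    obtain ⟨c, rfl⟩ := h.surj y
    have : p (t - i' c) = 0 := by
      rw [map_sub]
      simpa [hφ] using hyt
    obtain ⟨x, hx⟩ := h'.exists_of this
    refine ⟨c + f x, Prod.ext (by simp [h.zero]) ?_⟩
    simp [hi, hx]

theorem switch_left {I X' : Type u} [AddCommGroup I] [Module R I] [AddCommGroup X'] [Module R X']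
    {f : X →ₗ[R] B} {g : B →ₗ[R] Y} (h : Ses f g) {i : X' →ₗ[R] I} {p : I →ₗ[R] Y} (h' : Ses i p)
    {p' : I →ₗ[R] B} (hp : ∀ x, g (p' x) = p x) :
    ∃ a : X' →ₗ[R] X × I, Ses a (f.coprod p') ∧ (∀ x, (a x).2 = i x) := by
  obtain ⟨φ, hφ⟩ := h.lift (p' ∘ₗ i) fun x => by rw [LinearMap.comp_apply, hp, h'.zero]
  replace hφ : ∀ x, f (φ x) = p' (i x) := hφ
  refine ⟨(-φ).prod i, of_zero ?_ ?_ ?_ ?_, fun _ => rfl⟩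
  · intro x y hxy
    exact h'.inj (congrArg Prod.snd hxy)
  · intro c
    obtain ⟨t, ht⟩ := h'.surj (g c)
    obtain ⟨x, hx⟩ := h.exists_of (y := c - p' t) (by rw [map_sub, hp, ht, sub_self])
    exact ⟨(x, t), by simp [hx]⟩
  · intro x
    simp [hφ]
  · rintro ⟨x, t⟩ hxt
    have h0 : f x + p' t = 0 := by simpa using hxt
    have h1 : p t = 0 := by
      rw [← hp]
      have := congrArg g h0
      rwa [map_add, h.zero, zero_add, map_zero] at this
    obtain ⟨y, rfl⟩ := h'.exists_of h1
    refine ⟨y, Prod.ext (h.inj ?_) rfl⟩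
    change f (-φ y) = f x
    rw [map_neg, hφ]
    exact (eq_neg_of_add_eq_zero_left h0).symm

theorem horseshoe {I X' K Y' : Type u} [AddCommGroup I] [Module R I] [AddCommGroup X'] [Module R X']
    [AddCommGroup K] [Module R K] [AddCommGroup Y'] [Module R Y']
    {f : X →ₗ[R] B} {g : B →ₗ[R] Y} (h : Ses f g) {i : X →ₗ[R] I} {p : I →ₗ[R] X'} (h' : Ses i p)
    {j : Y →ₗ[R] K} {q : K →ₗ[R] Y'} (h'' : Ses j q) {i' : B →ₗ[R] I} (hi : ∀ x, i' (f x) = i x) :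
    ∃ (C : ModuleCat.{u} R) (a : B →ₗ[R] I × K) (b : I × K →ₗ[R] C) (c : X' →ₗ[R] C)
      (d : C →ₗ[R] Y'), Ses a b ∧ Ses c d := by
  let a : B →ₗ[R] I × K := i'.prod (j ∘ₗ g)
  have ha : Function.Injective a := by
    rw [← LinearMap.ker_eq_bot, LinearMap.ker_eq_bot']
    intro c hc
    have h1 : g c = 0 := h''.inj ((congrArg Prod.snd hc).trans (map_zero j).symm)
    obtain ⟨x, rfl⟩ := h.exists_of h1
    have : i x = 0 := by rw [← hi x]; exact congrArg Prod.fst hc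
    rw [h'.inj (this.trans (map_zero i).symm), map_zero]
  have hq := quot (R := R) ha
  obtain ⟨c, hc⟩ := h'.desc ((LinearMap.range a).mkQ ∘ₗ LinearMap.inl R I K) fun x => by
    have : LinearMap.inl R I K (i x) = a (f x) := Prod.ext (hi x).symm (by simp [a, h.zero])
    rw [LinearMap.comp_apply, this, hq.zero]
  obtain ⟨d, hd⟩ := hq.desc (q ∘ₗ LinearMap.snd R I K) fun x => by simp [a, h''.zero]
  refine ⟨ModuleCat.of R ((I × K) ⧸ LinearMap.range a), a, (LinearMap.range a).mkQ, c, d, hq,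
    of_zero ?_ ?_ ?_ ?_⟩
  · rw [← LinearMap.ker_eq_bot, LinearMap.ker_eq_bot']
    intro x hx
    obtain ⟨t, rfl⟩ := h'.surj x
    rw [hc] at hx
    obtain ⟨s, hs⟩ := hq.exists_of hx
    have h1 : g s = 0 := h''.inj ((congrArg Prod.snd hs).trans (map_zero j).symm)
    obtain ⟨x, rfl⟩ := h.exists_of h1
    have : t = i x := by rw [← hi x]; exact (congrArg Prod.fst hs).symm
    rw [this, h'.zero]
  · intro y
    obtain ⟨k, rfl⟩ := h''.surj y
    exact ⟨(LinearMap.range a).mkQ (0, k), hd (0, k)⟩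
  · intro x
    obtain ⟨t, rfl⟩ := h'.surj x
    rw [hc, LinearMap.comp_apply, hd]
    simp
  · intro x hx
    obtain ⟨⟨t, k⟩, rfl⟩ := hq.surj x
    rw [hd] at hx
    obtain ⟨y, rfl⟩ := h''.exists_of (show q k = 0 from hx)
    obtain ⟨s, rfl⟩ := h.surj y
    refine ⟨p (t - i' s), ?_⟩
    rw [hc, LinearMap.comp_apply, ← sub_eq_zero, ← map_sub]
    have : LinearMap.inl R I K (t - i' s) - (t, j (g s)) = a (-s) := Prod.ext (by simp [a]) (by simp [a])
    rw [this, hq.zero]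

theorem horseshoe_left {I X' K Y' : Type u} [AddCommGroup I] [Module R I] [AddCommGroup X']
    [Module R X'] [AddCommGroup K] [Module R K] [AddCommGroup Y'] [Module R Y']
    {f : X →ₗ[R] B} {g : B →ₗ[R] Y} (h : Ses f g) {i : X' →ₗ[R] I} {p : I →ₗ[R] X} (h1 : Ses i p)
    {j : Y' →ₗ[R] K} {q : K →ₗ[R] Y} (h4 : Ses j q) {q' : K →ₗ[R] B}
    (hq : ∀ x, g (q' x) = q x) :
    ∃ (C : ModuleCat.{u} R) (a : C →ₗ[R] I × K) (b : I × K →ₗ[R] B) (c : X' →ₗ[R] C)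
      (d : C →ₗ[R] Y'), Ses a b ∧ Ses c d := by
  let π : I × K →ₗ[R] B := (f ∘ₗ p).coprod q'
  have hπ : ∀ z, π z = f (p z.1) + q' z.2 := fun z => by simp [π]
  have hsurj : Function.Surjective π := fun w => by
    obtain ⟨k, hk⟩ := h4.surj (g w)
    obtain ⟨u, hu⟩ := h.exists_of (y := w - q' k) (by rw [map_sub, hq, hk, sub_self])
    obtain ⟨t, rfl⟩ := h1.surj u
    exact ⟨(t, k), by rw [hπ, hu]; simp⟩
  have hker : ∀ z : LinearMap.ker π, q z.1.2 = 0 := fun z => by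
    have := congrArg g (z.2 : π z.1 = 0)
    rwa [hπ, map_add, h.zero, hq, zero_add, map_zero] at this
  obtain ⟨b, hb⟩ := h4.lift (LinearMap.snd R I K ∘ₗ (LinearMap.ker π).subtype) hker
  refine ⟨ModuleCat.of R (LinearMap.ker π), _, π,
    (LinearMap.inl R I K ∘ₗ i).codRestrict _ fun x => ?_, b, Ses.ker hsurj,
    Ses.of_zero ?_ ?_ ?_ ?_⟩
  · change π (i x, 0) = 0
    simp [hπ, h1.zero]
  · intro x y hxy
    exact h1.inj (congrArg (fun z : LinearMap.ker π => z.1.1) hxy)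
  · intro v
    obtain ⟨u, hu⟩ := h.exists_of (y := - q' (j v)) (by rw [map_neg, hq, h4.zero, neg_zero])
    obtain ⟨t, rfl⟩ := h1.surj u
    refine ⟨⟨(t, j v), ?_⟩, h4.inj ?_⟩
    · change π (t, j v) = 0
      rw [hπ, hu]
      simp
    · rw [hb]
      rfl
  · intro x
    exact h4.inj ((hb _).trans (map_zero j).symm)
  · rintro ⟨⟨t, k⟩, hz⟩ h0
    have h7 : k = 0 := by
      have := hb ⟨⟨t, k⟩, hz⟩
      rw [h0, map_zero] at this
      exact this.symm
    subst h7
    have h8 : p t = 0 := h.inj (by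
      rw [map_zero]
      have : π (t, 0) = 0 := hz
      simpa [hπ] using this)
    obtain ⟨x, rfl⟩ := h1.exists_of h8
    exact ⟨x, rfl⟩

end

end Ses

end ShortExact

section GorensteinClasses

variable {R : Type u} [CommRing R] {𝔞 : Ideal R}

/-- Torsion injective modules lift along surjections with kernel `X`. -/
def Van (𝔞 : Ideal R) (X : Type u) [AddCommGroup X] [Module R X] : Prop :=
  ∀ (Y Z : Type u) [AddCommGroup Y] [Module R Y] [AddCommGroup Z] [Module R Z]
    (f : X →ₗ[R] Y) (g : Y →ₗ[R] Z), Ses f g →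
    ∀ (J : Type u) [AddCommGroup J] [Module R J], TInj 𝔞 J → ∀ h : J →ₗ[R] Z,
      ∃ h' : J →ₗ[R] Y, ∀ j, g (h' j) = h j

theorem Van.of_ses {X I X' : Type u} [AddCommGroup X] [Module R X] [AddCommGroup I] [Module R I]
    [AddCommGroup X'] [Module R X'] {i : X →ₗ[R] I} {p : I →ₗ[R] X'} (h : Ses i p)
    (hI : Module.Injective R I)
    (hl : ∀ (J : Type u) [AddCommGroup J] [Module R J], TInj 𝔞 J → ∀ h : J →ₗ[R] X',
      ∃ h' : J →ₗ[R] I, ∀ j, p (h' j) = h j) : Van 𝔞 X := by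
  intro Y Z _ _ _ _ f g hfg J _ _ hJ t
  obtain ⟨i', hi⟩ := hI.extend hfg.inj i
  obtain ⟨a, b, hab, ha, φ, hb⟩ := hfg.switch h (LinearMap.congr_fun hi)
  obtain ⟨s, hs⟩ := hl J hJ (φ ∘ₗ t)
  obtain ⟨r, hr⟩ := hab.lift (t.prod s) fun w => by simp [hb, hs]
  refine ⟨r, fun j => ?_⟩
  rw [← ha, hr]
  rfl

/-- A class of modules which is closed under torsion injective (co)syzygies. -/
structure IsGood (𝔞 : Ideal R) (P : ModuleCat.{u} R → Prop) : Prop where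
  van : ∀ X, P X → Van 𝔞 X
  right : ∀ X, P X → ∃ (I X' : ModuleCat.{u} R) (f : X →ₗ[R] I) (g : I →ₗ[R] X'),
    Ses f g ∧ TInj 𝔞 I ∧ P X'
  left : ∀ X, P X → ∃ (I X' : ModuleCat.{u} R) (f : X' →ₗ[R] I) (g : I →ₗ[R] X),
    Ses f g ∧ TInj 𝔞 I ∧ P X'

/-- Gorenstein injective modules relative to torsion injective modules. -/
def GI (𝔞 : Ideal R) (X : Type u) [AddCommGroup X] [Module R X] : Prop :=
  ∃ P : ModuleCat.{u} R → Prop, IsGood 𝔞 P ∧ P (ModuleCat.of R X)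

theorem isGood_GI : IsGood 𝔞 fun X => GI 𝔞 X where
  van := fun X ⟨_, h, hX⟩ => h.van X hX
  right := fun X ⟨P, h, hX⟩ => by
    obtain ⟨I, X', f, g, h1, h2, h3⟩ := h.right X hX
    exact ⟨I, X', f, g, h1, h2, P, h, h3⟩
  left := fun X ⟨P, h, hX⟩ => by
    obtain ⟨I, X', f, g, h1, h2, h3⟩ := h.left X hX
    exact ⟨I, X', f, g, h1, h2, P, h, h3⟩

variable {X Y B : Type u} [AddCommGroup X] [Module R X] [AddCommGroup Y] [Module R Y]
  [AddCommGroup B] [Module R B]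

theorem IsGood.GI {P : ModuleCat.{u} R → Prop} (h : IsGood 𝔞 P) (hX : P (ModuleCat.of R X)) :
    GI 𝔞 X := ⟨P, h, hX⟩

theorem GI.van (h : GI 𝔞 X) : Van 𝔞 X := isGood_GI.van (ModuleCat.of R X) h

theorem GI.right (h : GI 𝔞 X) : ∃ (I X' : ModuleCat.{u} R) (f : X →ₗ[R] I) (g : I →ₗ[R] X'),
    Ses f g ∧ TInj 𝔞 I ∧ GI 𝔞 X' := isGood_GI.right (ModuleCat.of R X) h

theorem GI.left (h : GI 𝔞 X) : ∃ (I X' : ModuleCat.{u} R) (f : X' →ₗ[R] I) (g : I →ₗ[R] X),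
    Ses f g ∧ TInj 𝔞 I ∧ GI 𝔞 X' := isGood_GI.left (ModuleCat.of R X) h

theorem Van.of_equiv (e : X ≃ₗ[R] Y) (h : Van 𝔞 X) : Van 𝔞 Y :=
  fun U V _ _ _ _ f g hfg J _ _ hJ t => h U V (f ∘ₗ e.toLinearMap) g (hfg.equiv_left e) J hJ t

theorem GI.of_equiv (e : X ≃ₗ[R] Y) (h : GI 𝔞 X) : GI 𝔞 Y := by
  refine IsGood.GI (P := fun W => ∃ (V : ModuleCat.{u} R), GI 𝔞 V ∧ Nonempty (V ≃ₗ[R] W)) ?_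
    ⟨ModuleCat.of R X, h, ⟨e⟩⟩
  refine ⟨?_, ?_, ?_⟩
  · rintro W ⟨V, hV, ⟨e⟩⟩
    exact hV.van.of_equiv e
  · rintro W ⟨V, hV, ⟨e⟩⟩
    obtain ⟨I, X', f, g, h1, h2, h3⟩ := hV.right
    exact ⟨I, X', f ∘ₗ e.symm.toLinearMap, g, h1.equiv_left e.symm, h2, X', h3, ⟨LinearEquiv.refl _ _⟩⟩
  · rintro W ⟨V, hV, ⟨e⟩⟩
    obtain ⟨I, X', f, g, h1, h2, h3⟩ := hV.left
    exact ⟨I, X', f, e.toLinearMap ∘ₗ g, h1.equiv_right e, h2, X', h3, ⟨LinearEquiv.refl _ _⟩⟩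

theorem TInj.punit : TInj 𝔞 PUnit.{u + 1} :=
  ⟨⟨fun _ _ _ _ _ _ _ _ _ => ⟨0, fun _ => rfl⟩⟩, fun _ => ⟨0, fun _ _ => rfl⟩⟩

theorem Ses.exists_section {X Y Z : Type u} [AddCommGroup X] [Module R X] [AddCommGroup Y]
    [Module R Y] [AddCommGroup Z] [Module R Z] {f : X →ₗ[R] Y} {g : Y →ₗ[R] Z} (h : Ses f g)
    (hX : Module.Injective R X) : ∃ s : Z →ₗ[R] Y, ∀ z, g (s z) = z := by
  obtain ⟨r, hr⟩ := hX.extend h.inj LinearMap.id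
  replace hr : ∀ x, r (f x) = x := LinearMap.congr_fun hr
  obtain ⟨s, hs⟩ := h.desc (LinearMap.id - f ∘ₗ r) fun x => by simp [hr]
  refine ⟨s, fun z => ?_⟩
  obtain ⟨y, rfl⟩ := h.surj z
  simp [hs, h.zero]

theorem TInj.GI (h : TInj 𝔞 X) : GI 𝔞 X := by
  refine IsGood.GI (P := fun W => TInj 𝔞 W) ⟨?_, ?_, ?_⟩ h
  · intro W hW U V _ _ _ _ f g hfg J _ _ hJ t
    obtain ⟨s, hs⟩ := hfg.exists_section hW.inj
    exact ⟨s ∘ₗ t, fun j => hs _⟩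
  · intro W hW
    exact ⟨W, ModuleCat.of R PUnit, _, _, Ses.id_zero, hW, TInj.punit⟩
  · intro W hW
    exact ⟨W, ModuleCat.of R PUnit, _, _, Ses.zero_id, hW, TInj.punit⟩

theorem Van.of_ses_middle {f : X →ₗ[R] B} {g : B →ₗ[R] Y} (h : Ses f g) (hX : Van 𝔞 X)
    (hY : Van 𝔞 Y) : Van 𝔞 B := by
  intro U V _ _ _ _ i p hip J _ _ hJ t
  obtain ⟨a, b, hab, hb, -⟩ := h.quot_of_comp hip
  obtain ⟨s, hs⟩ := hY _ _ a b hab J hJ t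
  obtain ⟨r, hr⟩ := hX _ _ _ _ (Ses.quot (f := i ∘ₗ f) (hip.inj.comp h.inj)) J hJ s
  exact ⟨r, fun j => by rw [← hb, hr, hs]⟩

theorem GI.ext {f : X →ₗ[R] B} {g : B →ₗ[R] Y} (h : Ses f g) (hX : GI 𝔞 X) (hY : GI 𝔞 Y) :
    GI 𝔞 B := by
  refine IsGood.GI (P := fun W => ∃ (U V : ModuleCat.{u} R) (f : U →ₗ[R] W) (g : W →ₗ[R] V),
    Ses f g ∧ GI 𝔞 U ∧ GI 𝔞 V) ⟨?_, ?_, ?_⟩ ⟨ModuleCat.of R X, ModuleCat.of R Y, f, g, h, hX, hY⟩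
  · rintro W ⟨U, V, f, g, h, hU, hV⟩
    exact hU.van.of_ses_middle h hV.van
  · rintro W ⟨U, V, f, g, h, hU, hV⟩
    obtain ⟨I, U', i, p, h1, h2, h3⟩ := hU.right
    obtain ⟨K, V', j, q, h4, h5, h6⟩ := hV.right
    obtain ⟨i', hi⟩ := h2.inj.extend h.inj i
    obtain ⟨C, a, b, c, d, hab, hcd⟩ := h.horseshoe h1 h4 (LinearMap.congr_fun hi)
    exact ⟨ModuleCat.of R (I × K), C, a, b, hab, h2.prod h5, U', V', c, d, hcd, h3, h6⟩
  · rintro W ⟨U, V, f, g, h, hU, hV⟩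
    obtain ⟨I, U', i, p, h1, h2, h3⟩ := hU.left
    obtain ⟨K, V', j, q, h4, h5, h6⟩ := hV.left
    obtain ⟨q', hq⟩ := hU.van _ _ f g h K h5 q
    obtain ⟨C, a, b, c, d, hab, hcd⟩ := h.horseshoe_left h1 h4 hq
    exact ⟨ModuleCat.of R (I × K), C, a, b, hab, h2.prod h5, U', V', c, d, hcd, h3, h6⟩

variable {J : Type u} [AddCommGroup J] [Module R J]

theorem GI.of_prod (hJ : TInj 𝔞 J) (h : GI 𝔞 (X × J)) : GI 𝔞 X := by
  refine IsGood.GI (P := fun W => ∃ J : ModuleCat.{u} R, TInj 𝔞 J ∧ GI 𝔞 (W × J)) ⟨?_, ?_, ?_⟩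
    ⟨ModuleCat.of R J, hJ, h⟩
  · rintro W ⟨J, hJ, h⟩ U V _ _ _ _ f g hfg K _ _ hK t
    have : Ses (LinearMap.prodMap f (LinearMap.id (R := R) (M := J)))
        (g ∘ₗ LinearMap.fst R U J) := by
      refine Ses.of_zero ?_ ?_ ?_ ?_
      · exact Function.Injective.prodMap hfg.inj Function.injective_id
      · exact hfg.surj.comp Prod.fst_surjective
      · intro x; simp [hfg.zero]
      · rintro ⟨a, b⟩ hab
        obtain ⟨x, rfl⟩ := hfg.exists_of (show g a = 0 from hab)
        exact ⟨(x, b), rfl⟩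
    obtain ⟨s, hs⟩ := h.van _ _ _ _ this K hK t
    exact ⟨LinearMap.fst R U J ∘ₗ s, hs⟩
  · rintro W ⟨J, hJ, h⟩
    obtain ⟨I, V, i, p, h1, h2, h3⟩ := h.right
    obtain ⟨a, b, hab, -⟩ := (Ses.inl_snd (R := R) (X := W) (Y := J)).quot_of_comp h1
    refine ⟨I, ModuleCat.of R (I ⧸ _), _, _, Ses.quot (f := i ∘ₗ LinearMap.inl R W J)
      (h1.inj.comp LinearMap.inl_injective), h2, ModuleCat.of R PUnit, TInj.punit, ?_⟩
    exact GI.ext Ses.inl_snd (GI.ext hab hJ.GI h3) TInj.punit.GI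
  · rintro W ⟨J, hJ, h⟩
    obtain ⟨I, V, i, p, h1, h2, h3⟩ := h.left
    obtain ⟨a, b, hab, -⟩ := (Ses.inr_fst (R := R) (X := W) (Y := J)).ker_of_comp h1
    refine ⟨I, ModuleCat.of R (LinearMap.ker (LinearMap.fst R W J ∘ₗ p)), _,
      LinearMap.fst R W J ∘ₗ p, Ses.ker (Prod.fst_surjective.comp h1.surj), h2,
      ModuleCat.of R PUnit, TInj.punit, ?_⟩
    exact GI.ext Ses.inl_snd (GI.ext hab h3 hJ.GI) TInj.punit.GI

/-- Having a coresolution of length `n` by torsion injectives ending in `GI`. -/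
def gd (𝔞 : Ideal R) : (n : ℕ) → (X : Type u) → [AddCommGroup X] → [Module R X] → Prop
  | 0, X, _, _ => GI 𝔞 X
  | n + 1, X, _, _ => ∃ (I X' : ModuleCat.{u} R) (f : X →ₗ[R] I) (g : I →ₗ[R] X'),
    Ses f g ∧ TInj 𝔞 I ∧ gd 𝔞 n X'

theorem gd.of_equiv (e : X ≃ₗ[R] Y) {n : ℕ} (h : gd 𝔞 n X) : gd 𝔞 n Y := by
  cases n with
  | zero => exact GI.of_equiv e h
  | succ n =>
    obtain ⟨I, X', f, g, h1, h2, h3⟩ := h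
    exact ⟨I, X', f ∘ₗ e.symm.toLinearMap, g, h1.equiv_left e.symm, h2, h3⟩

theorem gd.succ {n : ℕ} (h : gd 𝔞 n X) : gd 𝔞 (n + 1) X := by
  induction n generalizing X with
  | zero => exact GI.right h
  | succ n ih =>
    obtain ⟨I, X', f, g, h1, h2, h3⟩ := h
    exact ⟨I, X', f, g, h1, h2, ih h3⟩

theorem TInj.gd {n : ℕ} (h : TInj 𝔞 X) : gd 𝔞 n X := by
  induction n with
  | zero => exact h.GI
  | succ n ih => exact ih.succ

theorem gd.right {n : ℕ} (h : gd 𝔞 n X) : ∃ (I X' : ModuleCat.{u} R) (f : X →ₗ[R] I)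
    (g : I →ₗ[R] X'), Ses f g ∧ TInj 𝔞 I ∧ _root_.gd 𝔞 n X' := h.succ

theorem gd.ext {n : ℕ} {f : X →ₗ[R] B} {g : B →ₗ[R] Y} (h : Ses f g) (hX : gd 𝔞 n X)
    (hY : gd 𝔞 n Y) : gd 𝔞 n B := by
  induction n generalizing X Y B with
  | zero => exact GI.ext h hX hY
  | succ n ih =>
    obtain ⟨I, X', i, p, h1, h2, h3⟩ := hX
    obtain ⟨K, Y', j, q, h4, h5, h6⟩ := hY
    obtain ⟨i', hi⟩ := h2.inj.extend h.inj i
    obtain ⟨C, a, b, c, d, hab, hcd⟩ := h.horseshoe h1 h4 (LinearMap.congr_fun hi)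
    exact ⟨ModuleCat.of R (I × K), C, a, b, hab, h2.prod h5, ih hcd h3 h6⟩

theorem gd.of_prod {n : ℕ} (hJ : TInj 𝔞 J) (h : gd 𝔞 n (X × J)) : gd 𝔞 n X := by
  cases n with
  | zero => exact GI.of_prod hJ h
  | succ n =>
    obtain ⟨I, V, i, p, h1, h2, h3⟩ := h
    obtain ⟨a, b, hab, -⟩ := (Ses.inl_snd (R := R) (X := X) (Y := J)).quot_of_comp h1
    exact ⟨I, ModuleCat.of R (I ⧸ _), _, _, Ses.quot (f := i ∘ₗ LinearMap.inl R X J)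
      (h1.inj.comp LinearMap.inl_injective), h2, gd.ext hab hJ.gd h3⟩

theorem gd.of_ses_right {n : ℕ} {f : X →ₗ[R] B} {g : B →ₗ[R] Y} (h : Ses f g)
    (hX : gd 𝔞 (n + 1) X) (hB : gd 𝔞 n B) : gd 𝔞 n Y := by
  obtain ⟨I, X', i, p, h1, h2, h3⟩ := hX
  obtain ⟨i', hi⟩ := h2.inj.extend h.inj _
  obtain ⟨a, b, hab, -⟩ := h.switch h1 (LinearMap.congr_fun hi)
  exact gd.of_prod h2 (gd.ext hab hB h3)

theorem gd.of_ses_left {n : ℕ} {f : X →ₗ[R] B} {g : B →ₗ[R] Y} (h : Ses f g)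
    (hB : gd 𝔞 n B) (hY : gd 𝔞 n Y) : gd 𝔞 (n + 1) X := by
  obtain ⟨I, B', i, p, h1, h2, h3⟩ := hB.right
  obtain ⟨a, b, hab, -⟩ := h.quot_of_comp h1
  exact ⟨I, ModuleCat.of R (I ⧸ _), _, _, Ses.quot (f := i ∘ₗ f) (h1.inj.comp h.inj), h2,
    gd.ext hab hY h3⟩

end GorensteinClasses

section Transfer

variable {R : Type u} [CommRing R]

theorem tInj_bot_iff {J : Type u} [AddCommGroup J] [Module R J] :
    TInj (⊥ : Ideal R) J ↔ Module.Injective R J :=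
  ⟨fun h => h.inj, fun h => ⟨h, fun x => ⟨1, fun r hr => by
    rw [pow_one, Ideal.mem_bot] at hr
    rw [hr, zero_smul]⟩⟩⟩

attribute [local instance] GorensteinInjectiveWitness.instAdd GorensteinInjectiveWitness.instMod

theorem IsGorensteinInjective.GI {X : Type u} [AddCommGroup X] [Module R X]
    (h : IsGorensteinInjective R X) : GI (⊥ : Ideal R) X := by
  obtain ⟨w⟩ := h
  have key : ∀ i, ∃ t : w.I (i + 1 + 1) →ₗ[R] LinearMap.range (w.d (i + 1)),
      Ses (LinearMap.range (w.d (i + 1 + 1))).subtype t ∧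
      ∀ x, (t x : w.I (i + 1)) = w.d (i + 1) x := fun i =>
    ⟨(w.d (i + 1)).rangeRestrict, Ses.of_zero Subtype.val_injective
      (LinearMap.surjective_rangeRestrict _)
      (by rintro ⟨_, x, rfl⟩
          exact Subtype.ext ((w.exact (i + 1)).apply_apply_eq_zero x))
      (fun y hy => ⟨⟨y, (w.exact (i + 1) y).mp (congrArg Subtype.val hy)⟩, rfl⟩), fun _ => rfl⟩
  refine IsGood.GI (P := fun W => ∃ i, Nonempty (LinearMap.range (w.d i) ≃ₗ[R] W)) ⟨?_, ?_, ?_⟩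
    ⟨0, ⟨w.iso.some.symm⟩⟩
  · rintro W ⟨i, ⟨e⟩⟩
    obtain ⟨i, rfl⟩ : ∃ j, i = j + 1 + 1 := ⟨i - 2, by ring⟩
    refine Van.of_equiv e ?_
    obtain ⟨t, ht, ht'⟩ := key i
    refine Van.of_ses ht (w.injective _) fun J _ _ hJ h => ?_
    obtain ⟨s, hs⟩ := (w.exact_hom J hJ.inj i
      ((LinearMap.range (w.d (i + 1))).subtype ∘ₗ h)).mp (LinearMap.ext fun j => by
        obtain ⟨x, hx⟩ := (h j).2
        change w.d i (h j).1 = 0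
        rw [← hx]
        exact (w.exact i).apply_apply_eq_zero x)
    refine ⟨s, fun j => Subtype.ext ?_⟩
    rw [ht']
    exact LinearMap.congr_fun hs j
  · rintro W ⟨i, ⟨e⟩⟩
    obtain ⟨i, rfl⟩ : ∃ j, i = j + 1 + 1 := ⟨i - 2, by ring⟩
    obtain ⟨t, ht, -⟩ := key i
    exact ⟨ModuleCat.of R (w.I (i + 1 + 1)), ModuleCat.of R (LinearMap.range (w.d (i + 1))), _, t,
      ht.equiv_left e.symm, tInj_bot_iff.mpr (w.injective _), i + 1, ⟨LinearEquiv.refl _ _⟩⟩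
  · rintro W ⟨i, ⟨e⟩⟩
    obtain ⟨i, rfl⟩ : ∃ j, i = j + 1 := ⟨i - 1, by ring⟩
    obtain ⟨t, ht, -⟩ := key i
    exact ⟨ModuleCat.of R (w.I (i + 1 + 1)), ModuleCat.of R (LinearMap.range (w.d (i + 1 + 1))), _,
      e.toLinearMap ∘ₗ t, ht.equiv_right e, tInj_bot_iff.mpr (w.injective _), i + 1 + 1,
      ⟨LinearEquiv.refl _ _⟩⟩

theorem gidLE.gd {n : ℕ} {X : Type u} [AddCommGroup X] [Module R X] (h : gidLE R n X) :
    gd (⊥ : Ideal R) n X := by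
  induction n generalizing X with
  | zero => exact IsGorensteinInjective.GI h
  | succ n ih =>
    obtain ⟨c, hc⟩ := h
    have hJ : _root_.gd (⊥ : Ideal R) n c.J := by
      have := c.ginj.GI
      clear ih hc
      induction n with
      | zero => exact this
      | succ n ih => exact ih.succ
    exact gd.of_ses_left (Ses.quot c.inj) hJ (ih hc)

/-- Divisibility up to torsion. -/
def QuasiDiv (x : R) (X : Type u) [AddCommGroup X] [Module R X] : Prop :=
  ∀ (u : X) (n : ℕ), ∃ (u' : X) (k : ℕ), x ^ k • (u - x ^ n • u') = 0

theorem QuasiDiv.of_surjective {x : R} {X Y : Type u} [AddCommGroup X] [Module R X]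
    [AddCommGroup Y] [Module R Y] (h : QuasiDiv x X) (f : X →ₗ[R] Y)
    (hf : Function.Surjective f) : QuasiDiv x Y := by
  intro u n
  obtain ⟨u, rfl⟩ := hf u
  obtain ⟨u', k, hk⟩ := h u n
  exact ⟨f u', k, by rw [← map_smul, ← map_sub, ← map_smul, hk, map_zero]⟩

theorem QuasiDiv.of_injective [IsNoetherianRing R] (x : R) {X : Type u} [AddCommGroup X] [Module R X]
    (h : Module.Injective R X) : QuasiDiv x X := by
  intro u n
  obtain ⟨k, hk⟩ := monotone_stabilizes_iff_noetherian.mpr (inferInstance : IsNoetherianRing R)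
    ⟨fun k => LinearMap.ker (LinearMap.toSpanSingleton R R (x ^ k)), fun a b hab r hr => by
      simp only [LinearMap.mem_ker, LinearMap.toSpanSingleton_apply, smul_eq_mul] at hr ⊢
      obtain ⟨c, rfl⟩ := Nat.exists_eq_add_of_le hab
      rw [pow_add, ← mul_assoc, hr, zero_mul]⟩
  have hk' := hk (n + k) (by omega)
  have hw : ∀ r : R, r • x ^ (n + k) = 0 → r • (x ^ k • u) = 0 := fun r hr => by
    have : r ∈ LinearMap.ker (LinearMap.toSpanSingleton R R (x ^ k)) := by
      rw [show LinearMap.ker (LinearMap.toSpanSingleton R R (x ^ k)) = _ from hk']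
      exact hr
    rw [← mul_smul]
    rw [show r * x ^ k = 0 from this, zero_smul]
  let φ := (LinearPMap.mkSpanSingleton' (σ := RingHom.id R) (x ^ (n + k)) (x ^ k • u) hw)
  obtain ⟨g, hg⟩ := (Module.Baer.of_injective h) φ.domain φ.toFun
  refine ⟨g 1, k, ?_⟩
  have hmem : x ^ (n + k) ∈ φ.domain := Submodule.mem_span_singleton_self _
  have h1 := hg _ hmem
  have h2 : φ ⟨x ^ (n + k), hmem⟩ = x ^ k • u := by
    have := LinearPMap.mkSpanSingleton'_apply (σ := RingHom.id R) (x ^ (n + k)) (x ^ k • u) hw 1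
      (by rw [one_smul]; exact hmem)
    refine (congrArg φ (Subtype.ext (one_smul _ _).symm)).trans (this.trans ?_)
    exact one_smul R _
  have h3 : g (x ^ (n + k)) = x ^ (n + k) • g 1 := by rw [← map_smul, smul_eq_mul, mul_one]
  rw [smul_sub, ← mul_smul, ← pow_add, add_comm k n]
  rw [← h3, h1, sub_eq_zero]
  exact h2.symm

theorem torsSub_sup {𝔞 𝔟 : Ideal R} {X : Type u} [AddCommGroup X] [Module R X] {x : X}
    (ha : x ∈ torsSub 𝔞 X) (hb : x ∈ torsSub 𝔟 X) : x ∈ torsSub (𝔞 ⊔ 𝔟) X := by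
  obtain ⟨n, hn⟩ := ha
  obtain ⟨m, hm⟩ := hb
  refine ⟨n + m, fun r hr => ?_⟩
  obtain ⟨a, ha, b, hb, rfl⟩ := Submodule.mem_sup.mp (Ideal.sup_pow_add_le_pow_sup_pow hr)
  rw [add_smul, hn a ha, hm b hb, add_zero]

theorem torsSub_anti {𝔞 𝔟 : Ideal R} (h : 𝔞 ≤ 𝔟) {X : Type u} [AddCommGroup X] [Module R X] :
    torsSub 𝔟 X ≤ torsSub 𝔞 X := fun _ ⟨n, hn⟩ =>
  ⟨n, fun r hr => hn r (Ideal.pow_right_mono h n hr)⟩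

theorem map_mem_torsSub {𝔞 : Ideal R} {X Y : Type u} [AddCommGroup X] [Module R X]
    [AddCommGroup Y] [Module R Y] (f : X →ₗ[R] Y) {x : X} (hx : x ∈ torsSub 𝔞 X) :
    f x ∈ torsSub 𝔞 Y := by
  obtain ⟨n, hn⟩ := hx
  exact ⟨n, fun r hr => by rw [← map_smul, hn r hr, map_zero]⟩

/-- The map induced on torsion submodules. -/
def torsMap (𝔞 : Ideal R) {X Y : Type u} [AddCommGroup X] [Module R X]
    [AddCommGroup Y] [Module R Y] (f : X →ₗ[R] Y) : torsSub 𝔞 X →ₗ[R] torsSub 𝔞 Y :=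
  f.restrict fun _ hx => map_mem_torsSub f hx

theorem Ses.torsMap {𝔞 : Ideal R} {X Y Z : Type u} [AddCommGroup X] [Module R X]
    [AddCommGroup Y] [Module R Y] [AddCommGroup Z] [Module R Z] {f : X →ₗ[R] Y} {g : Y →ₗ[R] Z}
    (h : Ses f g) (hs : ∀ z ∈ torsSub 𝔞 Z, ∃ y ∈ torsSub 𝔞 Y, g y = z) :
    Ses (torsMap 𝔞 f) (torsMap 𝔞 g) := by
  refine Ses.of_zero ?_ ?_ ?_ ?_
  · intro x y hxy
    exact Subtype.ext (h.inj (congrArg Subtype.val hxy))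
  · rintro ⟨z, hz⟩
    obtain ⟨y, hy, hyz⟩ := hs z hz
    exact ⟨⟨y, hy⟩, Subtype.ext hyz⟩
  · intro x
    exact Subtype.ext (h.zero _)
  · rintro ⟨y, n, hn⟩ hy0
    obtain ⟨x, rfl⟩ := h.exists_of (congrArg Subtype.val hy0)
    exact ⟨⟨x, n, fun r hr => h.inj (by rw [map_smul, hn r hr, map_zero])⟩, rfl⟩

theorem Ses.exists_of_quasiDiv {x : R} {X Y Z : Type u} [AddCommGroup X] [Module R X]
    [AddCommGroup Y] [Module R Y] [AddCommGroup Z] [Module R Z] {f : X →ₗ[R] Y} {g : Y →ₗ[R] Z}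
    (h : Ses f g) (hX : QuasiDiv x X) {z : Z} {n : ℕ} (hz : x ^ n • z = 0) :
    ∃ (y : Y) (m : ℕ), g y = z ∧ x ^ m • y = 0 := by
  obtain ⟨y, rfl⟩ := h.surj z
  rw [← map_smul] at hz
  obtain ⟨u, hu⟩ := h.exists_of hz
  obtain ⟨u', k, hk⟩ := hX u n
  refine ⟨y - f u', k + n, by rw [map_sub, h.zero, sub_zero], ?_⟩
  rw [pow_add, mul_smul, smul_sub, ← hu, ← map_smul, ← map_sub, ← map_smul, hk, map_zero]

theorem GI.exists_torsSub [IsNoetherianRing R] (𝔟 : Ideal R) {X : Type u} [AddCommGroup X]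
    [Module R X] (hX : GI (⊥ : Ideal R) X) {Y Z : Type u} [AddCommGroup Y] [Module R Y]
    [AddCommGroup Z] [Module R Z] {f : X →ₗ[R] Y} {g : Y →ₗ[R] Z}
    (h : Ses f g) : ∀ z ∈ torsSub 𝔟 Z, ∃ y ∈ torsSub 𝔟 Y, g y = z := by
  classical
  obtain ⟨s, rfl⟩ := (inferInstance : IsNoetherianRing R).noetherian 𝔟
  induction s using Finset.induction_on generalizing X Y Z with
  | empty =>
    intro z _
    obtain ⟨y, rfl⟩ := h.surj z
    refine ⟨y, ⟨1, fun r hr => ?_⟩, rfl⟩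
    simp only [Finset.coe_empty, Submodule.span_empty, pow_one, Ideal.mem_bot] at hr
    rw [hr, zero_smul]
  | insert x s _ ih =>
    intro z hz
    rw [Finset.coe_insert, Submodule.span_insert] at hz ⊢
    obtain ⟨n, hn⟩ := torsSub_anti le_sup_left hz
    have hzL : z ∈ torsSub _ Z := torsSub_anti le_sup_right hz
    have hses := h.torsMap (ih hX h)
    have hD : QuasiDiv x (torsSub (Submodule.span R (s : Set R)) X) := by
      obtain ⟨I, X', i, p, h1, h2, h3⟩ := hX.left
      exact (QuasiDiv.of_injective x (TInj.torsSub h2.inj).inj).of_surjective _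
        (h1.torsMap (ih h3 h1)).surj
    obtain ⟨y, m, hy, hym⟩ := hses.exists_of_quasiDiv hD (z := ⟨z, hzL⟩) (n := n)
      (Subtype.ext (hn _ (Ideal.pow_mem_pow (Submodule.mem_span_singleton_self x) n)))
    refine ⟨y, torsSub_sup ⟨m, fun r hr => ?_⟩ y.2, congrArg Subtype.val hy⟩
    rw [← Ideal.span, Ideal.span_singleton_pow, Ideal.mem_span_singleton'] at hr
    obtain ⟨c, rfl⟩ := hr
    have : x ^ m • (y : Y) = 0 := congrArg Subtype.val hym
    rw [mul_smul, this, smul_zero]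

theorem GI.of_bot [IsNoetherianRing R] {𝔪 : Ideal R} {X : Type u} [AddCommGroup X]
    [Module R X] (hX : GI (⊥ : Ideal R) X) (ht : IsTors 𝔪 X) : GI 𝔪 X := by
  have htop : torsSub 𝔪 X = ⊤ := top_unique fun x _ => ht x
  refine IsGood.GI (P := fun W => ∃ V : ModuleCat.{u} R, GI (⊥ : Ideal R) V ∧
    Nonempty (torsSub 𝔪 V ≃ₗ[R] W)) ⟨?_, ?_, ?_⟩ ⟨ModuleCat.of R X, hX, ⟨?_⟩⟩
  · rintro W ⟨V, hV, ⟨e⟩⟩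
    refine Van.of_equiv e ?_
    obtain ⟨I, V', i, p, h1, h2, h3⟩ := hV.right
    refine Van.of_ses (h1.torsMap (hV.exists_torsSub 𝔪 h1)) (TInj.torsSub h2.inj).inj ?_
    intro J _ _ hJ t
    obtain ⟨s, hs⟩ := hV.van _ _ i p h1 J (tInj_bot_iff.mpr hJ.inj) ((torsSub 𝔪 V').subtype ∘ₗ t)
    exact ⟨s.codRestrict _ fun j => map_mem_torsSub s (hJ.tors j), fun j => Subtype.ext (hs j)⟩
  · rintro W ⟨V, hV, ⟨e⟩⟩
    obtain ⟨I, V', i, p, h1, h2, h3⟩ := hV.right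
    exact ⟨ModuleCat.of R (torsSub 𝔪 I), ModuleCat.of R (torsSub 𝔪 V'), _, _,
      (h1.torsMap (hV.exists_torsSub 𝔪 h1)).equiv_left e.symm, TInj.torsSub h2.inj, V', h3,
      ⟨LinearEquiv.refl _ _⟩⟩
  · rintro W ⟨V, hV, ⟨e⟩⟩
    obtain ⟨I, V', i, p, h1, h2, h3⟩ := hV.left
    exact ⟨ModuleCat.of R (torsSub 𝔪 I), ModuleCat.of R (torsSub 𝔪 V'), _, _,
      (h1.torsMap (h3.exists_torsSub 𝔪 h1)).equiv_right e, TInj.torsSub h2.inj, V', h3,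
      ⟨LinearEquiv.refl _ _⟩⟩
  · exact LinearEquiv.ofTop _ htop

theorem gd.of_bot [IsNoetherianRing R] {𝔪 : Ideal R} {n : ℕ} {X : Type u} [AddCommGroup X]
    [Module R X] (hX : gd (⊥ : Ideal R) n X) (ht : IsTors 𝔪 X) : gd 𝔪 n X := by
  induction n generalizing X with
  | zero => exact GI.of_bot hX ht
  | succ n ih =>
    obtain ⟨J, i, hJ, hi⟩ := ht.exists_embedding
    exact ⟨J, ModuleCat.of R _, i, _, Ses.quot hi, hJ,
      ih (gd.of_ses_right (Ses.quot hi) hX (tInj_bot_iff.mpr hJ.inj).gd)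
        (hJ.tors.of_surjective _ (Submodule.mkQ_surjective _))⟩

end Transfer

section

open Polynomial

section PolynomialStep

variable {R : Type u} [CommRing R]

theorem Module.Injective.of_flat {B : Type u} [CommRing B] [Algebra R B] [Module.Flat R B]
    {Q : Type u} [AddCommGroup Q] [Module R Q] [Module B Q] [IsScalarTower R B Q]
    (h : Module.Injective B Q) : Module.Injective R Q := by
  refine ⟨fun X Y _ _ _ _ i hi f => ?_⟩
  have hi' : Function.Injective (i.baseChange B) :=
    Module.Flat.lTensor_preserves_injective_linearMap i hi
  obtain ⟨g, hg⟩ := h.extend hi' (TensorProduct.AlgebraTensorModule.lift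
    (LinearMap.toSpanSingleton B (X →ₗ[R] Q) f))
  refine ⟨g.restrictScalars R ∘ₗ (TensorProduct.mk R B Y 1), fun x => ?_⟩
  have := LinearMap.congr_fun hg (1 ⊗ₜ x)
  simpa using this

theorem TInj.of_flat {B : Type u} [CommRing B] [Algebra R B] [Module.Flat R B] {𝔪 : Ideal R}
    {𝔫 : Ideal B} (h𝔪 : 𝔪.map (algebraMap R B) ≤ 𝔫)
    {Q : Type u} [AddCommGroup Q] [Module R Q] [Module B Q] [IsScalarTower R B Q]
    (h : TInj 𝔫 Q) : TInj 𝔪 Q := by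
  refine ⟨h.inj.of_flat, fun x => ?_⟩
  obtain ⟨n, hn⟩ := h.tors x
  refine ⟨n, fun r hr => ?_⟩
  rw [← algebraMap_smul B r x]
  refine hn _ (Ideal.pow_right_mono h𝔪 n ?_)
  rw [← Ideal.map_pow]
  exact Ideal.mem_map_of_mem _ hr

/-- Linear maps commuting with `X`. -/
def LinearMap.ofX {W W' : Type*} [AddCommGroup W] [Module R W] [Module R[X] W]
    [IsScalarTower R R[X] W] [AddCommGroup W'] [Module R W'] [Module R[X] W']
    [IsScalarTower R R[X] W'] (f : W →ₗ[R] W')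
    (h : ∀ w, f ((X : R[X]) • w) = (X : R[X]) • f w) : W →ₗ[R[X]] W' :=
  { f with
    map_smul' := fun p w => by
      simp only [AddHom.toFun_eq_coe, LinearMap.coe_toAddHom, RingHom.id_apply]
      induction p using Polynomial.induction_on' generalizing w with
      | add p q hp hq => rw [add_smul, map_add, hp, hq, add_smul]
      | monomial n a =>
        rw [← C_mul_X_pow_eq_monomial, mul_smul, mul_smul]
        have hC : ∀ {U : Type _} [AddCommGroup U] [Module R U] [Module R[X] U]
            [IsScalarTower R R[X] U] (z : U), C a • z = a • z := fun z =>
          algebraMap_smul R[X] a z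
        have hC' : ∀ (z : W'), C a • z = a • z := fun z => algebraMap_smul R[X] a z
        rw [hC, hC', map_smul]
        congr 1
        induction n generalizing w with
        | zero => simp
        | succ n ih => rw [pow_succ, mul_smul, ih, h, mul_smul] }

variable (R) in
/-- Inverse polynomials over `V`, on which `X` acts by lowering the degree. -/
abbrev InvPoly (V : Type u) [AddCommGroup V] [Module R V] : Type u :=
  Module.AEval' (Finsupp.lcomapDomain (M := V) (R := R) Nat.succ Nat.succ_injective :
    Module.End R (ℕ →₀ V))

namespace InvPoly

variable {V V' V'' W : Type u} [AddCommGroup V] [Module R V] [AddCommGroup V'] [Module R V']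
  [AddCommGroup V''] [Module R V''] [AddCommGroup W]

/-- The coefficients of an inverse polynomial. -/
noncomputable def coeff (i : ℕ) : InvPoly R V →ₗ[R] V :=
  Finsupp.lapply i ∘ₗ (Module.AEval'.of _).symm.toLinearMap

theorem ext {v w : InvPoly R V} (h : ∀ i, coeff i v = coeff i w) : v = w :=
  (Module.AEval'.of _).symm.injective (Finsupp.ext h)

theorem coeff_X_smul (i : ℕ) (v : InvPoly R V) : coeff i ((X : R[X]) • v) = coeff (i + 1) v := by
  obtain ⟨v, rfl⟩ := (Module.AEval'.of _).surjective v
  rw [Module.AEval'.X_smul_of]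
  rfl

theorem coeff_X_pow_smul (i k : ℕ) (v : InvPoly R V) :
    coeff i ((X ^ k : R[X]) • v) = coeff (i + k) v := by
  induction k generalizing i with
  | zero => simp
  | succ k ih => rw [pow_succ', mul_smul, coeff_X_smul, ih, show i + 1 + k = i + (k + 1) by omega]

theorem exists_bound (v : InvPoly R V) : ∃ k, ∀ i ≥ k, coeff i v = 0 := by
  obtain ⟨v, rfl⟩ := (Module.AEval'.of _).surjective v
  refine ⟨v.support.sup id + 1, fun i hi => ?_⟩
  by_contra h
  have : i ∈ v.support := Finsupp.mem_support_iff.mpr h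
  have := Finset.le_sup (f := id) this
  simp only [id_eq] at this
  omega

theorem exists_mk (a : ℕ → V) {k : ℕ} (h : ∀ i ≥ k, a i = 0) : ∃ v : InvPoly R V, ∀ i, coeff i v = a i :=
  ⟨Module.AEval'.of _ (Finsupp.onFinset (Finset.range k) a fun i hi => by
    by_contra h'
    exact hi (h i (by simpa using h'))), fun _ => rfl⟩

theorem ext_hom [Module R[X] W] {f g : W →ₗ[R[X]] InvPoly R V}
    (h : ∀ w, coeff 0 (f w) = coeff 0 (g w)) : f = g := by
  ext w
  refine ext fun i => ?_
  have h1 : ∀ f : W →ₗ[R[X]] InvPoly R V, coeff i (f w) = coeff 0 (f ((X ^ i : R[X]) • w)) :=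
    fun f => by rw [map_smul, coeff_X_pow_smul, zero_add]
  rw [h1, h1, h]

theorem exists_hom [Module R W] [Module R[X] W] [IsScalarTower R R[X] W]
    (hW : ∀ w : W, ∃ n, (X ^ n : R[X]) • w = 0) (t : W →ₗ[R] V) :
    ∃ f : W →ₗ[R[X]] InvPoly R V, ∀ w i, coeff i (f w) = t ((X ^ i : R[X]) • w) := by
  choose n hn using hW
  have hz : ∀ w, ∀ i ≥ n w, t ((X ^ i : R[X]) • w) = 0 := fun w i hi => by
    obtain ⟨k, rfl⟩ := Nat.exists_eq_add_of_le hi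
    rw [add_comm, pow_add, mul_smul, hn, smul_zero, map_zero]
  choose F hF using fun w => exists_mk (R := R) _ (hz w)
  let F' : W →ₗ[R] InvPoly R V :=
    { toFun := F
      map_add' := fun a b => ext fun i => by simp [hF]
      map_smul' := fun r a => ext fun i => by
        simp only [hF, map_smul, RingHom.id_apply]
        rw [smul_comm, map_smul] }
  refine ⟨LinearMap.ofX F' fun w => ext fun i => ?_, hF⟩
  · change coeff i (F _) = coeff i ((X : R[X]) • F w)
    rw [hF, coeff_X_smul, hF, pow_succ, mul_smul]

variable (𝔪 : Ideal R)

/-- The ideal `(𝔪, X)`. -/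
noncomputable def idealX : Ideal R[X] := 𝔪.map C ⊔ Ideal.span {X}

theorem pow_smul_eq_zero_of_isTors {𝔪 : Ideal R} [Module R[X] W] (h : IsTors (idealX 𝔪) W) (w : W) :
    ∃ n, (X ^ n : R[X]) • w = 0 := by
  obtain ⟨n, hn⟩ := h w
  exact ⟨n, hn _ (Ideal.pow_mem_pow (Ideal.mem_sup_right (Ideal.mem_span_singleton_self X)) n)⟩

theorem isTors {𝔪 : Ideal R} (h : IsTors 𝔪 V) : IsTors (idealX 𝔪) (InvPoly R V) := by
  intro v
  refine torsSub_sup (x := v) ?_ ?_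
  · obtain ⟨k, hk⟩ := exists_bound v
    choose n hn using fun i => h (coeff i v)
    refine ⟨(Finset.range k).sup n, fun r hr => ?_⟩
    rw [← Ideal.map_pow] at hr
    induction hr using Submodule.span_induction with
    | mem x hx =>
      obtain ⟨a, ha, rfl⟩ := hx
      refine ext fun i => ?_
      rw [Module.AEval.C_smul, map_smul, map_zero]
      by_cases hi : k ≤ i
      · rw [hk i hi, smul_zero]
      · exact hn i a (Ideal.pow_le_pow_right (Finset.le_sup (by simpa using hi)) ha)
    | zero => rw [zero_smul]
    | add a b _ _ ha hb => rw [add_smul, ha, hb, add_zero]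
    | smul a b _ hb => rw [smul_assoc, hb, smul_zero]
  · obtain ⟨k, hk⟩ := exists_bound v
    refine ⟨k, fun r hr => ?_⟩
    rw [Ideal.span_singleton_pow, Ideal.mem_span_singleton'] at hr
    obtain ⟨c, rfl⟩ := hr
    have : (X ^ k : R[X]) • v = 0 := ext fun i => by
      rw [coeff_X_pow_smul, hk _ (by omega), map_zero]
    rw [mul_smul, this, smul_zero]

theorem X_pow_smul_eq_zero (v : InvPoly R V) : ∃ n, (X ^ n : R[X]) • v = 0 := by
  obtain ⟨k, hk⟩ := exists_bound v
  exact ⟨k, ext fun i => by rw [coeff_X_pow_smul, hk _ (by omega), map_zero]⟩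

theorem exists_map (t : V →ₗ[R] V') :
    ∃ f : InvPoly R V →ₗ[R[X]] InvPoly R V', ∀ w i, coeff i (f w) = t (coeff i w) := by
  obtain ⟨f, hf⟩ := exists_hom (X_pow_smul_eq_zero (R := R) (V := V)) (t ∘ₗ coeff 0)
  exact ⟨f, fun w i => by rw [hf, LinearMap.comp_apply, coeff_X_pow_smul, zero_add]⟩

theorem exists_ses {t : V →ₗ[R] V'} {s : V' →ₗ[R] V''} (h : Ses t s) :
    ∃ (f : InvPoly R V →ₗ[R[X]] InvPoly R V') (g : InvPoly R V' →ₗ[R[X]] InvPoly R V''), Ses f g ∧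
      (∀ w i, coeff i (f w) = t (coeff i w)) ∧ ∀ w i, coeff i (g w) = s (coeff i w) := by
  obtain ⟨f, hf⟩ := exists_map t
  obtain ⟨g, hg⟩ := exists_map s
  refine ⟨f, g, Ses.of_zero ?_ ?_ ?_ ?_, hf, hg⟩
  · intro v w hvw
    exact ext fun i => h.inj (by rw [← hf, ← hf, hvw])
  · intro v
    obtain ⟨k, hk⟩ := exists_bound v
    choose σ hσ using h.surj
    obtain ⟨w, hw⟩ := exists_mk (R := R) (fun i => if k ≤ i then 0 else σ (coeff i v)) (k := k)
      fun i hi => if_pos hi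
    refine ⟨w, ext fun i => ?_⟩
    rw [hg, hw]
    split_ifs with hi
    · rw [hk i hi, map_zero]
    · exact hσ _
  · intro v
    exact ext fun i => by rw [hg, hf, h.zero, map_zero]
  · intro v hv
    have h0 : ∀ i, s (coeff i v) = 0 := fun i => by rw [← hg, hv, map_zero]
    choose a ha using fun i => h.exists_of (h0 i)
    obtain ⟨k, hk⟩ := exists_bound v
    obtain ⟨w, hw⟩ := exists_mk (R := R) a (k := k) fun i hi => h.inj (by rw [ha, hk i hi, map_zero])
    exact ⟨w, ext fun i => by rw [hf, hw, ha]⟩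

theorem tInj [IsNoetherianRing R] {𝔪 : Ideal R} (h : TInj 𝔪 V) : TInj (idealX 𝔪) (InvPoly R V) := by
  have ht := isTors h.tors
  obtain ⟨Q, i, hQ, hi⟩ := ht.exists_embedding
  let _ : Module R Q := Module.compHom Q (algebraMap R R[X])
  have _ : IsScalarTower R R[X] Q := IsScalarTower.of_algebraMap_smul fun _ _ => rfl
  obtain ⟨t, ht'⟩ := h.inj.extend (i := i.restrictScalars R) hi (coeff 0)
  obtain ⟨f, hf⟩ := exists_hom (pow_smul_eq_zero_of_isTors hQ.tors) t
  refine ⟨hQ.inj.of_retract i f fun x => ?_, ht⟩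
  have : f ∘ₗ i = LinearMap.id := ext_hom fun w => by
    rw [LinearMap.comp_apply, hf, pow_zero, one_smul]
    exact LinearMap.congr_fun ht' w
  exact LinearMap.congr_fun this x

theorem van [IsNoetherianRing R] {𝔪 : Ideal R} (h : GI 𝔪 V) : Van (idealX 𝔪) (InvPoly R V) := by
  obtain ⟨I, V', i, p, h1, h2, h3⟩ := h.right
  obtain ⟨f, g, hfg, hf, hg⟩ := exists_ses h1
  refine Van.of_ses hfg (tInj h2).inj fun J _ _ hJ t => ?_
  let _ : Module R J := Module.compHom J (algebraMap R R[X])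
  have _ : IsScalarTower R R[X] J := IsScalarTower.of_algebraMap_smul fun _ _ => rfl
  have hJ' : TInj 𝔪 J := hJ.of_flat le_sup_left
  obtain ⟨s, hs⟩ := h.van _ _ i p h1 J hJ' (coeff 0 ∘ₗ t.restrictScalars R)
  obtain ⟨r, hr⟩ := exists_hom (pow_smul_eq_zero_of_isTors hJ.tors) s
  refine ⟨r, fun j => ?_⟩
  have : g ∘ₗ r = t := ext_hom fun w => by
    rw [LinearMap.comp_apply, hg, hr, hs, pow_zero, one_smul]
    rfl
  exact LinearMap.congr_fun this j

theorem GI [IsNoetherianRing R] {𝔪 : Ideal R} (h : GI 𝔪 V) : GI (idealX 𝔪) (InvPoly R V) := by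
  refine IsGood.GI (P := fun W => ∃ (V : ModuleCat.{u} R), _root_.GI 𝔪 V ∧
    Nonempty (InvPoly R V ≃ₗ[R[X]] W)) ⟨?_, ?_, ?_⟩ ⟨ModuleCat.of R V, h, ⟨LinearEquiv.refl _ _⟩⟩
  · rintro W ⟨V, hV, ⟨e⟩⟩
    exact (van hV).of_equiv e
  · rintro W ⟨V, hV, ⟨e⟩⟩
    obtain ⟨I, V', i, p, h1, h2, h3⟩ := hV.right
    obtain ⟨f, g, hfg, -⟩ := exists_ses h1
    exact ⟨ModuleCat.of R[X] (InvPoly R I), ModuleCat.of R[X] (InvPoly R V'), _, _, hfg.equiv_left e.symm,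
      tInj h2, V', h3, ⟨LinearEquiv.refl _ _⟩⟩
  · rintro W ⟨V, hV, ⟨e⟩⟩
    obtain ⟨I, V', i, p, h1, h2, h3⟩ := hV.left
    obtain ⟨f, g, hfg, -⟩ := exists_ses h1
    exact ⟨ModuleCat.of R[X] (InvPoly R I), ModuleCat.of R[X] (InvPoly R V'), _, _, hfg.equiv_right e,
      tInj h2, V', h3, ⟨LinearEquiv.refl _ _⟩⟩

theorem gd [IsNoetherianRing R] {𝔪 : Ideal R} {n : ℕ} (h : gd 𝔪 n V) :
    gd (idealX 𝔪) n (InvPoly R V) := by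
  induction n generalizing V with
  | zero => exact GI h
  | succ n ih =>
    obtain ⟨I, V', i, p, h1, h2, h3⟩ := h
    obtain ⟨f, g, hfg, -⟩ := exists_ses h1
    exact ⟨ModuleCat.of R[X] (InvPoly R I), ModuleCat.of R[X] (InvPoly R V'), _, _, hfg, tInj h2, ih h3⟩

theorem ses_self [Module R W] [Module R[X] W] [IsScalarTower R R[X] W]
    (hW : ∀ w : W, ∃ n, (X ^ n : R[X]) • w = 0) :
    ∃ (f : W →ₗ[R[X]] InvPoly R W) (g : InvPoly R W →ₗ[R[X]] InvPoly R W), Ses f g := by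
  obtain ⟨f, hf⟩ := exists_hom hW LinearMap.id
  obtain ⟨m, hm⟩ := exists_map (R := R) (V := W) (V' := W)
    ((LinearMap.lsmul R[X] W X).restrictScalars R)
  have hm' : ∀ (w : InvPoly R W) i, coeff i (m w) = (X : R[X]) • coeff i w := hm
  have hd : ∀ v i, coeff i ((LinearMap.lsmul R[X] (InvPoly R W) X - m) v) =
      coeff (i + 1) v - (X : R[X]) • coeff i v := fun v i => by
    rw [LinearMap.sub_apply, map_sub, hm', LinearMap.lsmul_apply, coeff_X_smul]
  refine ⟨f, LinearMap.lsmul R[X] _ X - m, Ses.of_zero ?_ ?_ ?_ ?_⟩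
  · intro v w hvw
    have := congrArg (coeff 0) hvw
    simpa [hf] using this
  · intro v
    obtain ⟨k, hk⟩ := exists_bound v
    choose n hn using fun i => hW (coeff i v)
    let a : ℕ → W := fun i => ∑ j ∈ Finset.range i, (X ^ (i - 1 - j) : R[X]) • coeff j v
    obtain ⟨w, hw⟩ := exists_mk (R := R) a (k := k + (Finset.range k).sup n + 1) fun i hi => by
      refine Finset.sum_eq_zero fun j hj => ?_
      by_cases hjk : k ≤ j
      · rw [hk j hjk, smul_zero]
      · have h1 : n j ≤ (Finset.range k).sup n := Finset.le_sup (by simpa using hjk)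
        obtain ⟨c, hc⟩ := Nat.exists_eq_add_of_le (show n j ≤ i - 1 - j by omega)
        rw [hc, add_comm, pow_add, mul_smul, hn, smul_zero]
    refine ⟨w, ext fun i => ?_⟩
    rw [hd, hw, hw]
    simp only [a]
    rw [Finset.sum_range_succ, Finset.smul_sum]
    have : ∀ j ∈ Finset.range i, (X ^ (i + 1 - 1 - j) : R[X]) • coeff j v =
        (X : R[X]) • (X ^ (i - 1 - j) : R[X]) • coeff j v := fun j hj => by
      have := Finset.mem_range.mp hj
      rw [← mul_smul, ← pow_succ']
      congr 2
      omega
    rw [Finset.sum_congr rfl this]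
    simp
  · intro v
    refine ext fun i => ?_
    rw [hd, hf, hf, pow_succ', mul_smul]
    simp
  · intro v hv
    have h0 : ∀ i, coeff (i + 1) v = (X : R[X]) • coeff i v := fun i => by
      rw [← sub_eq_zero, ← hd, hv, map_zero]
    refine ⟨coeff 0 v, ext fun i => ?_⟩
    rw [hf]
    simp only [LinearMap.id_apply]
    induction i with
    | zero => simp
    | succ i ih => rw [h0, pow_succ', mul_smul, ih]

end InvPoly

theorem gd.polynomial [IsNoetherianRing R] {𝔪 : Ideal R} {n : ℕ} {W : Type u} [AddCommGroup W]
    [Module R W] [Module R[X] W] [IsScalarTower R R[X] W] (h : gd 𝔪 n W)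
    (hW : ∀ w : W, ∃ n, (X ^ n : R[X]) • w = 0) : gd (InvPoly.idealX 𝔪) (n + 1) W := by
  obtain ⟨f, g, hfg⟩ := InvPoly.ses_self hW
  exact gd.of_ses_left hfg (InvPoly.gd h) (InvPoly.gd h)

end PolynomialStep

end

section FlatDimension

open TensorProduct

variable {R : Type u} [CommRing R]

theorem Ses.rTensor_injective_of_lTensor {L F W K P K' : Type*} [AddCommGroup L] [Module R L]
    [AddCommGroup F] [Module R F] [AddCommGroup W] [Module R W] [AddCommGroup K] [Module R K]
    [AddCommGroup P] [Module R P] [AddCommGroup K'] [Module R K']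
    {a : L →ₗ[R] F} {b : F →ₗ[R] W} (hab : Ses a b) {c : K →ₗ[R] P} {d : P →ₗ[R] K'}
    (hcd : Ses c d) (h1 : Function.Injective (c.rTensor F))
    (h2 : Function.Injective (a.lTensor K')) : Function.Injective (c.rTensor W) := by
  refine (injective_iff_map_eq_zero _).mpr fun z hz => ?_
  obtain ⟨y, rfl⟩ := LinearMap.lTensor_surjective K hab.surj z
  have hbc : b.lTensor P (c.rTensor F y) = c.rTensor W (b.lTensor K y) := by
    rw [← LinearMap.comp_apply, ← LinearMap.comp_apply, LinearMap.rTensor_comp_lTensor,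
      LinearMap.lTensor_comp_rTensor]
  rw [← hbc] at hz
  obtain ⟨p, hp⟩ := (lTensor_exact P hab.exact hab.surj _).mp hz
  have hdp : d.rTensor L p = 0 := by
    apply h2
    have h3 : a.lTensor K' (d.rTensor L p) = d.rTensor F (a.lTensor P p) := by
      rw [← LinearMap.comp_apply, ← LinearMap.comp_apply, LinearMap.rTensor_comp_lTensor,
        LinearMap.lTensor_comp_rTensor]
    rw [h3, hp, map_zero]
    exact (rTensor_exact F hcd.exact hcd.surj _).mpr ⟨y, rfl⟩
  obtain ⟨q, rfl⟩ := (rTensor_exact L hcd.exact hcd.surj _).mp hdp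
  have h4 : a.lTensor P (c.rTensor L q) = c.rTensor F (a.lTensor K q) := by
    rw [← LinearMap.comp_apply, ← LinearMap.comp_apply, LinearMap.rTensor_comp_lTensor,
      LinearMap.lTensor_comp_rTensor]
  rw [h4] at hp
  rw [← h1 hp]
  exact (lTensor_exact K hab.exact hab.surj _).mpr ⟨q, rfl⟩

variable (R) in
/-- `K` is a `d`-th syzygy in flat modules. -/
def FlatSyz : (d : ℕ) → (K : Type u) → [AddCommGroup K] → [Module R K] → Prop
  | 0, _, _, _ => True
  | d + 1, K, _, _ => ∃ (P X : ModuleCat.{u} R) (f : K →ₗ[R] P) (g : P →ₗ[R] X),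
      Ses f g ∧ Module.Flat R P ∧ FlatSyz d X

variable (R) in
/-- Vanishing of the first Tor modules against `d`-th flat syzygies. -/
def TorLE (d : ℕ) (W : Type u) [AddCommGroup W] [Module R W] : Prop :=
  ∀ (K P K' : Type u) [AddCommGroup K] [AddCommGroup P] [AddCommGroup K'] [Module R K]
    [Module R P] [Module R K'] (f : K →ₗ[R] P) (g : P →ₗ[R] K'), Ses f g → Module.Flat R P →
    FlatSyz R d K' → Function.Injective (f.rTensor W)

theorem FlatSyz.of_succ {d : ℕ} {K : Type u} [AddCommGroup K] [Module R K]
    (h : FlatSyz R (d + 1) K) : FlatSyz R d K := by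
  induction d generalizing K with
  | zero => trivial
  | succ d ih =>
    obtain ⟨P, X, f, g, h1, h2, h3⟩ := h
    exact ⟨P, X, f, g, h1, h2, ih h3⟩

theorem FlatSyz.restrict {B : Type u} [CommRing B] [Algebra R B] [Module.Flat R B] {d : ℕ}
    {K : Type u} [AddCommGroup K] [Module R K] [Module B K] [IsScalarTower R B K]
    (h : FlatSyz B d K) : FlatSyz R d K := by
  induction d generalizing K with
  | zero => trivial
  | succ d ih =>
    obtain ⟨P, X, f, g, h1, h2, h3⟩ := h
    let _ : Module R P := Module.compHom P (algebraMap R B)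
    have _ : IsScalarTower R B P := IsScalarTower.of_algebraMap_smul fun _ _ => rfl
    let _ : Module R X := Module.compHom X (algebraMap R B)
    have _ : IsScalarTower R B X := IsScalarTower.of_algebraMap_smul fun _ _ => rfl
    exact ⟨ModuleCat.of R P, ModuleCat.of R X, f.restrictScalars R, g.restrictScalars R,
      ⟨h1.inj, h1.exact, h1.surj⟩, Module.Flat.trans R B P, ih h3⟩

namespace TorLE

variable {L F W : Type u} [AddCommGroup L] [Module R L] [AddCommGroup F] [Module R F]
  [AddCommGroup W] [Module R W] {d : ℕ}

theorem of_flat (h : Module.Flat R F) : TorLE R d F :=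
  fun _ _ _ _ _ _ _ _ _ f _ hf _ _ => Module.Flat.rTensor_preserves_injective_linearMap f hf.inj

theorem of_ses {a : L →ₗ[R] F} {b : F →ₗ[R] W} (hab : Ses a b) (hL : TorLE R d L)
    (hF : TorLE R d F) : TorLE R (d + 1) W := by
  intro K P K' _ _ _ _ _ _ f g hfg hP hK
  refine hab.rTensor_injective_of_lTensor hfg (hF K P K' f g hfg hP hK.of_succ) ?_
  obtain ⟨P', X, i, p, h1, h2, h3⟩ := hK
  have h4 := hL K' P' X i p h1 h2 h3
  have h5 : Function.Injective (a.lTensor P') :=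
    Module.Flat.lTensor_preserves_injective_linearMap a hab.inj
  have h6 := h5.comp h4
  rw [← LinearMap.coe_comp, LinearMap.lTensor_comp_rTensor, ← LinearMap.rTensor_comp_lTensor,
    LinearMap.coe_comp] at h6
  exact h6.of_comp

theorem left {a : L →ₗ[R] F} {b : F →ₗ[R] W} (hab : Ses a b) [Module.Flat R F]
    (hW : TorLE R (d + 1) W) : TorLE R d L := by
  intro K P K' _ _ _ _ _ _ f g hfg hP hK
  have h0 := Ses.ker (Finsupp.linearCombination_id_surjective R K)
  have h1 := hW _ _ _ _ _ h0 inferInstance ⟨ModuleCat.of R P, ModuleCat.of R K', f, g, hfg, hP, hK⟩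
  have h2 := h0.rTensor_injective_of_lTensor hab
    (Module.Flat.rTensor_preserves_injective_linearMap a hab.inj)
    ((LinearMap.lTensor_inj_iff_rTensor_inj _ _).mpr h1)
  rw [← LinearMap.lTensor_inj_iff_rTensor_inj] at h2
  have h6 : Function.Injective (f.rTensor F) :=
    Module.Flat.rTensor_preserves_injective_linearMap f hfg.inj
  replace h6 := h6.comp h2
  rw [← LinearMap.coe_comp, LinearMap.rTensor_comp_lTensor, ← LinearMap.lTensor_comp_rTensor,
    LinearMap.coe_comp] at h6
  exact h6.of_comp

theorem flat (h : TorLE R 0 W) : Module.Flat R W := by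
  rw [Module.Flat.iff_rTensor_injective']
  intro I
  exact h _ _ _ _ _ (Ses.mkQ I) inferInstance trivial

theorem baseChange {B : Type u} [CommRing B] [Algebra R B] [Module.Flat R B] (h : TorLE R d W) :
    TorLE B d (B ⊗[R] W) := by
  intro K P K' _ _ _ _ _ _ f g hfg hP hK
  let _ : Module R K := Module.compHom K (algebraMap R B)
  have _ : IsScalarTower R B K := IsScalarTower.of_algebraMap_smul fun _ _ => rfl
  let _ : Module R P := Module.compHom P (algebraMap R B)
  have _ : IsScalarTower R B P := IsScalarTower.of_algebraMap_smul fun _ _ => rfl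
  let _ : Module R K' := Module.compHom K' (algebraMap R B)
  have _ : IsScalarTower R B K' := IsScalarTower.of_algebraMap_smul fun _ _ => rfl
  have h1 := h K P K' (f.restrictScalars R) (g.restrictScalars R) ⟨hfg.inj, hfg.exact, hfg.surj⟩
    (Module.Flat.trans R B P) hK.restrict
  let eK := TensorProduct.AlgebraTensorModule.cancelBaseChange R B B K W
  let eP := TensorProduct.AlgebraTensorModule.cancelBaseChange R B B P W
  have h2 : ∀ z, eP (f.rTensor (B ⊗[R] W) z) = (f.restrictScalars R).rTensor W (eK z) := by
    intro z
    induction z with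
    | zero => simp
    | add x y hx hy => simp only [map_add, hx, hy]
    | tmul x y =>
      induction y with
      | zero => simp
      | add x y hx hy => simp only [tmul_add, map_add, hx, hy]
      | tmul b w => simp [eP, eK]
  intro x y hxy
  apply eK.injective
  apply h1
  rw [← h2, ← h2, hxy]

theorem of_algebra {S T : Type u} [CommRing S] [Algebra R S] [CommRing T] [Algebra S T]
    [Algebra R T] [IsScalarTower R S T] [Module.Flat S T] (h : TorLE R d S) : TorLE R d T := by
  intro K P K' _ _ _ _ _ _ f g hfg hP hK
  have h1 := h K P K' f g hfg hP hK
  rw [← LinearMap.lTensor_inj_iff_rTensor_inj] at h1 ⊢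
  have h2 : Function.Injective ((f.baseChange S).lTensor T) :=
    Module.Flat.lTensor_preserves_injective_linearMap (f.baseChange S) h1
  let eK := TensorProduct.AlgebraTensorModule.cancelBaseChange R S S T K
  let eP := TensorProduct.AlgebraTensorModule.cancelBaseChange R S S T P
  have h3 : ∀ z, eP ((f.baseChange S).lTensor T z) = f.lTensor T (eK z) := by
    intro z
    induction z with
    | zero => simp
    | add x y hx hy => simp only [map_add, hx, hy]
    | tmul x y =>
      induction y with
      | zero => simp
      | add x y hx hy => simp only [tmul_add, map_add, hx, hy]
      | tmul b w => simp [eP, eK]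
  intro x y hxy
  obtain ⟨x, rfl⟩ := eK.surjective x
  obtain ⟨y, rfl⟩ := eK.surjective y
  rw [← h3, ← h3] at hxy
  exact congrArg eK (h2 (eP.injective hxy))

end TorLE

theorem fdLE.torLE {n : ℕ} {W : Type u} [AddCommGroup W] [Module R W] (h : fdLE R n W) :
    TorLE R n W := by
  induction n generalizing W with
  | zero => exact TorLE.of_flat h
  | succ n ih =>
    obtain ⟨c, hc⟩ := h
    exact TorLE.of_ses (Ses.ker c.surj) (ih hc) (TorLE.of_flat c.flat)

open Polynomial

/-- The characteristic sequence of an `R[X]`-module. -/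
theorem exists_ses_polynomial (W : Type u) [AddCommGroup W] [Module R W] [Module R[X] W]
    [IsScalarTower R R[X] W] : ∃ (a : R[X] ⊗[R] W →ₗ[R[X]] R[X] ⊗[R] W)
      (b : R[X] ⊗[R] W →ₗ[R[X]] W), Ses a b := by
  let m : W →ₗ[R] W := (LinearMap.lsmul R[X] W X).restrictScalars R
  let a : R[X] ⊗[R] W →ₗ[R[X]] R[X] ⊗[R] W := LinearMap.lsmul R[X] _ X - m.baseChange R[X]
  let b : R[X] ⊗[R] W →ₗ[R[X]] W := TensorProduct.AlgebraTensorModule.lift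
    (LinearMap.toSpanSingleton R[X] (W →ₗ[R] W) LinearMap.id)
  have hb : ∀ p w, b (p ⊗ₜ w) = p • w := fun p w => by simp [b]
  have ha : ∀ (p : R[X]) (w : W), a (p ⊗ₜ w) = (X * p) ⊗ₜ w - p ⊗ₜ ((X : R[X]) • w) :=
    fun p w => by simp [a, m, smul_tmul']
  refine ⟨a, b, Ses.of_zero ?_ ?_ ?_ ?_⟩
  · let e := PolynomialModule.polynomialTensorProductLEquivPolynomialModule R W
    have h0 : ∀ (n : ℕ) (w : W), e (monomial n 1 ⊗ₜ w) = PolynomialModule.single R n w := by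
      intro n w
      simp [e, PolynomialModule.polynomialTensorProductLEquivPolynomialModule]
      rfl
    have h1 : ∀ z i, (e (a z)).coeff (i + 1) =
        (e z).coeff i - (X : R[X]) • (e z).coeff (i + 1) := by
      intro z i
      induction z with
      | zero => simp
      | add x y hx hy =>
        simp only [map_add, PolynomialModule.coeff_add, Finsupp.add_apply, hx, hy, smul_add]
        abel
      | tmul p w =>
        induction p using Polynomial.induction_on' with
        | add p q hp hq =>
          simp only [add_tmul, map_add, PolynomialModule.coeff_add,
            Finsupp.add_apply, hp, hq, smul_add]
          abel
        | monomial n r =>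
          have : monomial n r ⊗ₜ[R] w = monomial n 1 ⊗ₜ[R] (r • w) := by
            rw [← smul_tmul]; simp [smul_monomial]
          rw [this, ha, map_sub, X_mul_monomial, h0, h0, h0]
          have hs : ∀ x y : PolynomialModule R W, (x - y).coeff = x.coeff - y.coeff :=
            fun x y => rfl
          rw [hs]
          simp [Finsupp.single_apply]
    refine (injective_iff_map_eq_zero _).mpr fun z hz => ?_
    have h2 : ∀ i, (e z).coeff i = (X : R[X]) • (e z).coeff (i + 1) := fun i => by
      rw [← sub_eq_zero, ← h1, hz, map_zero]
      rfl
    have h3 : ∀ k i, (e z).coeff i = (X ^ k : R[X]) • (e z).coeff (i + k) := by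
      intro k
      induction k with
      | zero => simp
      | succ k ih =>
        intro i
        rw [ih, h2 (i + k), ← mul_smul, ← pow_succ, add_assoc]
    apply e.injective
    rw [map_zero]
    apply PolynomialModule.coeff_injective
    ext i
    rw [h3 ((e z).coeff.support.sup id + 1) i]
    have : i + ((e z).coeff.support.sup id + 1) ∉ (e z).coeff.support := fun h => by
      have := Finset.le_sup (f := id) h
      simp only [id_eq] at this
      omega
    rw [Finsupp.notMem_support_iff.mp this, smul_zero]
    rfl
  · exact fun w => ⟨1 ⊗ₜ w, by rw [hb, one_smul]⟩
  · intro z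
    induction z with
    | zero => simp
    | add x y hx hy => rw [map_add, map_add, hx, hy, add_zero]
    | tmul p w => rw [ha, map_sub, hb, hb, mul_comm, mul_smul, sub_self]
  · have key : ∀ z, ∃ y, a y = z - 1 ⊗ₜ b z := by
      intro z
      induction z with
      | zero => exact ⟨0, by simp⟩
      | add x y hx hy =>
        obtain ⟨x', hx'⟩ := hx
        obtain ⟨y', hy'⟩ := hy
        exact ⟨x' + y', by rw [map_add, map_add, hx', hy', tmul_add]; abel⟩
      | tmul p w =>
        induction p using Polynomial.induction_on' with
        | add p q hp hq =>
          obtain ⟨x', hx'⟩ := hp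
          obtain ⟨y', hy'⟩ := hq
          exact ⟨x' + y', by rw [map_add, add_tmul, map_add, hx', hy', tmul_add]; abel⟩
        | monomial n r =>
          induction n generalizing w with
          | zero =>
            refine ⟨0, ?_⟩
            rw [map_zero, hb, monomial_zero_left]
            have h1 : (C r : R[X]) • w = r • w := algebraMap_smul R[X] r w
            rw [h1, ← smul_tmul, Polynomial.smul_eq_C_mul, mul_one, sub_self]
          | succ n ih =>
            obtain ⟨y, hy⟩ := ih ((X : R[X]) • w)
            refine ⟨y + monomial n r ⊗ₜ w, ?_⟩
            rw [map_add, hy, ha, X_mul_monomial, hb, hb, ← mul_smul, monomial_mul_X]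
            abel
    intro z hz
    obtain ⟨y, hy⟩ := key z
    exact ⟨y, by rw [hy, hz, tmul_zero, sub_zero]⟩

theorem TorLE.polynomial {d : ℕ} {W : Type u} [AddCommGroup W] [Module R W] [Module R[X] W]
    [IsScalarTower R R[X] W] (h : TorLE R d W) : TorLE R[X] (d + 1) W := by
  obtain ⟨a, b, hab⟩ := exists_ses_polynomial (R := R) W
  exact TorLE.of_ses hab h.baseChange h.baseChange

end FlatDimension

section Tower

open TensorProduct Polynomial RingTheory.Sequence Pointwise

theorem isWeaklyRegular_cons_of_addMonoidHom {A B U V : Type*} [CommRing A] [CommRing B]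
    [AddCommGroup U] [AddCommGroup V] [Module A U] [Module B V] (q : U →+ V)
    (hq : Function.Surjective q) (x : A) (hx : IsSMulRegular U x)
    (hker : ∀ u, q u = 0 ↔ ∃ u', x • u' = u) (φ : B → A)
    (hφ : ∀ b u, q (φ b • u) = b • q u) {zs : List B} (h : IsWeaklyRegular V zs) :
    IsWeaklyRegular U (x :: zs.map φ) := by
  rw [isWeaklyRegular_cons_iff]
  refine ⟨hx, ?_⟩
  have hk : (x • (⊤ : Submodule A U)).toAddSubgroup = q.ker := by
    ext u
    rw [Submodule.mem_toAddSubgroup, Submodule.mem_smul_pointwise_iff_exists,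
      AddMonoidHom.mem_ker, hker]
    simp
  let e₁ : QuotSMulTop x U ≃+ U ⧸ q.ker := QuotientAddGroup.quotientAddEquivOfEq hk
  let e : QuotSMulTop x U ≃+ V :=
    e₁.trans (QuotientAddGroup.quotientKerEquivOfSurjective q hq)
  have he : ∀ u : U, e (Submodule.Quotient.mk u) = q u := fun u => rfl
  refine (AddEquiv.isWeaklyRegular_congr (e := e) ?_).mpr h
  rw [List.forall₂_map_left_iff, List.forall₂_same]
  intro z _ u
  obtain ⟨u, rfl⟩ := Submodule.Quotient.mk_surjective _ u
  rw [← Submodule.Quotient.mk_smul, he, he, hφ]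

theorem isWeaklyRegular_polynomial {R B W : Type*} [CommRing R] [CommRing B] [Algebra R B]
    [AddCommGroup W] [Module R W] {zs : List B} (h : IsWeaklyRegular (B ⊗[R] W) zs) :
    IsWeaklyRegular (B[X] ⊗[R] W) (X :: zs.map C) := by
  let c : B[X] →ₗ[R] B := (Polynomial.lcoeff B 0).restrictScalars R
  let m : B[X] →ₗ[R] B[X] := (LinearMap.lsmul B[X] B[X] X).restrictScalars R
  let dX : B[X] →ₗ[R] B[X] :=
    { divX_hom with
      map_smul' := fun r p => by
        ext i
        simp [coeff_divX] }
  have hd : dX ∘ₗ m = LinearMap.id := by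
    ext p i
    simp [dX, m, coeff_divX]
  have hm : ∀ u, m.rTensor W u = (X : B[X]) • u := by
    intro u
    induction u with
    | zero => simp
    | add x y hx hy => rw [map_add, hx, hy, smul_add]
    | tmul p w => simp [m, smul_tmul']
  have hc : Function.Surjective c := fun b => ⟨C b, by simp [c]⟩
  have hex : Function.Exact m c := by
    intro p
    constructor
    · intro hp
      refine ⟨divX p, ?_⟩
      have := X_mul_divX_add p
      have hp' : p.coeff 0 = 0 := hp
      rw [hp', C_0, add_zero] at this
      exact this
    · rintro ⟨p, rfl⟩
      simp [m, c]
  refine isWeaklyRegular_cons_of_addMonoidHom (c.rTensor W).toAddMonoidHom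
    (LinearMap.rTensor_surjective W hc) X ?_ ?_ C ?_ h
  · intro u v huv
    simp only at huv
    rw [← hm, ← hm] at huv
    have := congrArg (dX.rTensor W) huv
    rw [← LinearMap.comp_apply, ← LinearMap.comp_apply, ← LinearMap.rTensor_comp, hd] at this
    simpa using this
  · intro u
    simp only [LinearMap.toAddMonoidHom_coe, ← hm]
    exact rTensor_exact W hex hc u
  · intro b u
    simp only [LinearMap.toAddMonoidHom_coe]
    induction u with
    | zero => simp
    | add x y hx hy => rw [smul_add, map_add, hx, hy, map_add, smul_add]
    | tmul p w => simp [c, smul_tmul']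

/-- The elements of the list are linearly independent modulo `𝔪 ^ 2`. -/
def CotIndep {B : Type*} [CommRing B] (𝔪 : Ideal B) : List B → Prop
  | [] => True
  | w :: ws => (w ∈ 𝔪 ∧ w ∉ 𝔪 ^ 2 ⊔ Ideal.ofList ws) ∧ CotIndep 𝔪 ws

theorem CotIndep.mem {B : Type*} [CommRing B] {𝔪 : Ideal B} {ws : List B} (h : CotIndep 𝔪 ws) :
    ∀ w ∈ ws, w ∈ 𝔪 := by
  induction ws with
  | nil => simp
  | cons w ws ih =>
    intro v hv
    rcases List.mem_cons.mp hv with rfl | hv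
    · exact h.1.1
    · exact ih h.2 v hv

theorem CotIndep.ofList_le {B : Type*} [CommRing B] {𝔪 : Ideal B} {ws : List B}
    (h : CotIndep 𝔪 ws) : Ideal.ofList ws ≤ 𝔪 := Ideal.span_le.mpr h.mem

theorem CotIndep.map_C {B : Type*} [CommRing B] {𝔪 : Ideal B} {ws : List B}
    (h : CotIndep 𝔪 ws) : CotIndep (InvPoly.idealX 𝔪) (ws.map C) := by
  induction ws with
  | nil => trivial
  | cons w ws ih =>
    refine ⟨⟨Ideal.mem_sup_left (Ideal.mem_map_of_mem _ h.1.1), fun hw => h.1.2 ?_⟩, ih h.2⟩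
    have h1 := Ideal.mem_map_of_mem (constantCoeff : B[X] →+* B) hw
    have h2 : (InvPoly.idealX 𝔪).map (constantCoeff : B[X] →+* B) ≤ 𝔪 := by
      rw [InvPoly.idealX, Ideal.map_sup, Ideal.map_map, Ideal.map_span]
      refine sup_le ?_ ?_
      · rw [show (constantCoeff : B[X] →+* B).comp C = RingHom.id B by ext; simp, Ideal.map_id]
      · simp
    rw [Ideal.map_sup, Ideal.map_pow, Ideal.map_ofList, List.map_map] at h1
    have h3 : (⇑(constantCoeff : B[X] →+* B) ∘ ⇑C) = id := by ext; simp
    rw [h3, List.map_id] at h1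
    have h4 : (constantCoeff : B[X] →+* B) (C w) = w := by simp
    rw [h4] at h1
    exact sup_le_sup_right (Ideal.pow_right_mono h2 2) _ h1

theorem CotIndep.polynomial {B : Type*} [CommRing B] {𝔪 : Ideal B} (h𝔪 : 𝔪 ≠ ⊤) {ws : List B}
    (h : CotIndep 𝔪 ws) : CotIndep (InvPoly.idealX 𝔪) (X :: ws.map C) := by
  refine ⟨⟨Ideal.mem_sup_right (Ideal.mem_span_singleton_self X), fun hX => ?_⟩, h.map_C⟩
  let I : Ideal B[X] :=
    { carrier := {p | p.coeff 0 ∈ 𝔪 ∧ p.coeff 1 ∈ 𝔪}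
      add_mem' := fun ha hb => ⟨by simpa using add_mem ha.1 hb.1, by simpa using add_mem ha.2 hb.2⟩
      zero_mem' := by simp
      smul_mem' := fun c p hp => by
        refine ⟨?_, ?_⟩
        · rw [smul_eq_mul, mul_coeff_zero]
          exact 𝔪.mul_mem_left _ hp.1
        · rw [smul_eq_mul, mul_coeff_one]
          exact add_mem (𝔪.mul_mem_left _ hp.2) (𝔪.mul_mem_left _ hp.1) }
  have hC : 𝔪.map C ≤ I := Ideal.map_le_iff_le_comap.mpr fun a ha => by
    refine ⟨by simpa using ha, ?_⟩
    simp
  have hI : InvPoly.idealX 𝔪 ^ 2 ⊔ Ideal.ofList (ws.map C) ≤ I := by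
    refine sup_le ?_ ?_
    · rw [InvPoly.idealX, pow_two, Ideal.mul_sup, sup_comm, sup_le_iff]
      refine ⟨?_, Ideal.mul_le_right.trans hC⟩
      rw [Ideal.sup_mul, sup_le_iff]
      refine ⟨Ideal.mul_le_left.trans hC, ?_⟩
      rw [Ideal.span_singleton_mul_span_singleton, Ideal.span_singleton_le_iff_mem, ← pow_two]
      constructor <;> simp [coeff_X_pow]
    · rw [← Ideal.map_ofList]
      exact (Ideal.map_mono h.ofList_le).trans hC
  have := (hI hX).2
  rw [coeff_X_one] at this
  exact h𝔪 ((Ideal.eq_top_iff_one _).mpr this)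

/-- Data of a flat extension `R → B → S` by polynomial variables. -/
structure Tower (R : Type u) (S : Type u) (M : Type u) [CommRing R] [CommRing S] [Algebra R S]
    [AddCommGroup M] [Module S M] (𝔪 : Ideal R) (ys : List S) (ws : List R) (g d : ℕ) where
  B : Type u
  [commRing : CommRing B]
  [algebra : Algebra R B]
  [algebra' : Algebra B S]
  [tower : IsScalarTower R B S]
  [module : Module B M]
  [tower' : IsScalarTower B S M]
  noeth : IsNoetherianRing B
  flat : Module.Flat R B
  zs : List B
  map_zs : zs.map (algebraMap B S) = ys
  π : B →ₐ[R] R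
  ker_π : RingHom.ker π = Ideal.ofList zs
  reg : ∀ (W : Type u) [AddCommGroup W] [Module R W], IsWeaklyRegular (B ⊗[R] W) zs
  indep : CotIndep (𝔪.map (algebraMap R B) ⊔ Ideal.ofList zs) (zs ++ ws.map (algebraMap R B))
  gd : gd (𝔪.map (algebraMap R B) ⊔ Ideal.ofList zs) g M
  torLE : TorLE B d S

attribute [instance] Tower.commRing Tower.algebra Tower.algebra' Tower.tower Tower.module
  Tower.tower'

theorem Tower.nonempty {R S M : Type u} [CommRing R] [IsNoetherianRing R] [CommRing S]
    [Algebra R S] [AddCommGroup M] [Module R M] [Module S M] [IsScalarTower R S M] {𝔪 : Ideal R}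
    (h𝔪 : 𝔪 ≠ ⊤) {𝔫 : Ideal S} (hM : IsTors 𝔫 M) (ys : List S) (hys : ∀ y ∈ ys, y ∈ 𝔫) {ws : List R}
    (hws : CotIndep 𝔪 ws) {g d : ℕ} (hg : _root_.gd 𝔪 g M) (hd : TorLE R d S) :
    Nonempty (Tower R S M 𝔪 ys ws (g + ys.length) (d + ys.length)) := by
  induction ys with
  | nil =>
    refine ⟨{ B := R, noeth := inferInstance, flat := inferInstance, zs := [], map_zs := rfl,
              π := AlgHom.id R R, ker_π := ?_, reg := fun _ _ _ => IsWeaklyRegular.nil _ _,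
              indep := ?_, gd := ?_, torLE := hd }⟩
    · simp only [Ideal.ofList_nil]
      exact (RingHom.injective_iff_ker_eq_bot _).mp Function.injective_id
    · simpa using hws
    · simpa [Ideal.map_id] using hg
  | cons y ys ih =>
    obtain ⟨t⟩ := ih fun z hz => hys z (List.mem_cons_of_mem _ hz)
    let φ : t.B[X] →+* S := eval₂RingHom (algebraMap t.B S) y
    let _ : Algebra t.B[X] S := φ.toAlgebra
    let _ : Module t.B[X] M := Module.compHom M φ
    have hφ : algebraMap t.B[X] S = φ := rfl
    have _ : IsScalarTower t.B t.B[X] S := IsScalarTower.of_algebraMap_eq fun b => by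
      rw [hφ, algebraMap_eq]; simp [φ]
    have _ : IsScalarTower R t.B[X] S := IsScalarTower.of_algebraMap_eq fun b => by
      rw [hφ, IsScalarTower.algebraMap_apply R t.B t.B[X], algebraMap_eq,
        IsScalarTower.algebraMap_apply R t.B S]; simp [φ]
    have _ : IsScalarTower t.B[X] S M := IsScalarTower.of_algebraMap_smul fun p m => rfl
    have _ : IsScalarTower t.B t.B[X] M := IsScalarTower.of_algebraMap_smul fun p m => by
      rw [← algebraMap_smul S (algebraMap t.B t.B[X] p) m, ← IsScalarTower.algebraMap_apply,
        algebraMap_smul]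
    have _ := t.noeth
    have _ := t.flat
    have hid : 𝔪.map (algebraMap R t.B[X]) ⊔ Ideal.ofList (X :: t.zs.map C) =
        InvPoly.idealX (𝔪.map (algebraMap R t.B) ⊔ Ideal.ofList t.zs) := by
      rw [InvPoly.idealX, Ideal.ofList_cons, ← Ideal.map_ofList,
        IsScalarTower.algebraMap_eq R t.B t.B[X], ← Ideal.map_map, algebraMap_eq, Ideal.map_sup,
        sup_assoc, sup_comm (Ideal.span {X})]
    have hne : 𝔪.map (algebraMap R t.B) ⊔ Ideal.ofList t.zs ≠ ⊤ := by
      intro h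
      have h1 := congrArg (Ideal.map t.π) h
      rw [Ideal.map_sup, Ideal.map_top] at h1
      have h2 : (Ideal.ofList t.zs).map t.π = ⊥ := by
        rw [← t.ker_π]
        exact (Ideal.map_eq_bot_iff_le_ker _).mpr le_rfl
      have h3 : (𝔪.map (algebraMap R t.B)).map t.π = 𝔪 := by
        have : (t.π : t.B →+* R).comp (algebraMap R t.B) = RingHom.id R := t.π.comp_algebraMap
        have h4 := Ideal.map_map (I := 𝔪) (algebraMap R t.B) (t.π : t.B →+* R)
        rw [this, Ideal.map_id] at h4
        exact h4
      rw [h2, h3, sup_bot_eq] at h1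
      exact h𝔪 h1
    refine ⟨{ B := t.B[X], noeth := inferInstance, flat := Module.Flat.trans R t.B t.B[X],
              zs := X :: t.zs.map C, map_zs := ?_,
              π := t.π.comp ((Polynomial.aeval (0 : t.B)).restrictScalars R), ker_π := ?_,
              reg := fun W _ _ => isWeaklyRegular_polynomial (t.reg W),
              indep := ?_, gd := ?_, torLE := t.torLE.polynomial }⟩
    · rw [List.map_cons, List.map_map]
      congr 1
      · rw [hφ]; simp [φ]
      · refine Eq.trans (List.map_congr_left fun b _ => ?_) t.map_zs
        rw [Function.comp_apply, hφ]; simp [φ]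
    · rw [Ideal.ofList_cons, ← Ideal.map_ofList, ← t.ker_π]
      refine le_antisymm (fun p hp => ?_) (sup_le ?_ ?_)
      · rw [← X_mul_divX_add p]
        refine add_mem (Ideal.mem_sup_left (Ideal.mul_mem_right _ _
          (Ideal.mem_span_singleton_self X))) (Ideal.mem_sup_right (Ideal.mem_map_of_mem _ ?_))
        have hp' : t.π (Polynomial.aeval (0 : t.B) p) = 0 := hp
        rw [Polynomial.aeval_def, eval₂_at_zero] at hp'
        exact hp'
      · rw [Ideal.span_singleton_le_iff_mem, RingHom.mem_ker]
        simp
      · rw [Ideal.map_le_iff_le_comap]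
        intro b hb
        rw [Ideal.mem_comap, RingHom.mem_ker]
        simpa using hb
    · rw [hid]
      have := t.indep.polynomial hne
      rw [List.map_append, List.map_map] at this
      exact this
    · rw [hid]
      refine _root_.gd.polynomial t.gd fun w => ?_
      obtain ⟨n, hn⟩ := hM w
      refine ⟨n, ?_⟩
      rw [← algebraMap_smul S (X ^ n : t.B[X]) w, map_pow]
      refine hn _ (Ideal.pow_mem_pow ?_ n)
      rw [hφ]
      simpa [φ] using hys y List.mem_cons_self

theorem Tower.comap_π {R S M : Type u} [CommRing R] [CommRing S] [Algebra R S]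
    [AddCommGroup M] [Module S M] {𝔪 : Ideal R} {ys : List S} {ws : List R} {g d : ℕ}
    (t : Tower R S M 𝔪 ys ws g d) :
    𝔪.comap t.π = 𝔪.map (algebraMap R t.B) ⊔ Ideal.ofList t.zs := by
  rw [← t.ker_π]
  refine le_antisymm (fun b hb => ?_) (sup_le ?_ ?_)
  · have h1 : b = algebraMap R t.B (t.π b) + (b - algebraMap R t.B (t.π b)) := by abel
    rw [h1]
    refine add_mem (Ideal.mem_sup_left (Ideal.mem_map_of_mem _ hb)) (Ideal.mem_sup_right ?_)
    rw [RingHom.mem_ker, map_sub, AlgHom.commutes]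
    simp
  · rw [Ideal.map_le_iff_le_comap]
    intro r hr
    rw [Ideal.mem_comap, Ideal.mem_comap, AlgHom.commutes]
    exact hr
  · intro b hb
    rw [Ideal.mem_comap, show t.π b = 0 from hb]
    exact zero_mem _

end Tower

section Theta

open MvPolynomial

variable {B : Type u} {l : Type u} {ι : Type u} [CommRing B] [Field l]

open Classical in
/-- Reduce coefficients along `β` and substitute `σ i` for the variables indexed by `U`. -/
noncomputable def partialEval (β : B →+* l) (σ : ι → l) (U : Set ι) :
    MvPolynomial ι B →+* MvPolynomial ι l :=
  eval₂Hom (C.comp β) (fun i => if i ∈ U then C (σ i) else X i)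

theorem partialEval_univ (β : B →+* l) (σ : ι → l) :
    partialEval β σ Set.univ = C.comp (eval₂Hom β σ) := by
  ext i <;> simp [partialEval]

theorem partialEval_empty (β : B →+* l) (σ : ι → l) :
    partialEval β σ ∅ = MvPolynomial.map β := by
  ext i <;> simp [partialEval]

open Classical in
theorem eval₂Hom_comp_partialEval (β : B →+* l) (σ : ι → l) {U V : Set ι} (h : U ⊆ V) :
    (eval₂Hom C (fun i => if i ∈ V then C (σ i) else X i)).comp (partialEval β σ U) =
      partialEval β σ V := by
  refine MvPolynomial.ringHom_ext' ?_ fun i => ?_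
  · ext b : 1
    simp [partialEval]
  · by_cases hi : i ∈ U
    · simp [partialEval, hi, h hi]
    · simp [partialEval, hi]

theorem ker_partialEval_mono (β : B →+* l) (σ : ι → l) {U V : Set ι} (h : U ⊆ V) :
    RingHom.ker (partialEval β σ U) ≤ RingHom.ker (partialEval β σ V) := by
  classical
  intro a ha
  rw [RingHom.mem_ker] at ha ⊢
  rw [← eval₂Hom_comp_partialEval β σ h, RingHom.comp_apply, ha, map_zero]

instance (β : B →+* l) (σ : ι → l) (U : Set ι) :
    (RingHom.ker (partialEval β σ U)).IsPrime := RingHom.ker_isPrime _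

theorem ker_partialEval_univ (β : B →+* l) (σ : ι → l) :
    RingHom.ker (partialEval β σ Set.univ) = RingHom.ker (eval₂Hom β σ) := by
  ext a
  rw [partialEval_univ, RingHom.mem_ker, RingHom.mem_ker, RingHom.comp_apply,
    map_eq_zero_iff _ (C_injective ι l)]

theorem ker_partialEval_empty (β : B →+* l) (σ : ι → l) :
    RingHom.ker (partialEval β σ ∅) = (RingHom.ker β).map C := by
  ext a
  rw [partialEval_empty, RingHom.mem_ker, mem_map_C_iff, MvPolynomial.ext_iff]
  simp [coeff_map, RingHom.mem_ker]

open Classical in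
/-- A polynomial only sees finitely many variables. -/
theorem exists_mem_ker_partialEval_of_directed (β : B →+* l) (σ : ι → l) (c : Set (Set ι))
    (hc : IsChain (· ⊆ ·) c) (hne : c.Nonempty) (a : MvPolynomial ι B)
    (ha : a ∈ RingHom.ker (partialEval β σ (⋃₀ c))) :
    ∃ U ∈ c, a ∈ RingHom.ker (partialEval β σ U) := by
  obtain ⟨U, hU, h⟩ : ∃ U ∈ c, ∀ i ∈ a.vars, i ∈ ⋃₀ c → i ∈ U := by
    have : ∀ s : Finset ι, ∃ U ∈ c, ∀ i ∈ s, i ∈ ⋃₀ c → i ∈ U := by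
      intro s
      induction s using Finset.induction with
      | empty => exact ⟨_, hne.some_mem, by simp⟩
      | insert i s _ ih =>
        obtain ⟨U, hU, h⟩ := ih
        by_cases hi : i ∈ ⋃₀ c
        · obtain ⟨V, hV, hiV⟩ := hi
          rcases hc.total hU hV with h1 | h1
          · refine ⟨V, hV, fun j hj hj' => ?_⟩
            rcases Finset.mem_insert.1 hj with rfl | hj
            · exact hiV
            · exact h1 (h j hj hj')
          · refine ⟨U, hU, fun j hj hj' => ?_⟩
            rcases Finset.mem_insert.1 hj with rfl | hj
            · exact h1 hiV
            · exact h j hj hj'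
        · refine ⟨U, hU, fun j hj hj' => ?_⟩
          rcases Finset.mem_insert.1 hj with rfl | hj
          · exact (hi hj').elim
          · exact h j hj hj'
    exact this _
  refine ⟨U, hU, ?_⟩
  rw [RingHom.mem_ker] at ha ⊢
  rw [← ha]
  refine eval₂Hom_congr' rfl (fun i hi _ => ?_) rfl
  by_cases hiU : i ∈ U
  · rw [if_pos hiU, if_pos (Set.mem_sUnion_of_mem hiU hU)]
  · rw [if_neg hiU, if_neg fun h' => hiU (h i hi h')]

section Key

open Classical

/-- The field generated by the image of the coefficients and of the variables in `U`. -/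
def partialField (β : B →+* l) (σ : ι → l) (U : Set ι) : Subfield l :=
  Subfield.closure (Set.range β ∪ σ '' U)

/-- `partialEval` with coefficients in `partialField`. -/
noncomputable def partialEvalField (β : B →+* l) (σ : ι → l) (U : Set ι) :
    MvPolynomial ι B →+* MvPolynomial ι (partialField β σ U) :=
  eval₂Hom (C.comp (β.codRestrict (partialField β σ U)
      fun b => Subfield.subset_closure (Or.inl ⟨b, rfl⟩)))
    (fun i => if h : i ∈ U then C ⟨σ i, Subfield.subset_closure (Or.inr ⟨i, h, rfl⟩)⟩ else X i)

theorem map_comp_partialEvalField (β : B →+* l) (σ : ι → l) (U : Set ι) :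
    (MvPolynomial.map (partialField β σ U).subtype).comp (partialEvalField β σ U) =
      partialEval β σ U := by
  refine MvPolynomial.ringHom_ext' ?_ fun i => ?_
  · ext b : 1
    simp [partialEval, partialEvalField]
    rfl
  · by_cases hi : i ∈ U <;> simp [partialEval, partialEvalField, hi]

theorem ker_partialEvalField (β : B →+* l) (σ : ι → l) (U : Set ι) :
    RingHom.ker (partialEvalField β σ U) = RingHom.ker (partialEval β σ U) := by
  ext a
  rw [RingHom.mem_ker, RingHom.mem_ker, ← map_comp_partialEvalField, RingHom.comp_apply,
    map_eq_zero_iff _ (map_injective _ (partialField β σ U).subtype_injective)]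

theorem exists_partialEvalField_eq_C (β : B →+* l) (σ : ι → l) (U : Set ι)
    (x : partialField β σ U) (hx : (x : l) ∈ Subring.closure (Set.range β ∪ σ '' U)) :
    ∃ p, partialEvalField β σ U p = C x := by
  have key : ∀ y ∈ Subring.closure (Set.range β ∪ σ '' U), ∃ p,
      ∃ h : y ∈ partialField β σ U, partialEvalField β σ U p = C ⟨y, h⟩ := by
    intro y hy
    induction hy using Subring.closure_induction with
    | mem y hy =>
      rcases hy with ⟨b, rfl⟩ | ⟨i, hi, rfl⟩
      · exact ⟨C b, Subfield.subset_closure (Or.inl ⟨b, rfl⟩), by simp [partialEvalField]; rfl⟩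
      · exact ⟨X i, Subfield.subset_closure (Or.inr ⟨i, hi, rfl⟩),
          by simp [partialEvalField, hi]⟩
    | zero => exact ⟨0, zero_mem _, by rw [map_zero]; exact C_0.symm⟩
    | one => exact ⟨1, one_mem _, by rw [map_one]; exact C_1.symm⟩
    | add a b _ _ ha hb =>
      obtain ⟨p, h, hp⟩ := ha
      obtain ⟨q, h', hq⟩ := hb
      exact ⟨p + q, add_mem h h', by rw [map_add, hp, hq, ← C_add]; rfl⟩
    | neg a _ ha =>
      obtain ⟨p, h, hp⟩ := ha
      exact ⟨-p, neg_mem h, by rw [map_neg, hp, ← C_neg]; rfl⟩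
    | mul a b _ _ ha hb =>
      obtain ⟨p, h, hp⟩ := ha
      obtain ⟨q, h', hq⟩ := hb
      exact ⟨p * q, mul_mem h h', by rw [map_mul, hp, hq, ← C_mul]; rfl⟩
  obtain ⟨p, h, hp⟩ := key x hx
  exact ⟨p, hp⟩

/-- Up to denominators every polynomial over `partialField` comes from `B`. -/
theorem exists_partialEvalField_eq (β : B →+* l) (σ : ι → l) (U : Set ι)
    (H : MvPolynomial ι (partialField β σ U)) :
    ∃ (t h : MvPolynomial ι B) (c : partialField β σ U), c ≠ 0 ∧
      partialEvalField β σ U t = C c ∧ partialEvalField β σ U h =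
        C c * eval₂Hom C (fun i => partialEvalField β σ U (X i)) H := by
  induction H using MvPolynomial.induction_on with
  | C a =>
    obtain ⟨y, hy, z, hz, hyz⟩ := Subfield.mem_closure_iff.1 a.2
    by_cases hz0 : z = 0
    · refine ⟨1, 0, 1, one_ne_zero, by simp, ?_⟩
      have : a = 0 := by
        apply Subtype.ext
        rw [← hyz, hz0, div_zero]
        rfl
      simp [this]
    · have hle : Subring.closure (Set.range β ∪ σ '' U) ≤ (partialField β σ U).toSubring :=
        Subring.closure_le.2 Subfield.subset_closure
      obtain ⟨t, ht⟩ := exists_partialEvalField_eq_C β σ U ⟨z, hle hz⟩ hz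
      obtain ⟨h, hh⟩ := exists_partialEvalField_eq_C β σ U ⟨y, hle hy⟩ hy
      refine ⟨t, h, ⟨z, hle hz⟩, fun h0 => hz0 (congrArg Subtype.val h0), ht, ?_⟩
      rw [hh, coe_eval₂Hom, eval₂_C, ← C_mul]
      congr 1
      apply Subtype.ext
      change y = z * a
      rw [← hyz, mul_div_cancel₀ _ hz0]
  | add p q hp hq =>
    obtain ⟨t, h, c, hc, ht, hh⟩ := hp
    obtain ⟨t', h', c', hc', ht', hh'⟩ := hq
    refine ⟨t * t', t' * h + t * h', c * c', mul_ne_zero hc hc', ?_, ?_⟩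
    · rw [map_mul, ht, ht', C_mul]
    · rw [map_add, map_mul, map_mul, ht, ht', hh, hh', C_mul, map_add]
      ring
  | mul_X p i hp =>
    obtain ⟨t, h, c, hc, ht, hh⟩ := hp
    refine ⟨t, h * X i, c, hc, ht, ?_⟩
    rw [map_mul, hh, map_mul, mul_assoc]
    simp

/-- The kernel of substituting an element `x` of an extension for one variable is principal. -/
theorem exists_ker_eval₂Hom_eq_span {K L : Type u} [Field K] [Field L] [Algebra K L] (s : ι)
    (x : L) : ∃ w : Polynomial K, Polynomial.aeval x w = 0 ∧
      RingHom.ker (eval₂Hom (C.comp (algebraMap K L))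
        (fun i => if i = s then C x else X i) : MvPolynomial ι K →+* MvPolynomial ι L) ≤
      Ideal.span {Polynomial.aeval (X s : MvPolynomial ι K) w} := by
  refine ⟨minpoly K x, minpoly.aeval K x, ?_⟩
  let e : MvPolynomial ι K →+* MvPolynomial ι (Polynomial K) :=
    eval₂Hom (C.comp Polynomial.C) (fun i => if i = s then C Polynomial.X else X i)
  let d : MvPolynomial ι (Polynomial K) →+* MvPolynomial ι K :=
    eval₂Hom (Polynomial.aeval (X s : MvPolynomial ι K)).toRingHom X
  have hde : d.comp e = RingHom.id _ := by
    refine MvPolynomial.ringHom_ext' ?_ fun i => ?_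
    · ext b : 1
      simp [d, e]
    · by_cases hi : i = s <;> simp [d, e, hi]
  have hev : (MvPolynomial.map (Polynomial.aeval x : Polynomial K →ₐ[K] L).toRingHom).comp e =
      eval₂Hom (C.comp (algebraMap K L)) (fun i => if i = s then C x else X i) := by
    refine MvPolynomial.ringHom_ext' ?_ fun i => ?_
    · ext b : 1
      simp [e]
    · by_cases hi : i = s <;> simp [e, hi]
  intro a ha
  rw [RingHom.mem_ker, ← hev, RingHom.comp_apply, ← RingHom.mem_ker,
    ← partialEval_empty _ (fun _ => 0), ker_partialEval_empty] at ha
  have h1 : RingHom.ker (Polynomial.aeval x : Polynomial K →ₐ[K] L).toRingHom =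
    Ideal.span {minpoly K x} := minpoly.ker_aeval_eq_span_minpoly K x
  rw [h1, Ideal.map_span, Set.image_singleton] at ha
  have h2 := Ideal.mem_map_of_mem d ha
  rw [Ideal.map_span, Set.image_singleton] at h2
  have h3 : d (e a) = a := DFunLike.congr_fun hde a
  have h4 : d (C (minpoly K x)) = Polynomial.aeval (X s : MvPolynomial ι K) (minpoly K x) := by
    simp [d]
  rwa [h3, h4] at h2

/-- One more substitution costs one generator, up to denominators. -/
theorem exists_partialEval_insert (β : B →+* l) (σ : ι → l) (U : Set ι) (s : ι) (hs : s ∉ U) :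
    ∃ h ∈ RingHom.ker (partialEval β σ (insert s U)),
      ∀ a ∈ RingHom.ker (partialEval β σ (insert s U)),
        ∃ t ∉ RingHom.ker (eval₂Hom β σ), ∃ b,
          a * t - h * b ∈ RingHom.ker (partialEval β σ U) := by
  obtain ⟨w, hw, hker⟩ := exists_ker_eval₂Hom_eq_span (K := partialField β σ U) s (σ s)
  set ev : MvPolynomial ι (partialField β σ U) →+* MvPolynomial ι l :=
    eval₂Hom (C.comp (algebraMap (partialField β σ U) l))
      (fun i => if i = s then C (σ s) else X i) with hevdef
  set α := partialEvalField β σ U with hα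
  have hev : ev.comp α = partialEval β σ (insert s U) := by
    refine MvPolynomial.ringHom_ext' ?_ fun i => ?_
    · ext b : 1
      simp [ev, hα, partialEval, partialEvalField]
      rfl
    · by_cases hi : i ∈ U
      · simp [ev, hα, partialEval, partialEvalField, hi]
        rfl
      · by_cases hi' : i = s
        · simp [ev, hα, partialEval, partialEvalField, hi', hs]
        · simp [ev, hα, partialEval, partialEvalField, hi, hi']
  set ρ : MvPolynomial ι (partialField β σ U) →+* MvPolynomial ι (partialField β σ U) :=
    eval₂Hom C (fun i => α (X i)) with hρ
  have hρα : ρ.comp α = α := by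
    refine MvPolynomial.ringHom_ext' ?_ fun i => ?_
    · ext b : 1
      simp [hρ, hα, partialEvalField]
    · by_cases hi : i ∈ U <;> simp [hρ, hα, partialEvalField, hi]
  have hunit : ∀ t c, c ≠ 0 → α t = C c → t ∉ RingHom.ker (eval₂Hom β σ) := by
    intro t c hc ht h0
    rw [← ker_partialEval_univ, RingHom.mem_ker,
      ← eval₂Hom_comp_partialEval β σ (Set.subset_univ U), ← map_comp_partialEvalField,
      RingHom.comp_apply, RingHom.comp_apply, ← hα, ht] at h0
    simp at h0
    exact hc h0
  have hρw : ρ (Polynomial.aeval (X s : MvPolynomial ι (partialField β σ U)) w) =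
      Polynomial.aeval (X s : MvPolynomial ι (partialField β σ U)) w := by
    have : (X s : MvPolynomial ι (partialField β σ U)) = ρ (X s) := by
      simp [hρ, hα, partialEvalField, hs]
    rw [Polynomial.aeval_def, Polynomial.hom_eval₂, ← this]
    congr 1
    ext b : 1
    simp [hρ]
  obtain ⟨t₁, h₁, c₁, hc₁, ht₁, hh₁⟩ := exists_partialEvalField_eq β σ U
    (Polynomial.aeval (X s : MvPolynomial ι (partialField β σ U)) w)
  change α h₁ = C c₁ * ρ _ at hh₁
  refine ⟨h₁, ?_, fun a ha => ?_⟩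
  · rw [RingHom.mem_ker, ← hev, RingHom.comp_apply, hh₁, hρw, map_mul]
    have : ev (Polynomial.aeval (X s : MvPolynomial ι (partialField β σ U)) w) = 0 := by
      have h5 : ev (X s) = C (σ s) := by simp [ev]
      rw [Polynomial.aeval_def, Polynomial.hom_eval₂, h5]
      have h6 : ev.comp (algebraMap (partialField β σ U) _) =
          C.comp (algebraMap (partialField β σ U) l) := by
        ext b : 1
        simp [ev]
      rw [h6, ← Polynomial.hom_eval₂, ← Polynomial.aeval_def, hw, map_zero]
    rw [this, mul_zero]
  · rw [RingHom.mem_ker, ← hev, RingHom.comp_apply, ← RingHom.mem_ker] at ha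
    obtain ⟨H, hH⟩ := Ideal.mem_span_singleton'.1 (hker ha)
    obtain ⟨t₂, h₂, c₂, hc₂, ht₂, hh₂⟩ := exists_partialEvalField_eq β σ U H
    change α h₂ = C c₂ * ρ _ at hh₂
    refine ⟨t₁ * t₂, hunit _ (c₁ * c₂) (mul_ne_zero hc₁ hc₂) ?_, h₂, ?_⟩
    · rw [map_mul, C_mul]
      exact congrArg₂ _ ht₁ ht₂
    · rw [← ker_partialEvalField, RingHom.mem_ker, ← hα, map_sub, map_mul, map_mul, map_mul]
      have h7 : α a = ρ (α a) := (DFunLike.congr_fun hρα a).symm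
      rw [h7, ← hH, map_mul, hh₁, hh₂, show α t₁ = C c₁ from ht₁, show α t₂ = C c₂ from ht₂]
      ring

end Key

end Theta

section Complement

open MvPolynomial IsLocalRing

/-- Abstract Zorn step: a family of primes between `I` and the maximal ideal, each obtained
from the previous ones by adding one element, gives a complement of `I` inside `J`. -/
theorem exists_complement_of_chain {P ι : Type u} [CommRing P] (I J : Ideal P)
    (Q : Set ι → Ideal P) (hprime : ∀ U, (Q U).IsPrime) (hmono : Monotone Q) (h0 : Q ∅ = I)
    (hJ : Q Set.univ ≤ J ⊔ I)
    (hchain : ∀ c : Set (Set ι), IsChain (· ⊆ ·) c → c.Nonempty → Q (⋃₀ c) ≤ ⨆ U ∈ c, Q U)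
    (hstep : ∀ U, ∀ s ∉ U, ∃ h, Q (insert s U) = Q U ⊔ Ideal.span {h}) :
    ∃ Z ≤ J, Z ⊔ I = Q Set.univ ∧ Z ⊓ I ≤ I * Z := by
  have hI : ∀ U, I ≤ Q U := fun U => h0 ▸ hmono (Set.empty_subset U)
  obtain ⟨⟨U, Z⟩, -, hmax⟩ := zorn_le_nonempty₀
    {p : Set ι × Ideal P | p.2 ≤ J ∧ p.2 ⊔ I = Q p.1 ∧ p.2 ⊓ I ≤ I * p.2} (by
      intro c hc hch y hy
      have hch1 : IsChain (· ⊆ ·) (Prod.fst '' c) := by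
        rintro _ ⟨p, hp, rfl⟩ _ ⟨q, hq, rfl⟩ hne
        rcases hch.total hp hq with h | h
        · exact Or.inl h.1
        · exact Or.inr h.1
      have hdir : DirectedOn (· ≤ ·) (Prod.snd '' c) := by
        rintro _ ⟨p, hp, rfl⟩ _ ⟨q, hq, rfl⟩
        rcases hch.total hp hq with h | h
        · exact ⟨_, ⟨q, hq, rfl⟩, h.2, le_rfl⟩
        · exact ⟨_, ⟨p, hp, rfl⟩, le_rfl, h.2⟩
      refine ⟨(⋃₀ (Prod.fst '' c), sSup (Prod.snd '' c)), ⟨?_, le_antisymm ?_ ?_, ?_⟩, ?_⟩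
      · apply sSup_le
        rintro _ ⟨p, hp, rfl⟩
        exact (hc hp).1
      · refine sup_le (sSup_le ?_) (hI _)
        rintro _ ⟨p, hp, rfl⟩
        refine le_trans (le_sup_left.trans (hc hp).2.1.le) (hmono ?_)
        exact Set.subset_sUnion_of_mem ⟨p, hp, rfl⟩
      · refine (hchain _ hch1 ⟨_, y, hy, rfl⟩).trans (iSup₂_le ?_)
        rintro _ ⟨p, hp, rfl⟩
        rw [← (hc hp).2.1]
        exact sup_le_sup_right (le_sSup (Set.mem_image_of_mem _ hp)) _
      · rintro x ⟨hx, hxI⟩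
        obtain ⟨_, ⟨p, hp, rfl⟩, hxp⟩ :=
          (Submodule.mem_sSup_of_directed ⟨_, Set.mem_image_of_mem _ hy⟩ hdir).1 hx
        exact Ideal.mul_mono_right (le_sSup (Set.mem_image_of_mem _ hp)) ((hc hp).2.2 ⟨hxp, hxI⟩)
      · intro p hp
        exact ⟨Set.subset_sUnion_of_mem ⟨p, hp, rfl⟩, le_sSup ⟨p, hp, rfl⟩⟩)
    (∅, ⊥) ⟨bot_le, by simp [h0], by simp⟩
  obtain ⟨⟨hZJ, hZQ, hZI⟩, hmax⟩ := hmax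
  by_cases hU : U = Set.univ
  · subst hU
    exact ⟨Z, hZJ, hZQ, hZI⟩
  obtain ⟨s, hs⟩ := (Set.ne_univ_iff_exists_notMem U).1 hU
  exfalso
  obtain ⟨h, hh⟩ := hstep U s hs
  have hhJ : h ∈ J ⊔ I := hJ (hmono (Set.subset_univ (insert s U))
    (hh ▸ (le_sup_right : _ ≤ Q U ⊔ _) (Ideal.mem_span_singleton_self h)))
  obtain ⟨z, hz, y, hy, rfl⟩ := Submodule.mem_sup.1 hhJ
  have hspan : Q (insert s U) = Q U ⊔ Ideal.span {z} := by
    rw [hh]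
    apply le_antisymm
    · refine sup_le le_sup_left ((Ideal.span_singleton_le_iff_mem _).2 ?_)
      exact add_mem ((le_sup_right : _ ≤ Q U ⊔ _) (Ideal.mem_span_singleton_self z))
        ((le_sup_left : Q U ≤ _) (hI U hy))
    · refine sup_le le_sup_left ((Ideal.span_singleton_le_iff_mem _).2 ?_)
      have := sub_mem ((le_sup_right : _ ≤ Q U ⊔ _) (Ideal.mem_span_singleton_self (z + y)))
        ((le_sup_left : Q U ≤ Q U ⊔ Ideal.span {z + y}) (hI U hy))
      simpa using this
  by_cases hzU : z ∈ Q U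
  · have h1 : Q (insert s U) = Q U := by
      rw [hspan]
      exact sup_eq_left.2 ((Ideal.span_singleton_le_iff_mem _).2 hzU)
    have := hmax (y := (insert s U, Z)) ⟨hZJ, by rw [h1]; exact hZQ, hZI⟩
      ⟨Set.subset_insert s U, le_rfl⟩
    exact hs (this.1 (Set.mem_insert s U))
  · have := hmax (y := (insert s U, Z ⊔ Ideal.span {z}))
      ⟨sup_le hZJ ((Ideal.span_singleton_le_iff_mem _).2 hz), ?_, ?_⟩
      ⟨Set.subset_insert s U, le_sup_left⟩
    · exact hs (this.1 (Set.mem_insert s U))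
    · change (Z ⊔ Ideal.span {z}) ⊔ I = Q (insert s U)
      rw [sup_right_comm, hspan]
      exact congrArg (· ⊔ Ideal.span {z}) hZQ
    · rintro x ⟨hx, hxI⟩
      change x ∈ I * (Z ⊔ Ideal.span {z})
      obtain ⟨z₀, hz₀, w, hw, rfl⟩ := Submodule.mem_sup.1 hx
      obtain ⟨r, rfl⟩ := Ideal.mem_span_singleton'.1 hw
      have h2 : r * z ∈ Q U := by
        have : r * z = (z₀ + r * z) - z₀ := by ring
        rw [this]
        exact sub_mem (hI U hxI) (hZQ ▸ (le_sup_left : Z ≤ Z ⊔ I) hz₀)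
      have h3 : r ∈ Q U := ((hprime U).mem_or_mem h2).resolve_right hzU
      rw [← hZQ] at h3
      obtain ⟨z₁, hz₁, m, hm, rfl⟩ := Submodule.mem_sup.1 h3
      have h4 : m * z ∈ I * (Z ⊔ Ideal.span {z}) :=
        Ideal.mul_mem_mul hm ((le_sup_right : _ ≤ Z ⊔ _) (Ideal.mem_span_singleton_self z))
      have h5 : z₀ + z₁ * z ∈ Z ⊓ I := by
        refine ⟨add_mem hz₀ (Ideal.mul_mem_right _ _ hz₁), ?_⟩
        have : z₀ + z₁ * z = (z₀ + (z₁ + m) * z) - m * z := by ring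
        rw [this]
        exact sub_mem hxI (Ideal.mul_mem_right _ _ hm)
      have : z₀ + (z₁ + m) * z = (z₀ + z₁ * z) + m * z := by ring
      rw [this]
      exact add_mem (Ideal.mul_mono_right le_sup_left (hZI h5)) h4

theorem exists_local_complement {B S : Type u} [CommRing B] [CommRing S] [IsLocalRing S]
    [Algebra B S] (𝔪 : Ideal B) (hmap : 𝔪.map (algebraMap B S) = maximalIdeal S)
    (hcomap : (maximalIdeal S).comap (algebraMap B S) = 𝔪) :
    ∃ (P : Type u) (_ : CommRing P) (_ : IsLocalRing P) (_ : Algebra B P) (ψ : P →ₐ[B] S)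
      (Z : Ideal P), Module.Flat B P ∧ Function.Surjective ψ ∧ Z ≤ RingHom.ker ψ ∧
        Z ⊔ 𝔪.map (algebraMap B P) = maximalIdeal P ∧
        Z ⊓ 𝔪.map (algebraMap B P) ≤ 𝔪.map (algebraMap B P) * Z := by
  classical
  let β : B →+* ResidueField S := (residue S).comp (algebraMap B S)
  let σ : S → ResidueField S := residue S
  let φ : MvPolynomial S B →ₐ[B] S := aeval id
  let 𝔭 : Ideal (MvPolynomial S B) := RingHom.ker (eval₂Hom β σ)
  have : 𝔭.IsPrime := RingHom.ker_isPrime _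
  have h𝔭 : ∀ x, x ∈ 𝔭 ↔ φ x ∈ maximalIdeal S := by
    intro x
    have : (residue S).comp φ.toRingHom = eval₂Hom β σ := by
      refine MvPolynomial.ringHom_ext' ?_ fun i => ?_
      · ext b : 1
        simp [φ, β]
      · simp [φ, σ]
    rw [← residue_eq_zero_iff, RingHom.mem_ker, ← this]
    rfl
  have hker : RingHom.ker β = 𝔪 := by
    rw [← hcomap]
    ext b
    simp [RingHom.mem_ker, β]
  have hunit : ∀ y : 𝔭.primeCompl, IsUnit (φ.toRingHom y) := by
    intro y
    by_contra h
    exact y.2 ((h𝔭 _).2 h)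
  let P := Localization.AtPrime 𝔭
  let ψ₀ : P →+* S := IsLocalization.lift hunit
  have hψ₀ : ∀ x, ψ₀ (algebraMap (MvPolynomial S B) P x) = φ x :=
    fun x => IsLocalization.lift_eq hunit x
  let ψ : P →ₐ[B] S :=
    { ψ₀ with
      commutes' := fun b => by
        have := hψ₀ (C b)
        simp only [φ, aeval_C] at this
        change ψ₀ (algebraMap B P b) = _
        rw [← this, IsScalarTower.algebraMap_apply B (MvPolynomial S B) P]
        rfl }
  have hψ : ∀ x, ψ (algebraMap (MvPolynomial S B) P x) = φ x := hψ₀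
  have hsurj : Function.Surjective ψ := fun s => ⟨algebraMap _ P (X s), by
    rw [hψ]
    simp [φ]⟩
  let Q : Set S → Ideal P := fun U => (RingHom.ker (partialEval β σ U)).map (algebraMap _ P)
  have hle : ∀ U, RingHom.ker (partialEval β σ U) ≤ 𝔭 := fun U => by
    have := ker_partialEval_mono β σ (Set.subset_univ U)
    rwa [ker_partialEval_univ] at this
  have hQ0 : Q ∅ = 𝔪.map (algebraMap B P) := by
    simp only [Q]
    rw [ker_partialEval_empty, Ideal.map_map, hker]
    rfl
  have hQ1 : Q Set.univ = maximalIdeal P := by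
    simp only [Q]
    rw [ker_partialEval_univ]
    exact Localization.AtPrime.map_eq_maximalIdeal
  obtain ⟨Z, hZJ, hZ1, hZ2⟩ := exists_complement_of_chain (𝔪.map (algebraMap B P))
    (RingHom.ker ψ) Q
    (fun U => by
      refine IsLocalization.isPrime_of_isPrime_disjoint 𝔭.primeCompl P _ inferInstance ?_
      rw [Set.disjoint_left]
      exact fun x hx hx' => hx (hle U hx'))
    (fun U V h => Ideal.map_mono (ker_partialEval_mono β σ h)) hQ0
    (by
      rw [hQ1]
      intro x hx
      have h1 : ψ x ∈ (𝔪.map (algebraMap B P)).map (ψ : P →+* S) := by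
        rw [Ideal.map_map]
        have : (ψ : P →+* S).comp (algebraMap B P) = algebraMap B S := ψ.comp_algebraMap
        rw [this, hmap]
        rw [← Localization.AtPrime.map_eq_maximalIdeal] at hx
        have h2 : ψ x ∈ (𝔭.map (algebraMap (MvPolynomial S B) P)).map (ψ : P →+* S) :=
          Ideal.mem_map_of_mem _ hx
        rw [Ideal.map_map] at h2
        refine (Ideal.map_le_iff_le_comap.2 ?_) h2
        intro y hy
        change ψ (algebraMap _ P y) ∈ maximalIdeal S
        rw [hψ]
        exact (h𝔭 y).1 hy
      obtain ⟨y, hy, hxy⟩ := (Ideal.mem_map_iff_of_surjective (ψ : P →+* S) hsurj).1 h1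
      refine Submodule.mem_sup.2 ⟨x - y, ?_, y, hy, sub_add_cancel x y⟩
      rw [RingHom.mem_ker, map_sub, sub_eq_zero]
      exact hxy.symm)
    (by
      intro c hc hne
      refine Ideal.map_le_iff_le_comap.2 fun a ha => ?_
      obtain ⟨U, hU, haU⟩ := exists_mem_ker_partialEval_of_directed β σ c hc hne a ha
      exact (le_iSup₂_of_le U hU le_rfl : Q U ≤ _) (Ideal.mem_map_of_mem _ haU))
    (by
      intro U s hs
      obtain ⟨h, hh, H⟩ := exists_partialEval_insert β σ U s hs
      refine ⟨algebraMap _ P h, le_antisymm ?_ ?_⟩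
      · refine Ideal.map_le_iff_le_comap.2 fun a ha => ?_
        obtain ⟨t, ht, b, hb⟩ := H a ha
        have hu : IsUnit (algebraMap (MvPolynomial S B) P t) :=
          IsLocalization.map_units P (⟨t, ht⟩ : 𝔭.primeCompl)
        rw [Ideal.mem_comap, ← Ideal.mul_unit_mem_iff_mem _ hu, ← map_mul]
        have : a * t = (a * t - h * b) + h * b := by ring
        rw [this, map_add, map_mul]
        exact add_mem ((le_sup_left : Q U ≤ _) (Ideal.mem_map_of_mem _ hb))
          ((le_sup_right : _ ≤ Q U ⊔ _)
            (Ideal.mul_mem_right _ _ (Ideal.mem_span_singleton_self _)))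
      · exact sup_le (Ideal.map_mono (ker_partialEval_mono β σ (Set.subset_insert s U)))
          ((Ideal.span_singleton_le_iff_mem _).2 (Ideal.mem_map_of_mem _ hh)))
  have hflat : Module.Flat (MvPolynomial S B) P := IsLocalization.flat P 𝔭.primeCompl
  exact ⟨P, inferInstance, inferInstance, inferInstance, ψ, Z,
    Module.Flat.trans B (MvPolynomial S B) P, hsurj, hZJ, hZ1.trans hQ1, hZ2⟩

end Complement

section TorsFlat

open TensorProduct

variable {B : Type u} [CommRing B]

/-- `W` is flat against finite modules killed by a power of `𝔪`. -/
def TorsFlat (𝔪 : Ideal B) (W : Type u) [AddCommGroup W] [Module B W] : Prop :=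
  ∀ (V' V : Type u) [AddCommGroup V'] [Module B V'] [AddCommGroup V] [Module B V]
    [Module.Finite B V] (i : V' →ₗ[B] V), Function.Injective i →
    ∀ N : ℕ, (∀ r ∈ 𝔪 ^ N, ∀ v : V, r • v = 0) → Function.Injective (i.rTensor W)

/-- Extension step for injectivity of `V ⊗ Z → V ⊗ P`. -/
theorem lTensor_injective_of_ses {V₁ V₂ V₃ Z P : Type u} [AddCommGroup V₁] [Module B V₁]
    [AddCommGroup V₂] [Module B V₂] [AddCommGroup V₃] [Module B V₃] [AddCommGroup Z] [Module B Z]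
    [AddCommGroup P] [Module B P] [Module.Flat B P] {f : V₁ →ₗ[B] V₂} {g : V₂ →ₗ[B] V₃}
    (hf : Function.Injective f) (hg : Function.Surjective g) (hfg : Function.Exact f g)
    (j : Z →ₗ[B] P) (h₁ : Function.Injective (j.lTensor V₁))
    (h₃ : Function.Injective (j.lTensor V₃)) : Function.Injective (j.lTensor V₂) := by
  refine (injective_iff_map_eq_zero _).2 fun x hx => ?_
  have h4 : g.rTensor Z x = 0 := by
    apply h₃
    rw [map_zero, ← LinearMap.comp_apply, LinearMap.lTensor_comp_rTensor,
      ← LinearMap.rTensor_comp_lTensor, LinearMap.comp_apply, hx, map_zero]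
  obtain ⟨y, rfl⟩ := (rTensor_exact Z hfg hg x).1 h4
  have h5 : j.lTensor V₁ y = 0 := by
    apply Module.Flat.rTensor_preserves_injective_linearMap (M := P) f hf
    rw [map_zero, ← LinearMap.comp_apply, LinearMap.rTensor_comp_lTensor,
      ← LinearMap.lTensor_comp_rTensor, LinearMap.comp_apply, hx]
  rw [h₁ (h5.trans (map_zero _).symm), map_zero]

theorem lTensor_injective_of_torsion [IsNoetherianRing B] {Z P : Type u} [AddCommGroup Z]
    [Module B Z] [AddCommGroup P] [Module B P] [Module.Flat B P] (𝔪 : Ideal B)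
    [h𝔪 : 𝔪.IsMaximal] (j : Z →ₗ[B] P) (hbase : Function.Injective (j.lTensor (B ⧸ 𝔪)))
    (V : Type u) [AddCommGroup V] [Module B V] [Module.Finite B V] :
    ∀ N : ℕ, (∀ r ∈ 𝔪 ^ N, ∀ v : V, r • v = 0) → Function.Injective (j.lTensor V) := by
  induction (inferInstance : Module.Finite B V) using
    IsNoetherianRing.induction_on_isQuotientEquivQuotientPrime (A := B) with
  | subsingleton V =>
    intro N _
    exact Function.injective_of_subsingleton _
  | quotient V p e =>
    intro N hN
    have hle : 𝔪 ^ N ≤ p.1 := fun r hr => by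
      have := hN r hr (e.symm 1)
      rw [← map_smul, LinearEquiv.map_eq_zero_iff, Algebra.smul_def, mul_one] at this
      exact Ideal.Quotient.eq_zero_iff_mem.1 this
    have hp : 𝔪 = p.1 := h𝔪.eq_of_le p.2.ne_top (p.2.le_of_pow_le hle)
    rw [← hp] at e
    have h6 : j.lTensor (B ⧸ 𝔪) ∘ₗ e.toLinearMap.rTensor Z =
        e.toLinearMap.rTensor P ∘ₗ j.lTensor V := by
      rw [LinearMap.lTensor_comp_rTensor, LinearMap.rTensor_comp_lTensor]
    refine Function.Injective.of_comp (f := e.toLinearMap.rTensor P) ?_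
    rw [← LinearMap.coe_comp, ← h6, LinearMap.coe_comp]
    exact hbase.comp (e.rTensor Z).injective
  | exact V₁ V₂ V₃ f g hf hg hfg h₁ h₃ =>
    intro N hN
    refine lTensor_injective_of_ses hf hg hfg j (h₁ N fun r hr v => hf ?_)
      (h₃ N fun r hr v => ?_)
    · rw [map_smul, hN r hr, map_zero]
    · obtain ⟨v, rfl⟩ := hg v
      rw [← map_smul, hN r hr, map_zero]

theorem lTensor_residue_injective {P : Type u} [CommRing P] [Algebra B P] (𝔪 : Ideal B)
    (Z : Ideal P) (hZ : Z ⊓ 𝔪.map (algebraMap B P) ≤ 𝔪.map (algebraMap B P) * Z) :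
    Function.Injective ((Z.subtype.restrictScalars B).lTensor (B ⧸ 𝔪)) := by
  refine (injective_iff_map_eq_zero _).2 fun x hx => ?_
  obtain ⟨z', hz'⟩ := (quotTensorEquivQuotSMul Z 𝔪).symm.surjective x
  obtain ⟨z, rfl⟩ := Submodule.mkQ_surjective _ z'
  rw [Submodule.mkQ_apply, quotTensorEquivQuotSMul_symm_mk] at hz'
  subst hz'
  rw [LinearMap.lTensor_tmul] at hx
  change (1 : B ⧸ 𝔪) ⊗ₜ[B] (z : P) = 0 at hx
  have h1 := congrArg (quotTensorEquivQuotSMul P 𝔪) hx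
  rw [quotTensorEquivQuotSMul_mk_one_tmul, map_zero, Submodule.Quotient.mk_eq_zero,
    Ideal.smul_top_eq_map] at h1
  have h2 : (z : P) ∈ 𝔪.map (algebraMap B P) * Z := hZ ⟨z.2, h1⟩
  have h3 : z ∈ (𝔪 • ⊤ : Submodule B Z) := by
    have key : 𝔪.map (algebraMap B P) * Z ≤ Submodule.map Z.subtype
        ((𝔪.map (algebraMap B P)) • (⊤ : Submodule P Z)) := by
      refine Ideal.mul_le.2 fun r hr s hs => ?_
      exact ⟨r • ⟨s, hs⟩, Submodule.smul_mem_smul hr trivial, rfl⟩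
    obtain ⟨w, hw, hwz⟩ := key h2
    have : w = z := Subtype.ext hwz
    subst this
    have h4 := Ideal.smul_restrictScalars 𝔪 (⊤ : Submodule P Z)
    rw [Submodule.restrictScalars_top] at h4
    rw [← h4]
    exact hw
  rw [← quotTensorEquivQuotSMul_symm_mk, (Submodule.Quotient.mk_eq_zero _).2 h3, map_zero]

/-- A complement of `𝔪P` in a flat algebra has a quotient flat against torsion modules. -/
theorem torsFlat_quotient [IsNoetherianRing B] {P : Type u} [CommRing P] [Algebra B P]
    [Module.Flat B P] (𝔪 : Ideal B) [h𝔪 : 𝔪.IsMaximal] (Z : Ideal P)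
    (hZ : Z ⊓ 𝔪.map (algebraMap B P) ≤ 𝔪.map (algebraMap B P) * Z) : TorsFlat 𝔪 (P ⧸ Z) := by
  have hjq : Ses (Z.subtype.restrictScalars B) (Z.mkQ.restrictScalars B) := ⟨Subtype.val_injective, (Ses.mkQ Z).exact, Submodule.mkQ_surjective _⟩
  intro V' V _ _ _ _ _ i hi N hN
  refine hjq.rTensor_injective_of_lTensor (Ses.quot hi)
    (Module.Flat.rTensor_preserves_injective_linearMap (M := P) i hi) ?_
  refine lTensor_injective_of_torsion 𝔪 _ (lTensor_residue_injective 𝔪 Z hZ) _ N fun r hr v => ?_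
  obtain ⟨v, rfl⟩ := Submodule.mkQ_surjective _ v
  rw [← map_smul, hN r hr, map_zero]

theorem lTensor_mkQ_smul_injective {V W : Type u} [AddCommGroup V] [Module B V] [AddCommGroup W]
    [Module B W] (I : Ideal B) (hV : ∀ r ∈ I, ∀ v : V, r • v = 0) :
    Function.Injective ((I • ⊤ : Submodule B W).mkQ.lTensor V) := by
  refine (injective_iff_map_eq_zero _).2 fun x hx => ?_
  have h := Ses.mkQ (I • ⊤ : Submodule B W)
  obtain ⟨y, rfl⟩ := (lTensor_exact V h.exact h.surj x).1 hx
  clear hx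
  induction y with
  | zero => simp
  | add a b ha hb => rw [map_add, ha, hb, add_zero]
  | tmul v w =>
    rw [LinearMap.lTensor_tmul]
    obtain ⟨w, hw⟩ := w
    change v ⊗ₜ[B] w = 0
    induction hw using Submodule.smul_induction_on' with
    | smul r hr w _ => rw [tmul_smul, smul_tmul', hV r hr, zero_tmul]
    | add a _ b _ ha hb => rw [tmul_add, ha, hb, add_zero]

/-- `TorsFlat` only depends on the quotients modulo powers of `𝔪`. -/
theorem TorsFlat.of_map {𝔪 : Ideal B} {W W' : Type u} [AddCommGroup W] [Module B W]
    [AddCommGroup W'] [Module B W'] (hW : TorsFlat 𝔪 W) (γ : W →ₗ[B] W')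
    (hsurj : ∀ (N : ℕ) (a : W'), ∃ c, a - γ c ∈ (𝔪 ^ N • ⊤ : Submodule B W'))
    (hinj : ∀ (N : ℕ) (c : W), γ c ∈ (𝔪 ^ N • ⊤ : Submodule B W') →
      c ∈ (𝔪 ^ N • ⊤ : Submodule B W)) : TorsFlat 𝔪 W' := by
  intro V' V _ _ _ _ _ i hi N hN
  have hN' : ∀ r ∈ 𝔪 ^ N, ∀ v : V', r • v = 0 := fun r hr v => hi (by
    rw [map_smul, hN r hr, map_zero])
  let p := (𝔪 ^ N • ⊤ : Submodule B W').mkQ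
  let q := (𝔪 ^ N • ⊤ : Submodule B W).mkQ
  have hpγ : (𝔪 ^ N • ⊤ : Submodule B W) ≤ LinearMap.ker (p ∘ₗ γ) := by
    refine Submodule.smul_le.2 fun r hr w _ => ?_
    rw [LinearMap.mem_ker, LinearMap.comp_apply, map_smul, Submodule.mkQ_apply,
      Submodule.Quotient.mk_eq_zero]
    exact Submodule.smul_mem_smul hr trivial
  let γ' := (𝔪 ^ N • ⊤ : Submodule B W).liftQ (p ∘ₗ γ) hpγ
  have hγ' : γ' ∘ₗ q = p ∘ₗ γ := Submodule.liftQ_mkQ _ _ _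
  have hγ'inj : Function.Injective γ' := by
    refine (injective_iff_map_eq_zero _).2 fun x hx => ?_
    obtain ⟨c, rfl⟩ := Submodule.mkQ_surjective _ x
    have : p (γ c) = 0 := by rw [← LinearMap.comp_apply, ← hγ']; exact hx
    rw [Submodule.mkQ_apply, Submodule.Quotient.mk_eq_zero] at this ⊢
    exact hinj N c this
  have hγ'surj : Function.Surjective γ' := by
    intro x
    obtain ⟨a, rfl⟩ := Submodule.mkQ_surjective _ x
    obtain ⟨c, hc⟩ := hsurj N a
    refine ⟨q c, ?_⟩
    rw [← LinearMap.comp_apply, hγ', LinearMap.comp_apply, eq_comm, ← sub_eq_zero, ← map_sub]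
    exact (Submodule.Quotient.mk_eq_zero _).2 hc
  let e := LinearEquiv.ofBijective γ' ⟨hγ'inj, hγ'surj⟩
  refine (injective_iff_map_eq_zero _).2 fun x hx => ?_
  apply lTensor_mkQ_smul_injective (V := V') (W := W') (𝔪 ^ N) hN'
  rw [map_zero]
  obtain ⟨y', hy'⟩ := (e.lTensor V').surjective (p.lTensor V' x)
  obtain ⟨y, rfl⟩ := LinearMap.lTensor_surjective V' (Submodule.mkQ_surjective _) y'
  have h1 : i.rTensor W y = 0 := by
    apply lTensor_mkQ_smul_injective (V := V) (W := W) (𝔪 ^ N) hN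
    apply (e.lTensor V).injective
    rw [map_zero, map_zero]
    have h2 : (e.lTensor V) (q.lTensor V (i.rTensor W y)) =
        i.rTensor _ ((e.lTensor V') (q.lTensor V' y)) := by
      rw [← LinearMap.comp_apply (q.lTensor V), LinearMap.lTensor_comp_rTensor,
        ← LinearMap.rTensor_comp_lTensor, LinearMap.comp_apply]
      change (γ'.lTensor V) _ = i.rTensor _ ((γ'.lTensor V') _)
      rw [← LinearMap.comp_apply (γ'.lTensor V), LinearMap.lTensor_comp_rTensor,
        ← LinearMap.rTensor_comp_lTensor, LinearMap.comp_apply]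
    refine h2.trans ?_
    rw [show (e.lTensor V') (q.lTensor V' y) = _ from hy', ← LinearMap.comp_apply,
      LinearMap.rTensor_comp_lTensor, ← LinearMap.lTensor_comp_rTensor, LinearMap.comp_apply, hx,
      map_zero]
  have h3 : y = 0 := hW V' V i hi N hN (h1.trans (map_zero _).symm)
  change p.lTensor V' x = 0
  rw [← hy', h3, map_zero, map_zero]

/-- Local criterion of flatness. -/
theorem TorsFlat.flat [IsNoetherianRing B] {𝔪 : Ideal B} {A : Type u} [CommRing A] [Algebra B A]
    [IsNoetherianRing A] (hA : TorsFlat 𝔪 A)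
    (hjac : 𝔪.map (algebraMap B A) ≤ Ideal.jacobson ⊥) : Module.Flat B A := by
  refine Module.Flat.iff_lTensor_injective'.2 fun b => ?_
  refine (injective_iff_map_eq_zero _).2 fun x hx => ?_
  have hkrull := Ideal.iInf_pow_smul_eq_bot_of_le_jacobson (M := A ⊗[B] b) _ hjac
  rw [← Submodule.mem_bot A, ← hkrull, Submodule.mem_iInf]
  intro N
  obtain ⟨k, hk⟩ := Ideal.exists_pow_inf_eq_pow_smul 𝔪 b
  have hle : ∀ y ∈ b, y ∈ 𝔪 ^ (k + N) → y ∈ 𝔪 ^ N • b := by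
    intro y hy hy'
    have h1 : y ∈ 𝔪 ^ (k + N) • ⊤ ⊓ b := ⟨by simpa using hy', hy⟩
    rw [hk (k + N) (by lia), Nat.add_sub_cancel_left] at h1
    exact Submodule.smul_mono le_rfl inf_le_right h1
  let j : b →ₗ[B] B ⧸ 𝔪 ^ (k + N) := (𝔪 ^ (k + N)).mkQ ∘ₗ b.subtype
  have h2 : j.rangeRestrict.lTensor A x = 0 := by
    have h3 := hA _ _ (LinearMap.range j).subtype Subtype.val_injective (k + N) (fun r hr v => by
      obtain ⟨v, rfl⟩ := Ideal.Quotient.mk_surjective v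
      rw [Algebra.smul_def, Ideal.Quotient.algebraMap_eq, ← map_mul,
        Ideal.Quotient.eq_zero_iff_mem]
      exact Ideal.mul_mem_right _ _ hr)
    rw [← LinearMap.lTensor_inj_iff_rTensor_inj] at h3
    apply h3
    rw [map_zero, ← LinearMap.comp_apply, ← LinearMap.lTensor_comp]
    have h4 : (LinearMap.range j).subtype ∘ₗ j.rangeRestrict = j := by ext; rfl
    rw [h4, LinearMap.lTensor_comp, LinearMap.comp_apply, hx, map_zero]
  have hses := Ses.ker (g := j.rangeRestrict) j.surjective_rangeRestrict
  obtain ⟨y, rfl⟩ := (lTensor_exact A hses.exact hses.surj x).1 h2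
  clear hx h2 hses
  induction y with
  | zero => simp
  | add y z hy hz =>
    rw [map_add]
    exact add_mem hy hz
  | tmul a y =>
    rw [LinearMap.lTensor_tmul]
    obtain ⟨⟨y, hyb⟩, hy⟩ := y
    have hy1 : y ∈ 𝔪 ^ (k + N) := by
      rw [LinearMap.mem_ker] at hy
      have : j ⟨y, hyb⟩ = 0 := congrArg Subtype.val hy
      exact (Submodule.Quotient.mk_eq_zero _).1 this
    have hy2 := hle y hyb hy1
    have hy3 : (⟨y, hyb⟩ : b) ∈ 𝔪 ^ N • (⊤ : Submodule B b) := by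
      have : 𝔪 ^ N • b ≤ Submodule.map b.subtype (𝔪 ^ N • (⊤ : Submodule B b)) := by
        refine Submodule.smul_le.2 fun r hr s hs => ?_
        exact ⟨r • ⟨s, hs⟩, Submodule.smul_mem_smul hr trivial, rfl⟩
      obtain ⟨w, hw, hwy⟩ := this hy2
      have : w = ⟨y, hyb⟩ := Subtype.ext hwy
      exact this ▸ hw
    change a ⊗ₜ[B] (⟨y, hyb⟩ : b) ∈ _
    generalize (⟨y, hyb⟩ : b) = w at hy3
    induction hy3 using Submodule.smul_induction_on' with
    | smul r hr w _ =>
      rw [tmul_smul, ← algebraMap_smul A r]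
      refine Submodule.smul_mem_smul ?_ trivial
      rw [← Ideal.map_pow]
      exact Ideal.mem_map_of_mem _ hr
    | add w _ w' _ h h' =>
      rw [tmul_add]
      exact add_mem h h'

end TorsFlat

section CompleteNoetherian

open MvPolynomial

variable {A : Type u} [CommRing A]

theorem MvPolynomial.IsHomogeneous.eval_mem_pow {ι : Type*} {m : Ideal A} {x : ι → A}
    (hx : ∀ i, x i ∈ m) {F : MvPolynomial ι A} {d : ℕ} (hF : F.IsHomogeneous d) :
    eval x F ∈ m ^ d := by
  have h : Ideal.span (Set.range x) ≤ m := Ideal.span_le.2 (by rintro _ ⟨i, rfl⟩; exact hx i)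
  exact Ideal.pow_right_mono h d
    ((Ideal.mem_span_pow_iff_exists_isHomogeneous x _).2 ⟨F, hF, rfl⟩)

theorem MvPolynomial.IsHomogeneous.eval_mem_pow_succ {ι : Type*} {m : Ideal A} {x : ι → A}
    (hx : ∀ i, x i ∈ m) {F : MvPolynomial ι A} {d : ℕ} (hF : F.IsHomogeneous d)
    (hm : ∀ u, coeff u F ∈ m) : eval x F ∈ m ^ (d + 1) := by
  rw [eval_eq, pow_succ']
  refine sum_mem fun u hu => Ideal.mul_mem_mul (hm u) ?_
  have := (isHomogeneous_monomial (1 : A) (n := d)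
    (by rw [Finsupp.degree_eq_weight_one]; exact hF (mem_support_iff.1 hu))).eval_mem_pow hx
  simpa [eval_monomial, Finsupp.prod] using this

theorem MvPolynomial.IsHomogeneous.homogeneousComponent_mul {ι : Type*} {F : MvPolynomial ι A}
    {e : ℕ} (hF : F.IsHomogeneous e) (H : MvPolynomial ι A) (d : ℕ) :
    homogeneousComponent d (H * F) =
      if e ≤ d then homogeneousComponent (d - e) H * F else 0 := by
  conv_lhs => rw [← sum_homogeneousComponent H, Finset.sum_mul, map_sum]
  have h1 : ∀ i, homogeneousComponent d (homogeneousComponent i H * F) =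
      if i + e = d then homogeneousComponent i H * F else 0 := fun i => by
    rw [homogeneousComponent_of_mem ((homogeneousComponent_isHomogeneous i H).mul hF)]
    simp [eq_comm]
  simp only [h1]
  split_ifs with h
  · rw [Finset.sum_eq_single (d - e)]
    · rw [if_pos (by lia)]
    · intro i _ hi
      rw [if_neg (by lia)]
    · intro hi
      rw [homogeneousComponent_eq_zero, zero_mul]
      · simp
      · simp only [Finset.mem_range] at hi
        lia
  · refine Finset.sum_eq_zero fun i _ => if_neg (by lia)

/-- Leading forms: an ideal is generated, up to higher order, by finitely many elements. -/
theorem exists_finite_leading (m : Ideal A) (hfg : m.FG) [IsNoetherianRing (A ⧸ m)]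
    (b : Ideal A) : ∃ (n : ℕ) (c : Fin n → A) (D : ℕ), (∀ p, c p ∈ b) ∧
      ∀ d, ∀ y ∈ b, y ∈ m ^ d → ∃ a : Fin n → A, (∀ p, a p ∈ m ^ (d - D)) ∧
        y - ∑ p, a p * c p ∈ m ^ (d + 1) := by
  classical
  obtain ⟨r, x, hx⟩ := Submodule.fg_iff_exists_fin_generating_family.1 hfg
  have hxm : ∀ i, x i ∈ m := fun i => hx ▸ Ideal.subset_span ⟨i, rfl⟩
  let κ : MvPolynomial (Fin r) A →+* MvPolynomial (Fin r) (A ⧸ m) :=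
    MvPolynomial.map (Ideal.Quotient.mk m)
  have hκsurj : Function.Surjective κ := map_surjective _ Ideal.Quotient.mk_surjective
  have hκker : ∀ F, κ F = 0 → ∀ u, coeff u F ∈ m := by
    intro F hF u
    have := congrArg (coeff u) hF
    rw [coeff_map, coeff_zero] at this
    exact Ideal.Quotient.eq_zero_iff_mem.1 this
  let G : Set (MvPolynomial (Fin r) (A ⧸ m)) :=
    {P | ∃ (F : MvPolynomial (Fin r) A) (d : ℕ) (c : A), c ∈ b ∧ F.IsHomogeneous d ∧
      eval x F - c ∈ m ^ (d + 1) ∧ κ F = P}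
  obtain ⟨t, htG, ht⟩ := (Submodule.fg_span_iff_fg_span_finset_subset G).1
    (IsNoetherian.noetherian (Ideal.span G))
  obtain ⟨n, P, hP⟩ : ∃ (n : ℕ) (P : Fin n → MvPolynomial (Fin r) (A ⧸ m)),
      Set.range P = t := ⟨t.card, fun i => (t.equivFin.symm i : _), by
        ext z
        constructor
        · rintro ⟨i, rfl⟩
          exact (t.equivFin.symm i).2
        · intro hz
          exact ⟨t.equivFin ⟨z, hz⟩, by simp⟩⟩
  have hPG : ∀ i, P i ∈ G := fun i => htG (hP ▸ ⟨i, rfl⟩)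
  choose F e c hcb hF hFc hFP using hPG
  refine ⟨n, c, ∑ p, e p, hcb, fun d y hy hyd => ?_⟩
  have heD : ∀ p, e p ≤ ∑ p, e p := fun p => Finset.single_le_sum (by simp) (Finset.mem_univ p)
  have hyd' := hyd
  rw [← hx] at hyd'
  obtain ⟨Y, hY, rfl⟩ := (Ideal.mem_span_pow_iff_exists_isHomogeneous x y).1 hyd'
  have h1 : κ Y ∈ Ideal.span (Set.range P) := by
    rw [hP]
    change κ Y ∈ Submodule.span _ (t : Set _)
    rw [← ht]
    exact Submodule.subset_span ⟨Y, d, _, hy, hY, by simp, rfl⟩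
  obtain ⟨h, hh⟩ := (Ideal.mem_span_range_iff_exists_fun).1 h1
  choose H hH using fun p => hκsurj (h p)
  have h2 : κ (Y - ∑ p, H p * F p) = 0 := by
    rw [map_sub, map_sum, ← hh, sub_eq_zero]
    exact Finset.sum_congr rfl fun p _ => by rw [map_mul, hH, hFP]
  let H' : Fin n → MvPolynomial (Fin r) A := fun p =>
    if e p ≤ d then homogeneousComponent (d - e p) (H p) else 0
  have h3 : homogeneousComponent d (Y - ∑ p, H p * F p) = Y - ∑ p, H' p * F p := by
    rw [map_sub, map_sum, homogeneousComponent_of_mem hY, if_pos rfl]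
    congr 1
    refine Finset.sum_congr rfl fun p _ => ?_
    rw [(hF p).homogeneousComponent_mul]
    simp only [H', ite_mul, zero_mul]
  have h4 : eval x (Y - ∑ p, H' p * F p) ∈ m ^ (d + 1) := by
    rw [← h3]
    refine (homogeneousComponent_isHomogeneous d _).eval_mem_pow_succ hxm fun u => ?_
    rw [coeff_homogeneousComponent]
    split_ifs
    · exact hκker _ h2 u
    · exact zero_mem _
  have h5 : ∀ p, eval x (H' p) ∈ m ^ (d - e p) := by
    intro p
    simp only [H']
    split_ifs
    · exact (homogeneousComponent_isHomogeneous _ _).eval_mem_pow hxm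
    · simp
  refine ⟨fun p => eval x (H' p), fun p => Ideal.pow_le_pow_right ?_ (h5 p), ?_⟩
  · have := heD p
    lia
  · have h6 : eval x Y - ∑ p, eval x (H' p) * c p = eval x (Y - ∑ p, H' p * F p) +
        ∑ p, eval x (H' p) * (eval x (F p) - c p) := by
      simp only [map_sub, map_sum, map_mul, mul_sub, Finset.sum_sub_distrib]
      ring
    rw [h6]
    refine add_mem h4 (sum_mem fun p _ => ?_)
    by_cases hp : e p ≤ d
    · have := Ideal.mul_mem_mul (h5 p) (hFc p)
      rw [← pow_add] at this
      exact Ideal.pow_le_pow_right (by lia) this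
    · simp [H', hp]

theorem isNoetherianRing_of_isAdicComplete (m : Ideal A) [IsAdicComplete m A] (hfg : m.FG)
    [IsNoetherianRing (A ⧸ m)] : IsNoetherianRing A := by
  refine (isNoetherianRing_iff_ideal_fg A).2 fun b => ?_
  obtain ⟨n, c, D, hcb, H⟩ := exists_finite_leading m hfg b
  choose a ha₁ ha₂ using H
  suffices h : b = Ideal.span (Set.range c) by
    rw [h]
    exact ⟨(Set.finite_range c).toFinset, by simp⟩
  refine le_antisymm (fun y hy => ?_) (Ideal.span_le.2 (by rintro _ ⟨p, rfl⟩; exact hcb p))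
  let Yseq : ∀ d, {z : A // z ∈ b ∧ z ∈ m ^ d} := fun d =>
    Nat.rec ⟨y, hy, by simp⟩ (fun d z => ⟨z.1 - ∑ p, a d z.1 z.2.1 z.2.2 p * c p,
      sub_mem z.2.1 (sum_mem fun p _ => Ideal.mul_mem_left _ _ (hcb p)),
      ha₂ d z.1 z.2.1 z.2.2⟩) d
  let α : ℕ → Fin n → A := fun d => a d (Yseq d).1 (Yseq d).2.1 (Yseq d).2.2
  have hα : ∀ d p, α d p ∈ m ^ (d - D) := fun d p => ha₁ d _ _ _ p
  have hY : ∀ d, (Yseq d).1 = y - ∑ p, (∑ i ∈ Finset.range d, α i p) * c p := by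
    intro d
    induction d with
    | zero => simp [Yseq]
    | succ d ih =>
      have : (Yseq (d + 1)).1 = (Yseq d).1 - ∑ p, α d p * c p := rfl
      rw [this, ih]
      simp only [Finset.sum_range_succ, add_mul, Finset.sum_add_distrib]
      ring
  have hlim : ∀ p, ∃ L : A, ∀ N, (∑ i ∈ Finset.range (N + D), α i p) - L ∈ m ^ N := by
    intro p
    obtain ⟨L, hL⟩ := IsPrecomplete.prec (inferInstance : IsPrecomplete m A)
      (f := fun N => ∑ i ∈ Finset.range (N + D), α i p) (by
        intro k N hkN
        refine SModEq.symm ?_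
        rw [SModEq.sub_mem, ← Finset.sum_range_add_sum_Ico _ (show k + D ≤ N + D by lia)]
        simp only [add_sub_cancel_left, smul_eq_mul, Ideal.mul_top]
        refine sum_mem fun i hi => Ideal.pow_le_pow_right ?_ (hα i p)
        have := (Finset.mem_Ico.1 hi).1
        lia)
    refine ⟨L, fun N => ?_⟩
    have := hL N
    rw [SModEq.sub_mem] at this
    simpa using this
  choose L hL using hlim
  have hyL : y = ∑ p, L p * c p := by
    rw [← sub_eq_zero]
    refine IsHausdorff.haus (inferInstance : IsHausdorff m A) _ fun N => ?_
    rw [SModEq.zero, smul_eq_mul, Ideal.mul_top]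
    have : y - ∑ p, L p * c p = (Yseq (N + D)).1 +
        ∑ p, ((∑ i ∈ Finset.range (N + D), α i p) - L p) * c p := by
      rw [hY]
      simp only [sub_mul, Finset.sum_sub_distrib]
      ring
    rw [this]
    exact add_mem (Ideal.pow_le_pow_right (by lia) (Yseq (N + D)).2.2)
      (sum_mem fun p _ => Ideal.mul_mem_right _ _ (hL p N))
  rw [hyL]
  exact sum_mem fun p _ => Ideal.mul_mem_left _ _ (Ideal.subset_span ⟨p, rfl⟩)

end CompleteNoetherian

section CompleteCover

open IsLocalRing

theorem mem_pow_smul_top_iff {B C : Type u} [CommRing B] [CommRing C]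
    [Algebra B C] {𝔪 : Ideal B} {I : Ideal C} (hm : 𝔪.map (algebraMap B C) = I)
    {X : Type u} [AddCommGroup X] [Module B X] [Module C X] [IsScalarTower B C X] (N : ℕ) (x : X) :
    x ∈ (𝔪 ^ N • ⊤ : Submodule B X) ↔ x ∈ (I ^ N • ⊤ : Submodule C X) := by
  rw [← hm, ← Ideal.map_pow, ← Submodule.restrictScalars_mem B (Ideal.map _ _ • _),
    Ideal.smul_restrictScalars]
  rfl

variable {B C S : Type u} [CommRing B] [CommRing C] [CommRing S] [Algebra B C] [Algebra B S]
  [IsLocalRing C] [IsLocalRing S]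

/-- The map induced on completions by a surjection of local algebras. -/
theorem exists_completion_surjective [IsNoetherianRing S] (hfg : (maximalIdeal C).FG)
    (ψ : C →ₐ[B] S) (hψ : Function.Surjective ψ) :
    ∃ h : AdicCompletion (maximalIdeal C) C →ₐ[B] AdicCompletion (maximalIdeal S) S,
      Function.Surjective h := by
  have hmap : (maximalIdeal C).map (ψ : C →+* S) = maximalIdeal S := by
    rw [← eq_maximalIdeal (Ideal.map_eq_top_or_isMaximal_of_surjective (ψ : C →+* S) hψ
      (maximalIdeal.isMaximal C) |>.resolve_left ?_)]
    have : IsLocalHom (ψ : C →+* S) := Function.Surjective.isLocalHom (ψ : C →+* S) hψ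
    exact ne_top_of_le_ne_top (maximalIdeal.isMaximal S).ne_top
      (((local_hom_TFAE (ψ : C →+* S)).out 0 2).1 this)
  have hpow : ∀ k, maximalIdeal C ^ k ≤ (maximalIdeal S ^ k).comap ψ := fun k => by
    rw [← Ideal.map_le_iff_le_comap]
    change Ideal.map (ψ : C →+* S) _ ≤ _
    rw [Ideal.map_pow, hmap]
  let F : ∀ k, AdicCompletion (maximalIdeal C) C →ₐ[B] S ⧸ maximalIdeal S ^ k := fun k =>
    (Ideal.quotientMapₐ (maximalIdeal S ^ k) ψ (hpow k)).comp
      ((AdicCompletion.evalₐ (maximalIdeal C) k).restrictScalars B)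
  have hF : ∀ k (x : AdicCompletion.AdicCauchySequence (maximalIdeal C) C),
      F k (AdicCompletion.mk _ _ x) = Ideal.Quotient.mk _ (ψ (x k)) := fun k x => by
    simp only [F, AlgHom.comp_apply, AlgHom.restrictScalars_apply, AdicCompletion.evalₐ_mk]
    rfl
  let h := AdicCompletion.liftAlgHom (maximalIdeal S) F (by
    intro m n hle
    ext x
    induction x using AdicCompletion.induction_on with
    | h x =>
      rw [AlgHom.comp_apply, hF, hF]
      change Ideal.Quotient.mk _ (ψ (x n)) = _
      rw [Ideal.Quotient.mk_eq_mk_iff_sub_mem, ← map_sub]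
      refine hpow m ?_
      have := (x.2 hle).symm
      rw [SModEq.sub_mem] at this
      simpa using this)
  refine ⟨h, ?_⟩
  have hof : ∀ c : C, h (algebraMap C _ c) = algebraMap S _ (ψ c) := fun c => by
    refine AdicCompletion.ext_evalₐ fun k => ?_
    rw [AdicCompletion.evalₐ_liftAlgHom]
    simp only [F, AlgHom.comp_apply, AlgHom.restrictScalars_apply, AlgHom.commutes]
    rfl
  have := AdicCompletion.isAdicComplete_self _ hfg
  have hm : ((maximalIdeal C).map (algebraMap C (AdicCompletion (maximalIdeal C) C))).map
      (h : AdicCompletion (maximalIdeal C) C →+* AdicCompletion (maximalIdeal S) S) =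
      maximalIdeal (AdicCompletion (maximalIdeal S) S) := by
    have : (maximalIdeal S).map (algebraMap S (AdicCompletion (maximalIdeal S) S)) =
        ((maximalIdeal C).map (ψ : C →+* S)).map
          (algebraMap S (AdicCompletion (maximalIdeal S) S)) := congrArg _ hmap.symm
    rw [AdicCompletion.maximalIdeal_eq_map, this, Ideal.map_map, Ideal.map_map]
    congr 1
  have : IsHausdorff (((maximalIdeal C).map (algebraMap C (AdicCompletion (maximalIdeal C) C))).map
      (h : AdicCompletion (maximalIdeal C) C →+* AdicCompletion (maximalIdeal S) S))
      (AdicCompletion (maximalIdeal S) S) := by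
    rw [hm]
    infer_instance
  refine surjective_of_mk_map_comp_surjective
    (I := (maximalIdeal C).map (algebraMap C (AdicCompletion (maximalIdeal C) C)))
    (h : AdicCompletion (maximalIdeal C) C →+* AdicCompletion (maximalIdeal S) S) ?_
  intro t
  obtain ⟨t, rfl⟩ := Ideal.Quotient.mk_surjective t
  obtain ⟨s, hs⟩ := Ideal.Quotient.mk_surjective (AdicCompletion.evalOneₐ (maximalIdeal S) t)
  obtain ⟨c, rfl⟩ := hψ s
  refine ⟨algebraMap C _ c, ?_⟩
  change Ideal.Quotient.mk _ (h _) = _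
  rw [Ideal.Quotient.mk_eq_mk_iff_sub_mem, hm, AdicCompletion.maximalIdeal_eq_map,
    ← AdicCompletion.ker_evalOneₐ_eq_map _ (maximalIdeal S).fg_of_isNoetherianRing, hof]
  change AdicCompletion.evalOneₐ (maximalIdeal S) _ = 0
  rw [map_sub, ← hs, sub_eq_zero]
  rfl

/-- The completion of a local algebra that is flat modulo the powers of `𝔪`. -/
theorem flat_completion [IsNoetherianRing B] {𝔪 : Ideal B} (hC : TorsFlat 𝔪 C)
    (hm : 𝔪.map (algebraMap B C) = maximalIdeal C) :
    IsNoetherianRing (AdicCompletion (maximalIdeal C) C) ∧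
      Module.Flat B (AdicCompletion (maximalIdeal C) C) := by
  have hfg : (maximalIdeal C).FG := hm ▸ (𝔪.fg_of_isNoetherianRing).map _
  have hloc := AdicCompletion.isLocalRing_of_fg hfg
  have hcomp := AdicCompletion.isAdicComplete_of_fg hfg
  have hmax := AdicCompletion.maximalIdeal_eq_map_of_fg hfg
  have : IsNoetherianRing (AdicCompletion (maximalIdeal C) C ⧸
      maximalIdeal (AdicCompletion (maximalIdeal C) C)) := by
    let := Ideal.Quotient.field (maximalIdeal (AdicCompletion (maximalIdeal C) C))
    infer_instance
  have hn := isNoetherianRing_of_isAdicComplete (maximalIdeal (AdicCompletion (maximalIdeal C) C))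
    (hmax ▸ hfg.map _)
  refine ⟨hn, ?_⟩
  have hker : ∀ (N : ℕ) (a : AdicCompletion (maximalIdeal C) C),
      a ∈ (𝔪 ^ N • ⊤ : Submodule B (AdicCompletion (maximalIdeal C) C)) ↔
      AdicCompletion.eval (maximalIdeal C) C N a = 0 := fun N a => by
    rw [← LinearMap.mem_ker, ← AdicCompletion.pow_smul_top_eq_ker_eval hfg,
      mem_pow_smul_top_iff hm]
  refine TorsFlat.flat (𝔪 := 𝔪) (hC.of_map
    ((AdicCompletion.of (maximalIdeal C) C).restrictScalars B) ?_ ?_) ?_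
  · intro N a
    obtain ⟨c, hc⟩ := Submodule.mkQ_surjective _ (AdicCompletion.eval (maximalIdeal C) C N a)
    refine ⟨c, ?_⟩
    rw [hker, map_sub, ← hc, sub_eq_zero]
    rfl
  · intro N c hc
    rw [hker] at hc
    rw [mem_pow_smul_top_iff hm]
    exact (Submodule.Quotient.mk_eq_zero _).1 hc
  · rw [IsScalarTower.algebraMap_eq B C, ← Ideal.map_map, hm, ← hmax,
      jacobson_eq_maximalIdeal _ bot_ne_top]

/-- A complete local ring, flat over `B` with closed fibre a field, mapping onto the completion
of a given local `B`-algebra. -/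
theorem exists_complete_cover [IsNoetherianRing B] [IsNoetherianRing S] (𝔪 : Ideal B)
    [𝔪.IsMaximal] (hmap : 𝔪.map (algebraMap B S) = maximalIdeal S)
    (hcomap : (maximalIdeal S).comap (algebraMap B S) = 𝔪) :
    ∃ (A : Type u) (_ : CommRing A) (_ : IsLocalRing A) (_ : IsNoetherianRing A)
      (_ : Algebra B A) (h : A →ₐ[B] AdicCompletion (maximalIdeal S) S),
      IsAdicComplete (maximalIdeal A) A ∧ Module.Flat B A ∧
      𝔪.map (algebraMap B A) = maximalIdeal A ∧ Function.Surjective h := by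
  obtain ⟨P, _, _, _, ψ, Z, hflat, hψ, hZψ, hZm, hZ⟩ := exists_local_complement 𝔪 hmap hcomap
  have hZne : Z ≠ ⊤ := fun h => (maximalIdeal.isMaximal P).ne_top (by rw [← hZm, h, top_sup_eq])
  have : Nontrivial (P ⧸ Z) := Ideal.Quotient.nontrivial_iff.2 hZne
  have : IsLocalRing (P ⧸ Z) := .of_surjective' _ Ideal.Quotient.mk_surjective
  have hm : 𝔪.map (algebraMap B (P ⧸ Z)) = maximalIdeal (P ⧸ Z) := by
    have h1 : (maximalIdeal P).map (Ideal.Quotient.mk Z) = maximalIdeal (P ⧸ Z) := by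
      refine eq_maximalIdeal ?_
      refine (Ideal.map_eq_top_or_isMaximal_of_surjective _ Ideal.Quotient.mk_surjective
        (maximalIdeal.isMaximal P)).resolve_left fun h => ?_
      have := Ideal.comap_map_of_surjective' _ (Ideal.Quotient.mk_surjective (I := Z))
        (maximalIdeal P)
      rw [h, Ideal.mk_ker, Ideal.comap_top, ← hZm, sup_right_comm, sup_idem, hZm] at this
      exact (maximalIdeal.isMaximal P).ne_top this.symm
    rw [← h1, ← hZm, Ideal.map_sup, Ideal.map_quotient_self, bot_sup_eq, Ideal.map_map]
    rfl
  have hT := torsFlat_quotient 𝔪 Z hZ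
  have hfg : (maximalIdeal (P ⧸ Z)).FG := hm ▸ (𝔪.fg_of_isNoetherianRing).map _
  obtain ⟨h, hh⟩ := exists_completion_surjective hfg
    (Ideal.Quotient.liftₐ Z ψ fun a ha => hZψ ha) 
    (Ideal.Quotient.lift_surjective_of_surjective _ _ hψ)
  obtain ⟨hn, hf⟩ := flat_completion hT hm
  have hloc := AdicCompletion.isLocalRing_of_fg hfg
  refine ⟨_, _, hloc, hn, _, h, AdicCompletion.isAdicComplete_of_fg hfg, hf, ?_, hh⟩
  rw [AdicCompletion.maximalIdeal_eq_map_of_fg hfg, ← hm, Ideal.map_map]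
  rfl

end CompleteCover

section MatlisBaseChange

open TensorProduct IsLocalRing

variable {B A : Type u} [CommRing B] [CommRing A] [Algebra B A]

theorem piRight_lTensor_pi {X Y : Type u} [AddCommGroup X] [Module B X] [AddCommGroup Y]
    [Module B Y] {ι : Type} [Fintype ι] [DecidableEq ι] (f : ι → X →ₗ[B] Y) (z : A ⊗[B] X)
    (i : ι) : TensorProduct.piRight B B A (fun _ => Y) ((LinearMap.pi f).lTensor A z) i =
      (f i).lTensor A z := by
  induction z with
  | zero => simp
  | add x y hx hy => simp only [map_add, Pi.add_apply, hx, hy]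
  | tmul a x => simp

theorem lTensor_smul_apply {X : Type u} [AddCommGroup X] [Module B X] (r : B) (z : A ⊗[B] X) :
    (r • (LinearMap.id : X →ₗ[B] X)).lTensor A z = r • z := by
  rw [LinearMap.lTensor_smul, LinearMap.lTensor_id]
  rfl

theorem exists_smul_of_flat [IsNoetherianRing B] [Module.Flat B A] (I : Ideal B) {Q : Type u}
    [AddCommGroup Q] [Module B Q] (hQ : Module.Injective B Q) (φ : I →ₗ[B] A ⊗[B] Q) :
    ∃ w, ∀ r : I, φ r = (r : B) • w := by
  classical
  obtain ⟨q, π, hπ⟩ := Module.Finite.exists_fin' B I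
  obtain ⟨p, c, hc⟩ := Module.Finite.exists_fin' B (LinearMap.ker π)
  let d : (Fin p → B) →ₗ[B] (Fin q → B) := (LinearMap.ker π).subtype ∘ₗ c
  let f : Q →ₗ[B] (Fin q → Q) := LinearMap.pi fun j => (π (Pi.single j 1) : B) • LinearMap.id
  let g : (Fin q → Q) →ₗ[B] (Fin p → Q) :=
    LinearMap.pi fun i => ∑ j, d (Pi.single i 1) j • LinearMap.proj j
  have hsum : ∀ x : Fin q → B, (π x : B) = ∑ j, x j * π (Pi.single j 1) := fun x => by
    conv_lhs => rw [pi_eq_sum_univ' x]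
    simp
  have hfg : Function.Exact f g := by
    intro x
    constructor
    · intro hx
      let ψ : (Fin q → B) →ₗ[B] Q := Fintype.linearCombination B x
      have hψ : LinearMap.ker π ≤ LinearMap.ker ψ := by
        intro y hy
        obtain ⟨z, hz⟩ := hc ⟨y, hy⟩
        have hz : d z = y := congrArg Subtype.val hz
        have : ψ ∘ₗ d = 0 := by
          ext i
          simpa [g, ψ, Fintype.linearCombination_apply] using congrFun hx i
        rw [LinearMap.mem_ker, ← hz]
        exact LinearMap.congr_fun this z
      let χ : I →ₗ[B] Q := (LinearMap.ker π).liftQ ψ hψ ∘ₗ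
        (π.quotKerEquivOfSurjective hπ).symm.toLinearMap
      have hχ : ∀ y, χ (π y) = ψ y := fun y => by
        have : (π.quotKerEquivOfSurjective hπ).symm (π y) = Submodule.Quotient.mk y :=
          (LinearEquiv.symm_apply_eq _).2 rfl
        simp [χ, this]
      obtain ⟨h, hh⟩ := hQ.extend (i := I.subtype) Subtype.val_injective χ
      refine ⟨h 1, funext fun j => ?_⟩
      have h1 := LinearMap.congr_fun hh (π (Pi.single j 1))
      rw [hχ] at h1
      simp only [ψ, Fintype.linearCombination_apply_single, one_smul] at h1
      rw [← h1]
      simp only [f, LinearMap.pi_apply, LinearMap.smul_apply, LinearMap.id_apply,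
        LinearMap.comp_apply, Submodule.subtype_apply]
      rw [← map_smul, smul_eq_mul, mul_one]
    · rintro ⟨y, rfl⟩
      funext i
      have h0 : (π (d (Pi.single i 1)) : B) = 0 := by
        rw [show π (d (Pi.single i 1)) = 0 from (c (Pi.single i 1)).2]
        rfl
      rw [hsum] at h0
      simp only [f, g, LinearMap.pi_apply, LinearMap.sum_apply, LinearMap.smul_apply,
        LinearMap.proj_apply, LinearMap.id_apply, smul_smul, ← Finset.sum_smul, h0, zero_smul]
      rfl
  have hex := Module.Flat.lTensor_exact A hfg
  let ξ := (TensorProduct.piRight B B A (fun _ : Fin q => Q)).symm fun j => φ (π (Pi.single j 1))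
  have hξ : ∀ j, (LinearMap.proj j : (Fin q → Q) →ₗ[B] Q).lTensor A ξ = φ (π (Pi.single j 1)) := by
    intro j
    have := piRight_lTensor_pi (A := A) (fun j => (LinearMap.proj j : (Fin q → Q) →ₗ[B] Q)) ξ j
    rw [← this]
    have h2 : LinearMap.pi (fun j => (LinearMap.proj j : (Fin q → Q) →ₗ[B] Q)) = LinearMap.id := rfl
    rw [h2, LinearMap.lTensor_id, LinearMap.id_apply]
    simp [ξ]
  have h0 : g.lTensor A ξ = 0 := by
    apply (TensorProduct.piRight B B A (fun _ : Fin p => Q)).injective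
    rw [map_zero]
    funext i
    rw [piRight_lTensor_pi]
    rw [← LinearMap.coe_lTensorHom, map_sum]
    simp only [map_smul, LinearMap.coe_lTensorHom, LinearMap.sum_apply,
      LinearMap.smul_apply, hξ]
    simp only [← map_smul]
    rw [← map_sum, ← map_sum]
    have : ∑ j, d (Pi.single i 1) j • (Pi.single j (1 : B) : Fin q → B) = d (Pi.single i 1) := by
      conv_rhs => rw [pi_eq_sum_univ' (d (Pi.single i 1))]
    rw [this, show π (d (Pi.single i 1)) = 0 from (c (Pi.single i 1)).2, map_zero]
    rfl
  obtain ⟨w, hw⟩ := (hex ξ).1 h0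
  refine ⟨w, fun r => ?_⟩
  obtain ⟨x, rfl⟩ := hπ r
  have h1 : ∀ j, φ (π (Pi.single j 1)) = (π (Pi.single j 1) : B) • w := fun j => by
    rw [← hξ, ← hw, ← LinearMap.comp_apply, ← LinearMap.lTensor_comp]
    exact lTensor_smul_apply _ _
  rw [hsum]
  conv_lhs => rw [pi_eq_sum_univ' x]
  simp only [map_sum, map_smul, h1, Finset.sum_smul, smul_smul]

theorem IsMatlis.baseChange [IsNoetherianRing B] [IsNoetherianRing A] [Module.Flat B A]
    {𝔪 : Ideal B} {𝔫 : Ideal A} [𝔪.IsMaximal] [h𝔫 : 𝔫.IsMaximal]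
    (h : 𝔪.map (algebraMap B A) = 𝔫) {E : Type u} [AddCommGroup E]
    [Module B E] {e : E} (hE : IsMatlis 𝔪 E e) : IsMatlis 𝔫 (A ⊗[B] E) (1 ⊗ₜ e) := by
  classical
  have hmem : ∀ {X : Type u} [AddCommGroup X] [Module B X] [Module A X] [IsScalarTower B A X]
      (n : ℕ) (x : X), (∀ r ∈ 𝔪 ^ n, r • x = 0) → ∀ a ∈ 𝔫 ^ n, a • x = 0 := by
    intro X _ _ _ _ n x hx a ha
    rw [← h, ← Ideal.map_pow] at ha
    have : (𝔪 ^ n).map (algebraMap B A) ≤ LinearMap.ker (LinearMap.toSpanSingleton A X x) := by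
      rw [Ideal.map_le_iff_le_comap]
      intro r hr
      simpa using hx r hr
    exact this ha
  have htors : IsTors 𝔫 (A ⊗[B] E) := by
    intro z
    suffices ∃ n, ∀ r ∈ 𝔪 ^ n, r • z = 0 from this.imp fun n hn => hmem n z hn
    induction z with
    | zero => exact ⟨0, by simp⟩
    | add x y hx hy =>
      obtain ⟨n, hn⟩ := hx
      obtain ⟨k, hk⟩ := hy
      refine ⟨max n k, fun r hr => ?_⟩
      rw [smul_add, hn r (Ideal.pow_le_pow_right (le_max_left _ _) hr),
        hk r (Ideal.pow_le_pow_right (le_max_right _ _) hr), add_zero]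
    | tmul a x =>
      obtain ⟨n, hn⟩ := hE.tinj.tors x
      exact ⟨n, fun r hr => by rw [← TensorProduct.tmul_smul, hn r hr, TensorProduct.tmul_zero]⟩
  refine ⟨⟨Module.Baer.injective (htors.baer fun φ => ?_), htors⟩, ?_, ?_, ?_⟩
  · let ψ : 𝔪 →ₗ[B] A ⊗[B] E :=
      { toFun := fun r => φ ⟨algebraMap B A r, h ▸ Ideal.mem_map_of_mem _ r.2⟩
        map_add' := fun r s => by
          rw [← map_add]
          congr 1
          ext
          simp
        map_smul' := fun r s => by
          rw [RingHom.id_apply, ← algebraMap_smul A r (φ _), ← map_smul]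
          congr 1
          ext
          simp [Algebra.smul_def] }
    obtain ⟨w, hw⟩ := exists_smul_of_flat 𝔪 hE.tinj.inj ψ
    refine ⟨w, fun r => ?_⟩
    obtain ⟨r, hr⟩ := r
    have hr' := hr
    rw [← h] at hr'
    suffices 𝔪.map (algebraMap B A) ≤ (LinearMap.eqLocus φ
        ((LinearMap.toSpanSingleton A _ w) ∘ₗ 𝔫.subtype)).map 𝔫.subtype by
      obtain ⟨⟨s, hs⟩, hs1, hs2⟩ := this hr'
      obtain rfl : s = r := hs2
      exact hs1
    rw [Ideal.map_le_iff_le_comap]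
    intro s hs
    refine ⟨⟨algebraMap B A s, h ▸ Ideal.mem_map_of_mem _ hs⟩, ?_, rfl⟩
    change φ _ = algebraMap B A s • w
    rw [algebraMap_smul]
    exact hw ⟨s, hs⟩
  · have hk : ∀ r ∈ 𝔪, r • e = 0 := hE.smul_eq_zero
    have hinj : Function.Injective ((LinearMap.toSpanSingleton B E e).ker.liftQ
        (LinearMap.toSpanSingleton B E e) le_rfl) := by
      rw [← LinearMap.ker_eq_bot]
      exact Submodule.ker_liftQ_eq_bot' _ _ rfl
    have hker : LinearMap.ker (LinearMap.toSpanSingleton B E e) = 𝔪 := by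
      refine (Ideal.IsMaximal.eq_of_le ‹𝔪.IsMaximal› ?_ fun r hr => by simpa using hk r hr).symm
      intro h1
      exact hE.ne_zero (by simpa using (Ideal.eq_top_iff_one _).1 h1)
    have hinj' := Module.Flat.lTensor_preserves_injective_linearMap (M := A) _ hinj
    intro h0
    have h1 : (1 : A) ⊗ₜ[B] (Submodule.Quotient.mk (1 : B) :
        B ⧸ LinearMap.ker (LinearMap.toSpanSingleton B E e)) = 0 := by
      apply hinj'
      rw [map_zero, LinearMap.lTensor_tmul, Submodule.liftQ_apply,
        LinearMap.toSpanSingleton_apply, one_smul, h0]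
    have h2 := congrArg (TensorProduct.lift ((LinearMap.ker
      (LinearMap.toSpanSingleton B E e)).liftQ ((LinearMap.toSpanSingleton B (A →ₗ[B] A ⧸ 𝔫)
        (𝔫.mkQ.restrictScalars B))) ?_).flip) h1
    · rw [map_zero, TensorProduct.lift.tmul] at h2
      change ((1 : B) • (𝔫.mkQ.restrictScalars B)) 1 = 0 at h2
      rw [one_smul] at h2
      exact h𝔫.ne_top ((Ideal.eq_top_iff_one _).2 ((Submodule.Quotient.mk_eq_zero _).1 h2))
    · rw [hker]
      intro r hr
      rw [LinearMap.mem_ker, LinearMap.toSpanSingleton_apply]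
      ext a
      change r • Submodule.Quotient.mk (p := 𝔫) a = 0
      rw [← Submodule.Quotient.mk_smul, Submodule.Quotient.mk_eq_zero, Algebra.smul_def]
      exact Ideal.mul_mem_right _ _ (h ▸ Ideal.mem_map_of_mem _ hr)
  · intro r hr
    refine hmem 1 _ (fun s hs => ?_) r (by simpa using hr)
    rw [← TensorProduct.tmul_smul, hE.smul_eq_zero s (by simpa using hs), TensorProduct.tmul_zero]
  · intro x hx
    obtain ⟨q, π, hπ⟩ := Module.Finite.exists_fin' B 𝔪
    let f : E →ₗ[B] (Fin q → E) := LinearMap.pi fun j => (π (Pi.single j 1) : B) • LinearMap.id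
    have hfg : Function.Exact (LinearMap.toSpanSingleton B E e) f := by
      intro y
      constructor
      · intro hy
        obtain ⟨c, hc⟩ := hE.socle y fun r hr => by
          obtain ⟨z, hz⟩ := hπ ⟨r, hr⟩
          have : r = ∑ j, z j * π (Pi.single j 1) := by
            have := congrArg Subtype.val hz
            rw [pi_eq_sum_univ' z] at this
            simpa using this.symm
          rw [this, Finset.sum_smul]
          refine Finset.sum_eq_zero fun j _ => ?_
          rw [mul_smul, show (π (Pi.single j 1) : B) • y = 0 from congrFun hy j, smul_zero]
        exact ⟨c, hc.symm⟩
      · rintro ⟨c, rfl⟩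
        funext j
        change (π (Pi.single j 1) : B) • (c • e) = 0
        rw [smul_comm, hE.smul_eq_zero _ (π (Pi.single j 1)).2, smul_zero]
    obtain ⟨y, hy⟩ := (Module.Flat.lTensor_exact A hfg x).1 (by
      apply (TensorProduct.piRight B B A (fun _ : Fin q => E)).injective
      rw [map_zero]
      funext i
      rw [piRight_lTensor_pi, lTensor_smul_apply, ← algebraMap_smul A]
      exact hx _ (h ▸ Ideal.mem_map_of_mem _ (π (Pi.single i 1)).2))
    refine ⟨TensorProduct.rid B A y, ?_⟩
    rw [← hy]
    clear hy
    induction y with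
    | zero => simp
    | add x y hx hy => rw [map_add, hx, hy, map_add, add_smul]
    | tmul a b =>
      rw [LinearMap.lTensor_tmul, LinearMap.toSpanSingleton_apply, TensorProduct.rid_tmul,
        TensorProduct.tmul_smul, TensorProduct.smul_tmul', TensorProduct.smul_tmul', smul_eq_mul,
        mul_one]

end MatlisBaseChange

section MatlisDuality

open IsLocalRing

variable {A : Type u} [CommRing A]

theorem IsMatlis.exists_smul_of_eq_zero [IsNoetherianRing A] {𝔪 : Ideal A} {E : Type u}
    [AddCommGroup E] [Module A E]
    {e : E} (hE : IsMatlis 𝔪 E e) (f : E →ₗ[A] E) (k : ℕ)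
    (hf : ∀ x, (∀ r ∈ 𝔪 ^ k, r • x = 0) → f x = 0) :
    ∃ c ∈ 𝔪 ^ k, ∀ x, (∀ r ∈ 𝔪 ^ (k + 1), r • x = 0) → f x = c • x := by
  classical
  obtain ⟨q, π, hπ⟩ := Module.Finite.exists_fin' A ↥(𝔪 ^ k)
  let r : Fin q → A := fun i => π (Pi.single i 1)
  let V : Submodule A E :=
    { carrier := {x | ∀ r ∈ 𝔪 ^ (k + 1), r • x = 0}
      add_mem' := fun hx hy r hr => by rw [smul_add, hx r hr, hy r hr, add_zero]
      zero_mem' := fun r _ => smul_zero r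
      smul_mem' := fun c x hx r hr => by rw [smul_comm, hx r hr, smul_zero] }
  let ρ : V →ₗ[A] Fin q → E := LinearMap.pi fun i => r i • V.subtype
  have hker : LinearMap.ker ρ ≤ LinearMap.ker (f ∘ₗ V.subtype) := by
    intro x hx
    refine hf _ fun s hs => ?_
    obtain ⟨z, hz⟩ := hπ ⟨s, hs⟩
    have hz' : s = ∑ j, z j * r j := by
      have := congrArg Subtype.val hz
      rw [pi_eq_sum_univ' z] at this
      simpa using this.symm
    rw [hz', Finset.sum_smul]
    refine Finset.sum_eq_zero fun j _ => ?_
    rw [mul_smul]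
    have : r j • (x : E) = 0 := congrFun hx j
    rw [Submodule.subtype_apply, this, smul_zero]
  obtain ⟨h, hh⟩ := hE.tinj.inj.extend (i := (LinearMap.ker ρ).liftQ ρ le_rfl)
    (LinearMap.ker_eq_bot.1 (Submodule.ker_liftQ_eq_bot' _ _ rfl))
    ((LinearMap.ker ρ).liftQ (f ∘ₗ V.subtype) hker)
  have hh' : ∀ x : V, h (ρ x) = f x := fun x =>
    LinearMap.congr_fun hh (Submodule.Quotient.mk x)
  have hc : ∀ i, ∃ c : A, h (Pi.single i e) = c • e := fun i =>
    hE.socle _ fun s hs => by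
      rw [← map_smul, ← Pi.single_smul, hE.smul_eq_zero s hs, Pi.single_zero, map_zero]
  choose c hc using hc
  refine ⟨∑ i, c i * r i, Ideal.sum_mem _ fun i _ => Ideal.mul_mem_left _ _ (π _).2,
    fun x hx => ?_⟩
  have h1 := hh' ⟨x, hx⟩
  rw [← h1, Finset.sum_smul]
  have h2 : ρ ⟨x, hx⟩ = ∑ i, Pi.single i (r i • x) :=
    (Finset.univ_sum_single fun i => r i • x).symm
  rw [h2, map_sum]
  refine Finset.sum_congr rfl fun i _ => ?_
  obtain ⟨a, ha⟩ := hE.socle (r i • x) fun s hs => by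
    rw [smul_smul]
    exact hx _ (by rw [pow_succ']; exact Ideal.mul_mem_mul hs (π _).2)
  rw [mul_smul, ha, Pi.single_smul, map_smul, hc, smul_comm]

/-- Endomorphisms of the Matlis module over a complete ring are homotheties. -/
theorem IsMatlis.exists_eq_smul [IsNoetherianRing A] {𝔪 : Ideal A} [IsAdicComplete 𝔪 A]
    {E : Type u} [AddCommGroup E] [Module A E] {e : E} (hE : IsMatlis 𝔪 E e) (f : E →ₗ[A] E) :
    ∃ a : A, ∀ x, f x = a • x := by
  have step : ∀ k (a : {a : A // ∀ x, (∀ r ∈ 𝔪 ^ k, r • x = 0) → f x = a • x}),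
      ∃ b : {a : A // ∀ x, (∀ r ∈ 𝔪 ^ (k + 1), r • x = 0) → f x = a • x},
        b.1 - a.1 ∈ 𝔪 ^ k := by
    rintro k ⟨a, ha⟩
    obtain ⟨c, hc, hc'⟩ := hE.exists_smul_of_eq_zero (f - a • LinearMap.id) k fun x hx => by
      simp [ha x hx]
    refine ⟨⟨a + c, fun x hx => ?_⟩, by simpa using hc⟩
    have := hc' x hx
    simp only [LinearMap.sub_apply, LinearMap.smul_apply, LinearMap.id_apply] at this
    rw [add_smul, ← this]
    abel
  choose b hb using step
  let s : ∀ k, {a : A // ∀ x, (∀ r ∈ 𝔪 ^ k, r • x = 0) → f x = a • x} := fun k =>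
    Nat.rec ⟨0, fun x hx => by
      have : x = 0 := by simpa using hx 1 (by simp)
      simp [this]⟩ (fun k a => b k a) k
  have hs : ∀ k, (s (k + 1)).1 - (s k).1 ∈ 𝔪 ^ k := fun k => hb k (s k)
  have hs' : ∀ m d, (s m).1 - (s (m + d)).1 ∈ 𝔪 ^ m := by
    intro m d
    induction d with
    | zero => simp
    | succ d ih =>
      have h1 := Ideal.pow_le_pow_right (Nat.le_add_right m d) (hs (m + d))
      have := sub_mem ih h1
      rwa [sub_sub, add_sub_cancel] at this
  obtain ⟨L, hL⟩ := IsPrecomplete.prec' (I := 𝔪) (fun k => (s k).1) fun {m n} hmn => by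
    obtain ⟨d, rfl⟩ := Nat.exists_eq_add_of_le hmn
    rw [SModEq.sub_mem, smul_eq_mul, Ideal.mul_top]
    exact hs' m d
  refine ⟨L, fun x => ?_⟩
  obtain ⟨n, hn⟩ := hE.tinj.tors x
  have h1 := hL n
  rw [SModEq.sub_mem, smul_eq_mul, Ideal.mul_top] at h1
  rw [(s n).2 x hn]
  have := hn _ h1
  rwa [sub_smul, sub_eq_zero] at this

theorem IsMatlis.exists_eq_sum_smul [IsNoetherianRing A] {𝔪 : Ideal A} [IsAdicComplete 𝔪 A]
    {E : Type u} [AddCommGroup E] [Module A E] {e : E} (hE : IsMatlis 𝔪 E e) {b : ℕ}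
    (f : (Fin b → E) →ₗ[A] E) : ∃ a : Fin b → A, ∀ x, f x = ∑ i, a i • x i := by
  classical
  choose a ha using fun i => hE.exists_eq_smul (f ∘ₗ LinearMap.single A (fun _ => E) i)
  refine ⟨a, fun x => ?_⟩
  conv_lhs => rw [← Finset.univ_sum_single x, map_sum]
  exact Finset.sum_congr rfl fun i _ => ha i (x i)

theorem TInj.pi [IsNoetherianRing A] {𝔪 : Ideal A} [𝔪.IsMaximal] {E : Type u}
    [AddCommGroup E] [Module A E] (hE : TInj 𝔪 E) (b : ℕ) : TInj 𝔪 (Fin b → E) :=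
  (hE.finsupp (ULift.{u} (Fin b))).of_equiv
    ((Finsupp.linearEquivFunOnFinite A E _).trans (LinearEquiv.funCongrLeft A E Equiv.ulift.symm))

theorem IsMatlis.exists_embedding_of_isArtinian [IsNoetherianRing A] {𝔪 : Ideal A} [𝔪.IsMaximal] {E : Type u}
    [AddCommGroup E] [Module A E] {e : E} (hE : IsMatlis 𝔪 E e) {X : Type u} [AddCommGroup X]
    [Module A X] [IsArtinian A X] (hX : IsTors 𝔪 X) :
    ∃ (b : ℕ) (j : X →ₗ[A] Fin b → E), Function.Injective j := by
  obtain ⟨K, ⟨b, j, rfl⟩, hK⟩ := IsArtinian.set_has_minimal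
    {K : Submodule A X | ∃ (b : ℕ) (j : X →ₗ[A] Fin b → E), LinearMap.ker j = K}
    ⟨_, 0, 0, rfl⟩
  refine ⟨b, j, LinearMap.ker_eq_bot.1 ?_⟩
  by_contra h
  obtain ⟨x, hx, hx0⟩ := Submodule.exists_mem_ne_zero_of_ne_bot h
  obtain ⟨ψ, hψ⟩ := hE.exists_apply_ne_zero hX hx0
  refine hK _ ⟨b + 1, LinearMap.pi (Fin.cons ψ fun i => LinearMap.proj i ∘ₗ j), rfl⟩ ?_
  refine lt_of_le_of_ne (fun y hy => ?_) fun heq => hψ ?_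
  · funext i
    exact congrFun hy i.succ
  · rw [← heq] at hx
    exact congrFun hx 0

theorem isTors_of_isArtinian [IsLocalRing A] [IsNoetherianRing A] {X : Type u} [AddCommGroup X]
    [Module A X] [IsArtinian A X] : IsTors (maximalIdeal A) X := by
  intro x
  obtain ⟨n, hn⟩ := IsArtinian.monotone_stabilizes (R := A) (M := X)
    ⟨fun n => OrderDual.toDual (maximalIdeal A ^ n • Submodule.span A {x}), fun a b hab =>
      Submodule.smul_mono_left (Ideal.pow_le_pow_right hab)⟩
  have h1 : maximalIdeal A ^ n • Submodule.span A {x} =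
      maximalIdeal A ^ (n + 1) • Submodule.span A {x} := hn (n + 1) n.le_succ
  have h2 : maximalIdeal A ^ n • Submodule.span A {x} = ⊥ := by
    refine Submodule.eq_bot_of_le_smul_of_le_jacobson_bot (maximalIdeal A) _
      (Submodule.FG.smul (IsNoetherian.noetherian _) (Submodule.fg_span_singleton x)) ?_
      (IsLocalRing.maximalIdeal_le_jacobson _)
    rw [smul_smul, ← pow_succ', ← h1]
  refine ⟨n, fun r hr => ?_⟩
  have : r • x ∈ maximalIdeal A ^ n • Submodule.span A {x} :=
    Submodule.smul_mem_smul hr (Submodule.mem_span_singleton_self x)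
  rwa [h2] at this

/-- Artinian modules are Matlis duals of finite modules. -/
theorem IsMatlis.exists_dual [IsNoetherianRing A] {𝔪 : Ideal A} [𝔪.IsMaximal]
    [IsAdicComplete 𝔪 A] {E : Type u} [AddCommGroup E] [Module A E] {e : E} (hE : IsMatlis 𝔪 E e)
    {X : Type u} [AddCommGroup X] [Module A X] [IsArtinian A X] (hX : IsTors 𝔪 X) :
    Module.Finite A (X →ₗ[A] E) ∧ Function.Bijective
      (LinearMap.id.flip : X →ₗ[A] (X →ₗ[A] E) →ₗ[A] E) := by
  classical
  obtain ⟨b, j, hj⟩ := hE.exists_embedding_of_isArtinian hX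
  have hext : ∀ g : X →ₗ[A] E, ∃ a : Fin b → A, g = ∑ i, a i • (LinearMap.proj i ∘ₗ j) := by
    intro g
    obtain ⟨h, hh⟩ := hE.tinj.inj.extend hj g
    obtain ⟨a, ha⟩ := hE.exists_eq_sum_smul h
    refine ⟨a, LinearMap.ext fun x => ?_⟩
    rw [← hh, LinearMap.comp_apply, ha]
    simp
  refine ⟨⟨⟨Finset.univ.image fun i : Fin b => LinearMap.proj i ∘ₗ j, ?_⟩⟩, ?_, ?_⟩
  · rw [eq_top_iff]
    rintro g -
    obtain ⟨a, rfl⟩ := hext g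
    refine Submodule.sum_mem _ fun i _ => Submodule.smul_mem _ _ (Submodule.subset_span ?_)
    simp
  · rw [← LinearMap.ker_eq_bot, eq_bot_iff]
    intro x hx
    by_contra hx0
    obtain ⟨ψ, hψ⟩ := hE.exists_apply_ne_zero hX hx0
    exact hψ (LinearMap.congr_fun hx ψ)
  · intro ξ
    let x : Fin b → E := fun i => ξ (LinearMap.proj i ∘ₗ j)
    have hx : x ∈ LinearMap.range j := by
      by_contra hx
      obtain ⟨ψ, hψ⟩ := hE.exists_apply_ne_zero
        ((hE.tinj.pi b).tors.of_surjective _ (Submodule.mkQ_surjective (LinearMap.range j)))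
        (x := Submodule.Quotient.mk x) (by rwa [Ne, Submodule.Quotient.mk_eq_zero])
      obtain ⟨a, ha⟩ := hE.exists_eq_sum_smul (ψ ∘ₗ (LinearMap.range j).mkQ)
      have h0 : ∑ i, a i • (LinearMap.proj i ∘ₗ j) = 0 := by
        ext y
        have := ha (j y)
        rw [LinearMap.comp_apply, (LinearMap.range j).mkQ_apply,
          (Submodule.Quotient.mk_eq_zero _).2 (LinearMap.mem_range_self j y), map_zero] at this
        simpa using this.symm
      apply hψ
      have h1 := ha x
      have h2 := congrArg ξ h0
      rw [map_sum, map_zero] at h2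
      simp only [map_smul] at h2
      exact h1.trans h2
    obtain ⟨y, hy⟩ := hx
    refine ⟨y, LinearMap.ext fun g => ?_⟩
    obtain ⟨a, rfl⟩ := hext g
    rw [map_sum, map_sum]
    simp only [map_smul, LinearMap.flip_apply, LinearMap.id_apply, LinearMap.comp_apply,
      LinearMap.proj_apply]
    rw [hy]

end MatlisDuality

section TotallyReflexiveClasses

variable {A : Type u} [CommRing A]

/-- Finitely generated projective modules. -/
structure FinProj (A : Type u) [CommRing A] (P : Type u) [AddCommGroup P] [Module A P] : Prop where
  fin : Module.Finite A P
  proj : Module.Projective A P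

variable {X Y B P Q : Type u} [AddCommGroup X] [Module A X] [AddCommGroup Y] [Module A Y]
  [AddCommGroup B] [Module A B] [AddCommGroup P] [Module A P] [AddCommGroup Q] [Module A Q]

theorem FinProj.prod (hP : FinProj A P) (hQ : FinProj A Q) : FinProj A (P × Q) :=
  have := hP.fin; have := hQ.fin; have := hP.proj; have := hQ.proj
  ⟨inferInstance, inferInstance⟩

theorem FinProj.of_free [Module.Finite A P] [Module.Free A P] : FinProj A P :=
  ⟨inferInstance, inferInstance⟩

theorem FinProj.fin_fun (b : ℕ) : FinProj A (Fin b → A) := FinProj.of_free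

theorem FinProj.punit : FinProj A PUnit.{u + 1} := FinProj.of_free

theorem FinProj.exists_lift (hP : FinProj A P) {g : B →ₗ[A] Y} (hg : Function.Surjective g)
    (t : P →ₗ[A] Y) : ∃ t' : P →ₗ[A] B, ∀ x, g (t' x) = t x := by
  have := hP.proj
  obtain ⟨t', ht⟩ := Module.projective_lifting_property g t hg
  exact ⟨t', LinearMap.congr_fun ht⟩

theorem FinProj.exists_retract (hP : FinProj A P) :
    ∃ (b : ℕ) (i : P →ₗ[A] Fin b → A) (r : (Fin b → A) →ₗ[A] P), ∀ x, r (i x) = x := by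
  have := hP.fin
  obtain ⟨b, r, hr⟩ := Module.Finite.exists_fin' A P
  obtain ⟨i, hi⟩ := hP.exists_lift hr LinearMap.id
  exact ⟨b, i, r, hi⟩

/-- Extension of linear forms gives extension of maps to projective modules. -/
theorem FinProj.exists_extend (hP : FinProj A P) {f : X →ₗ[A] Y}
    (hf : ∀ φ : X →ₗ[A] A, ∃ ψ : Y →ₗ[A] A, ∀ x, ψ (f x) = φ x) (φ : X →ₗ[A] P) :
    ∃ ψ : Y →ₗ[A] P, ∀ x, ψ (f x) = φ x := by
  obtain ⟨b, i, r, hr⟩ := hP.exists_retract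
  choose ψ hψ using fun j => hf (LinearMap.proj j ∘ₗ i ∘ₗ φ)
  refine ⟨r ∘ₗ LinearMap.pi ψ, fun x => ?_⟩
  have : LinearMap.pi ψ (f x) = i (φ x) := funext fun j => hψ j x
  rw [LinearMap.comp_apply, this, hr]

/-- Linear forms extend along injections with cokernel `X`. -/
def CoVan (A : Type u) [CommRing A] (X : Type u) [AddCommGroup X] [Module A X] : Prop :=
  ∀ (Z Y : Type u) [AddCommGroup Y] [Module A Y] [AddCommGroup Z] [Module A Z]
    (f : Z →ₗ[A] Y) (g : Y →ₗ[A] X), Ses f g → ∀ φ : Z →ₗ[A] A,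
      ∃ ψ : Y →ₗ[A] A, ∀ z, ψ (f z) = φ z

theorem CoVan.of_ses (hP : FinProj A P) {f : Y →ₗ[A] P} {g : P →ₗ[A] X} (h : Ses f g)
    (hf : ∀ φ : Y →ₗ[A] A, ∃ ψ : P →ₗ[A] A, ∀ x, ψ (f x) = φ x) : CoVan A X := by
  intro Z V _ _ _ _ i p hip φ
  obtain ⟨p', hp'⟩ := hP.exists_lift hip.surj g
  obtain ⟨a, ha, ha2⟩ := hip.switch_left h hp'
  obtain ⟨ψ, hψ⟩ := hf (-(φ ∘ₗ LinearMap.fst A Z P ∘ₗ a))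
  obtain ⟨χ, hχ⟩ := ha.desc (φ.coprod ψ) fun y => by
    rw [LinearMap.coprod_apply, ha2, hψ]
    simp
  refine ⟨χ, fun z => ?_⟩
  have := hχ (z, 0)
  simpa using this

theorem CoVan.of_ses_middle {f : X →ₗ[A] B} {g : B →ₗ[A] Y} (h : Ses f g) (hX : CoVan A X)
    (hY : CoVan A Y) : CoVan A B := by
  intro Z V _ _ _ _ i p hip φ
  obtain ⟨a, b, hab, ha⟩ := h.ker_of_comp hip
  obtain ⟨s, hs⟩ := hX _ _ a b hab φ
  obtain ⟨r, hr⟩ := hY _ _ _ _ (Ses.ker (g := g ∘ₗ p) (h.surj.comp hip.surj)) s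
  exact ⟨r, fun z => by rw [← ha, ← hs, ← hr, Submodule.subtype_apply]⟩

theorem CoVan.of_prod (h : CoVan A (X × Q)) : CoVan A X := by
  intro Z V _ _ _ _ f g hfg φ
  have : Ses (LinearMap.inl A V Q ∘ₗ f) (LinearMap.prodMap g (LinearMap.id (R := A) (M := Q))) := by
    refine Ses.of_zero ?_ ?_ ?_ ?_
    · exact LinearMap.inl_injective.comp hfg.inj
    · exact hfg.surj.prodMap Function.surjective_id
    · intro x
      simp [hfg.zero]
    · rintro ⟨a, b⟩ hab
      obtain ⟨x, rfl⟩ := hfg.exists_of (congrArg Prod.fst hab)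
      exact ⟨x, Prod.ext rfl (congrArg Prod.snd hab).symm⟩
  obtain ⟨s, hs⟩ := h _ _ _ _ this φ
  exact ⟨s ∘ₗ LinearMap.inl A V Q, hs⟩

theorem CoVan.of_finProj (hP : FinProj A P) : CoVan A P := by
  refine CoVan.of_ses hP Ses.zero_id fun φ => ⟨0, fun x => ?_⟩
  rw [Subsingleton.elim x 0, map_zero, map_zero, map_zero]

/-- A class of finite modules which is closed under projective (co)syzygies. -/
structure IsTRClass (P : ModuleCat.{u} A → Prop) : Prop where
  fin : ∀ X, P X → Module.Finite A X
  van : ∀ X, P X → CoVan A X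
  right : ∀ X, P X → ∃ (F X' : ModuleCat.{u} A) (f : X →ₗ[A] F) (g : F →ₗ[A] X'),
    Ses f g ∧ FinProj A F ∧ P X'
  left : ∀ X, P X → ∃ (F X' : ModuleCat.{u} A) (f : X' →ₗ[A] F) (g : F →ₗ[A] X),
    Ses f g ∧ FinProj A F ∧ P X'

/-- Totally reflexive modules, via their complete resolutions. -/
def TR (A : Type u) [CommRing A] (X : Type u) [AddCommGroup X] [Module A X] : Prop :=
  ∃ P : ModuleCat.{u} A → Prop, IsTRClass P ∧ P (ModuleCat.of A X)

theorem IsTRClass.TR {P : ModuleCat.{u} A → Prop} (h : IsTRClass P) (hX : P (ModuleCat.of A X)) :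
    TR A X := ⟨P, h, hX⟩

theorem isTRClass_TR : IsTRClass (A := A) fun X => TR A X where
  fin := fun X ⟨_, h, hX⟩ => h.fin X hX
  van := fun X ⟨_, h, hX⟩ => h.van X hX
  right := fun X ⟨P, h, hX⟩ => by
    obtain ⟨I, X', f, g, h1, h2, h3⟩ := h.right X hX
    exact ⟨I, X', f, g, h1, h2, P, h, h3⟩
  left := fun X ⟨P, h, hX⟩ => by
    obtain ⟨I, X', f, g, h1, h2, h3⟩ := h.left X hX
    exact ⟨I, X', f, g, h1, h2, P, h, h3⟩

theorem TR.fin (h : TR A X) : Module.Finite A X := isTRClass_TR.fin (ModuleCat.of A X) h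

theorem TR.van (h : TR A X) : CoVan A X := isTRClass_TR.van (ModuleCat.of A X) h

theorem TR.right (h : TR A X) : ∃ (F X' : ModuleCat.{u} A) (f : X →ₗ[A] F) (g : F →ₗ[A] X'),
    Ses f g ∧ FinProj A F ∧ TR A X' := isTRClass_TR.right (ModuleCat.of A X) h

theorem TR.left (h : TR A X) : ∃ (F X' : ModuleCat.{u} A) (f : X' →ₗ[A] F) (g : F →ₗ[A] X),
    Ses f g ∧ FinProj A F ∧ TR A X' := isTRClass_TR.left (ModuleCat.of A X) h

theorem FinProj.TR (h : FinProj A P) : TR A P := by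
  refine IsTRClass.TR (P := fun X => FinProj A X) ⟨fun X h => h.fin, fun X h => .of_finProj h,
    fun X h => ?_, fun X h => ?_⟩ h
  · exact ⟨X, ModuleCat.of A PUnit, _, _, Ses.id_zero, h, FinProj.punit⟩
  · exact ⟨X, ModuleCat.of A PUnit, _, _, Ses.zero_id, h, FinProj.punit⟩

theorem TR.ext {f : X →ₗ[A] B} {g : B →ₗ[A] Y} (h : Ses f g) (hX : TR A X) (hY : TR A Y) :
    TR A B := by
  refine IsTRClass.TR (P := fun W => ∃ (U V : ModuleCat.{u} A) (f : U →ₗ[A] W) (g : W →ₗ[A] V),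
    Ses f g ∧ TR A U ∧ TR A V) ⟨?_, ?_, ?_, ?_⟩
    ⟨ModuleCat.of A X, ModuleCat.of A Y, f, g, h, hX, hY⟩
  · rintro W ⟨U, V, f, g, h, hU, hV⟩
    obtain ⟨I, U', i, p, h1, h2, h3⟩ := hU.left
    obtain ⟨K, V', j, q, h4, h5, h6⟩ := hV.left
    obtain ⟨q', hq⟩ := h5.exists_lift h.surj q
    obtain ⟨C, a, b, c, d, hab, hcd⟩ := h.horseshoe_left h1 h4 hq
    have := (h2.prod h5).fin
    exact Module.Finite.of_surjective b hab.surj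
  · rintro W ⟨U, V, f, g, h, hU, hV⟩
    exact hU.van.of_ses_middle h hV.van
  · rintro W ⟨U, V, f, g, h, hU, hV⟩
    obtain ⟨I, U', i, p, h1, h2, h3⟩ := hU.right
    obtain ⟨K, V', j, q, h4, h5, h6⟩ := hV.right
    obtain ⟨i', hi⟩ := h2.exists_extend (hV.van _ _ f g h) i
    obtain ⟨C, a, b, c, d, hab, hcd⟩ := h.horseshoe h1 h4 hi
    exact ⟨ModuleCat.of A (I × K), C, a, b, hab, h2.prod h5, U', V', c, d, hcd, h3, h6⟩
  · rintro W ⟨U, V, f, g, h, hU, hV⟩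
    obtain ⟨I, U', i, p, h1, h2, h3⟩ := hU.left
    obtain ⟨K, V', j, q, h4, h5, h6⟩ := hV.left
    obtain ⟨q', hq⟩ := h5.exists_lift h.surj q
    obtain ⟨C, a, b, c, d, hab, hcd⟩ := h.horseshoe_left h1 h4 hq
    exact ⟨ModuleCat.of A (I × K), C, a, b, hab, h2.prod h5, U', V', c, d, hcd, h3, h6⟩

theorem TR.of_equiv (e : X ≃ₗ[A] Y) (h : TR A X) : TR A Y :=
  TR.ext ((Ses.id_zero (R := A) (X := Y)).equiv_left e) h FinProj.punit.TR

theorem TR.of_prod (hQ : FinProj A Q) (h : TR A (X × Q)) : TR A X := by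
  refine IsTRClass.TR (P := fun W => ∃ Q : ModuleCat.{u} A, FinProj A Q ∧ TR A (W × Q))
    ⟨?_, ?_, ?_, ?_⟩ ⟨ModuleCat.of A Q, hQ, h⟩
  · rintro W ⟨Q, hQ, h⟩
    have := h.fin
    exact Module.Finite.of_surjective (LinearMap.fst A W Q) Prod.fst_surjective
  · rintro W ⟨Q, hQ, h⟩
    exact h.van.of_prod
  · rintro W ⟨J, hJ, h⟩
    obtain ⟨I, V, i, p, h1, h2, h3⟩ := h.right
    obtain ⟨a, b, hab, -⟩ := (Ses.inl_snd (R := A) (X := W) (Y := J)).quot_of_comp h1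
    refine ⟨I, ModuleCat.of A (I ⧸ _), _, _, Ses.quot (f := i ∘ₗ LinearMap.inl A W J)
      (h1.inj.comp LinearMap.inl_injective), h2, ModuleCat.of A PUnit, FinProj.punit, ?_⟩
    exact TR.ext Ses.inl_snd (TR.ext hab hJ.TR h3) FinProj.punit.TR
  · rintro W ⟨J, hJ, h⟩
    obtain ⟨I, V, i, p, h1, h2, h3⟩ := h.left
    obtain ⟨a, b, hab, -⟩ := (Ses.inr_fst (R := A) (X := W) (Y := J)).ker_of_comp h1
    refine ⟨I, ModuleCat.of A (LinearMap.ker (LinearMap.fst A W J ∘ₗ p)), _,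
      LinearMap.fst A W J ∘ₗ p, Ses.ker (Prod.fst_surjective.comp h1.surj), h2,
      ModuleCat.of A PUnit, FinProj.punit, ?_⟩
    exact TR.ext Ses.inl_snd (TR.ext hab h3 hJ.TR) FinProj.punit.TR

/-- Syzygies of totally reflexive modules are totally reflexive. -/
theorem TR.syz (hX : TR A X) (hP : FinProj A P) {f : Y →ₗ[A] P} {g : P →ₗ[A] X} (h : Ses f g) :
    TR A Y := by
  obtain ⟨F, X', i, p, h1, h2, h3⟩ := hX.left
  obtain ⟨p', hp'⟩ := h2.exists_lift h.surj p
  obtain ⟨a, ha, -⟩ := h.switch_left h1 hp'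
  exact TR.of_prod h2 (TR.ext ha h3 hP.TR)

/-- A map to a projective module along which linear forms extend is a cosyzygy embedding. -/
theorem TR.cosyz (hX : TR A X) (hP : FinProj A P) {t : X →ₗ[A] P}
    (ht : ∀ φ : X →ₗ[A] A, ∃ ψ : P →ₗ[A] A, ∀ x, ψ (t x) = φ x) :
    Function.Injective t ∧ TR A (P ⧸ LinearMap.range t) := by
  obtain ⟨F, X', i, p, h1, h2, h3⟩ := hX.right
  obtain ⟨s, hs⟩ := h2.exists_extend ht i
  have hinj : Function.Injective t := fun x y hxy => h1.inj (by rw [← hs, hxy, hs])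
  obtain ⟨a, b, hab, -⟩ := (Ses.quot hinj).switch h1 hs
  exact ⟨hinj, TR.of_prod h2 (TR.ext hab hP.TR h3)⟩

end TotallyReflexiveClasses

section MatlisDual

theorem exists_forms (A G : Type u) [CommRing A] [IsNoetherianRing A] [AddCommGroup G] [Module A G]
    [Module.Finite A G] : ∃ (b : ℕ) (t : G →ₗ[A] Fin b → A), ∀ φ : G →ₗ[A] A,
      ∃ c : Fin b → A, ∀ x, φ x = ∑ i, c i * t x i := by
  have : Module.Finite A (G →ₗ[A] A) := by
    obtain ⟨n, p, hp⟩ := Module.Finite.exists_fin' A G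
    refine Module.Finite.of_injective (LinearMap.lcomp A A p) fun φ ψ h => ?_
    refine LinearMap.ext fun x => ?_
    obtain ⟨x, rfl⟩ := hp x
    exact LinearMap.congr_fun h x
  obtain ⟨b, q, hq⟩ := Module.Finite.exists_fin' A (G →ₗ[A] A)
  refine ⟨b, LinearMap.pi fun i => q (Pi.single i 1), fun φ => ?_⟩
  obtain ⟨c, rfl⟩ := hq φ
  refine ⟨c, fun x => ?_⟩
  conv_lhs => rw [← Finset.univ_sum_single c, map_sum, LinearMap.sum_apply]
  refine Finset.sum_congr rfl fun i _ => ?_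
  rw [LinearMap.pi_apply, ← smul_eq_mul, ← LinearMap.smul_apply, ← map_smul, ← Pi.single_smul,
    smul_eq_mul, mul_one]

theorem IsMatlis.eq_zero_of_forall {A : Type u} [CommRing A] [IsLocalRing A] [IsNoetherianRing A]
    {E : Type u} [AddCommGroup E] [Module A E] {e : E}
    (hE : IsMatlis (IsLocalRing.maximalIdeal A) E e)
    {G : Type u} [AddCommGroup G] [Module A G] [Module.Finite A G] {x : G}
    (hx : ∀ φ : G →ₗ[A] E, φ x = 0) : x = 0 := by
  have key : x ∈ ⨅ n : ℕ, IsLocalRing.maximalIdeal A ^ n • (⊤ : Submodule A G) := by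
    refine (Submodule.mem_iInf _).2 fun n => ?_
    by_contra hn
    have ht : IsTors (IsLocalRing.maximalIdeal A)
        (G ⧸ (IsLocalRing.maximalIdeal A ^ n • (⊤ : Submodule A G))) := by
      intro y
      obtain ⟨y, rfl⟩ := Submodule.mkQ_surjective _ y
      refine ⟨n, fun r hr => ?_⟩
      rw [← map_smul, Submodule.mkQ_apply, Submodule.Quotient.mk_eq_zero]
      exact Submodule.smul_mem_smul hr trivial
    obtain ⟨ψ, hψ⟩ := hE.exists_apply_ne_zero ht
      (x := Submodule.mkQ (IsLocalRing.maximalIdeal A ^ n • (⊤ : Submodule A G)) x)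
      (by rwa [Submodule.mkQ_apply, Ne, Submodule.Quotient.mk_eq_zero])
    exact hψ (hx (ψ ∘ₗ Submodule.mkQ _))
  rw [Ideal.iInf_pow_smul_eq_bot_of_isLocalRing _ (Ideal.IsPrime.ne_top')] at key
  exact key

theorem IsMatlis.eq_zero_of_smul {A : Type u} [CommRing A] [IsLocalRing A] [IsNoetherianRing A]
    {E : Type u} [AddCommGroup E] [Module A E] {e : E}
    (hE : IsMatlis (IsLocalRing.maximalIdeal A) E e) {c : A} (hc : ∀ x : E, c • x = 0) : c = 0 := by
  refine hE.eq_zero_of_forall fun φ => ?_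
  rw [← mul_one c, ← smul_eq_mul, map_smul, hc]

variable {B A : Type u} [CommRing B] [CommRing A] [Algebra B A]
  {E : Type u} [AddCommGroup E] [Module B E] [Module A E] [IsScalarTower B A E]

theorem Ses.dual (hE : Module.Injective A E) {X Y Z : Type u} [AddCommGroup X] [Module A X]
    [AddCommGroup Y] [Module A Y] [AddCommGroup Z] [Module A Z] {f : X →ₗ[A] Y} {g : Y →ₗ[A] Z}
    (h : Ses f g) : Ses (LinearMap.lcomp B E g) (LinearMap.lcomp B E f) := by
  refine Ses.of_zero ?_ ?_ ?_ ?_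
  · intro a b hab
    refine LinearMap.ext fun z => ?_
    obtain ⟨y, rfl⟩ := h.surj z
    exact LinearMap.congr_fun hab y
  · intro φ
    obtain ⟨ψ, hψ⟩ := hE.extend h.inj φ
    exact ⟨ψ, hψ⟩
  · intro φ
    refine LinearMap.ext fun x => ?_
    simp [h.zero]
  · intro φ hφ
    obtain ⟨ψ, hψ⟩ := h.desc φ fun x => LinearMap.congr_fun hφ x
    exact ⟨ψ, LinearMap.ext hψ⟩

variable {𝔪 : Ideal B}

theorem TInj.dual_fin_fun [IsNoetherianRing B] [𝔪.IsMaximal] (hE : TInj 𝔪 E) (b : ℕ) :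
    TInj 𝔪 ((Fin b → A) →ₗ[A] E) := by
  refine (hE.pi b).of_equiv ((LinearMap.lsum A (fun _ : Fin b => A) B).symm ≪≫ₗ
    LinearEquiv.piCongrRight fun _ => LinearMap.ringLmapEquivSelf A B E).symm

variable [IsLocalRing A] [IsNoetherianRing A] [IsNoetherianRing B]
  [IsAdicComplete (IsLocalRing.maximalIdeal A) A]
  {E₁ : Type u} [AddCommGroup E₁] [Module B E₁] {e₁ : E₁} {e : E} {j : E₁ →ₗ[B] E}

/-- The modules whose Matlis dual is Gorenstein injective over `B`. -/
def DualGI (A : Type u) [CommRing A] [Algebra B A] (𝔪 : Ideal B) (E : Type u) [AddCommGroup E] [Module B E] [Module A E]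
    [IsScalarTower B A E] (G : Type u) [AddCommGroup G] [Module A G] : Prop :=
  Module.Finite A G ∧ GI 𝔪 (G →ₗ[A] E)

theorem isTRClass_dualGI (h₁ : IsMatlis 𝔪 E₁ e₁) [𝔪.IsMaximal]
    (hE : IsMatlis (IsLocalRing.maximalIdeal A) E e)
    (hT : TInj 𝔪 E) (hj : IsBaseChange A j) :
    IsTRClass (A := A) fun G => DualGI A 𝔪 E G := by
  refine ⟨fun G h => h.1, ?_, ?_, ?_⟩
  · rintro G ⟨_, hG⟩
    obtain ⟨b, g, hg⟩ := Module.Finite.exists_fin' A G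
    refine CoVan.of_ses (FinProj.fin_fun b) (Ses.ker hg) fun φ => ?_
    have hses := (Ses.ker hg).dual (B := B) hE.tinj.inj
    let t : E →ₗ[B] (LinearMap.ker g →ₗ[A] E) :=
      { toFun := fun x => (LinearMap.toSpanSingleton A E x) ∘ₗ φ
        map_add' := fun x y => by ext; simp
        map_smul' := fun r x => by ext; simp [smul_comm r] }
    obtain ⟨s, hs⟩ := hG.van _ _ _ _ hses E₁ h₁.tinj (t ∘ₗ j)
    let s' : E →ₗ[A] ((Fin b → A) →ₗ[A] E) := hj.lift s
    have hs' : ∀ x z, s' x (z : LinearMap.ker g).1 = φ z • x := by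
      intro x z
      have : (LinearMap.applyₗ (z : LinearMap.ker g).1 : ((Fin b → A) →ₗ[A] E) →ₗ[A] E) ∘ₗ s' =
          LinearMap.lsmul A E (φ z) := by
        refine hj.algHom_ext _ _ fun x => ?_
        simp only [LinearMap.comp_apply, s', hj.lift_eq]
        exact LinearMap.congr_fun (hs x) z
      exact LinearMap.congr_fun this x
    choose a ha using fun k => hE.exists_eq_smul ((LinearMap.applyₗ (Pi.single k (1 : A)) :
      ((Fin b → A) →ₗ[A] E) →ₗ[A] E) ∘ₗ s')
    refine ⟨Fintype.linearCombination A a, fun z => sub_eq_zero.1 (hE.eq_zero_of_smul fun x => ?_)⟩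
    rw [sub_smul, ← hs', sub_eq_zero]
    conv_rhs => rw [← Finset.univ_sum_single (z : Fin b → A), map_sum]
    rw [Fintype.linearCombination_apply, Finset.sum_smul]
    refine Finset.sum_congr rfl fun k _ => ?_
    rw [smul_assoc, ← ha, LinearMap.comp_apply, LinearMap.applyₗ_apply_apply, ← map_smul,
      ← Pi.single_smul, smul_eq_mul, mul_one, Submodule.subtype_apply]
  · rintro G ⟨_, hG⟩
    obtain ⟨b, t, ht⟩ := exists_forms A G
    have hl₁ : ∀ s : E₁ →ₗ[B] (G →ₗ[A] E), ∃ s' : E₁ →ₗ[B] ((Fin b → A) →ₗ[A] E),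
        ∀ x, LinearMap.lcomp B E t (s' x) = s x := by
      intro s
      let s' : E →ₗ[A] (G →ₗ[A] E) := hj.lift s
      choose a ha using fun x : G => hE.exists_eq_smul ((LinearMap.applyₗ x :
        (G →ₗ[A] E) →ₗ[A] E) ∘ₗ s')
      replace ha : ∀ x y, s' y x = a x • y := ha
      let α : G →ₗ[A] A :=
        { toFun := a
          map_add' := fun x y => sub_eq_zero.1 <| hE.eq_zero_of_smul fun z => by
            rw [sub_smul, add_smul, ← ha, ← ha, ← ha, map_add, sub_self]
          map_smul' := fun c x => sub_eq_zero.1 <| hE.eq_zero_of_smul fun z => by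
            rw [sub_smul, smul_assoc, ← ha, RingHom.id_apply, ← ha, map_smul, sub_self] }
      obtain ⟨c, hc⟩ := ht α
      refine ⟨{ toFun := fun y => (LinearMap.toSpanSingleton A E (j y)) ∘ₗ
                  Fintype.linearCombination A c
                map_add' := fun x y => by ext; simp
                map_smul' := fun r x => by ext; simp [smul_comm r] }, fun y => ?_⟩
      ext x
      have h1 : s y x = α x • j y := by
        rw [← hj.lift_eq s y]
        exact ha x (j y)
      rw [h1, hc]
      simp [Fintype.linearCombination_apply, mul_comm, Finset.sum_smul]
    have hl : ∀ (J : Type u) [AddCommGroup J] [Module B J], TInj 𝔪 J →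
        ∀ s : J →ₗ[B] (G →ₗ[A] E), ∃ s' : J →ₗ[B] ((Fin b → A) →ₗ[A] E),
        ∀ x, LinearMap.lcomp B E t (s' x) = s x := by
      intro J _ _ hJ s
      obtain ⟨ι, k, hk, -⟩ := h₁.exists_embedding hJ.tors
      obtain ⟨r, hr⟩ := hJ.inj.extend hk LinearMap.id
      choose s' hs' using fun i => hl₁ (s ∘ₗ r ∘ₗ Finsupp.lsingle i)
      have : LinearMap.lcomp B E t ∘ₗ Finsupp.lsum B s' = s ∘ₗ r := by
        refine Finsupp.lhom_ext fun i x => ?_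
        simpa using hs' i x
      refine ⟨Finsupp.lsum B s' ∘ₗ k, fun x => ?_⟩
      have h1 := LinearMap.congr_fun this (k x)
      have h2 := LinearMap.congr_fun hr x
      simp only [LinearMap.comp_apply, LinearMap.id_apply] at h1 h2 ⊢
      rw [h1, h2]
    obtain ⟨I, X', i, p, h1, h2, h3⟩ := hG.left
    obtain ⟨p', hp'⟩ := hl I h2 p
    have hinj : Function.Injective t := by
      refine (injective_iff_map_eq_zero t).2 fun x hx => hE.eq_zero_of_forall fun φ => ?_
      obtain ⟨y, rfl⟩ := h1.surj φ
      rw [← hp']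
      simp [hx]
    have hses := (Ses.quot hinj).dual (B := B) hE.tinj.inj
    obtain ⟨a, hab, -⟩ := hses.switch_left h1 hp'
    refine ⟨ModuleCat.of A (Fin b → A), ModuleCat.of A ((Fin b → A) ⧸ LinearMap.range t), _, _,
      Ses.quot hinj, FinProj.fin_fun b, ?_, ?_⟩
    · exact inferInstanceAs (Module.Finite A ((Fin b → A) ⧸ LinearMap.range t))
    · exact GI.of_prod h2 (GI.ext hab h3 (hT.dual_fin_fun b).GI)
  · rintro G ⟨_, hG⟩
    obtain ⟨b, g, hg⟩ := Module.Finite.exists_fin' A G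
    refine ⟨ModuleCat.of A (Fin b → A), ModuleCat.of A (LinearMap.ker g), _, _, Ses.ker hg,
      FinProj.fin_fun b, ?_, ?_⟩
    · exact inferInstanceAs (Module.Finite A (LinearMap.ker g))
    · exact gd.of_ses_right (n := 0) ((Ses.ker hg).dual (B := B) hE.tinj.inj)
        (gd.succ (n := 0) hG) (hT.dual_fin_fun b).GI

/-- Having a resolution of length `n` by finite projectives ending in the class `P`. -/
def ResLE {A : Type u} [CommRing A] (P : ModuleCat.{u} A → Prop) :
    (n : ℕ) → (X : Type u) → [AddCommGroup X] → [Module A X] → Prop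
  | 0, X, _, _ => P (ModuleCat.of A X)
  | n + 1, X, _, _ => ∃ (F X' : ModuleCat.{u} A) (f : X' →ₗ[A] F) (g : F →ₗ[A] X),
    Ses f g ∧ FinProj A F ∧ ResLE P n X'

theorem resLE_of_gd (h₁ : IsMatlis 𝔪 E₁ e₁) [𝔪.IsMaximal]
    (hE : IsMatlis (IsLocalRing.maximalIdeal A) E e)
    (hT : TInj 𝔪 E) (hj : IsBaseChange A j) {n : ℕ} {N : Type u} [AddCommGroup N] [Module A N]
    [Module.Finite A N] (hN : gd 𝔪 n (N →ₗ[A] E)) : ResLE (A := A) (fun X => TR A X) n N := by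
  induction n generalizing N with
  | zero => exact (isTRClass_dualGI h₁ hE hT hj).TR ⟨inferInstance, hN⟩
  | succ n ih =>
    obtain ⟨b, g, hg⟩ := Module.Finite.exists_fin' A N
    exact ⟨ModuleCat.of A (Fin b → A), ModuleCat.of A (LinearMap.ker g), _, _, Ses.ker hg,
      FinProj.fin_fun b, ih (gd.of_ses_right ((Ses.ker hg).dual (B := B) hE.tinj.inj) hN
        (hT.dual_fin_fun b).gd)⟩

end MatlisDual

section

open TensorProduct

section BaseChange

/-- A finite module over a local ring which is flat over a base generating the maximal ideal is
free. -/
theorem Module.free_of_flat_of_map_eq {B A L : Type u} [CommRing B] [CommRing A] [Algebra B A]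
    [IsLocalRing A] [IsNoetherianRing A] {𝔪 : Ideal B}
    (h𝔪 : 𝔪.map (algebraMap B A) = IsLocalRing.maximalIdeal A) [AddCommGroup L] [Module A L]
    [Module B L] [IsScalarTower B A L] [Module.Finite A L] [Module.Flat B L] :
    Module.Free A L := by
  have : Module.FinitePresentation A L := Module.finitePresentation_of_finite A L
  apply Module.free_of_maximalIdeal_rTensor_injective
  let ι : 𝔪 →ₗ[B] IsLocalRing.maximalIdeal A :=
    { toFun := fun x => ⟨algebraMap B A x, h𝔪 ▸ Ideal.mem_map_of_mem _ x.2⟩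
      map_add' := fun x y => by ext; simp
      map_smul' := fun r x => by ext; simp [Algebra.smul_def] }
  let θ : 𝔪 ⊗[B] L →ₗ[B] IsLocalRing.maximalIdeal A ⊗[A] L :=
    TensorProduct.lift (((TensorProduct.mk A (IsLocalRing.maximalIdeal A) L).restrictScalars₁₂ B B)
      ∘ₗ ι)
  have hθ : ∀ x l, θ (x ⊗ₜ l) = ι x ⊗ₜ l := fun x l => rfl
  have hsurj : Function.Surjective θ := by
    have key : ∀ a ∈ 𝔪.map (algebraMap B A), ∀ (ha : a ∈ IsLocalRing.maximalIdeal A) (l : L),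
        (⟨a, ha⟩ : IsLocalRing.maximalIdeal A) ⊗ₜ[A] l ∈ LinearMap.range θ := by
      intro a ha
      refine Submodule.span_induction (p := fun a _ => ∀ (ha : a ∈ IsLocalRing.maximalIdeal A)
        (l : L), (⟨a, ha⟩ : IsLocalRing.maximalIdeal A) ⊗ₜ[A] l ∈ LinearMap.range θ) ?_ ?_ ?_ ?_ ha
      · rintro _ ⟨x, hx, rfl⟩ ha l
        exact ⟨⟨x, hx⟩ ⊗ₜ l, rfl⟩
      · intro ha l
        convert zero_mem (LinearMap.range θ)
        exact TensorProduct.zero_tmul _ _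
      · intro x y hx hy h1 h2 ha l
        convert add_mem (h1 (h𝔪 ▸ hx) l) (h2 (h𝔪 ▸ hy) l)
        rw [← TensorProduct.add_tmul]
        rfl
      · intro c x hx h1 ha l
        have h2 : (⟨c • x, ha⟩ : IsLocalRing.maximalIdeal A) ⊗ₜ[A] l =
            (⟨x, h𝔪 ▸ hx⟩ : IsLocalRing.maximalIdeal A) ⊗ₜ[A] (c • l) := by
          rw [← TensorProduct.smul_tmul]
          rfl
        rw [h2]
        exact h1 _ _
    rw [← LinearMap.range_eq_top, eq_top_iff]
    rintro z -
    induction z with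
    | zero => exact zero_mem _
    | add x y hx hy => exact add_mem hx hy
    | tmul a l => exact key a (h𝔪.symm ▸ a.2) a.2 l
  have hinj : Function.Injective (𝔪.subtype.rTensor L) :=
    Module.Flat.rTensor_preserves_injective_linearMap _ 𝔪.injective_subtype
  have hcomp : ∀ z, TensorProduct.lid A L ((Submodule.subtype _).rTensor L (θ z)) =
      TensorProduct.lid B L (𝔪.subtype.rTensor L z) := by
    intro z
    induction z with
    | zero => simp
    | add x y hx hy => simp only [map_add, hx, hy]
    | tmul a l =>
      rw [hθ]
      simp [ι]
  refine (injective_iff_map_eq_zero _).2 fun w hw => ?_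
  obtain ⟨z, rfl⟩ := hsurj w
  have h1 := hcomp z
  rw [hw, map_zero] at h1
  have h2 : 𝔪.subtype.rTensor L z = 𝔪.subtype.rTensor L 0 :=
    (TensorProduct.lid B L).injective (by rw [← h1, map_zero, map_zero])
  rw [hinj h2, map_zero]

theorem TorLE.resLE {B A : Type u} [CommRing B] [CommRing A] [Algebra B A] [Module.Flat B A]
    [IsLocalRing A] [IsNoetherianRing A] {𝔪 : Ideal B}
    (h𝔪 : 𝔪.map (algebraMap B A) = IsLocalRing.maximalIdeal A) {d : ℕ} {L : Type u}
    [AddCommGroup L] [Module A L] [Module B L] [IsScalarTower B A L] [Module.Finite A L]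
    (h : TorLE B d L) : ResLE (A := A) (fun X => FinProj A X) d L := by
  induction d generalizing L with
  | zero =>
    have := h.flat
    have := Module.free_of_flat_of_map_eq (L := L) h𝔪
    exact FinProj.of_free
  | succ d ih =>
    obtain ⟨b, g, hg⟩ := Module.Finite.exists_fin' A L
    refine ⟨ModuleCat.of A (Fin b → A), ModuleCat.of A (LinearMap.ker g), _, _, Ses.ker hg,
      FinProj.fin_fun b, ih (L := LinearMap.ker g) ?_⟩
    have hs : Ses ((LinearMap.ker g).subtype.restrictScalars B) (g.restrictScalars B) :=
      ⟨(Ses.ker hg).inj, (Ses.ker hg).exact, hg⟩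
    have : Module.Flat B (Fin b → A) := Module.Flat.trans B A _
    exact TorLE.left hs h

variable {A : Type u} [CommRing A]

theorem ResLE.torLE {d : ℕ} {L : Type u} [AddCommGroup L] [Module A L]
    (h : ResLE (A := A) (fun X => FinProj A X) d L) : TorLE A d L := by
  induction d generalizing L with
  | zero =>
    have : Module.Projective A L := FinProj.proj h
    exact TorLE.of_flat inferInstance
  | succ d ih =>
    obtain ⟨F, X', f, g, h1, h2, h3⟩ := h
    have := h2.proj
    exact TorLE.of_ses h1 (ih h3) (TorLE.of_flat inferInstance)

theorem TR.flatSyz {G : Type u} [AddCommGroup G] [Module A G] (h : TR A G) (d : ℕ) :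
    FlatSyz A d G := by
  induction d generalizing G with
  | zero => trivial
  | succ d ih =>
    obtain ⟨F, X', f, g, h1, h2, h3⟩ := h.right
    have := h2.proj
    exact ⟨F, X', f, g, h1, inferInstance, ih h3⟩

/-- Maps to modules of finite projective dimension extend along injections with totally reflexive
cokernel. -/
theorem TR.exists_extend {d : ℕ} {W : Type u} [AddCommGroup W] [Module A W]
    (hW : ResLE (A := A) (fun X => FinProj A X) d W) {G P X : Type u} [AddCommGroup G] [Module A G]
    [AddCommGroup P] [Module A P] [AddCommGroup X] [Module A X] (hX : TR A X) (hG : TR A G)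
    {f : G →ₗ[A] P} {g : P →ₗ[A] X} (h : Ses f g) (φ : G →ₗ[A] W) :
    ∃ ψ : P →ₗ[A] W, ∀ x, ψ (f x) = φ x := by
  induction d generalizing W G P X with
  | zero => exact FinProj.exists_extend hW (hX.van _ _ f g h) φ
  | succ d ih =>
    obtain ⟨F, K, i, p, h1, h2, h3⟩ := hW
    obtain ⟨P₁, G₁, j, q, h4, h5, h6⟩ := hG.left
    obtain ⟨t, ht⟩ := h5.exists_lift h1.surj (φ ∘ₗ q)
    obtain ⟨s, hs⟩ := h1.lift (t ∘ₗ j) fun x => by simp [ht, h4.zero]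
    obtain ⟨r, hr⟩ := ih h3 hG h6 h4 s
    obtain ⟨w, hw⟩ := h4.desc (t - i ∘ₗ r) fun x => by simp [hr, hs]
    obtain ⟨v, hv⟩ := h2.exists_extend (hX.van _ _ f g h) w
    refine ⟨p ∘ₗ v, fun x => ?_⟩
    obtain ⟨x, rfl⟩ := h4.surj x
    simp [hv, hw, ht, h1.zero]

variable {T : Type u} [CommRing T] [Algebra A T]

theorem TorLE.ses_baseChange {d : ℕ} (hT : TorLE A d T) {G P X : Type u} [AddCommGroup G]
    [Module A G] [AddCommGroup P] [Module A P] [AddCommGroup X] [Module A X] [Module.Flat A P]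
    (hX : TR A X) {f : G →ₗ[A] P} {g : P →ₗ[A] X} (h : Ses f g) :
    Ses (f.baseChange T) (g.baseChange T) := by
  refine ⟨?_, lTensor_exact T h.exact h.surj, LinearMap.lTensor_surjective T h.surj⟩
  exact (LinearMap.lTensor_inj_iff_rTensor_inj _ _).2
    (hT _ _ _ f g h inferInstance (hX.flatSyz d))

theorem FinProj.baseChange {P : Type u} [AddCommGroup P] [Module A P] (hP : FinProj A P) :
    FinProj T (T ⊗[A] P) :=
  have := hP.fin; have := hP.proj
  ⟨inferInstance, inferInstance⟩

/-- Base change of totally reflexive modules along algebras of finite projective dimension. -/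
theorem TR.baseChange {d : ℕ} (hT : ResLE (A := A) (fun X => FinProj A X) d T)
    {G : Type u} [AddCommGroup G] [Module A G] (hG : TR A G) : TR T (T ⊗[A] G) := by
  refine IsTRClass.TR (P := fun X => ∃ G : ModuleCat.{u} A, TR A G ∧ Nonempty (T ⊗[A] G ≃ₗ[T] X))
    ⟨?_, ?_, ?_, ?_⟩ ⟨ModuleCat.of A G, hG, ⟨LinearEquiv.refl _ _⟩⟩
  · rintro X ⟨G, hG, ⟨e⟩⟩
    have := hG.fin
    exact Module.Finite.equiv e
  · rintro X ⟨G, hG, ⟨e⟩⟩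
    obtain ⟨P, G', f, g, h1, h2, h3⟩ := hG.left
    have := h2.proj
    refine CoVan.of_ses h2.baseChange ((hT.torLE.ses_baseChange hG h1).equiv_right e) fun φ => ?_
    obtain ⟨ψ, hψ⟩ := hG.exists_extend hT h3 h1 (φ.restrictScalars A ∘ₗ TensorProduct.mk A T G' 1)
    refine ⟨TensorProduct.AlgebraTensorModule.lift (LinearMap.toSpanSingleton T (P →ₗ[A] T) ψ),
      fun z => ?_⟩
    induction z with
    | zero => simp only [map_zero]
    | add x y hx hy => simp only [map_add, hx, hy]
    | tmul t x =>
      have h4 : φ (t ⊗ₜ x) = t • φ (1 ⊗ₜ x) := by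
        rw [← map_smul, TensorProduct.smul_tmul', smul_eq_mul, mul_one]
      rw [h4]
      simpa using congrArg (t • ·) (hψ x)
  · rintro X ⟨G, hG, ⟨e⟩⟩
    obtain ⟨P, G', f, g, h1, h2, h3⟩ := hG.right
    have := h2.proj
    exact ⟨ModuleCat.of T (T ⊗[A] P), ModuleCat.of T (T ⊗[A] G'), _, _,
      (hT.torLE.ses_baseChange h3 h1).equiv_left e.symm, h2.baseChange, G', h3,
      ⟨LinearEquiv.refl _ _⟩⟩
  · rintro X ⟨G, hG, ⟨e⟩⟩
    obtain ⟨P, G', f, g, h1, h2, h3⟩ := hG.left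
    have := h2.proj
    exact ⟨ModuleCat.of T (T ⊗[A] P), ModuleCat.of T (T ⊗[A] G'), _, _,
      (hT.torLE.ses_baseChange hG h1).equiv_right e, h2.baseChange, G', h3,
      ⟨LinearEquiv.refl _ _⟩⟩

theorem subsingleton_of_tensor [IsLocalRing A] [Nontrivial T]
    (hs : Function.Surjective (algebraMap A T)) {K : Type u} [AddCommGroup K] [Module A K]
    [Module.Finite A K] (h : Subsingleton (T ⊗[A] K)) : Subsingleton K := by
  let e : (A ⧸ RingHom.ker (Algebra.ofId A T)) ≃ₗ[A] T :=
    (Ideal.quotientKerAlgEquivOfSurjective (f := Algebra.ofId A T) hs).toLinearEquiv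
  have h1 : Subsingleton (K ⧸ (RingHom.ker (Algebra.ofId A T) • ⊤ : Submodule A K)) :=
    ((TensorProduct.quotTensorEquivQuotSMul K _).symm ≪≫ₗ e.rTensor K).injective.subsingleton
  rw [Submodule.Quotient.subsingleton_iff] at h1
  have h2 : (⊤ : Submodule A K) = ⊥ := by
    refine Submodule.eq_bot_of_le_smul_of_le_jacobson_bot _ _ Module.Finite.fg_top h1.ge ?_
    refine le_trans (IsLocalRing.le_maximalIdeal (RingHom.ker_ne_top _)) ?_
    exact IsLocalRing.maximalIdeal_le_jacobson _
  exact (Submodule.subsingleton_iff A).1 (subsingleton_of_bot_eq_top h2.symm)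

theorem TR.free_of_baseChange [IsLocalRing A] [IsNoetherianRing A] [Nontrivial T]
    (hs : Function.Surjective (algebraMap A T)) {d : ℕ} (hT : TorLE A d T)
    {G : Type u} [AddCommGroup G] [Module A G] (hG : TR A G)
    (hfree : Module.Free T (T ⊗[A] G)) : Module.Free A G := by
  have := hG.fin
  let v := Module.Free.chooseBasis T (T ⊗[A] G)
  set ι := Module.Free.ChooseBasisIndex T (T ⊗[A] G)
  have hmk : Function.Surjective (TensorProduct.mk A T G 1) :=
    mk_surjective A G T hs
  choose w hw using fun i => hmk (v i)
  let t : (ι → A) →ₗ[A] G := Fintype.linearCombination A w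
  have ht : Function.Bijective (t.baseChange T) := by
    have h1 : t.baseChange T =
        (TensorProduct.piScalarRight A T T ι ≪≫ₗ v.equivFun.symm).toLinearMap := by
      refine TensorProduct.AlgebraTensorModule.ext fun a x => ?_
      rw [LinearMap.baseChange_tmul, LinearEquiv.coe_coe, LinearEquiv.trans_apply,
        Module.Basis.equivFun_symm_apply, Fintype.linearCombination_apply, TensorProduct.tmul_sum]
      refine Finset.sum_congr rfl fun i _ => ?_
      rw [← hw, TensorProduct.piScalarRight_apply, TensorProduct.piScalarRightHom_tmul]
      simp [TensorProduct.smul_tmul']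
    rw [h1]
    exact LinearEquiv.bijective _
  have hsurj : Function.Surjective t := by
    have h1 : Subsingleton (T ⊗[A] (G ⧸ LinearMap.range t)) := by
      refine subsingleton_of_forall_eq 0 fun z => ?_
      obtain ⟨z, rfl⟩ := LinearMap.lTensor_surjective T (Submodule.mkQ_surjective _) z
      exact (lTensor_exact T (LinearMap.exact_map_mkQ_range t) (Submodule.mkQ_surjective _) _).2
        (ht.2 z)
    have h2 := subsingleton_of_tensor hs h1
    rwa [Submodule.Quotient.subsingleton_iff, LinearMap.range_eq_top] at h2
  have hker : Subsingleton (LinearMap.ker t) := by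
    refine subsingleton_of_tensor hs (subsingleton_of_forall_eq 0 fun z => ?_)
    have h1 := hT.ses_baseChange hG (Ses.ker hsurj)
    exact h1.inj ((ht.1 ((h1.zero z).trans (map_zero _).symm)).trans (map_zero _).symm)
  exact Module.Free.of_equiv (LinearEquiv.ofBijective t
    ⟨LinearMap.ker_eq_bot.1 ((Submodule.subsingleton_iff_eq_bot).1 hker), hsurj⟩)

end BaseChange

end

section

open TensorProduct

section FlatDescent

variable {S T : Type u} [CommRing S] [CommRing T] [Algebra S T]

theorem Ses.baseChange [Module.Flat S T] {X Y Z : Type u} [AddCommGroup X] [Module S X]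
    [AddCommGroup Y] [Module S Y] [AddCommGroup Z] [Module S Z] {f : X →ₗ[S] Y} {g : Y →ₗ[S] Z}
    (h : Ses f g) : Ses (f.baseChange T) (g.baseChange T) :=
  ⟨Module.Flat.lTensor_preserves_injective_linearMap (M := T) f h.inj,
    lTensor_exact T h.exact h.surj, LinearMap.lTensor_surjective T h.surj⟩

/-- Solvability of linear systems descends along faithfully flat maps. -/
theorem mem_range_of_baseChange [Module.FaithfullyFlat S T] {P Q : Type u} [AddCommGroup P]
    [Module S P] [AddCommGroup Q] [Module S Q] {L : P →ₗ[S] Q} {v : Q}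
    (h : (1 : T) ⊗ₜ v ∈ LinearMap.range (L.baseChange T)) : v ∈ LinearMap.range L := by
  obtain ⟨w, hw⟩ := h
  have h1 : (LinearMap.range L).mkQ.lTensor T ((1 : T) ⊗ₜ v) = 0 := by
    rw [← hw]
    exact (lTensor_exact T (LinearMap.exact_map_mkQ_range L) (Submodule.mkQ_surjective _)).apply_apply_eq_zero w
  rw [LinearMap.lTensor_tmul] at h1
  have h2 := Module.FaithfullyFlat.tensorProduct_mk_injective (A := S) (B := T)
    (Q ⧸ LinearMap.range L) (a₁ := (LinearMap.range L).mkQ v) (a₂ := 0) (by simpa using h1)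
  simpa using h2

variable [IsNoetherianRing S]

theorem exists_extend_of_baseChange [Module.FaithfullyFlat S T] {K : Type u} [AddCommGroup K]
    [Module S K] [Module.Finite S K] {b : ℕ} {f : K →ₗ[S] Fin b → S}
    (hf : ∀ φ : T ⊗[S] K →ₗ[T] T, ∃ ψ : T ⊗[S] (Fin b → S) →ₗ[T] T, ∀ x,
      ψ (f.baseChange T x) = φ x) (φ : K →ₗ[S] S) :
    ∃ ψ : (Fin b → S) →ₗ[S] S, ∀ x, ψ (f x) = φ x := by
  have := Module.finitePresentation_of_finite S K
  obtain ⟨ψ, hψ⟩ := hf ((AlgebraTensorModule.rid S T T).toLinearMap ∘ₗ φ.baseChange T)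
  have h1 : φ ∈ LinearMap.range (LinearMap.lcomp S S f) := by
    refine mem_range_of_baseChange (T := T) ?_
    have hK := Module.FinitePresentation.isBaseChange_map S K S T
    have hF := Module.FinitePresentation.isBaseChange_map S (Fin b → S) S T
    refine ⟨hF.equiv.symm ((AlgebraTensorModule.rid S T T).symm.toLinearMap ∘ₗ ψ), ?_⟩
    apply hK.equiv.injective
    have h2 : ∀ z, hK.equiv ((LinearMap.lcomp S S f).baseChange T z) =
        hF.equiv z ∘ₗ f.baseChange T := by
      intro z
      induction z with
      | zero => simp
      | add x y hx hy => simp only [map_add, hx, hy, LinearMap.add_comp]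
      | tmul t x =>
        rw [LinearMap.baseChange_tmul, hK.equiv_tmul, hF.equiv_tmul, LinearMap.smul_comp]
        congr 1
        exact LinearMap.baseChange_comp f x
    rw [h2, LinearEquiv.apply_symm_apply, hK.equiv_tmul, one_smul]
    refine LinearMap.ext fun x => ?_
    have h3 := hψ x
    simp only [LinearMap.comp_apply, LinearEquiv.coe_coe] at h3 ⊢
    rw [h3, LinearEquiv.symm_apply_apply]
    rfl
  obtain ⟨ψ, hψ⟩ := h1
  exact ⟨ψ, LinearMap.congr_fun hψ⟩

theorem exists_extend_baseChange [Module.Flat S T] {G : Type u} [AddCommGroup G]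
    [Module S G] [Module.Finite S G] {P : Type u} [AddCommGroup P] [Module S P] {t : G →ₗ[S] P}
    (ht : ∀ φ : G →ₗ[S] S, ∃ ψ : P →ₗ[S] S, ∀ x, ψ (t x) = φ x) (φ : T ⊗[S] G →ₗ[T] T) :
    ∃ ψ : T ⊗[S] P →ₗ[T] T, ∀ x, ψ (t.baseChange T x) = φ x := by
  have := Module.finitePresentation_of_finite S G
  have hG := Module.FinitePresentation.isBaseChange_map S G S T
  have key : ∀ φ : T ⊗[S] G →ₗ[T] T ⊗[S] S, ∃ ψ : T ⊗[S] P →ₗ[T] T ⊗[S] S,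
      ∀ x, ψ (t.baseChange T x) = φ x := by
    intro φ
    induction φ using hG.inductionOn with
    | zero => exact ⟨0, fun _ => rfl⟩
    | tmul φ =>
      obtain ⟨ψ, hψ⟩ := ht φ
      refine ⟨ψ.baseChange T, fun x => ?_⟩
      rw [← LinearMap.comp_apply, ← LinearMap.baseChange_comp,
        show ψ ∘ₗ t = φ from LinearMap.ext hψ]
      rfl
    | smul c φ ih =>
      obtain ⟨ψ, hψ⟩ := ih
      exact ⟨c • ψ, fun x => by simp [hψ]⟩
    | add φ₁ φ₂ h₁ h₂ =>
      obtain ⟨ψ₁, h₁⟩ := h₁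
      obtain ⟨ψ₂, h₂⟩ := h₂
      exact ⟨ψ₁ + ψ₂, fun x => by simp [h₁, h₂]⟩
  obtain ⟨ψ, hψ⟩ := key ((AlgebraTensorModule.rid S T T).symm.toLinearMap ∘ₗ φ)
  refine ⟨(AlgebraTensorModule.rid S T T).toLinearMap ∘ₗ ψ, fun x => ?_⟩
  rw [LinearMap.comp_apply, hψ]
  exact LinearEquiv.apply_symm_apply _ _

/-- Total reflexivity descends along faithfully flat maps. -/
theorem TR.of_baseChange [Module.FaithfullyFlat S T] {G : Type u} [AddCommGroup G] [Module S G]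
    [Module.Finite S G] (h : TR T (T ⊗[S] G)) : TR S G := by
  refine IsTRClass.TR (P := fun G => Module.Finite S G ∧ TR T (T ⊗[S] G)) ⟨fun G h => h.1, ?_, ?_, ?_⟩
    ⟨inferInstanceAs (Module.Finite S G), h⟩
  · rintro G ⟨_, h⟩
    obtain ⟨b, g, hg⟩ := Module.Finite.exists_fin' S G
    refine CoVan.of_ses (FinProj.fin_fun b) (Ses.ker hg) fun φ => ?_
    exact exists_extend_of_baseChange (T := T) (h.van _ _ _ _ (Ses.ker hg).baseChange) φ
  · rintro G ⟨_, h⟩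
    obtain ⟨b, t, ht⟩ := exists_forms S G
    have ht' : ∀ φ : G →ₗ[S] S, ∃ ψ : (Fin b → S) →ₗ[S] S, ∀ x, ψ (t x) = φ x := by
      intro φ
      obtain ⟨c, hc⟩ := ht φ
      exact ⟨Fintype.linearCombination S c, fun x => by
        simp [hc, Fintype.linearCombination_apply, mul_comm]⟩
    obtain ⟨h1, h2⟩ := h.cosyz (FinProj.fin_fun b).baseChange (exists_extend_baseChange ht')
    have hinj : Function.Injective t := fun x y hxy =>
      Module.FaithfullyFlat.tensorProduct_mk_injective (A := S) (B := T) G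
        (h1 (by simp [hxy]))
    refine ⟨ModuleCat.of S (Fin b → S), ModuleCat.of S ((Fin b → S) ⧸ LinearMap.range t), _, _,
      Ses.quot hinj, FinProj.fin_fun b, ?_, ?_⟩
    · exact inferInstanceAs (Module.Finite S ((Fin b → S) ⧸ LinearMap.range t))
    · have h3 := (Ses.quot hinj).baseChange (T := T)
      exact h2.of_equiv ((Submodule.quotEquivOfEq _ _ h3.exact.linearMap_ker_eq.symm) ≪≫ₗ
        (LinearMap.quotKerEquivOfSurjective _ h3.surj))
  · rintro G ⟨_, h⟩
    obtain ⟨b, g, hg⟩ := Module.Finite.exists_fin' S G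
    refine ⟨ModuleCat.of S (Fin b → S), ModuleCat.of S (LinearMap.ker g), _, _, Ses.ker hg,
      FinProj.fin_fun b, ?_, ?_⟩
    · exact inferInstanceAs (Module.Finite S (LinearMap.ker g))
    · exact h.syz (FinProj.fin_fun b).baseChange (Ses.ker hg).baseChange

end FlatDescent

end

section MinimalCover

variable {A : Type u} [CommRing A]

/-- A finite module over a local ring is covered by a free module whose kernel consists of vectors
with entries in the maximal ideal. -/
theorem exists_minimal_cover [IsLocalRing A] (X : Type v) [AddCommGroup X] [Module A X] [Module.Finite A X] :
    ∃ (b : ℕ) (π : (Fin b → A) →ₗ[A] X), Function.Surjective π ∧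
      ∀ v, π v = 0 → ∀ i, v i ∈ IsLocalRing.maximalIdeal A := by
  let b := Module.finBasis (IsLocalRing.ResidueField A)
    (TensorProduct A (IsLocalRing.ResidueField A) X)
  have hs : ∀ i, ∃ x : X, (1 : IsLocalRing.ResidueField A) ⊗ₜ[A] x = b i := fun i =>
    TensorProduct.mk_surjective A X (IsLocalRing.ResidueField A)
      IsLocalRing.residue_surjective (b i)
  choose x hx using hs
  refine ⟨_, Fintype.linearCombination A x, ?_, fun v hv i => ?_⟩
  · rw [← LinearMap.range_eq_top, Fintype.range_linearCombination]
    exact IsLocalRing.span_eq_top_of_tmul_eq_basis x b hx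
  · have h1 : ∑ i, IsLocalRing.residue A (v i) • b i = 0 := by
      have h2 := congrArg (fun z => (1 : IsLocalRing.ResidueField A) ⊗ₜ[A] z) hv
      simp only [Fintype.linearCombination_apply, TensorProduct.tmul_sum, TensorProduct.tmul_zero,
        TensorProduct.tmul_smul, hx] at h2
      simpa [← IsLocalRing.ResidueField.algebraMap_eq, algebraMap_smul] using h2
    exact (IsLocalRing.residue_eq_zero_iff _).1
      (Fintype.linearIndependent_iff.1 b.linearIndependent _ h1 i)

/-- The pullback of multiplication by `y` along `π`. -/
def pullbackSMul (y : A) {F X : Type v} [AddCommGroup X] [Module A X] [AddCommGroup F]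
    [Module A F] (π : F →ₗ[A] X) : Submodule A (X × F) :=
  LinearMap.ker (y • LinearMap.fst A X F - π ∘ₗ LinearMap.snd A X F)

theorem mem_pullbackSMul {y : A} {F X : Type v} [AddCommGroup X] [Module A X] [AddCommGroup F]
    [Module A F] {π : F →ₗ[A] X} {z : X × F} : z ∈ pullbackSMul y π ↔ y • z.1 = π z.2 := by
  simp [pullbackSMul, sub_eq_zero]

theorem ses_pullbackSMul (y : A) {F X : Type u} [AddCommGroup X] [Module A X] [AddCommGroup F]
    [Module A F] (π : F →ₗ[A] X) (hπ : Function.Surjective π) :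
    Ses (LinearMap.codRestrict (pullbackSMul y π)
        (LinearMap.inr A X F ∘ₗ (LinearMap.ker π).subtype)
        fun c => mem_pullbackSMul.2 (by simp))
      (LinearMap.fst A X F ∘ₗ (pullbackSMul y π).subtype) where
  inj := fun a b h => by
    have := congrArg (fun z : pullbackSMul y π => z.1.2) h
    simpa using this
  exact := fun z => by
    constructor
    · intro hz
      have hz1 : z.1.1 = 0 := hz
      have h := mem_pullbackSMul.1 z.2
      rw [hz1, smul_zero] at h
      exact ⟨⟨z.1.2, h.symm⟩, Subtype.ext (Prod.ext hz1.symm rfl)⟩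
    · rintro ⟨c, rfl⟩
      rfl
  surj := fun x => by
    obtain ⟨p, hp⟩ := hπ (y • x)
    exact ⟨⟨(x, p), mem_pullbackSMul.2 hp.symm⟩, rfl⟩

theorem free_of_free_pullbackSMul [IsLocalRing A] [IsNoetherianRing A] {X : Type u} [AddCommGroup X] [Module A X]
    {b : ℕ} (π : (Fin b → A) →ₗ[A] X) (hπ : Function.Surjective π)
    (hmin : ∀ v, π v = 0 → ∀ i, v i ∈ IsLocalRing.maximalIdeal A) {y : A}
    (hy : y ∈ IsLocalRing.maximalIdeal A) (hfree : Module.Free A (pullbackSMul y π)) :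
    Module.Free A X := by
  have hses := ses_pullbackSMul y π hπ
  obtain ⟨f', hf'⟩ := Module.projective_lifting_property π
    (LinearMap.fst A X (Fin b → A) ∘ₗ (pullbackSMul y π).subtype) hπ
  obtain ⟨f, hf⟩ := Module.projective_lifting_property _ π hses.surj
  replace hf' : ∀ z, π (f' z) = z.1.1 := fun z => LinearMap.congr_fun hf' z
  replace hf : ∀ p, (f p).1.1 = π p := fun z => LinearMap.congr_fun hf z
  set 𝔪 := IsLocalRing.maximalIdeal A
  have hker : LinearMap.ker π ≤ 𝔪 • (⊤ : Submodule A (Fin b → A)) := fun v hv => by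
    rw [← Finset.univ_sum_single v]
    refine Submodule.sum_mem _ fun i _ => ?_
    have : Pi.single i (v i) = v i • (Pi.single i 1 : Fin b → A) := by
      rw [← Pi.single_smul, smul_eq_mul, mul_one]
    rw [this]
    exact Submodule.smul_mem_smul (hmin v hv i) trivial
  have hff : ∀ p, π (f' (f p)) = π p := fun p => by rw [hf', hf]
  have hsurj : Function.Surjective (f' ∘ₗ f) := by
    rw [← LinearMap.range_eq_top]
    refine top_le_iff.1 (Submodule.le_of_le_smul_of_le_jacobson_bot (I := 𝔪)
      Module.Finite.fg_top (IsLocalRing.maximalIdeal_le_jacobson _) fun p _ => ?_)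
    have h1 : p = (f' ∘ₗ f) p + (p - f' (f p)) := by simp
    rw [h1]
    refine Submodule.add_mem_sup ⟨p, rfl⟩ (hker ?_)
    simp [hff]
  have hs : ∀ p, (f p).1.2 - y • p ∈ LinearMap.ker π := fun p => by
    have h := mem_pullbackSMul.1 (f p).2
    rw [LinearMap.mem_ker, map_sub, ← h, hf, map_smul, sub_self]
  have hsm : ∀ p ∈ LinearMap.ker π, (f p).1.2 ∈ 𝔪 • LinearMap.ker π := fun p hp => by
    have h1 : (f p).1.2 = ∑ i, p i • ((f (Pi.single i 1)).1.2 - y • (Pi.single i 1 : Fin b → A))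
        + y • p := by
      simp only [smul_sub, Finset.sum_sub_distrib]
      have h2 : p = ∑ i, p i • (Pi.single i 1 : Fin b → A) := by
        conv_lhs => rw [← Finset.univ_sum_single p]
        refine Finset.sum_congr rfl fun i _ => ?_
        rw [← Pi.single_smul, smul_eq_mul, mul_one]
      have h3 : (f p).1.2 = ∑ i, p i • (f (Pi.single i 1)).1.2 := by
        conv_lhs => rw [h2]
        simp [Prod.snd_sum]
      have h4 : y • p = ∑ i, p i • y • (Pi.single i 1 : Fin b → A) := by
        conv_lhs => rw [h2]
        rw [Finset.smul_sum]
        exact Finset.sum_congr rfl fun i _ => smul_comm _ _ _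
      rw [h3, h4, sub_add_cancel]
    rw [h1]
    exact Submodule.add_mem _ (Submodule.sum_mem _ fun i _ =>
      Submodule.smul_mem_smul (hmin p hp i) (hs _)) (Submodule.smul_mem_smul hy hp)
  have hbot : LinearMap.ker π = ⊥ := by
    refine Submodule.eq_bot_of_le_smul_of_le_jacobson_bot 𝔪 _ (IsNoetherian.noetherian _) ?_
      (IsLocalRing.maximalIdeal_le_jacobson _)
    intro q hq
    obtain ⟨p, rfl⟩ := hsurj q
    have hp : p ∈ LinearMap.ker π := by
      rw [LinearMap.mem_ker, ← hff p]; exact hq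
    let j : LinearMap.ker π →ₗ[A] LinearMap.ker π :=
      LinearMap.codRestrict _ (f' ∘ₗ LinearMap.codRestrict (pullbackSMul y π)
        (LinearMap.inr A X (Fin b → A) ∘ₗ (LinearMap.ker π).subtype)
        fun c => mem_pullbackSMul.2 (by simp)) fun c => by
          simp [hf']
    have hjm : ∀ q (hq : q ∈ 𝔪 • LinearMap.ker π),
        (j ⟨q, Submodule.smul_le_right hq⟩).1 ∈ 𝔪 • LinearMap.ker π := fun q hq => by
      refine Submodule.smul_induction_on' (p := fun q hq =>
        (j ⟨q, Submodule.smul_le_right hq⟩).1 ∈ 𝔪 • LinearMap.ker π) hq ?_ ?_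
      · intro r hr n hn
        have : j ⟨r • n, Submodule.smul_mem _ r hn⟩ = r • j ⟨n, hn⟩ := by
          rw [← map_smul]; rfl
        rw [this]
        exact Submodule.smul_mem_smul hr (j ⟨n, hn⟩).2
      · intro x hx z hz h1 h2
        have : j ⟨x + z, Submodule.add_mem _ (Submodule.smul_le_right hx)
            (Submodule.smul_le_right hz)⟩ = j ⟨x, Submodule.smul_le_right hx⟩ +
            j ⟨z, Submodule.smul_le_right hz⟩ := by
          rw [← map_add]; rfl
        rw [this]
        exact Submodule.add_mem _ h1 h2
    have key := hjm _ (hsm p hp)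
    have h0 : (f p).1.1 = 0 := by rw [hf]; exact hp
    convert key using 1
    change f' (f p) = f' _
    congr 1
    exact Subtype.ext (Prod.ext h0 rfl)
  exact Module.Free.of_equiv (LinearEquiv.ofBijective π ⟨LinearMap.ker_eq_bot.1 hbot, hπ⟩)

end MinimalCover

section

open TensorProduct

section StepDescent

variable {S T : Type u} [CommRing S] [CommRing T] [Algebra S T]

theorem exists_descent_pullbackSMul [IsNoetherianRing S] [IsNoetherianRing T] [Module.Flat S T]
    {y : S} (hy : ∀ t : T, ∃ s u, t = algebraMap S T s + algebraMap S T y * u)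
    {X : Type u} [AddCommGroup X] [Module T X] [Module.Finite T X] {b : ℕ}
    (π : (Fin b → T) →ₗ[T] X) :
    ∃ Z : ModuleCat.{u} S, Module.Finite S Z ∧
      Nonempty (T ⊗[S] Z ≃ₗ[T] pullbackSMul (algebraMap S T y) π) := by
  let _ : Module S X := Module.compHom X (algebraMap S T)
  have _ : IsScalarTower S T X := IsScalarTower.of_algebraMap_smul fun _ _ => rfl
  let al : (Fin b → S) →ₗ[S] (Fin b → T) := (Algebra.linearMap S T).compLeft (Fin b)
  let Z : Submodule S (X × (Fin b → S)) :=
    LinearMap.ker (y • LinearMap.fst S X (Fin b → S) -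
      π.restrictScalars S ∘ₗ al ∘ₗ LinearMap.snd S X (Fin b → S))
  have hZ : ∀ z, z ∈ Z ↔ y • z.1 = π (al z.2) := fun z => by
    simp [Z, sub_eq_zero]
  let V : Submodule S X := LinearMap.ker (y • LinearMap.id)
  have hV : ∀ v, v ∈ V ↔ y • v = 0 := fun v => by simp [V]
  have htv : ∀ t : T, ∀ v ∈ V, ∃ s : S, ∃ u : T, t = algebraMap S T s + algebraMap S T y * u ∧
      t • v = s • v := fun t v hv => by
    obtain ⟨s, u, rfl⟩ := hy t
    refine ⟨s, u, rfl, ?_⟩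
    rw [add_smul, mul_comm, mul_smul, algebraMap_smul, algebraMap_smul, (hV v).1 hv, smul_zero,
      add_zero]
  have hVfg : V.FG := by
    let VT : Submodule T X := LinearMap.ker (algebraMap S T y • LinearMap.id)
    have hVT : ∀ v, v ∈ VT ↔ v ∈ V := fun v => by
      rw [hV]; simp [VT]
    obtain ⟨m, w, hw⟩ := Submodule.fg_iff_exists_fin_generating_family.1
      (IsNoetherian.noetherian VT)
    refine Submodule.fg_iff_exists_fin_generating_family.2 ⟨m, w, le_antisymm ?_ ?_⟩
    · rw [Submodule.span_le]
      rintro _ ⟨i, rfl⟩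
      exact (hVT _).1 (hw ▸ Submodule.subset_span ⟨i, rfl⟩)
    · intro v hv
      have hv' := (hVT v).2 hv
      rw [← hw, Submodule.mem_span_range_iff_exists_fun] at hv'
      obtain ⟨c, rfl⟩ := hv'
      refine Submodule.sum_mem _ fun i _ => ?_
      obtain ⟨s, u, -, h⟩ := htv (c i) (w i) ((hVT _).1 (hw ▸ Submodule.subset_span ⟨i, rfl⟩))
      rw [h]
      exact Submodule.smul_mem _ _ (Submodule.subset_span ⟨i, rfl⟩)
  have hZfg : Z.FG := by
    refine Submodule.fg_of_fg_map_of_fg_inf_ker (LinearMap.snd S X (Fin b → S))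
      (IsNoetherian.noetherian _) ?_
    have : Z ⊓ LinearMap.ker (LinearMap.snd S X (Fin b → S)) =
        V.map (LinearMap.inl S X (Fin b → S)) := by
      ext ⟨x, q⟩
      simp only [Submodule.mem_inf, LinearMap.mem_ker, LinearMap.snd_apply, Submodule.mem_map, hZ,
        hV]
      constructor
      · rintro ⟨h, rfl⟩
        exact ⟨x, by simpa using h, rfl⟩
      · rintro ⟨v, hv, h⟩
        obtain ⟨rfl, rfl⟩ := Prod.ext_iff.1 h
        exact ⟨by simpa using hv, rfl⟩
    rw [this]
    exact hVfg.map _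
  have hal : ∀ q i, al q i = algebraMap S T (q i) := fun q i => rfl
  let l : Z →ₗ[S] pullbackSMul (algebraMap S T y) π :=
    { toFun := fun z => ⟨(z.1.1, al z.1.2), mem_pullbackSMul.2 (by
        rw [algebraMap_smul]; exact (hZ z.1).1 z.2)⟩
      map_add' := fun z z' => Subtype.ext (Prod.ext rfl (al.map_add _ _))
      map_smul' := fun c z => Subtype.ext (Prod.ext rfl (al.map_smul _ _)) }
  refine ⟨ModuleCat.of S Z, Module.Finite.iff_fg.2 hZfg,
    ⟨LinearEquiv.ofBijective (l.liftBaseChange T) ⟨?_, ?_⟩⟩⟩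
  · rw [injective_iff_map_eq_zero]
    intro z hz
    let σ : Z →ₗ[S] (Fin b → S) := LinearMap.snd S X (Fin b → S) ∘ₗ Z.subtype
    let ι : V →ₗ[S] Z := LinearMap.codRestrict Z (LinearMap.inl S X (Fin b → S) ∘ₗ V.subtype)
      fun v => (hZ _).2 (by simpa using (hV v).1 v.2)
    have hex : Function.Exact ι σ := fun z => by
      constructor
      · intro h
        have h' : z.1.2 = 0 := h
        have h1 := (hZ z.1).1 z.2
        rw [h', map_zero, map_zero] at h1
        exact ⟨⟨z.1.1, (hV _).2 h1⟩, Subtype.ext (Prod.ext rfl h'.symm)⟩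
      · rintro ⟨v, rfl⟩; rfl
    have hcomp : ∀ z, TensorProduct.piScalarRight S T T (Fin b) (σ.lTensor T z) =
        (l.liftBaseChange T z).1.2 := fun z => by
      induction z with
      | zero => simp
      | add a c ha hc => simp only [map_add, ha, hc]; rfl
      | tmul t z =>
        funext i
        simp [σ, l, hal, Algebra.smul_def, mul_comm]
    have h0 : σ.lTensor T z = 0 := by
      apply (TensorProduct.piScalarRight S T T (Fin b)).injective
      rw [hcomp, hz, map_zero]; rfl
    obtain ⟨w, rfl⟩ := (Module.Flat.lTensor_exact T hex z).1 h0
    have hw : ∀ w : T ⊗[S] V, ∃ v : V, w = 1 ⊗ₜ v := fun w => by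
      induction w with
      | zero => exact ⟨0, by simp⟩
      | add a c ha hc =>
        obtain ⟨⟨v, rfl⟩, ⟨v', rfl⟩⟩ := And.intro ha hc
        exact ⟨v + v', (tmul_add _ _ _).symm⟩
      | tmul t v =>
        obtain ⟨s, u, ht, -⟩ := htv t v.1 v.2
        refine ⟨s • v, ?_⟩
        have hyv : y • v = 0 := Subtype.ext ((hV v).1 v.2)
        rw [ht, add_tmul, ← Algebra.smul_def, smul_tmul, hyv, tmul_zero, add_zero,
          Algebra.algebraMap_eq_smul_one, smul_tmul]
    obtain ⟨v, rfl⟩ := hw w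
    have h2 : v = 0 := by
      have := congrArg (fun z => z.1.1) hz
      simp only [LinearMap.lTensor_tmul, LinearMap.liftBaseChange_tmul, one_smul] at this
      exact Subtype.ext this
    rw [h2, tmul_zero, map_zero]
  · rintro ⟨⟨x, p⟩, hz⟩
    have hz' := mem_pullbackSMul.1 hz
    choose q p' hp using fun i => hy (p i)
    have hp0 : p = al q + algebraMap S T y • p' := funext fun i => hp i
    have hpe : p' = ∑ i, p' i • al (Pi.single i 1) := by
      funext j
      simp [hal, Finset.sum_apply, Pi.single_apply]
    let z₀ : Z := ⟨(x - π p', q), (hZ _).2 (by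
      have h1 : y • x = π (al q) + y • π p' := by
        have : algebraMap S T y • x = π p := hz'
        rw [hp0, map_add, map_smul, algebraMap_smul, algebraMap_smul] at this
        exact this
      rw [smul_sub, h1, add_sub_cancel_right])⟩
    let e : Fin b → Z := fun i => ⟨(π (al (Pi.single i 1)), y • Pi.single i 1), (hZ _).2 (by
      rw [map_smul]
      exact ((π.restrictScalars S).map_smul _ _).symm)⟩
    refine ⟨1 ⊗ₜ z₀ + ∑ i, p' i ⊗ₜ e i, Subtype.ext ?_⟩
    simp only [map_add, map_sum, LinearMap.liftBaseChange_tmul, one_smul]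
    refine Prod.ext ?_ ?_
    · have : (∑ i, p' i • (l (e i)).1.1) = π p' := by
        conv_rhs => rw [hpe]
        simp [l, e]
      simp only [Submodule.coe_add, AddSubmonoidClass.coe_finsetSum, SetLike.val_smul,
        Prod.fst_add, Prod.fst_sum, Prod.smul_fst, this]
      exact sub_add_cancel _ _
    · have : (∑ i, p' i • (l (e i)).1.2) = algebraMap S T y • p' := by
        conv_rhs => rw [hpe]
        simp only [Finset.smul_sum, l, e]
        refine Finset.sum_congr rfl fun i _ => ?_
        have : al (y • Pi.single i 1) = algebraMap S T y • al (Pi.single i 1) := by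
          rw [map_smul, algebraMap_smul]
        change p' i • al (y • Pi.single i 1) = _
        rw [this, smul_comm]
      simp only [Submodule.coe_add, AddSubmonoidClass.coe_finsetSum, SetLike.val_smul,
        Prod.snd_add, Prod.snd_sum, Prod.smul_snd, this]
      exact hp0.symm

theorem TR.free_of_faithfullyFlat [IsNoetherianRing S] [IsNoetherianRing T] [IsLocalRing T]
    [Module.FaithfullyFlat S T] {y : S}
    (hy : ∀ t : T, ∃ s u, t = algebraMap S T s + algebraMap S T y * u)
    (hyT : algebraMap S T y ∈ IsLocalRing.maximalIdeal T)
    (hS : ∀ Z : ModuleCat.{u} S, TR S Z → Module.Free S Z)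
    {X : Type u} [AddCommGroup X] [Module T X] (hX : TR T X) : Module.Free T X := by
  have _ := hX.fin
  obtain ⟨b, π, hπ, hmin⟩ := exists_minimal_cover (A := T) X
  have hses := ses_pullbackSMul (algebraMap S T y) π hπ
  have hΩ : TR T (LinearMap.ker π) := hX.syz (FinProj.fin_fun b) (Ses.ker hπ)
  have hTR : TR T (pullbackSMul (algebraMap S T y) π) := TR.ext hses hΩ hX
  obtain ⟨Z, _, ⟨e⟩⟩ := exists_descent_pullbackSMul hy π
  have hZ : TR S Z := TR.of_baseChange (hTR.of_equiv e.symm)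
  have _ := hS Z hZ
  exact free_of_free_pullbackSMul π hπ hmin hyT (Module.Free.of_equiv e)

end StepDescent

end

section

open IsLocalRing

section Completion

variable {C : Type u} [CommRing C] (K : Ideal C)

theorem AdicCompletion.exists_sub_mem_map (hK : K.FG) (d : AdicCompletion K C) :
    ∃ c, d - algebraMap C (AdicCompletion K C) c ∈ K.map (algebraMap C (AdicCompletion K C)) := by
  obtain ⟨c, hc⟩ := Ideal.Quotient.mk_surjective (AdicCompletion.evalOneₐ K d)
  refine ⟨c, ?_⟩
  rw [← AdicCompletion.ker_evalOneₐ_eq_map _ hK]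
  change AdicCompletion.evalOneₐ K _ = 0
  rw [map_sub, ← hc, AlgHom.commutes, sub_eq_zero]
  rfl

variable {K}

theorem AdicCompletion.map_le_jacobson (hK : K.FG) :
    K.map (algebraMap C (AdicCompletion K C)) ≤ (⊥ : Ideal (AdicCompletion K C)).jacobson := by
  have := AdicCompletion.isAdicComplete_self K hK
  exact IsAdicComplete.le_jacobson_bot _

theorem AdicCompletion.mk_comp_surjective (hK : K.FG) :
    Function.Surjective ((Ideal.Quotient.mk (K.map (algebraMap C (AdicCompletion K C)))).comp
      (algebraMap C (AdicCompletion K C))) := fun x => by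
  obtain ⟨d, rfl⟩ := Ideal.Quotient.mk_surjective x
  obtain ⟨c, hc⟩ := AdicCompletion.exists_sub_mem_map K hK d
  exact ⟨c, ((Ideal.Quotient.mk_eq_mk_iff_sub_mem _ _).2 hc).symm⟩

variable [IsNoetherianRing C]

theorem AdicCompletion.isNoetherianRing_self : IsNoetherianRing (AdicCompletion K C) := by
  have hK := K.fg_of_isNoetherianRing
  have := AdicCompletion.isAdicComplete_self K hK
  have := isNoetherianRing_of_surjective _ _ _ (AdicCompletion.mk_comp_surjective hK)
  exact isNoetherianRing_of_isAdicComplete (K.map (algebraMap C (AdicCompletion K C)))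
    (hK.map _)

theorem AdicCompletion.isLocalRing_self [IsLocalRing C] (hle : K ≤ maximalIdeal C) :
    ∃ _ : IsLocalRing (AdicCompletion K C), IsLocalHom (algebraMap C (AdicCompletion K C)) := by
  have hK := K.fg_of_isNoetherianRing
  have hm := AdicCompletion.isMaximal_map_of_le K (maximalIdeal C) hle hK
  have hne : K.map (algebraMap C (AdicCompletion K C)) ≠ ⊤ := fun h =>
    hm.ne_top (top_le_iff.1 (h ▸ Ideal.map_mono hle))
  have _ : Nontrivial (AdicCompletion K C ⧸ K.map (algebraMap C (AdicCompletion K C))) :=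
    Ideal.Quotient.nontrivial_iff.2 hne
  have _ := IsLocalRing.of_surjective' _ (AdicCompletion.mk_comp_surjective hK)
  have _ := isLocalHom_of_le_jacobson_bot _ (AdicCompletion.map_le_jacobson hK)
  have hl : IsLocalRing (AdicCompletion K C) := RingHom.domain_isLocalRing
    (Ideal.Quotient.mk (K.map (algebraMap C (AdicCompletion K C))))
  refine ⟨hl, ((IsLocalRing.local_hom_TFAE _).out 0 2).mpr ?_⟩
  rw [IsLocalRing.eq_maximalIdeal hm]

/-- If `C` is complete at `J`, then modulo `y` it surjects onto its completion at `J + (y)`. -/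
theorem AdicCompletion.exists_eq_add_mul [IsLocalRing C] {J : Ideal C} [IsPrecomplete J C]
    {y : C} (hle : J ⊔ Ideal.span {y} ≤ maximalIdeal C)
    (d : AdicCompletion (J ⊔ Ideal.span {y}) C) :
    ∃ c u, d = algebraMap C (AdicCompletion (J ⊔ Ideal.span {y}) C) c +
      algebraMap C (AdicCompletion (J ⊔ Ideal.span {y}) C) y * u := by
  have _ := AdicCompletion.isNoetherianRing_self (K := J ⊔ Ideal.span {y})
  obtain ⟨hl, hloc⟩ := AdicCompletion.isLocalRing_self hle
  let D := AdicCompletion (J ⊔ Ideal.span {y}) C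
  let q := (Ideal.Quotient.mk (Ideal.span {algebraMap C D y})).comp (algebraMap C D)
  have hJm : J.map q ≤ (⊥ : Ideal (D ⧸ Ideal.span {algebraMap C D y})).jacobson := by
    have h1 : J.map (algebraMap C D) ≤ (⊥ : Ideal D).jacobson :=
      (Ideal.map_mono le_sup_left).trans (AdicCompletion.map_le_jacobson
        (Ideal.fg_of_isNoetherianRing _))
    rw [← Ideal.map_map]
    refine (Ideal.map_mono h1).trans ?_
    refine (Ideal.map_le_iff_le_comap).2 fun a ha => ?_
    rw [Ideal.mem_comap, Ideal.mem_jacobson_bot]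
    intro b
    obtain ⟨b, rfl⟩ := Ideal.Quotient.mk_surjective b
    have := (Ideal.mem_jacobson_bot.1 ha b).map (Ideal.Quotient.mk (Ideal.span {algebraMap C D y}))
    simpa using this
  have _ : IsHausdorff (J.map q) (D ⧸ Ideal.span {algebraMap C D y}) :=
    IsHausdorff.of_le_jacobson _ _ hJm
  have hq : Function.Surjective q := by
    refine surjective_of_mk_map_comp_surjective (I := J) q fun x => ?_
    obtain ⟨x, rfl⟩ := Ideal.Quotient.mk_surjective x
    obtain ⟨d, rfl⟩ := Ideal.Quotient.mk_surjective x
    obtain ⟨c, hc⟩ := AdicCompletion.exists_sub_mem_map _ (Ideal.fg_of_isNoetherianRing _) d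
    refine ⟨c, ((Ideal.Quotient.mk_eq_mk_iff_sub_mem _ _).2 ?_).symm⟩
    have h2 := Ideal.mem_map_of_mem (Ideal.Quotient.mk (Ideal.span {algebraMap C D y})) hc
    rw [Ideal.map_map, Ideal.map_sup, Ideal.map_span, Set.image_singleton] at h2
    have h3 : ((Ideal.Quotient.mk (Ideal.span {algebraMap C D y})).comp (algebraMap C D)) y = 0 :=
      Ideal.Quotient.eq_zero_iff_mem.2 (Ideal.mem_span_singleton_self _)
    rw [h3, Ideal.span_singleton_eq_bot.2 rfl, sup_bot_eq, map_sub] at h2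
    exact h2
  obtain ⟨c, hc⟩ := hq (Ideal.Quotient.mk _ d)
  obtain ⟨u, hu⟩ := Ideal.mem_span_singleton.1 ((Ideal.Quotient.mk_eq_mk_iff_sub_mem _ _).1 hc.symm)
  exact ⟨c, u, sub_eq_iff_eq_add'.1 hu⟩

end Completion

section Chain

variable {S : Type u} [CommRing S] [IsNoetherianRing S] [IsLocalRing S]

/-- A noetherian local `S`-algebra with the formal properties of the completion of `S` at `J`, over
which all modules in the class `TR` are free. -/
structure TRFreeCompletion (S : Type u) [CommRing S] [IsLocalRing S] (J : Ideal S) (C : Type u)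
    [CommRing C] [Algebra S C] : Prop where
  noeth : IsNoetherianRing C
  isLocalRing : IsLocalRing C
  isLocalHom : IsLocalHom (algebraMap S C)
  flat : Module.Flat S C
  complete : IsAdicComplete (J.map (algebraMap S C)) C
  exists_sub_mem : ∀ c : C, ∃ s, c - algebraMap S C s ∈ J.map (algebraMap S C)
  free : ∀ Z : ModuleCat.{u} C, TR C Z → Module.Free C Z

theorem exists_trFreeCompletion (hS : ∀ Z : ModuleCat.{u} S, TR S Z → Module.Free S Z)
    (s : Finset S) (hs : Ideal.span (s : Set S) ≤ maximalIdeal S) :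
    ∃ (C : Type u) (_ : CommRing C) (_ : Algebra S C),
      TRFreeCompletion S (Ideal.span (s : Set S)) C := by
  classical
  induction s using Finset.induction_on with
  | empty =>
    refine ⟨S, _, Algebra.id S, inferInstance, inferInstance, ?_, inferInstance, ?_, fun c => ?_, hS⟩
    · exact ⟨fun a ha => ha⟩
    · simp only [Finset.coe_empty, Ideal.span_empty, Ideal.map_bot]
      infer_instance
    · exact ⟨c, by simp⟩
  | insert y s hys ih =>
    have hle : Ideal.span (s : Set S) ≤ maximalIdeal S :=
      (Ideal.span_mono (by simp)).trans hs
    obtain ⟨C, _, _, hC⟩ := ih hle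
    obtain ⟨_, _, _, _, _, h6, h7⟩ := hC
    set J := (Ideal.span (s : Set S)).map (algebraMap S C) with hJ
    have hK : (Ideal.span ((insert y s : Finset S) : Set S)).map (algebraMap S C) =
        J ⊔ Ideal.span {algebraMap S C y} := by
      rw [Finset.coe_insert, Ideal.span_insert, Ideal.map_sup, Ideal.map_span, Set.image_singleton,
        sup_comm]
    have hKle : J ⊔ Ideal.span {algebraMap S C y} ≤ maximalIdeal C := by
      rw [← hK]
      exact (Ideal.map_mono hs).trans
        (((IsLocalRing.local_hom_TFAE (algebraMap S C)).out 0 2).mp ‹IsLocalHom (algebraMap S C)›)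
    set K := J ⊔ Ideal.span {algebraMap S C y} with hKdef
    have _ := AdicCompletion.isNoetherianRing_self (K := K)
    obtain ⟨hl, hloc⟩ := AdicCompletion.isLocalRing_self hKle
    have hfl : Module.Flat C (AdicCompletion K C) := AdicCompletion.flat_of_isNoetherian K
    have hmap : (Ideal.span ((insert y s : Finset S) : Set S)).map
        (algebraMap S (AdicCompletion K C)) = K.map (algebraMap C (AdicCompletion K C)) := by
      rw [IsScalarTower.algebraMap_eq S C (AdicCompletion K C), ← Ideal.map_map, hK]
    refine ⟨AdicCompletion K C, inferInstance, inferInstance, inferInstance, hl, ?_, ?_, ?_, ?_, ?_⟩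
    · rw [IsScalarTower.algebraMap_eq S C (AdicCompletion K C)]
      infer_instance
    · exact Module.Flat.trans S C _
    · rw [hmap]
      exact AdicCompletion.isAdicComplete_self K K.fg_of_isNoetherianRing
    · intro d
      obtain ⟨c, hc⟩ := AdicCompletion.exists_sub_mem_map K K.fg_of_isNoetherianRing d
      obtain ⟨a, ha⟩ := h6 c
      refine ⟨a, ?_⟩
      rw [hmap]
      have := Ideal.mem_map_of_mem (algebraMap C (AdicCompletion K C))
        ((le_sup_left : J ≤ K) ha)
      rw [map_sub, ← IsScalarTower.algebraMap_apply] at this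
      convert add_mem hc this using 1
      ring
    · intro Z hZ
      have _ : Module.FaithfullyFlat C (AdicCompletion K C) :=
        Module.FaithfullyFlat.of_flat_of_isLocalHom
      refine TR.free_of_faithfullyFlat (S := C) (y := algebraMap S C y)
        (AdicCompletion.exists_eq_add_mul hKle) ?_ h7 hZ
      exact map_nonunit _ _ (hKle ((le_sup_right : _ ≤ K) (Ideal.mem_span_singleton_self _)))

end Chain

end

section

open IsLocalRing

section Chain

variable {S : Type u} [CommRing S] [IsNoetherianRing S] [IsLocalRing S]

theorem TRFreeCompletion.exists_ringEquiv {C : Type u} [CommRing C] [Algebra S C]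
    (h : TRFreeCompletion S (maximalIdeal S) C) :
    Nonempty (AdicCompletion (maximalIdeal S) S ≃+* C) := by
  obtain ⟨_, _, _, _, _, h6, -⟩ := h
  have _ : Module.FaithfullyFlat S C := Module.FaithfullyFlat.of_flat_of_isLocalHom
  set 𝔪 := (maximalIdeal S).map (algebraMap S C) with h𝔪
  have hpow : ∀ k, maximalIdeal S ^ k = (𝔪 ^ k).comap (algebraMap S C) := fun k => by
    rw [h𝔪, ← Ideal.map_pow, Ideal.comap_map_eq_self_of_faithfullyFlat]
  let F : ∀ k, AdicCompletion (maximalIdeal S) S →+* C ⧸ 𝔪 ^ k := fun k =>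
    (Ideal.quotientMap (𝔪 ^ k) (algebraMap S C) (hpow k).le).comp
      (AdicCompletion.evalₐ (maximalIdeal S) k : _ →+* _)
  have hF : ∀ k (x : AdicCompletion.AdicCauchySequence (maximalIdeal S) S),
      F k (AdicCompletion.mk _ _ x) = Ideal.Quotient.mk _ (algebraMap S C (x k)) := fun k x => by
    simp only [F, RingHom.comp_apply, RingHom.coe_coe, AdicCompletion.evalₐ_mk]
    rfl
  let φ : AdicCompletion (maximalIdeal S) S →+* C := IsAdicComplete.liftRingHom 𝔪 F (by
    intro m n hle
    ext x
    induction x using AdicCompletion.induction_on with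
    | h x =>
      rw [RingHom.comp_apply, hF, hF]
      change Ideal.Quotient.mk _ (algebraMap S C (x n)) = _
      rw [Ideal.Quotient.mk_eq_mk_iff_sub_mem, ← map_sub]
      refine (hpow m).le ?_
      have := (x.2 hle).symm
      rw [SModEq.sub_mem] at this
      simpa using this)
  have hφF : ∀ k x, Ideal.Quotient.mk (𝔪 ^ k) (φ x) = F k x := fun k x =>
    IsAdicComplete.mk_liftRingHom 𝔪 F _ k x
  have hφ : ∀ s, φ (algebraMap S _ s) = algebraMap S C s := fun s => by
    rw [IsHausdorff.eq_iff_smodEq (I := 𝔪)]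
    intro k
    rw [SModEq.sub_mem, smul_eq_mul, Ideal.mul_top, ← Ideal.Quotient.mk_eq_mk_iff_sub_mem, hφF]
    simp only [F, RingHom.comp_apply, RingHom.coe_coe, AlgHom.commutes]
    rfl
  refine ⟨RingEquiv.ofBijective φ ⟨?_, ?_⟩⟩
  · rw [injective_iff_map_eq_zero]
    intro x hx
    induction x using AdicCompletion.induction_on with
    | h x =>
      refine AdicCompletion.ext_evalₐ fun k => ?_
      have h1 := hφF k (AdicCompletion.mk _ _ x)
      rw [hx, hF, map_zero] at h1
      rw [AdicCompletion.evalₐ_mk, map_zero]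
      have h2 : algebraMap S C (x k) ∈ 𝔪 ^ k := Ideal.Quotient.eq_zero_iff_mem.1 h1.symm
      exact Ideal.Quotient.eq_zero_iff_mem.2 ((hpow k).ge h2)
  · have hm : (maximalIdeal (AdicCompletion (maximalIdeal S) S)).map φ = 𝔪 := by
      have : φ.comp (algebraMap S _) = algebraMap S C := RingHom.ext hφ
      rw [AdicCompletion.maximalIdeal_eq_map, Ideal.map_map, this]
    have _ : IsHausdorff ((maximalIdeal (AdicCompletion (maximalIdeal S) S)).map φ) C := by
      rw [hm]; infer_instance
    refine surjective_of_mk_map_comp_surjective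
      (I := maximalIdeal (AdicCompletion (maximalIdeal S) S)) φ fun x => ?_
    obtain ⟨c, rfl⟩ := Ideal.Quotient.mk_surjective x
    obtain ⟨s, hs⟩ := h6 c
    refine ⟨algebraMap S _ s, ((Ideal.Quotient.mk_eq_mk_iff_sub_mem _ _).2 ?_).symm⟩
    rw [hm, hφ]
    exact hs

theorem TR.free_adicCompletion (hS : ∀ Z : ModuleCat.{u} S, TR S Z → Module.Free S Z)
    {X : Type u} [AddCommGroup X] [Module (AdicCompletion (maximalIdeal S) S) X]
    (hX : TR (AdicCompletion (maximalIdeal S) S) X) :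
    Module.Free (AdicCompletion (maximalIdeal S) S) X := by
  obtain ⟨s, hs⟩ := (maximalIdeal S).fg_of_isNoetherianRing
  obtain ⟨C, _, _, hC⟩ := exists_trFreeCompletion hS s hs.le
  rw [hs] at hC
  obtain ⟨e⟩ := hC.exists_ringEquiv
  let _ := (e.symm : C →+* AdicCompletion (maximalIdeal S) S).toAlgebra
  have hb : Function.Bijective (algebraMap C (AdicCompletion (maximalIdeal S) S)) :=
    e.symm.bijective
  obtain ⟨_, _, -, -, -, -, h7⟩ := hC
  have _ := isNoetherianRing_of_surjective _ _ _ hb.2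
  have _ : Module.Free C (AdicCompletion (maximalIdeal S) S) :=
    Module.Free.of_equiv (LinearEquiv.ofBijective (Algebra.linearMap C _) hb)
  refine TR.free_of_faithfullyFlat (S := C) (y := 0) (fun t => ?_) ?_ h7 hX
  · obtain ⟨c, rfl⟩ := hb.2 t
    exact ⟨c, 0, by simp⟩
  · simp

end Chain

end

section ExtVanishing

variable {A : Type u} [CommRing A]

theorem CoVan.of_projective {P : Type u} [AddCommGroup P] [Module A P] [Module.Projective A P] :
    CoVan A P := by
  intro Z V _ _ _ _ f g hfg φ
  obtain ⟨s, hs⟩ := Module.projective_lifting_property g LinearMap.id hfg.surj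
  obtain ⟨r, hr⟩ := hfg.lift (LinearMap.id - s ∘ₗ g) fun v => by
    have := LinearMap.congr_fun hs (g v)
    simp only [LinearMap.comp_apply, LinearMap.id_apply] at this
    simp [this]
  refine ⟨φ ∘ₗ r, fun z => congrArg φ (hfg.inj ?_)⟩
  have := hr (f z)
  simpa [hfg.zero] using this

/-- A class of modules, closed under suitable syzygies, on which `Ext¹` with values in the ring
vanishes. -/
structure IsVanClass (P : ModuleCat.{u} A → Prop) : Prop where
  van : ∀ X, P X → CoVan A X
  left : ∀ X, P X → ∃ (F X' : ModuleCat.{u} A) (f : X' →ₗ[A] F) (g : F →ₗ[A] X),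
    Ses f g ∧ Module.Projective A F ∧ P X'

/-- The modules which become an extension of a projective module by a member of `P` after adding a
projective module. -/
def StablyIn (P : ModuleCat.{u} A → Prop) (Z : Type u) [AddCommGroup Z] [Module A Z] : Prop :=
  ∃ (G F Q : ModuleCat.{u} A) (a : G →ₗ[A] Z × F) (b : Z × F →ₗ[A] Q),
    P G ∧ Module.Projective A F ∧ Module.Projective A Q ∧ Ses a b

variable {P : ModuleCat.{u} A → Prop}

theorem IsVanClass.covan (h : IsVanClass P) {Z : Type u} [AddCommGroup Z] [Module A Z]
    (hZ : StablyIn P Z) : CoVan A Z := by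
  obtain ⟨G, F, Q, a, b, hG, _, _, hab⟩ := hZ
  exact (CoVan.of_ses_middle hab (h.van G hG) CoVan.of_projective).of_prod

theorem IsVanClass.stablyIn (h : IsVanClass P) {Z' P₁ Z : Type u} [AddCommGroup Z] [Module A Z]
    [AddCommGroup Z'] [Module A Z'] [AddCommGroup P₁] [Module A P₁] [Module.Projective A P₁]
    {f : Z' →ₗ[A] P₁} {g : P₁ →ₗ[A] Z} (hfg : Ses f g) (hZ : StablyIn P Z) : StablyIn P Z' := by
  obtain ⟨G, F, Q, a, b, hG, _, _, hab⟩ := hZ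
  obtain ⟨F₁, Y, i, p, hip, _, hY⟩ := h.left G hG
  obtain ⟨s, hs⟩ := Module.projective_lifting_property b LinearMap.id hab.surj
  replace hs : ∀ q, b (s q) = q := LinearMap.congr_fun hs
  have h₁ : Ses (LinearMap.inl A P₁ F ∘ₗ f) (LinearMap.prodMap g (LinearMap.id (R := A) (M := F))) := by
    refine Ses.of_zero ?_ ?_ ?_ ?_
    · exact LinearMap.inl_injective.comp hfg.inj
    · exact hfg.surj.prodMap Function.surjective_id
    · intro x
      simp [hfg.zero]
    · rintro ⟨a, b⟩ hab
      obtain ⟨x, rfl⟩ := hfg.exists_of (congrArg Prod.fst hab)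
      exact ⟨x, Prod.ext rfl (congrArg Prod.snd hab).symm⟩
  have h₂ : Ses (LinearMap.inl A F₁ Q ∘ₗ i) ((a ∘ₗ p).coprod s) := by
    refine Ses.of_zero ?_ ?_ ?_ ?_
    · exact LinearMap.inl_injective.comp hip.inj
    · intro z
      obtain ⟨c, hc⟩ := hab.exists_of (y := z - s (b z)) (by simp [hs])
      obtain ⟨c, rfl⟩ := hip.surj c
      exact ⟨(c, b z), by simp [hc]⟩
    · intro x
      simp [hip.zero]
    · rintro ⟨c, q⟩ hcq
      have hcq' : a (p c) + s q = 0 := hcq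
      have hq : q = 0 := by
        have := congrArg b hcq'
        simpa [hab.zero, hs] using this
      subst hq
      rw [map_zero, add_zero] at hcq'
      obtain ⟨y, rfl⟩ := hip.exists_of (hab.inj (hcq'.trans (map_zero a).symm))
      exact ⟨y, rfl⟩
  obtain ⟨p', hp'⟩ := Module.projective_lifting_property _ ((a ∘ₗ p).coprod s) h₁.surj
  obtain ⟨c, hc, -⟩ := h₁.switch_left h₂ (LinearMap.congr_fun hp')
  exact ⟨Y, ModuleCat.of A (F₁ × Q), ModuleCat.of A (P₁ × F), c, _, hY,
    inferInstanceAs (Module.Projective A (F₁ × Q)), inferInstanceAs (Module.Projective A (P₁ × F)),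
    hc⟩

theorem IsVanClass.stablyIn_self {X : Type u} [AddCommGroup X] [Module A X]
    (hX : P (ModuleCat.of A X)) : StablyIn P X := by
  refine ⟨ModuleCat.of A X, ModuleCat.of A PUnit.{u + 1}, ModuleCat.of A PUnit.{u + 1},
    LinearMap.inl A X PUnit.{u + 1}, LinearMap.snd A X PUnit.{u + 1}, hX,
    inferInstanceAs (Module.Projective A PUnit.{u + 1}),
    inferInstanceAs (Module.Projective A PUnit.{u + 1}), Ses.inl_snd⟩

theorem IsVanClass.exists_extend (h : IsVanClass P) {X : Type u} [AddCommGroup X] [Module A X]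
    (hX : P (ModuleCat.of A X)) {F : ℕ → Type u} [∀ i, AddCommGroup (F i)] [∀ i, Module A (F i)]
    [∀ i, Module.Projective A (F i)] (d : ∀ i, F (i + 1) →ₗ[A] F i) (ε : F 0 →ₗ[A] X)
    (hε : Function.Surjective ε) (h0 : Function.Exact (d 0) ε)
    (hd : ∀ i, Function.Exact (d (i + 1)) (d i)) (i : ℕ) (φ : F (i + 1) →ₗ[A] A)
    (hφ : ∀ x, φ (d (i + 1) x) = 0) : ∃ ψ : F i →ₗ[A] A, ∀ x, ψ (d i x) = φ x := by
  have hC : ∀ i, StablyIn P (F i ⧸ LinearMap.range (d i)) := fun i => by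
    induction i with
    | zero =>
      have e : (F 0 ⧸ LinearMap.range (d 0)) ≃ₗ[A] X :=
        (Submodule.quotEquivOfEq _ _ h0.linearMap_ker_eq.symm).trans
          (ε.quotKerEquivOfSurjective hε)
      obtain ⟨G, F, Q, a, b, hG, hF, hQ, hab⟩ := IsVanClass.stablyIn_self hX
      refine ⟨G, F, Q, (LinearEquiv.prodCongr e.symm (LinearEquiv.refl A F)).toLinearMap ∘ₗ a,
        b ∘ₗ (LinearEquiv.prodCongr e (LinearEquiv.refl A F)).toLinearMap, hG, hF, hQ, ?_⟩
      refine Ses.of_zero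
        ((LinearEquiv.prodCongr e.symm (LinearEquiv.refl A F)).injective.comp hab.inj)
        (hab.surj.comp (LinearEquiv.prodCongr e (LinearEquiv.refl A F)).surjective) (fun x => ?_) fun y hy => ?_
      · have : (LinearEquiv.prodCongr e (LinearEquiv.refl A F))
          ((LinearEquiv.prodCongr e.symm (LinearEquiv.refl A F)) (a x)) = a x :=
          Prod.ext (by simp) (by simp)
        simp only [LinearMap.comp_apply, LinearEquiv.coe_coe]
        rw [this, hab.zero]
      · obtain ⟨x, hx⟩ := hab.exists_of hy
        refine ⟨x, ?_⟩
        simp only [LinearMap.comp_apply, LinearEquiv.coe_coe, hx]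
        exact Prod.ext (by simp) (by simp)
    | succ i ih =>
      let j : (F (i + 1) ⧸ LinearMap.range (d (i + 1))) →ₗ[A] F i :=
        (LinearMap.range (d (i + 1))).liftQ (d i) (hd i).linearMap_ker_eq.ge
      refine h.stablyIn (f := j) (g := (LinearMap.range (d i)).mkQ) (Ses.of_zero ?_ ?_ ?_ ?_) ih
      · rw [← LinearMap.ker_eq_bot]
        exact Submodule.ker_liftQ_eq_bot _ _ _ (hd i).linearMap_ker_eq.le
      · exact Submodule.mkQ_surjective _
      · intro x
        obtain ⟨x, rfl⟩ := Submodule.mkQ_surjective _ x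
        exact (Submodule.Quotient.mk_eq_zero _).2 ⟨x, rfl⟩
      · intro y hy
        obtain ⟨x, rfl⟩ := (Submodule.Quotient.mk_eq_zero _).1 hy
        exact ⟨Submodule.Quotient.mk x, rfl⟩
  let φ' : LinearMap.range (d i) →ₗ[A] A :=
    (LinearMap.ker (d i)).liftQ φ (fun x hx => by
      obtain ⟨y, rfl⟩ := (hd i x).1 hx
      exact hφ y) ∘ₗ (d i).quotKerEquivRange.symm.toLinearMap
  have hs : Ses (LinearMap.range (d i)).subtype (LinearMap.range (d i)).mkQ := Ses.mkQ _
  obtain ⟨ψ, hψ⟩ := h.covan (hC i) _ _ _ _ hs φ'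
  refine ⟨ψ, fun x => ?_⟩
  have := hψ ⟨d i x, x, rfl⟩
  rw [Submodule.subtype_apply] at this
  rw [this]
  have h2 : (d i).quotKerEquivRange.symm ⟨d i x, x, rfl⟩ = Submodule.Quotient.mk x := by
    rw [LinearEquiv.symm_apply_eq]; rfl
  simp only [φ', LinearMap.comp_apply, LinearEquiv.coe_coe, h2, Submodule.liftQ_apply]

end ExtVanishing

section

open CategoryTheory in
theorem IsVanClass.subsingleton_extModule {A : Type u} [CommRing A] {P : ModuleCat.{u} A → Prop}
    (h : IsVanClass P) {X : Type u} [AddCommGroup X] [Module A X] (hX : P (ModuleCat.of A X))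
    {i : ℕ} (hi : 1 ≤ i) : Subsingleton (extModule A i X A) := by
  obtain ⟨i, rfl⟩ := Nat.exists_eq_add_of_le' hi
  let Q := projectiveResolution (ModuleCat.of A X)
  have hQ : ∀ j, Module.Projective A (Q.complex.X j) := fun j =>
    (IsProjective.iff_projective _).2 (Q.projective j)
  have hex : ∀ j, Function.Exact (Q.complex.d (j + 2) (j + 1)).hom (Q.complex.d (j + 1) j).hom :=
    fun j => (ShortComplex.ShortExact.moduleCat_exact_iff_function_exact _).1 (Q.exact_succ j)
  have h0 : Function.Exact (Q.complex.d 1 0).hom (Q.π.f 0).hom :=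
    (ShortComplex.ShortExact.moduleCat_exact_iff_function_exact _).1 Q.exact₀
  have hε : Function.Surjective (Q.π.f 0).hom := (ModuleCat.epi_iff_surjective _).1 inferInstance
  have key := fun (φ : Q.complex.X (i + 1) →ₗ[A] A) =>
    h.exists_extend hX (F := fun j => Q.complex.X j) (fun j => (Q.complex.d (j + 1) j).hom)
    (Q.π.f 0).hom hε h0 hex i φ
  refine ModuleCat.subsingleton_of_isZero ?_
  refine Limits.IsZero.of_iso ?_ (Q.isoExt (i + 1) (ModuleCat.of A A))
  rw [← HomologicalComplex.exactAt_iff_isZero_homology,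
    HomologicalComplex.exactAt_iff' _ i (i + 1) (i + 2) (by simp) (by simp)]
  rw [ShortComplex.moduleCat_exact_iff]
  intro φ hφ
  obtain ⟨ψ, hψ⟩ := key φ.hom fun x => congrArg (fun t => t.hom x) hφ
  exact ⟨ModuleCat.ofHom ψ, ModuleCat.hom_ext (LinearMap.ext hψ)⟩

section TotallyReflexive

variable {A : Type u} [CommRing A] {G : Type u} [AddCommGroup G] [Module A G]

theorem TR.eval_injective (h : TR A G) : Function.Injective (Module.Dual.eval A G) := by
  obtain ⟨F, G', f, g, hfg, hF, -⟩ := h.right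
  have := hF.fin
  have := hF.proj
  refine (injective_iff_map_eq_zero _).2 fun x hx => hfg.inj ?_
  rw [map_zero]
  refine (Module.bijective_dual_eval A F).injective (LinearMap.ext fun ψ => ?_)
  rw [map_zero]
  exact LinearMap.congr_fun hx (ψ ∘ₗ f)

theorem TR.eval_bijective (h : TR A G) : Function.Bijective (Module.Dual.eval A G) := by
  refine ⟨h.eval_injective, fun φ => ?_⟩
  obtain ⟨F, G', f, g, hfg, hF, hG'⟩ := h.right
  have := hF.fin
  have := hF.proj
  obtain ⟨p, hp⟩ := (Module.bijective_dual_eval A F).surjective (φ ∘ₗ LinearMap.lcomp A A f)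
  replace hp : ∀ ψ : F →ₗ[A] A, ψ p = φ (ψ ∘ₗ f) := LinearMap.congr_fun hp
  have hgp : g p = 0 := by
    refine hG'.eval_injective (LinearMap.ext fun χ => ?_)
    rw [map_zero]
    refine (hp (χ ∘ₗ g)).trans ?_
    rw [show (χ ∘ₗ g) ∘ₗ f = 0 from LinearMap.ext fun x => by simp [hfg.zero], map_zero]
    rfl
  obtain ⟨x, rfl⟩ := hfg.exists_of hgp
  refine ⟨x, LinearMap.ext fun ψ => ?_⟩
  obtain ⟨ψ', hψ'⟩ := hG'.van _ _ _ _ hfg ψ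
  obtain rfl : ψ' ∘ₗ f = ψ := LinearMap.ext hψ'
  exact hp ψ'

theorem isVanClass_TR : IsVanClass (A := A) fun X => TR A X where
  van _ h := h.van
  left X h := by
    obtain ⟨F, X', f, g, hfg, hF, hX'⟩ := h.left
    exact ⟨F, X', f, g, hfg, hF.proj, hX'⟩

theorem Ses.dual_of_coVan {X Y Z : Type u} [AddCommGroup X] [Module A X] [AddCommGroup Y]
    [Module A Y] [AddCommGroup Z] [Module A Z] {f : X →ₗ[A] Y} {g : Y →ₗ[A] Z} (h : Ses f g)
    (hZ : CoVan A Z) : Ses (LinearMap.lcomp A A g) (LinearMap.lcomp A A f) := by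
  refine Ses.of_zero (fun a b hab => ?_) (fun φ => ?_) (fun φ => ?_) fun φ hφ => ?_
  · exact (LinearMap.cancel_right h.surj).1 hab
  · obtain ⟨ψ, hψ⟩ := hZ _ _ _ _ h φ
    exact ⟨ψ, LinearMap.ext hψ⟩
  · exact LinearMap.ext fun x => by simp [h.zero]
  · obtain ⟨ψ, hψ⟩ := h.desc φ fun x => LinearMap.congr_fun hφ x
    exact ⟨ψ, LinearMap.ext hψ⟩

theorem isVanClass_dual_TR : IsVanClass (A := A) fun X =>
    ∃ G : ModuleCat.{u} A, TR A G ∧ Nonempty ((G →ₗ[A] A) ≃ₗ[A] X) where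
  van := by
    rintro X ⟨G, hG, ⟨e⟩⟩
    obtain ⟨F, G', f, g, hfg, hF, hG'⟩ := hG.right
    have := hF.fin
    have := hF.proj
    refine CoVan.of_ses (P := F →ₗ[A] A) ⟨inferInstance, inferInstance⟩
      ((hfg.dual_of_coVan hG'.van).equiv_right e) fun φ => ?_
    obtain ⟨x, rfl⟩ := hG'.eval_bijective.surjective φ
    obtain ⟨p, rfl⟩ := hfg.surj x
    exact ⟨Module.Dual.eval A F p, fun _ => rfl⟩
  left := by
    rintro X ⟨G, hG, ⟨e⟩⟩
    obtain ⟨F, G', f, g, hfg, hF, hG'⟩ := hG.right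
    have := hF.fin
    have := hF.proj
    exact ⟨ModuleCat.of A (F →ₗ[A] A), ModuleCat.of A (G' →ₗ[A] A), _, _,
      (hfg.dual_of_coVan hG'.van).equiv_right e,
      inferInstanceAs (Module.Projective A (Module.Dual A F)), G', hG', ⟨LinearEquiv.refl A _⟩⟩

theorem TR.isTotallyReflexive (h : TR A G) : IsTotallyReflexive A G :=
  ⟨h.fin, h.eval_bijective, fun _ hi => ⟨isVanClass_TR.subsingleton_extModule h hi,
    isVanClass_dual_TR.subsingleton_extModule
      ⟨ModuleCat.of A G, h, ⟨LinearEquiv.refl A _⟩⟩ hi⟩⟩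

theorem IsGRegular.free (hA : IsGRegular A) (h : TR A G) : Module.Free A G :=
  hA G h.isTotallyReflexive

end TotallyReflexive

end

section ProjectiveDimension

open CategoryTheory IsLocalRing TensorProduct

/-- The module `X` has projective dimension less than `n`. -/
def PdLT (A : Type u) [CommRing A] (n : ℕ) (X : Type u) [AddCommGroup X] [Module A X] : Prop :=
  HasProjectiveDimensionLT (ModuleCat.of A X) n

variable {A : Type u} [CommRing A] {X Y Z : Type u} [AddCommGroup X] [Module A X] [AddCommGroup Y]
  [Module A Y] [AddCommGroup Z] [Module A Z] {f : X →ₗ[A] Y} {g : Y →ₗ[A] Z} {n : ℕ}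

theorem Ses.shortExact (h : Ses f g) :
    (ShortComplex.mk (ModuleCat.ofHom f) (ModuleCat.ofHom g)
      (ModuleCat.hom_ext (LinearMap.ext h.zero))).ShortExact where
  exact := (ShortComplex.ShortExact.moduleCat_exact_iff_function_exact _).2 h.exact
  mono_f := (ModuleCat.mono_iff_injective _).2 h.inj
  epi_g := (ModuleCat.epi_iff_surjective _).2 h.surj

theorem PdLT.left (h : Ses f g) (hY : PdLT A n Y) (hZ : PdLT A (n + 1) Z) : PdLT A n X :=
  h.shortExact.hasProjectiveDimensionLT_X₁ n hY hZ

theorem PdLT.right (h : Ses f g) (hX : PdLT A n X) (hY : PdLT A (n + 1) Y) : PdLT A (n + 1) Z :=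
  h.shortExact.hasProjectiveDimensionLT_X₃ n hX hY

theorem pdLT_one_iff : PdLT A 1 X ↔ Module.Projective A X := by
  rw [PdLT, ← projective_iff_hasProjectiveDimensionLT_one, ← IsProjective.iff_projective]

theorem PdLT.mono {m : ℕ} (h : PdLT A n X) (hm : n ≤ m) : PdLT A m X :=
  have : HasProjectiveDimensionLT (ModuleCat.of A X) n := h
  hasProjectiveDimensionLT_of_ge _ n m hm

theorem PdLT.of_projective [Module.Projective A X] : PdLT A (n + 1) X :=
  (pdLT_one_iff.2 inferInstance).mono (by lia)

theorem ResLE.pdLT (h : ResLE (A := A) (fun X => FinProj A X) n X) : PdLT A (n + 1) X := by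
  induction n generalizing X with
  | zero => exact pdLT_one_iff.2 h.proj
  | succ n ih =>
    obtain ⟨F, X', f, g, hfg, hF, hX'⟩ := h
    have := hF.proj
    exact PdLT.right hfg (ih hX') PdLT.of_projective

end ProjectiveDimension

section Split

open IsLocalRing TensorProduct

variable {A : Type u} [CommRing A] [IsLocalRing A] {K F : Type u} [AddCommGroup K] [Module A K]
  [AddCommGroup F] [Module A F] [Module.Finite A K] [Module.Finite A F] [Module.Free A F]

theorem one_tmul_eq_zero_iff {X : Type u} [AddCommGroup X] [Module A X] (x : X) :
    (1 : ResidueField A) ⊗ₜ[A] x = 0 ↔ x ∈ maximalIdeal A • (⊤ : Submodule A X) := by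
  refine (quotTensorEquivQuotSMul X (maximalIdeal A)).map_eq_zero_iff.symm.trans ?_
  rw [← Submodule.Quotient.mk_eq_zero]
  refine Eq.congr ((quotTensorEquivQuotSMul_mk_tmul (maximalIdeal A) 1 x).trans ?_) rfl
  rw [one_smul]

theorem exists_retraction_of_forall_mem_smul (t : K →ₗ[A] F)
    (h : ∀ k, t k ∈ maximalIdeal A • (⊤ : Submodule A F) →
      k ∈ maximalIdeal A • (⊤ : Submodule A K)) : ∃ r : F →ₗ[A] K, r ∘ₗ t = LinearMap.id := by
  rw [split_injective_iff_lTensor_residueField_injective]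
  refine (injective_iff_map_eq_zero _).2 fun z hz => ?_
  obtain ⟨k, rfl⟩ := TensorProduct.mk_surjective A K (ResidueField A) residue_surjective z
  rw [TensorProduct.mk_apply] at hz ⊢
  rw [LinearMap.lTensor_tmul, one_tmul_eq_zero_iff] at hz
  exact (one_tmul_eq_zero_iff k).2 (h k hz)

end Split

theorem mem_smul_top_of_forall_repr {A F : Type*} [CommRing A] [AddCommGroup F]
    [Module A F] {ι : Type*} (b : Module.Basis ι A F) {I : Ideal A} {x : F}
    (h : ∀ i, b.repr x i ∈ I) : x ∈ I • (⊤ : Submodule A F) := by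
  rw [← b.linearCombination_repr x, Finsupp.linearCombination_apply]
  exact Submodule.sum_mem _ fun i _ => Submodule.smul_mem_smul (h i) trivial

section Rank

open IsLocalRing TensorProduct

theorem Ses.free_of_smul_maximalIdeal {L K F N : Type u} [CommRing L] [IsLocalRing L]
    [AddCommGroup K] [Module L K] [AddCommGroup F] [Module L F] [AddCommGroup N] [Module L N]
    [Module.Finite L K] [Module.Free L K] [Module.Finite L F] [Module.Free L F]
    {f : K →ₗ[L] F} {g : F →ₗ[L] N} (h : Ses f g) {a : L} (ha : a ≠ 0)
    (ham : ∀ x ∈ maximalIdeal L, a * x = 0) :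
    Module.Free L N ∧ Module.finrank L K + Module.finrank L N = Module.finrank L F := by
  obtain ⟨r, hr⟩ := exists_retraction_of_forall_mem_smul f fun k hk => by
    have hak : a • k = 0 := by
      refine h.inj ?_
      rw [map_smul, map_zero]
      refine Submodule.smul_induction_on hk (fun x hx y _ => ?_) fun y z hy hz => ?_
      · rw [smul_smul, ham x hx, zero_smul]
      · rw [smul_add, hy, hz, add_zero]
    refine mem_smul_top_of_forall_repr (Module.Free.chooseBasis L K) fun i => ?_
    by_contra hi
    refine ha ((IsUnit.mul_left_eq_zero (notMem_maximalIdeal.1 hi)).1 ?_)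
    simpa using congrArg (fun v => (Module.Free.chooseBasis L K).repr v i) hak
  replace hr : ∀ k, r (f k) = k := LinearMap.congr_fun hr
  let e : F ≃ₗ[L] K × N := LinearEquiv.ofBijective (r.prod g) ⟨by
    refine (injective_iff_map_eq_zero _).2 fun y hy => ?_
    obtain ⟨k, rfl⟩ := h.exists_of (congrArg Prod.snd hy)
    have : r (f k) = 0 := congrArg Prod.fst hy
    rw [← hr k, this, map_zero], fun ⟨k, n⟩ => by
    obtain ⟨y, rfl⟩ := h.surj n
    exact ⟨y + f (k - r y), by simp [hr, h.zero]⟩⟩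
  have : Module.Finite L N := Module.Finite.of_surjective g h.surj
  have : Module.Projective L (K × N) := Module.Projective.of_equiv e
  have : Module.Projective L N := Module.Projective.of_split (LinearMap.inr L K N)
    (LinearMap.snd L K N) (LinearMap.snd_comp_inr ..)
  have hN : Module.Free L N := Module.free_of_flat_of_isLocalRing
  exact ⟨hN, by rw [e.finrank_eq, Module.finrank_prod]⟩

theorem exists_mem_iff_of_mem_associatedPrimes {A M : Type*} [CommRing A] [IsNoetherianRing A]
    [AddCommGroup M] [Module A M] {𝔮 : Ideal A} (h : 𝔮 ∈ associatedPrimes A M) :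
    ∃ a : M, ∀ y, y ∈ 𝔮 ↔ y • a = 0 := by
  obtain ⟨-, a, rfl⟩ := isAssociatedPrime_iff.1 (AssociatedPrimes.mem_iff.1 h)
  exact ⟨a, fun y => by simp [Submodule.mem_colon_singleton]⟩

theorem PdLT.exists_rank {A : Type u} [CommRing A] [IsLocalRing A] [IsNoetherianRing A] {p : ℕ}
    {N : Type u} [AddCommGroup N] [Module A N] [Module.Finite A N] (hN : PdLT A (p + 1) N) :
    ∃ r, ∀ (𝔮 : Ideal A) [𝔮.IsPrime], 𝔮 ∈ associatedPrimes A A →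
      Module.Free (Localization.AtPrime 𝔮) (Localization.AtPrime 𝔮 ⊗[A] N) ∧
      Module.finrank (Localization.AtPrime 𝔮) (Localization.AtPrime 𝔮 ⊗[A] N) = r := by
  induction p generalizing N with
  | zero =>
    have := pdLT_one_iff.1 hN
    have : Module.Free A N := Module.free_of_flat_of_isLocalRing
    exact ⟨Module.finrank A N, fun 𝔮 _ _ => ⟨inferInstance, Module.finrank_baseChange⟩⟩
  | succ p ih =>
    obtain ⟨b, π, hπ⟩ := Module.Finite.exists_fin' A N
    have hs := Ses.ker hπ
    obtain ⟨r, hr⟩ := ih (PdLT.left hs PdLT.of_projective hN)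
    refine ⟨b - r, fun 𝔮 _ h𝔮 => ?_⟩
    let L := Localization.AtPrime 𝔮
    obtain ⟨hK, hKr⟩ := hr 𝔮 h𝔮
    obtain ⟨a, ha⟩ := exists_mem_iff_of_mem_associatedPrimes h𝔮
    have hF : Module.Free L (L ⊗[A] (Fin b → A)) := inferInstance
    have ha0 : algebraMap A L a ≠ 0 := fun h0 => by
      obtain ⟨m, hm⟩ := (IsLocalization.map_eq_zero_iff 𝔮.primeCompl L a).1 h0
      exact m.2 ((ha m).2 hm)
    have ham : ∀ x ∈ maximalIdeal L, algebraMap A L a * x = 0 := fun x hx => by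
      rw [← Localization.AtPrime.map_eq_maximalIdeal] at hx
      refine Submodule.span_induction ?_ ?_ ?_ ?_ hx
      · rintro _ ⟨y, hy, rfl⟩
        rw [← map_mul, mul_comm, ← smul_eq_mul, (ha y).1 hy, map_zero]
      · rw [mul_zero]
      · intro y z _ _ hy hz
        rw [mul_add, hy, hz, add_zero]
      · intro c y _ hy
        rw [smul_eq_mul, mul_left_comm, hy, mul_zero]
    obtain ⟨h₁, h₂⟩ := (hs.baseChange (T := L)).free_of_smul_maximalIdeal ha0 ham
    rw [hKr, Module.finrank_baseChange (M' := Fin b → A), Module.finrank_fin_fun] at h₂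
    exact ⟨h₁, Nat.eq_sub_of_add_eq' h₂⟩

theorem PdLT.exists_mem_nonZeroDivisors {A : Type u} [CommRing A] [IsLocalRing A]
    [IsNoetherianRing A] {p : ℕ} {N : Type u} [AddCommGroup N] [Module A N] [Module.Finite A N]
    [Nontrivial N] (hN : PdLT A (p + 1) N) (h0 : Module.annihilator A N ≠ ⊥) :
    ∃ x ∈ Module.annihilator A N, x ∈ nonZeroDivisors A := by
  obtain ⟨r, hr⟩ := hN.exists_rank
  by_contra! hcon
  obtain ⟨P, hP, hPN⟩ : ∃ P ∈ associatedPrimes A A, Module.annihilator A N ≤ P :=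
    ((Module.annihilator A N).subset_union_prime_finite (associatedPrimes.finite ..)
      (f := id) 0 0 fun _ h _ _ => h.1).1 <| by
    simp_rw [id, biUnion_associatedPrimes_eq_compl_nonZeroDivisors]
    exact hcon
  have := hP.1
  obtain ⟨hP1, hP2⟩ := hr P hP
  have hPnt : Nontrivial (Localization.AtPrime P ⊗[A] N) := by
    have hm : (⟨P, inferInstance⟩ : PrimeSpectrum A) ∈ Module.support A N := by
      rw [Module.support_eq_zeroLocus]
      exact hPN
    have := Module.mem_support_iff.1 hm
    exact (IsLocalizedModule.iso P.primeCompl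
      (TensorProduct.mk A (Localization.AtPrime P) N 1)).symm.toEquiv.nontrivial
  have hr0 : 0 < r := hP2 ▸ (Module.finrank_pos_iff_of_free _ _).2 hPnt
  have : Nontrivial (Module.annihilator A N) := Submodule.nontrivial_iff_ne_bot.2 h0
  obtain ⟨𝔮, h𝔮⟩ := associatedPrimes.nonempty A (Module.annihilator A N)
  have h𝔮A : 𝔮 ∈ associatedPrimes A A := h𝔮.map_of_injective _
    (Submodule.subtype_injective (Module.annihilator A N))
  obtain ⟨⟨x, hx⟩, hx𝔮⟩ := exists_mem_iff_of_mem_associatedPrimes h𝔮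
  have := h𝔮.1
  obtain ⟨h𝔮1, h𝔮2⟩ := hr 𝔮 h𝔮A
  have hnt : Nontrivial (Localization.AtPrime 𝔮 ⊗[A] N) :=
    Module.nontrivial_of_finrank_pos (R := Localization.AtPrime 𝔮) (h𝔮2 ▸ hr0)
  have hx0 : algebraMap A (Localization.AtPrime 𝔮) x = 0 := by
    refine FaithfulSMul.eq_of_smul_eq_smul (α := Localization.AtPrime 𝔮 ⊗[A] N) fun z => ?_
    rw [zero_smul, algebraMap_smul]
    induction z with
    | zero => rw [smul_zero]
    | add y z hy hz => rw [smul_add, hy, hz, add_zero]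
    | tmul y z => rw [← tmul_smul, Module.mem_annihilator.1 hx, tmul_zero]
  obtain ⟨m, hm⟩ := (IsLocalization.map_eq_zero_iff 𝔮.primeCompl _ x).1 hx0
  exact m.2 ((hx𝔮 m).2 (Subtype.ext hm))

end Rank

section Hypersurface

open IsLocalRing

/-- A linear map from a free module to a module killed by `I` factors through `A ⧸ I`. -/
theorem exists_linearMap_quotient {A : Type u} [CommRing A] (I : Ideal A) {N : Type u}
    [AddCommGroup N] [Module A N] [Module (A ⧸ I) N] [IsScalarTower A (A ⧸ I) N] {b : ℕ}
    (π : (Fin b → A) →ₗ[A] N) :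
    ∃ φ : (Fin b → A ⧸ I) →ₗ[A ⧸ I] N, ∀ w, φ (fun i => Ideal.Quotient.mk I (w i)) = π w := by
  refine ⟨Fintype.linearCombination (A ⧸ I) fun i => π (Pi.single i 1), fun w => ?_⟩
  rw [Fintype.linearCombination_apply, LinearMap.pi_apply_eq_sum_univ π w]
  refine Finset.sum_congr rfl fun i _ => ?_
  rw [← Ideal.Quotient.algebraMap_eq, algebraMap_smul]
  congr 2
  ext j
  simp [Pi.single_apply, eq_comm]

theorem PdLT.quotient_of_one {A : Type u} [CommRing A] [IsLocalRing A] [IsNoetherianRing A]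
    {x : A} (hx2 : x ∉ maximalIdeal A ^ 2)
    {N : Type u} [AddCommGroup N] [Module A N] [Module.Finite A N]
    [Module (A ⧸ Ideal.span {x}) N] [IsScalarTower A (A ⧸ Ideal.span {x}) N]
    (hN : PdLT A 2 N) : PdLT (A ⧸ Ideal.span {x}) 1 N := by
  obtain ⟨b, π, hπ, hmin⟩ := exists_minimal_cover (A := A) N
  have hK := pdLT_one_iff.1 (PdLT.left (Ses.ker hπ) PdLT.of_projective hN)
  have hxN : ∀ n : N, x • n = 0 := fun n => by
    rw [← algebraMap_smul (A ⧸ Ideal.span {x}) x n, Ideal.Quotient.algebraMap_eq,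
      Ideal.Quotient.eq_zero_iff_mem.2 (Ideal.mem_span_singleton_self x), zero_smul]
  have : Module.Free A (LinearMap.ker π) := Module.free_of_flat_of_isLocalRing
  let t : (Fin b → A) →ₗ[A] LinearMap.ker π := (x • LinearMap.id).codRestrict _ fun w => by
    simp [hxN]
  have ht : ∀ w i, (t w : Fin b → A) i = x * w i := fun w i => rfl
  obtain ⟨r, hr⟩ : ∃ r : LinearMap.ker π →ₗ[A] (Fin b → A), r ∘ₗ t = LinearMap.id := by
    refine exists_retraction_of_forall_mem_smul t fun w hw => ?_
    have hmem : ∀ i, x * w i ∈ maximalIdeal A ^ 2 := fun i => by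
      rw [← ht]
      refine Submodule.smul_induction_on hw (fun a ha k _ => ?_) fun y z hy hz => add_mem hy hz
      rw [pow_two]
      exact Ideal.mul_mem_mul ha (hmin _ k.2 i)
    refine mem_smul_top_of_forall_repr (Pi.basisFun A (Fin b)) fun i => ?_
    by_contra hi
    exact hx2 ((Ideal.mul_unit_mem_iff_mem _ (notMem_maximalIdeal.1 hi)).1 (hmem i))
  replace hr : ∀ w, r (t w) = w := LinearMap.congr_fun hr
  have hker : ∀ w, π w = 0 → ∀ i, w i ∈ Ideal.span {x} := fun w hw i => by
    have h1 : t w = x • (⟨w, hw⟩ : LinearMap.ker π) := Subtype.ext rfl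
    have h2 : x • r ⟨w, hw⟩ = w := by rw [← map_smul, ← h1, hr]
    rw [← h2]
    exact Ideal.mul_mem_right _ _ (Ideal.mem_span_singleton_self x)
  obtain ⟨φ, hφ⟩ := exists_linearMap_quotient (Ideal.span {x}) π
  have hb : Function.Bijective φ := by
    refine ⟨(injective_iff_map_eq_zero _).2 fun w hw => ?_, fun n => ?_⟩
    · choose w' hw' using fun i => Ideal.Quotient.mk_surjective (w i)
      obtain rfl := funext hw'
      rw [hφ] at hw
      exact funext fun i => Ideal.Quotient.eq_zero_iff_mem.2 (hker w' hw i)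
    · obtain ⟨w, rfl⟩ := hπ n
      exact ⟨_, hφ w⟩
  exact pdLT_one_iff.2 (Module.Projective.of_equiv (LinearEquiv.ofBijective φ hb))

theorem pdLT_two_quotient {A : Type u} [CommRing A] {x : A} (hx : x ∈ nonZeroDivisors A) (b : ℕ) :
    PdLT A 2 (Fin b → A ⧸ Ideal.span {x}) := by
  have h : Ses (x • LinearMap.id : (Fin b → A) →ₗ[A] (Fin b → A))
      ((Algebra.linearMap A (A ⧸ Ideal.span {x})).compLeft (Fin b)) := by
    refine ⟨fun w w' hw => funext fun i => ?_, fun w => ⟨fun hw => ?_, ?_⟩, fun w => ?_⟩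
    · exact (mem_nonZeroDivisors_iff_right.1 hx |> fun h => sub_eq_zero.1 (h _ (by
        have := congrFun hw i
        simp only [LinearMap.smul_apply, LinearMap.id_apply, Pi.smul_apply, smul_eq_mul] at this
        linear_combination this)))
    · choose c hc using fun i => Ideal.mem_span_singleton'.1
        (Ideal.Quotient.eq_zero_iff_mem.1 (congrFun hw i))
      exact ⟨c, funext fun i => (mul_comm _ _).trans (hc i)⟩
    · rintro ⟨c, rfl⟩
      exact funext fun i => Ideal.Quotient.eq_zero_iff_mem.2
        (Ideal.mul_mem_right _ _ (Ideal.mem_span_singleton_self x))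
    · choose w' hw' using fun i => Ideal.Quotient.mk_surjective (w i)
      exact ⟨w', funext hw'⟩
  exact PdLT.right h PdLT.of_projective PdLT.of_projective

theorem PdLT.quotient {A : Type u} [CommRing A] [IsLocalRing A] [IsNoetherianRing A]
    {x : A} (hx : x ∈ nonZeroDivisors A) (hx2 : x ∉ maximalIdeal A ^ 2) {p : ℕ}
    {N : Type u} [AddCommGroup N] [Module A N] [Module.Finite A N]
    [Module (A ⧸ Ideal.span {x}) N] [IsScalarTower A (A ⧸ Ideal.span {x}) N]
    (hN : PdLT A (p + 2) N) : PdLT (A ⧸ Ideal.span {x}) (p + 1) N := by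
  induction p generalizing N with
  | zero => exact hN.quotient_of_one hx2
  | succ p ih =>
    have : Module.Finite (A ⧸ Ideal.span {x}) N := Module.Finite.of_restrictScalars_finite A _ _
    obtain ⟨b, π, hπ⟩ := Module.Finite.exists_fin' (A ⧸ Ideal.span {x}) N
    have hs := Ses.ker hπ
    have hsA : Ses ((LinearMap.ker π).subtype.restrictScalars A) (π.restrictScalars A) :=
      ⟨hs.inj, hs.exact, hs.surj⟩
    have hK : PdLT A (p + 2) (LinearMap.ker π) :=
      PdLT.left hsA ((pdLT_two_quotient hx b).mono (by lia)) hN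
    have : Module.Finite A (LinearMap.ker π) := Module.Finite.of_injective
      ((LinearMap.ker π).subtype.restrictScalars A) hs.inj
    exact PdLT.right hs (ih hK) PdLT.of_projective

end Hypersurface

section Generators

open IsLocalRing Pointwise RingTheory.Sequence

theorem embDim_eq_spanFinrank (A : Type u) [CommRing A] [IsLocalRing A] [IsNoetherianRing A] :
    embDim A = (maximalIdeal A).spanFinrank :=
  (spanFinrank_maximalIdeal_eq_finrank_cotangentSpace A).symm

theorem embDim_le_ncard {A : Type u} [CommRing A] [IsLocalRing A] [IsNoetherianRing A] {s : Set A}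
    (hs : s.Finite) (h : maximalIdeal A = Ideal.span s) : embDim A ≤ s.ncard := by
  rw [embDim_eq_spanFinrank, h]
  exact Submodule.spanFinrank_span_le_ncard_of_finite hs

theorem embDim_le_of_le_span {A : Type u} [CommRing A] [IsLocalRing A] [IsNoetherianRing A]
    {k : ℕ} {v : Fin k → A} (hv : ∀ i, v i ∈ maximalIdeal A)
    (h : maximalIdeal A ≤ Ideal.span (Set.range v)) : embDim A ≤ k := by
  refine (embDim_le_ncard (Set.finite_range v) (h.antisymm (Ideal.span_le.2 ?_))).trans ?_
  · rintro _ ⟨i, rfl⟩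
    exact hv i
  · rw [← Set.image_univ]
    exact (Set.ncard_image_le Set.finite_univ).trans (by simp)

theorem embDim_le_embDim_quotient_add_one {A : Type u} [CommRing A] [IsLocalRing A]
    [IsNoetherianRing A] (x : A) [IsLocalRing (A ⧸ Ideal.span {x})] :
    embDim A ≤ embDim (A ⧸ Ideal.span {x}) + 1 := by
  obtain ⟨s, hs, hspan⟩ := (IsNoetherian.noetherian
    (maximalIdeal (A ⧸ Ideal.span {x}))).exists_span_finset_card_eq_spanFinrank
  choose g hg using (Ideal.Quotient.mk_surjective (I := Ideal.span {x}))
  have hm : (maximalIdeal (A ⧸ Ideal.span {x})).comap (Ideal.Quotient.mk _) = maximalIdeal A := by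
    have := IsLocalHom.of_surjective _ (Ideal.Quotient.mk_surjective (I := Ideal.span {x}))
    exact ((local_hom_TFAE (Ideal.Quotient.mk (Ideal.span {x}))).out 0 4).1 this
  have h : maximalIdeal A = Ideal.span (insert x (g '' s)) := by
    rw [Ideal.span_insert, ← hm, ← hspan, Ideal.submodule_span_eq, sup_comm]
    have : (s : Set (A ⧸ Ideal.span {x})) = Ideal.Quotient.mk (Ideal.span {x}) '' (g '' s) := by
      simp [Set.image_image, hg]
    conv_lhs => rw [this, ← Ideal.map_span, Ideal.comap_map_of_surjective _
      Ideal.Quotient.mk_surjective, ← RingHom.ker_eq_comap_bot, Ideal.mk_ker]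
  refine (embDim_le_ncard ((s.finite_toSet.image g).insert x) h).trans
    ((Set.ncard_insert_le _ _).trans ?_)
  rw [embDim_eq_spanFinrank (A ⧸ Ideal.span {x}), ← hs]
  exact Nat.succ_le_succ ((Set.ncard_image_le s.finite_toSet).trans (by simp))

theorem isRegular_cons_of_quotient {A : Type u} [CommRing A] {x : A} (hx : x ∈ nonZeroDivisors A)
    {l : List A} (h : IsRegular (A ⧸ Ideal.span {x}) (l.map (Ideal.Quotient.mk (Ideal.span {x})))) :
    IsRegular A (x :: l) := by
  refine (isRegular_cons_iff _ _ _).2 ⟨?_, ?_⟩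
  · exact isSMulRegular_iff_right_eq_zero_of_smul.2 fun y hy =>
      mem_nonZeroDivisors_iff_right.1 hx y (by rw [mul_comm]; exact hy)
  · let e : QuotSMulTop x A ≃ₗ[A] A ⧸ Ideal.span {x} := Submodule.quotEquivOfEq _ _ (by
      rw [← Submodule.ideal_span_singleton_smul, smul_eq_mul, Ideal.mul_top])
    refine (AddEquiv.isRegular_congr (e := e.toAddEquiv) (List.forall₂_map_right_iff.2
      (List.forall₂_same.2 fun r _ y => ?_))).2 h
    exact map_smul e r y

theorem exists_notMem_of_forall_not_le {A : Type u} [CommRing A] (s : Finset (Ideal A))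
    (hs : ∀ 𝔭 ∈ s, 𝔭.IsPrime) {J : Ideal A} (hJ : ∀ 𝔭 ∈ s, ¬ J ≤ 𝔭) (x : A) :
    ∃ y ∈ J, ∀ 𝔭 ∈ s, x + y ∉ 𝔭 := by
  classical
  induction s using Finset.strongInduction with
  | H s ih =>
    obtain rfl | hne := s.eq_empty_or_nonempty
    · exact ⟨0, J.zero_mem, by simp⟩
    obtain ⟨𝔭, h𝔭⟩ := s.exists_minimal hne
    obtain ⟨y, hy, hys⟩ := ih (s.erase 𝔭) (Finset.erase_ssubset h𝔭.1)
      (fun 𝔮 h => hs 𝔮 (Finset.mem_of_mem_erase h)) fun 𝔮 h => hJ 𝔮 (Finset.mem_of_mem_erase h)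
    by_cases hyp : x + y ∈ 𝔭
    · have := hs 𝔭 h𝔭.1
      have hnle : ¬ J * ∏ 𝔮 ∈ s.erase 𝔭, 𝔮 ≤ 𝔭 := fun hle => by
        rcases (Ideal.IsPrime.mul_le this).1 hle with h | h
        · exact hJ 𝔭 h𝔭.1 h
        · obtain ⟨𝔮, h𝔮, hle⟩ := (Ideal.IsPrime.prod_le this).1 h
          exact (Finset.mem_erase.1 h𝔮).1 (hle.antisymm (h𝔭.2 (Finset.mem_erase.1 h𝔮).2 hle))
      obtain ⟨c, hc, hcp⟩ := SetLike.not_le_iff_exists.1 hnle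
      have hcJ : c ∈ J := Ideal.mul_le_left (I := J) (J := ∏ 𝔮 ∈ s.erase 𝔭, 𝔮) hc
      have hcP : ∀ 𝔮 ∈ s.erase 𝔭, c ∈ 𝔮 := fun 𝔮 h𝔮 =>
        Finset.inf_le (f := id) h𝔮 (Ideal.prod_le_inf (Ideal.mul_le_right (I := J) hc))
      refine ⟨y + c, J.add_mem hy hcJ, fun 𝔮 h𝔮 hmem => ?_⟩
      rw [← add_assoc] at hmem
      by_cases hq : 𝔮 = 𝔭
      · subst hq
        exact hcp ((Ideal.add_mem_iff_right _ hyp).1 hmem)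
      · have hq' := Finset.mem_erase.2 ⟨hq, h𝔮⟩
        exact hys 𝔮 hq' ((Ideal.add_mem_iff_left _ (hcP 𝔮 hq')).1 hmem)
    · refine ⟨y, hy, fun 𝔮 h𝔮 => ?_⟩
      by_cases hq : 𝔮 = 𝔭
      · exact hq ▸ hyp
      · exact hys 𝔮 (Finset.mem_erase.2 ⟨hq, h𝔮⟩)

theorem exists_add_mem_nonZeroDivisors {A : Type u} [CommRing A] [IsNoetherianRing A]
    {J : Ideal A} {z : A} (hz : z ∈ J) (hzd : z ∈ nonZeroDivisors A) (x : A) :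
    ∃ y ∈ J, x + y ∈ nonZeroDivisors A := by
  have hc := biUnion_associatedPrimes_eq_compl_nonZeroDivisors A
  have hmem : ∀ w, w ∉ nonZeroDivisors A ↔ ∃ 𝔭 ∈ associatedPrimes A A, w ∈ 𝔭 := fun w => by
    simpa using (Set.ext_iff.1 hc w).symm
  obtain ⟨y, hy, h⟩ := exists_notMem_of_forall_not_le (associatedPrimes.finite A A).toFinset
    (fun 𝔭 h => ((Set.Finite.mem_toFinset _).1 h).1) (J := J) (fun 𝔭 h hle =>
      (hmem z).2 ⟨𝔭, (Set.Finite.mem_toFinset _).1 h, hle hz⟩ hzd) x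
  refine ⟨y, hy, not_not.1 fun hn => ?_⟩
  obtain ⟨𝔭, h𝔭, hw⟩ := (hmem _).1 hn
  exact h 𝔭 ((Set.Finite.mem_toFinset _).2 h𝔭) hw

end Generators

section Structure

open IsLocalRing RingTheory.Sequence

theorem Ideal.Quotient.comap_maximalIdeal {A : Type u} [CommRing A] [IsLocalRing A] (I : Ideal A)
    [IsLocalRing (A ⧸ I)] :
    (maximalIdeal (A ⧸ I)).comap (Ideal.Quotient.mk I) = maximalIdeal A :=
  ((local_hom_TFAE (Ideal.Quotient.mk I)).out 0 4).1
    (IsLocalHom.of_surjective _ Ideal.Quotient.mk_surjective)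

/-- An element of `I` outside the square of the maximal ideal. -/
theorem exists_mem_notMem_sq {A : Type u} [CommRing A] [IsLocalRing A] [IsNoetherianRing A]
    {k : ℕ} {v : Fin k → A} (hv : ∀ i, v i ∈ maximalIdeal A) {I : Ideal A}
    (hm : maximalIdeal A ≤ I ⊔ Ideal.span (Set.range v)) (hk : k < embDim A) :
    ∃ x ∈ I, x ∉ maximalIdeal A ^ 2 := by
  by_contra! hI
  refine hk.not_ge (embDim_le_of_le_span hv ?_)
  refine Submodule.le_of_le_smul_of_le_jacobson_bot (I := maximalIdeal A)
    (IsNoetherian.noetherian _) (maximalIdeal_le_jacobson _) (hm.trans ?_)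
  rw [sup_comm, smul_eq_mul, ← pow_two]
  exact sup_le_sup_left hI _

theorem PdLT.exists_isRegular {A : Type u} [CommRing A] [IsLocalRing A] [IsNoetherianRing A]
    {p k : ℕ} {N : Type u} [AddCommGroup N] [Module A N] [Module.Finite A N] [Nontrivial N]
    (hN : PdLT A (p + 1) N) {I : Ideal A} (hI : I ≤ Module.annihilator A N) {v : Fin k → A}
    (hv : ∀ i, v i ∈ maximalIdeal A) (hm : maximalIdeal A ≤ I ⊔ Ideal.span (Set.range v))
    (hle : p + k ≤ embDim A) :
    p + k = embDim A ∧ (∃ rs : List A, IsRegular A rs ∧ Ideal.ofList rs = I ∧ rs.length = p) ∧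
      ∃ (b : ℕ) (π : (Fin b → A) →ₗ[A] N), Function.Surjective π ∧
        ∀ w, π w = 0 ↔ ∀ i, w i ∈ I := by
  induction p generalizing A with
  | zero =>
    have := pdLT_one_iff.1 hN
    have : Module.Free A N := Module.free_of_flat_of_isLocalRing
    obtain rfl : I = ⊥ := by
      rw [eq_bot_iff]
      intro x hx
      obtain ⟨i⟩ : Nonempty (Module.Free.ChooseBasisIndex A N) :=
        (Module.Free.chooseBasis A N).index_nonempty
      have h := Module.mem_annihilator.1 (hI hx) (Module.Free.chooseBasis A N i)
      simpa using congrArg (fun w => (Module.Free.chooseBasis A N).repr w i) h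
    rw [bot_sup_eq] at hm
    have := embDim_le_of_le_span hv hm
    let e := (Module.finBasis A N).equivFun.symm
    refine ⟨by lia, ⟨[], .nil A A, by simp, rfl⟩, _, e.toLinearMap, e.surjective,
      fun w => e.map_eq_zero_iff.trans (by simp [funext_iff])⟩
  | succ q ih =>
    obtain ⟨x₁, hx₁, hx₁2⟩ := exists_mem_notMem_sq hv hm (by lia)
    have hann : Module.annihilator A N ≤ maximalIdeal A := by
      refine le_maximalIdeal fun h => ?_
      exact not_subsingleton N (Module.annihilator_eq_top_iff.1 h)
    obtain ⟨z, hz, hzd⟩ := hN.exists_mem_nonZeroDivisors fun h => hx₁2 (by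
      have := hI hx₁
      rw [h] at this
      rw [(Submodule.mem_bot A).1 this]
      exact zero_mem _)
    obtain ⟨y, hy, hxy⟩ := exists_add_mem_nonZeroDivisors
      (J := maximalIdeal A * Module.annihilator A N) (Ideal.mul_mem_mul (hann hz) hz)
      (mul_mem hzd hzd) x₁
    have hy2 : y ∈ maximalIdeal A ^ 2 := by
      rw [pow_two]
      exact Ideal.mul_mono_right hann hy
    generalize hx' : x₁ + y = x at hxy
    have hx2 : x ∉ maximalIdeal A ^ 2 := fun h => hx₁2 ((Ideal.add_mem_iff_left _ hy2).1 (hx' ▸ h))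
    have hxN : x ∈ Module.annihilator A N :=
      hx' ▸ add_mem (hI hx₁) (Ideal.mul_le_right (I := maximalIdeal A) hy)
    have hxm := hann hxN
    let _ : Module (A ⧸ Ideal.span {x}) N := Module.IsTorsionBySet.module (I := Ideal.span {x}) (by
      rw [Module.isTorsionBySet_span_singleton_iff]
      exact fun n => Module.mem_annihilator.1 hxN n)
    have _ : IsScalarTower A (A ⧸ Ideal.span {x}) N := Module.IsTorsionBySet.isScalarTower _
    have hsmul : ∀ (a : A) (n : N), Ideal.Quotient.mk (Ideal.span {x}) a • n = a • n :=
      fun a n => algebraMap_smul (A ⧸ Ideal.span {x}) a n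
    have : Nontrivial (A ⧸ Ideal.span {x}) := Ideal.Quotient.nontrivial_iff.2 fun h =>
      (maximalIdeal.isMaximal A).ne_top (top_le_iff.1 (h ▸ (Ideal.span_singleton_le_iff_mem _).2 hxm))
    have : IsLocalRing (A ⧸ Ideal.span {x}) :=
      .of_surjective' (Ideal.Quotient.mk (Ideal.span {x})) Ideal.Quotient.mk_surjective
    have : Module.Finite (A ⧸ Ideal.span {x}) N := Module.Finite.of_restrictScalars_finite A _ _
    have hcm := Ideal.Quotient.comap_maximalIdeal (Ideal.span {x})
    have hed := embDim_le_embDim_quotient_add_one x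
    obtain ⟨heq, ⟨rs, hrs, hrsI, hlen⟩, b, π, hπ, hker⟩ := ih (hN.quotient hxy hx2)
      (I := I.map (Ideal.Quotient.mk (Ideal.span {x})))
      (Ideal.map_le_iff_le_comap.2 fun a ha => Module.mem_annihilator.2 fun n => by
        exact (hsmul a n).trans (Module.mem_annihilator.1 (hI ha) n))
      (v := fun i => Ideal.Quotient.mk (Ideal.span {x}) (v i))
      (fun i => Ideal.mem_comap.1 (hcm ▸ hv i)) (by
        rw [← Ideal.map_comap_of_surjective (Ideal.Quotient.mk (Ideal.span {x}))
          Ideal.Quotient.mk_surjective (maximalIdeal _), hcm]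
        refine (Ideal.map_mono hm).trans ?_
        rw [Ideal.map_sup, Ideal.map_span, ← Set.range_comp]
        rfl)
      (by lia)
    have hcI : (I.map (Ideal.Quotient.mk (Ideal.span {x}))).comap
        (Ideal.Quotient.mk (Ideal.span {x})) = I ⊔ Ideal.span {x} := by
      rw [Ideal.comap_map_of_surjective _ Ideal.Quotient.mk_surjective, ← RingHom.ker_eq_comap_bot,
        Ideal.mk_ker]
    have hb : Nonempty (Fin b) := by
      by_contra hb
      rw [not_nonempty_iff] at hb
      have := hπ.subsingleton
      exact not_subsingleton N this
    obtain ⟨i₀⟩ := hb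
    have hannI : Module.annihilator A N ≤ I ⊔ Ideal.span {x} := fun a ha => by
      rw [← hcI, Ideal.mem_comap]
      have := (hker fun _ => Ideal.Quotient.mk (Ideal.span {x}) a).1 (by
        have h1 : (fun _ : Fin b => Ideal.Quotient.mk (Ideal.span {x}) a) =
          Ideal.Quotient.mk (Ideal.span {x}) a • fun _ => 1 := by ext; simp
        rw [h1, map_smul, hsmul, Module.mem_annihilator.1 ha])
      exact this i₀
    have hIann : Module.annihilator A N ≤ I := by
      refine Submodule.le_of_le_smul_of_le_jacobson_bot (I := maximalIdeal A)
        (IsNoetherian.noetherian _) (maximalIdeal_le_jacobson _) (hannI.trans ?_)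
      refine sup_le le_sup_left ((Ideal.span_singleton_le_iff_mem _).2 ?_)
      rw [← hx']
      exact add_mem (Ideal.mem_sup_left hx₁) (Ideal.mem_sup_right hy)
    have hxI := hIann hxN
    have hIsup : I ⊔ Ideal.span {x} = I := sup_eq_left.2 ((Ideal.span_singleton_le_iff_mem _).2 hxI)
    obtain ⟨l, rfl⟩ := (List.map_surjective_iff.2
      (Ideal.Quotient.mk_surjective (I := Ideal.span {x}))) rs
    refine ⟨by lia, ⟨x :: l, isRegular_cons_of_quotient hxy hrs, ?_, by simpa using hlen⟩, b,
      π.restrictScalars A ∘ₗ (Algebra.linearMap A (A ⧸ Ideal.span {x})).compLeft (Fin b),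
      hπ.comp fun w => ?_, fun w => ?_⟩
    · rw [← Ideal.map_ofList] at hrsI
      have := congrArg (Ideal.comap (Ideal.Quotient.mk (Ideal.span {x}))) hrsI
      rw [hcI, hIsup, Ideal.comap_map_of_surjective _ Ideal.Quotient.mk_surjective,
        ← RingHom.ker_eq_comap_bot, Ideal.mk_ker, sup_comm] at this
      rw [← this, Ideal.ofList_cons]
    · choose w' hw' using fun i => Ideal.Quotient.mk_surjective (w i)
      exact ⟨w', funext hw'⟩
    · refine (hker _).trans (forall_congr' fun i => ?_)
      exact Ideal.mem_comap.symm.trans (by rw [hcI, hIsup])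

end Structure

section CotIndep

open TensorProduct IsLocalRing

theorem algebraMap_notMem_map_of_flat {B A : Type*} [CommRing B] [CommRing A] [Algebra B A]
    [Module.Flat B A] {𝔪 J : Ideal B} [h𝔪 : 𝔪.IsMaximal] (hA : 𝔪.map (algebraMap B A) ≠ ⊤)
    {a : B} (ha : a ∉ J) (haJ : ∀ b ∈ 𝔪, a * b ∈ J) : algebraMap B A a ∉ J.map (algebraMap B A) := by
  intro hmem
  let φ : (B ⧸ 𝔪) →ₗ[B] (B ⧸ J) :=
    Submodule.mapQ 𝔪 J (LinearMap.mulLeft B a) (fun b hb => haJ b hb)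
  have hφ : Function.Injective φ := by
    rw [injective_iff_map_eq_zero]
    intro x hx
    obtain ⟨b, rfl⟩ := Submodule.Quotient.mk_surjective _ x
    have hb : a * b ∈ J := (Submodule.Quotient.mk_eq_zero J).mp hx
    by_contra hne
    have hb𝔪 : b ∉ 𝔪 := fun h => hne ((Submodule.Quotient.mk_eq_zero 𝔪).mpr h)
    obtain ⟨y, hy⟩ := h𝔪.exists_inv hb𝔪
    obtain ⟨i, hi, hyi⟩ := hy
    refine ha ?_
    have : a = (a * b) * y + a * i := by linear_combination (-a) * hyi
    rw [this]
    exact J.add_mem (J.mul_mem_right _ hb) (haJ i hi)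
  have hinj : Function.Injective (φ.lTensor A) := Module.Flat.lTensor_preserves_injective_linearMap φ hφ
  have h0 : φ.lTensor A ((1 : A) ⊗ₜ Submodule.Quotient.mk 1) = 0 := by
    apply (tensorQuotEquivQuotSMul A J).injective
    rw [map_zero, LinearMap.lTensor_tmul]
    change (tensorQuotEquivQuotSMul A J) ((1 : A) ⊗ₜ[B] Ideal.Quotient.mk J (a * 1)) = 0
    rw [tensorQuotEquivQuotSMul_tmul_mk, Submodule.Quotient.mk_eq_zero, mul_one,
      Ideal.smul_top_eq_map, Algebra.smul_def, mul_one]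
    exact hmem
  have h1 := hinj (h0.trans (map_zero _).symm)
  have h2 := congrArg (tensorQuotEquivQuotSMul A 𝔪) h1
  change (tensorQuotEquivQuotSMul A 𝔪) ((1 : A) ⊗ₜ[B] Ideal.Quotient.mk 𝔪 1) = _ at h2
  rw [tensorQuotEquivQuotSMul_tmul_mk, map_zero, Submodule.Quotient.mk_eq_zero, one_smul,
    Ideal.smul_top_eq_map] at h2
  exact hA ((Ideal.eq_top_iff_one _).mpr h2)

theorem CotIndep.map_of_flat {B A : Type*} [CommRing B] [CommRing A] [Algebra B A]
    [Module.Flat B A] {𝔪 : Ideal B} [h𝔪 : 𝔪.IsMaximal] (hA : 𝔪.map (algebraMap B A) ≠ ⊤)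
    {ws : List B} (h : CotIndep 𝔪 ws) :
    CotIndep (𝔪.map (algebraMap B A)) (ws.map (algebraMap B A)) := by
  induction ws with
  | nil => trivial
  | cons w ws ih =>
    obtain ⟨⟨hw, hn⟩, hws⟩ := h
    refine ⟨⟨Ideal.mem_map_of_mem _ hw, ?_⟩, ih hws⟩
    rw [← Ideal.map_pow, ← Ideal.map_ofList, ← Ideal.map_sup]
    exact algebraMap_notMem_map_of_flat hA hn fun b hb =>
      le_sup_left (a := 𝔪 ^ 2) (by rw [pow_two]; exact Ideal.mul_mem_mul hw hb)

theorem CotIndep.length_le_embDim {A : Type u} [CommRing A] [IsLocalRing A] [IsNoetherianRing A]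
    {ws : List A} (h : CotIndep (maximalIdeal A) ws) : ws.length ≤ embDim A := by
  suffices H : ∃ V : Submodule (ResidueField A) (CotangentSpace A),
      ws.length ≤ Module.finrank (ResidueField A) V ∧ ∀ x : maximalIdeal A,
        (maximalIdeal A).toCotangent x ∈ V → (x : A) ∈ maximalIdeal A ^ 2 ⊔ Ideal.ofList ws by
    obtain ⟨V, hV, -⟩ := H
    exact hV.trans V.finrank_le
  induction ws with
  | nil =>
    refine ⟨⊥, by simp, fun x hx => ?_⟩
    rw [Submodule.mem_bot, Ideal.toCotangent_eq_zero] at hx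
    exact le_sup_left (a := maximalIdeal A ^ 2) hx
  | cons w ws ih =>
    obtain ⟨⟨hw, hn⟩, hws⟩ := h
    obtain ⟨V, hV, hVx⟩ := ih hws
    let t : CotangentSpace A := (maximalIdeal A).toCotangent ⟨w, hw⟩
    have ht : t ∉ V := fun ht => hn (hVx ⟨w, hw⟩ ht)
    refine ⟨V ⊔ Submodule.span (ResidueField A) {t}, ?_, ?_⟩
    · have hlt : V < V ⊔ Submodule.span (ResidueField A) {t} := by
        refine lt_of_le_of_ne le_sup_left fun heq => ht ?_
        rw [heq]
        exact le_sup_right (a := V) (Submodule.mem_span_singleton_self t)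
      have := Submodule.finrank_lt_finrank_of_lt hlt
      rw [List.length_cons]
      omega
    · intro x hx
      obtain ⟨v, hv, y, hy, hxy⟩ := Submodule.mem_sup.mp hx
      obtain ⟨c, rfl⟩ := Submodule.mem_span_singleton.mp hy
      obtain ⟨c, rfl⟩ := residue_surjective c
      have hv' : (maximalIdeal A).toCotangent (x - c • ⟨w, hw⟩) = v := by
        rw [map_sub, map_smul, ← hxy]
        exact add_sub_cancel_right v _
      have := hVx (x - c • ⟨w, hw⟩) (hv' ▸ hv)
      have h2 : (x : A) = (x - c • ⟨w, hw⟩ : maximalIdeal A) + c * w := by simp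
      rw [h2, Ideal.ofList_cons]
      refine Ideal.add_mem _ ((sup_le_sup_left le_sup_right (maximalIdeal A ^ 2) :) this) ?_
      exact le_sup_right (a := maximalIdeal A ^ 2) (le_sup_left (a := Ideal.span {w})
        (Ideal.mul_mem_left _ _ (Ideal.mem_span_singleton_self w)))

theorem exists_cotIndep (R : Type u) [CommRing R] [IsLocalRing R] [IsNoetherianRing R] :
    ∃ ws : List R, CotIndep (maximalIdeal R) ws ∧ Ideal.ofList ws = maximalIdeal R ∧
      ws.length = embDim R := by
  obtain ⟨s, hs, hsp⟩ := (IsNoetherian.noetherian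
    (maximalIdeal R)).exists_span_finset_card_eq_spanFinrank
  have hlist : Ideal.ofList s.toList = maximalIdeal R := by
    rw [← hsp]
    change Ideal.span _ = Ideal.span _
    congr 1
    ext
    simp
  have hlen : s.toList.length = embDim R := by
    rw [Finset.length_toList, hs, embDim_eq_spanFinrank]
  refine ⟨s.toList, ?_, hlist, hlen⟩
  suffices H : ∀ pre ws : List R, Ideal.ofList (pre ++ ws) = maximalIdeal R →
      (pre ++ ws).length = embDim R → CotIndep (maximalIdeal R) ws from
    H [] _ hlist hlen
  classical
  intro pre ws
  induction ws generalizing pre with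
  | nil => intros; trivial
  | cons w ws ih =>
    intro h1 h2
    refine ⟨⟨?_, fun hw => ?_⟩, ih (pre ++ [w]) (by simpa using h1) (by simpa using h2)⟩
    · rw [← h1]
      exact Ideal.subset_span (by simp)
    · have hle : maximalIdeal R ≤ Ideal.ofList (pre ++ ws) := by
        refine Submodule.le_of_le_smul_of_le_jacobson_bot (I := maximalIdeal R)
          (IsNoetherian.noetherian _) (maximalIdeal_le_jacobson _) ?_
        rw [smul_eq_mul, ← pow_two, sup_comm]
        conv_lhs => rw [← h1]
        rw [Ideal.ofList_append, Ideal.ofList_cons, Ideal.ofList_append]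
        refine sup_le (le_sup_left.trans le_sup_right) (sup_le ?_ (le_sup_right.trans le_sup_right))
        rw [Ideal.span_singleton_le_iff_mem]
        exact (sup_le_sup_left le_sup_right (maximalIdeal R ^ 2) :) hw
      have heq : maximalIdeal R = Ideal.span (pre ++ ws).toFinset := by
        have : Ideal.span ((pre ++ ws).toFinset : Set R) = Ideal.ofList (pre ++ ws) := by
          change Ideal.span _ = Ideal.span _
          congr 1
          ext
          simp
        rw [this]
        refine le_antisymm hle ?_
        rw [← h1, Ideal.ofList_append, Ideal.ofList_append, Ideal.ofList_cons]
        exact sup_le_sup_left le_sup_right _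
      have h3 := embDim_le_ncard (Finset.finite_toSet _) heq
      rw [Set.ncard_coe_finset] at h3
      have h4 := (pre ++ ws).toFinset_card_le
      simp only [List.length_append, List.length_cons] at h2 h4
      omega

end CotIndep

section AdicModule

open TensorProduct IsLocalRing

variable {S : Type u} [CommRing S] [IsLocalRing S] [IsNoetherianRing S]

/-- A torsion module over a local ring is a module over the completion. -/
theorem IsTors.exists_module_adicCompletion {M : Type u} [AddCommGroup M] [Module S M]
    (hM : IsTors (maximalIdeal S) M) :
    ∃ _ : Module (AdicCompletion (maximalIdeal S) S) M,
      IsScalarTower S (AdicCompletion (maximalIdeal S) S) M := by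
  have _ : Module.Flat S (AdicCompletion (maximalIdeal S) S) :=
    AdicCompletion.flat_of_isNoetherian _
  have _ : Module.FaithfullyFlat S (AdicCompletion (maximalIdeal S) S) :=
    Module.FaithfullyFlat.of_flat_of_isLocalHom
  have hfg : (maximalIdeal S).FG := IsNoetherian.noetherian _
  let i : M →ₗ[S] AdicCompletion (maximalIdeal S) S ⊗[S] M := TensorProduct.mk S _ M 1
  have hi : Function.Injective i :=
    Module.FaithfullyFlat.tensorProduct_mk_injective (A := S)
      (B := AdicCompletion (maximalIdeal S) S) M
  have hs : Function.Surjective i := by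
    intro x
    induction x with
    | zero => exact ⟨0, map_zero _⟩
    | add x y hx hy =>
      obtain ⟨x, rfl⟩ := hx
      obtain ⟨y, rfl⟩ := hy
      exact ⟨x + y, map_add _ _ _⟩
    | tmul t m =>
      obtain ⟨n, hn⟩ := hM m
      obtain ⟨s, hs⟩ := Submodule.Quotient.mk_surjective _ (AdicCompletion.eval (maximalIdeal S) S n t)
      have hker : t - AdicCompletion.of (maximalIdeal S) S s ∈
          (maximalIdeal S ^ n • ⊤ : Submodule S (AdicCompletion (maximalIdeal S) S)) := by
        rw [AdicCompletion.pow_smul_top_eq_ker_eval hfg, LinearMap.mem_ker, map_sub, ← hs,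
          sub_eq_zero]
        rfl
      have hzero : ∀ y ∈ (maximalIdeal S ^ n • ⊤ : Submodule S (AdicCompletion (maximalIdeal S) S)),
          y ⊗ₜ[S] m = 0 := by
        intro y hy
        refine Submodule.smul_induction_on hy (fun r hr z _ => ?_) fun x y hx hy => ?_
        · rw [TensorProduct.smul_tmul, hn r hr, TensorProduct.tmul_zero]
        · rw [TensorProduct.add_tmul, hx, hy, add_zero]
      refine ⟨s • m, ?_⟩
      have h1 := hzero _ hker
      rw [TensorProduct.sub_tmul, sub_eq_zero] at h1
      rw [h1, map_smul]
      change s • ((1 : AdicCompletion (maximalIdeal S) S) ⊗ₜ[S] m) = _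
      rw [TensorProduct.smul_tmul', ← Algebra.algebraMap_eq_smul_one]
      rfl
  let e := LinearEquiv.ofBijective i ⟨hi, hs⟩
  exact ⟨e.toAddEquiv.module _, e.isScalarTower _⟩

end AdicModule

section Surjective

variable {A T : Type u} [CommRing A] [CommRing T] [Algebra A T]

theorem IsArtinian.of_surjective_algebraMap {M : Type*} [AddCommGroup M] [Module A M] [Module T M]
    [IsScalarTower A T M] (hs : Function.Surjective (algebraMap A T)) (h : IsArtinian T M) :
    IsArtinian A M := by
  have _ : RingHomSurjective (algebraMap A T) := ⟨hs⟩
  let l : M →ₛₗ[algebraMap A T] M :=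
    { toFun := id
      map_add' := fun _ _ => rfl
      map_smul' := fun a m => (algebraMap_smul T a m).symm }
  exact (l.isArtinian_iff_of_bijective Function.bijective_id).mpr h

/-- The submodule of an injective module annihilated by the kernel of a surjection of rings
is injective over the target. -/
theorem Module.Injective.of_surjective_algebraMap {M Q : Type u} [AddCommGroup M] [Module A M]
    [Module T M] [IsScalarTower A T M] [AddCommGroup Q] [Module A Q]
    (hs : Function.Surjective (algebraMap A T)) (hQ : Module.Injective A Q)
    {j : M →ₗ[A] Q} (hj : Function.Injective j)
    (hrange : ∀ q : Q, (∀ a, algebraMap A T a = 0 → a • q = 0) → ∃ m, j m = q) :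
    Module.Injective T M := by
  refine ⟨fun X Y _ _ _ _ i hi f => ?_⟩
  let _ : Module A X := Module.compHom X (algebraMap A T)
  let _ : Module A Y := Module.compHom Y (algebraMap A T)
  have _ : IsScalarTower A T X := .of_algebraMap_smul fun _ _ => rfl
  have _ : IsScalarTower A T Y := .of_algebraMap_smul fun _ _ => rfl
  obtain ⟨g, hg⟩ := hQ.extend (i := i.restrictScalars A) hi (j ∘ₗ f.restrictScalars A)
  have hlift : ∀ y, ∃ m, j m = g y := fun y => hrange _ fun a ha => by
    rw [← map_smul, ← algebraMap_smul T a y, ha, zero_smul, map_zero]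
  let g' : Y →ₗ[A] M := (LinearEquiv.ofInjective j hj).symm ∘ₗ g.codRestrict (LinearMap.range j) hlift
  have hg' : ∀ y, j (g' y) = g y := fun y =>
    congrArg Subtype.val ((LinearEquiv.ofInjective j hj).apply_symm_apply _)
  refine ⟨g'.extendScalarsOfSurjective hs, fun x => hj ?_⟩
  exact (hg' _).trans (LinearMap.congr_fun hg x)

end Surjective

section Assembly

open TensorProduct IsLocalRing RingTheory.Sequence

theorem ResLE.mono {A : Type u} [CommRing A] {P Q : ModuleCat.{u} A → Prop}
    (hPQ : ∀ X, P X → Q X) {n : ℕ} {X : Type u} [AddCommGroup X] [Module A X]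
    (h : ResLE P n X) : ResLE Q n X := by
  induction n generalizing X with
  | zero => exact hPQ _ h
  | succ n ih =>
    obtain ⟨F, X', f, g, h1, h2, h3⟩ := h
    exact ⟨F, X', f, g, h1, h2, ih h3⟩

variable {A : Type u} [CommRing A] [IsLocalRing A] [IsNoetherianRing A]

theorem IsMatlis.exists_isRegular_and_injective [IsAdicComplete (maximalIdeal A) A]
    {E : Type u} [AddCommGroup E] [Module A E] {e : E} (hE : IsMatlis (maximalIdeal A) E e)
    {T : Type u} [CommRing T] [Algebra A T] (hs : Function.Surjective (algebraMap A T))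
    {M : Type u} [AddCommGroup M] [Module A M] [Module T M] [IsScalarTower A T M] [Nontrivial M]
    [IsArtinian A M] {p k : ℕ} (hN : PdLT A (p + 1) (M →ₗ[A] E)) {v : Fin k → A}
    (hv : ∀ i, v i ∈ maximalIdeal A)
    (hm : maximalIdeal A ≤ RingHom.ker (algebraMap A T) ⊔ Ideal.span (Set.range v))
    (hle : p + k ≤ embDim A) :
    p + k = embDim A ∧ (∃ rs : List A, IsRegular A rs ∧
      Ideal.ofList rs = RingHom.ker (algebraMap A T) ∧ rs.length = p) ∧ Module.Injective T M := by
  obtain ⟨_, hbij⟩ := hE.exists_dual (isTors_of_isArtinian (A := A) (X := M))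
  have _ : Nontrivial (M →ₗ[A] E) := by
    by_contra hcon
    rw [not_nontrivial_iff_subsingleton] at hcon
    have : Subsingleton M := ⟨fun a b => hbij.1 (LinearMap.ext fun n => by
      rw [Subsingleton.elim n 0, map_zero, map_zero])⟩
    exact not_subsingleton M this
  have hI : RingHom.ker (algebraMap A T) ≤ Module.annihilator A (M →ₗ[A] E) := by
    intro a ha
    rw [Module.mem_annihilator]
    refine fun n => LinearMap.ext fun m => ?_
    rw [LinearMap.smul_apply, ← map_smul, ← algebraMap_smul T a m, show algebraMap A T a = 0 from ha,
      zero_smul, map_zero, LinearMap.zero_apply]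
  obtain ⟨h1, h2, b, π, hπ, hker⟩ := hN.exists_isRegular hI hv hm hle
  refine ⟨h1, h2, ?_⟩
  have _ : Module.Injective A E := hE.tinj.inj
  let j : M →ₗ[A] (Fin b → E) := LinearMap.pi fun i => π (Pi.single i 1)
  refine Module.Injective.of_surjective_algebraMap (A := A) (Q := Fin b → E) hs
    (Module.Injective.pi A (fun _ => E)) (j := j) ?_ ?_
  · rw [injective_iff_map_eq_zero]
    intro m hjm
    refine hbij.1 (LinearMap.ext fun n => ?_)
    obtain ⟨w, rfl⟩ := hπ n
    rw [map_zero, LinearMap.zero_apply]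
    change π w m = 0
    have hz : LinearMap.applyₗ m ∘ₗ π = 0 := by
      refine LinearMap.pi_ext' fun i => LinearMap.ext_ring ?_
      exact congrFun hjm i
    exact LinearMap.congr_fun hz w
  · intro q hq
    let ψ : (Fin b → A) →ₗ[A] E := Fintype.linearCombination A q
    have hle : LinearMap.ker π ≤ LinearMap.ker ψ := by
      intro w hw
      rw [LinearMap.mem_ker, hker] at hw
      rw [LinearMap.mem_ker, Fintype.linearCombination_apply]
      exact Finset.sum_eq_zero fun i _ => congrFun (hq (w i) (hw i)) i
    obtain ⟨m, hm⟩ := hbij.2 ((LinearMap.ker π).liftQ ψ hle ∘ₗ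
      (π.quotKerEquivOfSurjective hπ).symm.toLinearMap)
    refine ⟨m, funext fun i => ?_⟩
    have hmi := LinearMap.congr_fun hm (π (Pi.single i 1))
    have hsymm : (π.quotKerEquivOfSurjective hπ).symm (π (Pi.single i 1)) =
        Submodule.Quotient.mk (Pi.single i 1) := by
      rw [LinearEquiv.symm_apply_eq]
      rfl
    rw [LinearMap.comp_apply, LinearEquiv.coe_coe, hsymm, Submodule.liftQ_apply] at hmi
    rw [Fintype.linearCombination_apply_single, one_smul] at hmi
    exact hmi

theorem TR.free_of_surjective {B S T : Type u} [CommRing B] [CommRing S] [CommRing T] [Nontrivial T]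
    [Algebra B S] [Algebra B A] [Module.Flat B A] {𝔪 : Ideal B}
    (h𝔪 : 𝔪.map (algebraMap B A) = maximalIdeal A) [Algebra A T] [Algebra B T] [Algebra S T]
    [Module.Flat S T] [IsScalarTower B A T] [IsScalarTower B S T]
    (hs : Function.Surjective (algebraMap A T)) {d : ℕ} (hd : TorLE B d S)
    (hT : ∀ X : ModuleCat.{u} T, TR T X → Module.Free T X)
    {G : Type u} [AddCommGroup G] [Module A G] (hG : TR A G) : Module.Free A G := by
  have _ : Module.Finite A T := Module.Finite.of_surjective (Algebra.linearMap A T) hs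
  have h1 : TorLE B d T := hd.of_algebra
  have h2 := h1.resLE (A := A) h𝔪
  exact hG.free_of_baseChange hs h2.torLE (hT (ModuleCat.of T (T ⊗[A] G)) (hG.baseChange h2))

/-- Over a complete cover the Matlis dual of a module of finite Gorenstein injective dimension has
finite projective dimension if totally reflexive modules are free. -/
theorem gd.pdLT {B : Type u} [CommRing B] [IsNoetherianRing B] [Algebra B A] [Module.Flat B A]
    [IsAdicComplete (maximalIdeal A) A] {𝔪 : Ideal B} [𝔪.IsMaximal]
    (h𝔪 : 𝔪.map (algebraMap B A) = maximalIdeal A)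
    (hTR : ∀ X : ModuleCat.{u} A, TR A X → Module.Free A X) {E₁ : Type u} [AddCommGroup E₁]
    [Module B E₁] {e₁ : E₁} (hE₁ : IsMatlis 𝔪 E₁ e₁) {M : Type u} [AddCommGroup M] [Module A M]
    [Module B M] [IsScalarTower B A M] [IsArtinian A M] {p : ℕ} (hp : gd 𝔪 p M) :
    PdLT A (p + 1) (M →ₗ[A] A ⊗[B] E₁) := by
  have hE : IsMatlis (maximalIdeal A) (A ⊗[B] E₁) (1 ⊗ₜ e₁) := hE₁.baseChange h𝔪
  obtain ⟨_, hbij⟩ := hE.exists_dual (isTors_of_isArtinian (A := A) (X := M))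
  have hgd : gd 𝔪 p ((M →ₗ[A] A ⊗[B] E₁) →ₗ[A] A ⊗[B] E₁) :=
    hp.of_equiv ((LinearEquiv.ofBijective _ hbij).restrictScalars B)
  have hres := resLE_of_gd (N := M →ₗ[A] A ⊗[B] E₁) hE₁ hE (TInj.of_flat h𝔪.le hE.tinj)
    (TensorProduct.isBaseChange B E₁ A) hgd
  refine ResLE.pdLT (hres.mono fun X hX => ?_)
  have := hTR X hX
  have := hX.fin
  exact FinProj.of_free

end Assembly

section Fibre

open TensorProduct IsLocalRing RingTheory.Sequence

theorem ringKrullDim_eq_add_of_flat (R A : Type u) [CommRing R] [CommRing A] [IsLocalRing R]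
    [IsLocalRing A] [IsNoetherianRing R] [IsNoetherianRing A] [Algebra R A] [Module.Flat R A]
    [IsLocalHom (algebraMap R A)] :
    ringKrullDim A =
      ringKrullDim R + ringKrullDim (A ⧸ (maximalIdeal R).map (algebraMap R A)) := by
  have hle : (maximalIdeal R).map (algebraMap R A) ≤ maximalIdeal A :=
    ((local_hom_TFAE (algebraMap R A)).out 0 2).mp ‹_›
  have _ : Nontrivial (A ⧸ (maximalIdeal R).map (algebraMap R A)) :=
    Ideal.Quotient.nontrivial_iff.mpr (ne_top_of_le_ne_top Ideal.IsPrime.ne_top' hle)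
  have _ : IsLocalRing (A ⧸ (maximalIdeal R).map (algebraMap R A)) :=
    .of_surjective' _ Ideal.Quotient.mk_surjective
  have hcomap : (maximalIdeal A).comap (algebraMap R A) = maximalIdeal R :=
    ((local_hom_TFAE (algebraMap R A)).out 0 4).mp ‹_›
  have _ : (maximalIdeal A).LiesOver (maximalIdeal R) := ⟨hcomap.symm⟩
  have h := Ideal.height_eq_height_add_of_liesOver_of_hasGoingDown (maximalIdeal R) (maximalIdeal A)
  have hmap : (maximalIdeal A).map (Ideal.Quotient.mk ((maximalIdeal R).map (algebraMap R A))) =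
      maximalIdeal _ := by
    rw [← Ideal.Quotient.comap_maximalIdeal ((maximalIdeal R).map (algebraMap R A)),
      Ideal.map_comap_of_surjective _ Ideal.Quotient.mk_surjective]
  rw [hmap] at h
  rw [← maximalIdeal_height_eq_ringKrullDim, h, WithBot.coe_add,
    maximalIdeal_height_eq_ringKrullDim, maximalIdeal_height_eq_ringKrullDim]

theorem ringKrullDim_adicCompletion (S : Type u) [CommRing S] [IsLocalRing S] [IsNoetherianRing S] :
    ringKrullDim (AdicCompletion (maximalIdeal S) S) = ringKrullDim S := by
  have _ : Module.Flat S (AdicCompletion (maximalIdeal S) S) :=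
    AdicCompletion.flat_of_isNoetherian _
  have _ := AdicCompletion.isNoetherianRing_self (K := maximalIdeal S)
  rw [ringKrullDim_eq_add_of_flat S, ← AdicCompletion.maximalIdeal_eq_map,
    ringKrullDim_eq_zero_of_isField ((Ideal.Quotient.maximal_ideal_iff_isField_quotient _).mp
      inferInstance), add_zero]

theorem isRegularLocal_fibre_and_ringKrullDim {R B A : Type u} [CommRing R] [CommRing B]
    [CommRing A] [IsLocalRing R] [IsLocalRing A] [IsNoetherianRing R] [IsNoetherianRing A]
    [Algebra R B] [Algebra B A] [Algebra R A] [IsScalarTower R B A] [Module.Flat R B]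
    [Module.Flat B A] {zs : List B}
    (hreg : IsWeaklyRegular (B ⊗[R] (R ⧸ maximalIdeal R)) zs)
    (hA : ((maximalIdeal R).map (algebraMap R B) ⊔ Ideal.ofList zs).map (algebraMap B A) =
      maximalIdeal A) :
    IsRegularLocal (A ⧸ (maximalIdeal R).map (algebraMap R A)) ∧
      ringKrullDim A = ringKrullDim R + zs.length := by
  rw [Ideal.map_sup, Ideal.map_map, ← IsScalarTower.algebraMap_eq, Ideal.map_ofList] at hA
  have hle : (maximalIdeal R).map (algebraMap R A) ≤ maximalIdeal A := hA ▸ le_sup_left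
  have _ : IsLocalHom (algebraMap R A) := (local_hom_TFAE (algebraMap R A)).out 0 2 |>.mpr hle
  have _ : Module.Flat R A := Module.Flat.trans R B A
  let F := A ⧸ (maximalIdeal R).map (algebraMap R A)
  have _ : Nontrivial F :=
    Ideal.Quotient.nontrivial_iff.mpr (ne_top_of_le_ne_top Ideal.IsPrime.ne_top' hle)
  have hloc : IsLocalRing F := .of_surjective' _ Ideal.Quotient.mk_surjective
  let L : List F := (zs.map (algebraMap B A)).map (algebraMap A F)
  have hL : Ideal.ofList L = maximalIdeal F := by
    rw [← Ideal.map_comap_of_surjective (algebraMap A F) Ideal.Quotient.mk_surjective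
      (maximalIdeal F), Ideal.Quotient.algebraMap_eq, Ideal.Quotient.comap_maximalIdeal, ← hA,
      Ideal.map_sup, Ideal.map_quotient_self, bot_sup_eq, Ideal.map_ofList]
    rfl
  have hw : IsWeaklyRegular F L := by
    have h1 : IsWeaklyRegular (A ⊗[B] (B ⊗[R] (R ⧸ maximalIdeal R))) (zs.map (algebraMap B A)) :=
      hreg.of_flat_of_isBaseChange (TensorProduct.isBaseChange B _ A)
    rw [isWeaklyRegular_map_algebraMap_iff,
      (Algebra.TensorProduct.quotIdealMapEquivTensorQuot A
        (maximalIdeal R)).toLinearEquiv.isWeaklyRegular_congr,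
      ← (TensorProduct.AlgebraTensorModule.cancelBaseChange R B A A
        (R ⧸ maximalIdeal R)).isWeaklyRegular_congr]
    exact h1
  have hr : IsRegular F L := by
    refine ⟨hw, ?_⟩
    rw [hL, smul_eq_mul, Ideal.mul_top]
    exact Ideal.IsPrime.ne_top'.symm
  refine ⟨⟨inferInstance, hloc, L, hr, hL⟩, ?_⟩
  have hdim := ringKrullDim_add_length_eq_ringKrullDim_of_isRegular L hr
  have _ : (Ideal.ofList L).IsMaximal := hL ▸ inferInstance
  rw [ringKrullDim_eq_zero_of_isField ((Ideal.Quotient.maximal_ideal_iff_isField_quotient _).mp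
      inferInstance), zero_add] at hdim
  rw [ringKrullDim_eq_add_of_flat R A, ← hdim, List.length_map, List.length_map]

end Fibre

section Assembly

open TensorProduct IsLocalRing RingTheory.Sequence

theorem IsTors.of_map_le {R S M : Type u} [CommRing R] [CommRing S] [Algebra R S] [AddCommGroup M]
    [Module R M] [Module S M] [IsScalarTower R S M] {𝔪 : Ideal R} {𝔫 : Ideal S}
    (h : 𝔪.map (algebraMap R S) ≤ 𝔫) (hM : IsTors 𝔫 M) : IsTors 𝔪 M := fun x => by
  obtain ⟨n, hn⟩ := hM x
  refine ⟨n, fun r hr => ?_⟩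
  rw [← algebraMap_smul S r x]
  refine hn _ (Ideal.pow_right_mono h n ?_)
  rw [← Ideal.map_pow]
  exact Ideal.mem_map_of_mem _ hr

namespace Tower

variable {R S M : Type u} [CommRing R] [CommRing S] [Algebra R S] [AddCommGroup M] [Module S M]
  {ys : List S} {ws : List R} {p d : ℕ}

section Ideal

variable {𝔪 : Ideal R} (t : Tower R S M 𝔪 ys ws p d)

/-- The ideal of the top of a tower lying over `𝔪` and containing the adjoined elements. -/
def ideal : Ideal t.B := 𝔪.map (algebraMap R t.B) ⊔ Ideal.ofList t.zs

theorem ideal_isMaximal [𝔪.IsMaximal] : t.ideal.IsMaximal := by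
  have h := t.comap_π
  rw [ideal, ← h]
  exact Ideal.comap_isMaximal_of_surjective t.π fun r =>
    ⟨algebraMap R t.B r, by rw [AlgHom.commutes]; rfl⟩

theorem map_ideal : t.ideal.map (algebraMap t.B S) =
    𝔪.map (algebraMap R S) ⊔ Ideal.ofList ys := by
  rw [ideal, Ideal.map_sup, Ideal.map_map, ← IsScalarTower.algebraMap_eq, Ideal.map_ofList,
    t.map_zs]

end Ideal

variable [IsLocalRing R] (t : Tower R S M (maximalIdeal R) ys ws p d)
  {A T : Type u} [CommRing A] [IsLocalRing A] [IsNoetherianRing A] [Algebra t.B A] [CommRing T]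
  [Algebra A T] [Algebra t.B T] [Algebra S T] [IsScalarTower t.B A T] [IsScalarTower t.B S T]
  [Module.Flat t.B A]

theorem exists_isRegular_and_injective [IsAdicComplete (maximalIdeal A) A]
    (hA : t.ideal.map (algebraMap t.B A) = maximalIdeal A)
    (hys : (maximalIdeal R).map (algebraMap R S) ≤ Ideal.ofList ys)
    [Module.Flat S T] [Nontrivial T] (hs : Function.Surjective (algebraMap A T))
    (hT : ∀ X : ModuleCat.{u} T, TR T X → Module.Free T X)
    [Module A M] [Module T M] [IsScalarTower A T M] [IsScalarTower t.B A M] [Nontrivial M]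
    [IsArtinian A M] (hle : p ≤ ws.length) :
    p = ws.length ∧ (∃ rs : List A, IsRegular A rs ∧
      Ideal.ofList rs = RingHom.ker (algebraMap A T) ∧ rs.length = p) ∧ Module.Injective T M := by
  have _ := t.noeth
  have _ := t.ideal_isMaximal
  obtain ⟨E₁, e₁, hE₁⟩ := exists_isMatlis t.ideal
  have hpd : PdLT A (p + 1) (M →ₗ[A] A ⊗[t.B] E₁) :=
    gd.pdLT hA (fun X hX => TR.free_of_surjective hA hs t.torLE hT hX) hE₁ t.gd
  have hind : CotIndep (maximalIdeal A)
      ((t.zs ++ ws.map (algebraMap R t.B)).map (algebraMap t.B A)) := by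
    rw [← hA]
    exact CotIndep.map_of_flat (hA ▸ Ideal.IsPrime.ne_top') t.indep
  have hemb : t.zs.length + ws.length ≤ embDim A := by
    simpa only [List.length_map, List.length_append] using hind.length_le_embDim
  have hm : maximalIdeal A ≤ RingHom.ker (algebraMap A T) ⊔
      Ideal.span (Set.range fun i => algebraMap t.B A (t.zs.get i)) := by
    have hspan : Ideal.span (Set.range fun i => algebraMap t.B A (t.zs.get i)) =
        (Ideal.ofList t.zs).map (algebraMap t.B A) := by
      rw [Ideal.ofList, Ideal.map_span]
      congr 1
      ext x
      simp [List.mem_iff_get]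
    rw [hspan, sup_comm, ← Ideal.comap_map_of_surjective' _ hs, ← Ideal.map_le_iff_le_comap, ← hA,
      Ideal.map_map, Ideal.map_map, ← IsScalarTower.algebraMap_eq,
      IsScalarTower.algebraMap_eq t.B S T, ← Ideal.map_map, ← Ideal.map_map, t.map_ideal,
      Ideal.map_ofList, t.map_zs, sup_eq_right.mpr hys]
  obtain ⟨h1, h2, h3⟩ := (hE₁.baseChange hA).exists_isRegular_and_injective hs hpd
    (fun i => hA ▸ Ideal.mem_map_of_mem _ (Ideal.mem_sup_right
      (Ideal.subset_span (List.get_mem t.zs i)))) hm (by omega)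
  exact ⟨by omega, h2, h3⟩

end Tower

end Assembly

section Assembly

open TensorProduct IsLocalRing RingTheory.Sequence

theorem ringKrullDim_add_length_of_ker {A T : Type u} [CommRing A] [IsNoetherianRing A]
    [IsLocalRing A] [CommRing T] (h : A →+* T) (hs : Function.Surjective h) {rs : List A}
    (hrs : IsRegular A rs) (hker : Ideal.ofList rs = RingHom.ker h) :
    ringKrullDim T + rs.length = ringKrullDim A := by
  rw [← ringKrullDim_add_length_eq_ringKrullDim_of_isRegular rs hrs, hker,
    ringKrullDim_eq_of_ringEquiv (RingHom.quotientKerEquivOfSurjective hs)]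

theorem isExceptionalCIMap_of_gidLE {R S M : Type u} [CommRing R] [CommRing S] [IsLocalRing R]
    [IsLocalRing S] [IsNoetherianRing R] [IsNoetherianRing S] [Algebra R S]
    [IsLocalHom (algebraMap R S)] [AddCommGroup M] [Module R M] [Module S M] [IsScalarTower R S M]
    [Nontrivial M] [hart : IsArtinian S M] (hS : IsGRegular S) {d g : ℕ} (hd : fdLE R d S)
    (hg : gidLE R g M) (hle : g + embDim S ≤ embDim R) :
    g + embDim S = embDim R ∧ Module.Injective S M ∧ IsExceptionalCIMap (algebraMap R S) := by
  obtain ⟨ys, -, hys, hyn⟩ := exists_cotIndep S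
  obtain ⟨ws, hws, -, hwn⟩ := exists_cotIndep R
  have hmap : (maximalIdeal R).map (algebraMap R S) ≤ maximalIdeal S :=
    ((local_hom_TFAE (algebraMap R S)).out 0 2).mp ‹_›
  have hM : IsTors (maximalIdeal S) M := isTors_of_isArtinian
  obtain ⟨t⟩ := Tower.nonempty (S := S) (Ideal.IsPrime.ne_top' (I := maximalIdeal R)) hM ys
    (fun y hy => hys ▸ Ideal.subset_span hy) hws (hg.gd.of_bot (hM.of_map_le hmap)) hd.torLE
  have _ := t.noeth
  have _ := t.flat
  have _ := t.ideal_isMaximal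
  have hmapB : t.ideal.map (algebraMap t.B S) = maximalIdeal S := by
    rw [t.map_ideal, hys, sup_eq_right.mpr hmap]
  have hcomap : (maximalIdeal S).comap (algebraMap t.B S) = t.ideal :=
    (Ideal.IsMaximal.eq_of_le ‹_› (Ideal.comap_ne_top _ Ideal.IsPrime.ne_top')
      (Ideal.map_le_iff_le_comap.mp hmapB.le)).symm
  obtain ⟨A, _, _, _, _, h, _, _, hA, hs⟩ := exists_complete_cover t.ideal hmapB hcomap
  obtain ⟨_, _⟩ := hM.exists_module_adicCompletion
  have _ : Module.Flat S (AdicCompletion (maximalIdeal S) S) :=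
    AdicCompletion.flat_of_isNoetherian _
  let _ : Algebra A (AdicCompletion (maximalIdeal S) S) := h.toRingHom.toAlgebra
  let _ : Module A M := Module.compHom M h.toRingHom
  have _ : IsScalarTower A (AdicCompletion (maximalIdeal S) S) M :=
    .of_algebraMap_smul fun _ _ => rfl
  have _ : IsScalarTower t.B A (AdicCompletion (maximalIdeal S) S) :=
    .of_algebraMap_eq fun b => (h.commutes b).symm
  have _ : IsScalarTower t.B A M := .of_algebraMap_smul fun b m => by
    change h (algebraMap t.B A b) • m = b • m
    rw [h.commutes, IsScalarTower.algebraMap_apply t.B S (AdicCompletion (maximalIdeal S) S),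
      algebraMap_smul, algebraMap_smul]
  have _ : IsArtinian A M := .of_surjective_algebraMap hs (isArtinian_of_tower S hart)
  obtain ⟨hp, ⟨rs, hrs, hker, hlen⟩, hinj⟩ := t.exists_isRegular_and_injective hA
    (hmap.trans_eq hys.symm) hs
    (fun X hX => TR.free_adicCompletion (fun Z hZ => hS.free hZ) hX) (by omega)
  refine ⟨by omega, hinj.of_flat, ?_⟩
  let _ : Algebra R A := ((algebraMap t.B A).comp (algebraMap R t.B)).toAlgebra
  have _ : IsScalarTower R t.B A := .of_algebraMap_eq fun _ => rfl
  obtain ⟨hfib, hdim⟩ := isRegularLocal_fibre_and_ringKrullDim (t.reg _) hA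
  have hflat : Module.Flat R A := Module.Flat.trans R t.B A
  have hloc : IsLocalHom (algebraMap R A) := by
    refine ((local_hom_TFAE (algebraMap R A)).out 0 2).mpr ?_
    rw [IsScalarTower.algebraMap_eq R t.B A, ← Ideal.map_map, ← hA]
    exact Ideal.map_mono le_sup_left
  refine ⟨⟨A, _, algebraMap R A, h.toRingHom, ⟨inferInstance, inferInstance, ?_, ?_, hloc, hflat,
    hfib, hs⟩, rs, hrs, hker.symm⟩, ?_⟩
  · rw [jacobson_eq_maximalIdeal _ bot_ne_top]
    infer_instance
  · refine RingHom.ext fun r => ?_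
    change h (algebraMap t.B A (algebraMap R t.B r)) = completionHom S (algebraMap R S r)
    rw [h.commutes, IsScalarTower.algebraMap_apply R t.B S,
      IsScalarTower.algebraMap_apply t.B S (AdicCompletion (maximalIdeal S) S)]
    rfl
  · have hdT := ringKrullDim_add_length_of_ker _ hs hrs hker
    have hzs : t.zs.length = embDim S :=
      List.length_map (algebraMap t.B S) ▸ (congrArg List.length t.map_zs).trans hyn
    rw [ringKrullDim_adicCompletion, hdim, hlen, hzs, hp, hwn] at hdT
    rw [add_comm, hdT, add_comm]

theorem exists_of_sInf_coe_lt_top {P : ℕ → Prop} (h : sInf ((↑) '' {n : ℕ | P n}) < (⊤ : ℕ∞)) :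
    ∃ n : ℕ, P n ∧ sInf ((↑) '' {n : ℕ | P n}) = (n : ℕ∞) := by
  have hne : ((↑) '' {n : ℕ | P n} : Set ℕ∞).Nonempty := by
    by_contra hcon
    rw [Set.not_nonempty_iff_eq_empty.mp hcon, sInf_empty] at h
    exact lt_irrefl _ h
  obtain ⟨n, hn, hn'⟩ := csInf_mem hne
  exact ⟨n, hn, hn'.symm⟩

end Assembly

/-- **Theorem C.** If `f : R → S` is a local homomorphism of noetherian local rings with
`fd_R S < ∞`, where `R` has a dualizing complex and `S` is G-regular, and `M` is a non-zero
artinian `S`-module with `Gid_R M ≤ edim R - edim S`, then `M` is an injective `S`-module,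
`f` is an exceptional complete intersection map, and `Gid_R M = edim R - edim S`;
in particular, if `M` is Gorenstein injective over `R`, then `edim R = edim S`. -/
theorem gid_bound_implies_eci_of_gregular {R S : Type u} [CommRing R] [CommRing S]
    [IsLocalRing R] [IsLocalRing S] [IsNoetherianRing R] [IsNoetherianRing S]
    (f : R →+* S) (hloc : IsLocalHom f) (hfd : flatDimAlong f < ⊤)
    (hD : HasDualizingComplex R) (hGreg : IsGRegular S)
    (M : Type u) [AddCommGroup M] [Module S M] [Nontrivial M] (hart : IsArtinian S M)
    (hgid : gidAlong f M + embDim S ≤ (embDim R : ℕ∞)) :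
    Module.Injective S M ∧ IsExceptionalCIMap f ∧
      gidAlong f M + embDim S = (embDim R : ℕ∞) ∧
      (IsGorensteinInjectiveAlong f M → embDim R = embDim S) := by
  let _ : Algebra R S := f.toAlgebra
  let _ : Module R M := Module.compHom M f
  have _ : IsScalarTower R S M := .of_algebraMap_smul fun _ _ => rfl
  have _ : IsLocalHom (algebraMap R S) := hloc
  obtain ⟨d, hd, -⟩ := exists_of_sInf_coe_lt_top (P := fun n => fdLE R n S) hfd
  have hfin : gidAlong f M < ⊤ :=
    (le_self_add.trans hgid).trans_lt (WithTop.coe_lt_top _)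
  obtain ⟨g, hg, hgeq⟩ := exists_of_sInf_coe_lt_top (P := fun n => gidLE R n M) hfin
  change gidAlong f M = g at hgeq
  rw [hgeq] at hgid ⊢
  obtain ⟨h1, h2, h3⟩ := isExceptionalCIMap_of_gidLE hGreg hd hg (by exact_mod_cast hgid)
  refine ⟨h2, h3, by exact_mod_cast h1, fun hGI => ?_⟩
  have h0 : gidAlong f M ≤ ((0 : ℕ) : ℕ∞) := sInf_le ⟨0, hGI, rfl⟩
  rw [hgeq, Nat.cast_le] at h0
  omega
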